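/- Let d ≥ 2 and n ≥ 1 be integers and let γ be a real number with 1/2 ≤ γ < 1. Let a = (a_1, …, a_d) : ℝ^d → ℝ^d be a continuously differentiable magnetic vector potential with real-valued components, and let V : ℝ^d → M_n(ℂ) be a continuous function whose values are Hermitian nonpositive matrices, such that x ↦ tr((−V(x))^{γ+d/2}) is Lebesgue integrable on ℝ^d. Let ψ_1, …, ψ_N : ℝ^d → ℂ^n be twice continuously differentiable, square-integrable functions forming an orthonormal family in L²(ℝ^d, ℂ^n), and let E_1, …, E_N > 0 satisfy ∑_{k=1}^d (i ∂/∂x_k + a_k)² ψ_j + V ψ_j = −E_j ψ_j on ℝ^d for each j. Then ∑_{j=1}^N E_j^γ ≤ 4 L^cl_{γ,d} ∫_{ℝ^d} tr((−V(x))^{γ+d/2}) dx, where L^cl_{γ,d} := Γ(γ+1)/(2^d π^{d/2} Γ(γ + d/2 + 1)). -/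

import Mathlib

open MeasureTheory Matrix
open scoped ComplexOrder

/-- The classical Lieb–Thirring constant `L^cl_{γ,d} = Γ(γ+1)/(2^d π^{d/2} Γ(γ+d/2+1))`. -/
noncomputable def Lcl (γ : ℝ) (d : ℕ) : ℝ :=
  Real.Gamma (γ + 1) / (2 ^ d * Real.pi ^ ((d : ℝ) / 2) * Real.Gamma (γ + d / 2 + 1))

/-- For a Hermitian matrix `A` (whose eigenvalues are nonnegative in our applications)
this is the trace of the power `A^p` defined by the functional calculus:
`tr(A^p) = ∑ λ_i(A)^p`. -/
noncomputable def traceRpow {n : ℕ} (A : Matrix (Fin n) (Fin n) ℂ)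
    (hA : A.IsHermitian) (p : ℝ) : ℝ :=
  ∑ i, hA.eigenvalues i ^ p

/-- The magnetic derivative `(i ∂/∂x_k + a_k) f` of a function `f : ℝ^d → ℂ`, for a
magnetic vector potential `a : ℝ^d → ℝ^d`. -/
noncomputable def magD {d : ℕ} (a : EuclideanSpace ℝ (Fin d) → EuclideanSpace ℝ (Fin d))
    (k : Fin d) (f : EuclideanSpace ℝ (Fin d) → ℂ) (x : EuclideanSpace ℝ (Fin d)) : ℂ :=
  Complex.I * fderiv ℝ f x (EuclideanSpace.single k (1 : ℝ)) + (a x k : ℂ) * f x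

/-- The real trace of `f(A)`, where `f(A)` is given by the continuous functional calculus. -/
noncomputable def trFun {m : ℕ} (f : ℝ → ℝ) (A : Matrix (Fin m) (Fin m) ℂ) : ℝ :=
  (Matrix.trace (cfc f A)).re

/-- `tr (A₊ ^ p)`. -/
noncomputable def trPow {m : ℕ} (p : ℝ) (A : Matrix (Fin m) (Fin m) ℂ) : ℝ :=
  trFun (fun t => max t 0 ^ p) A

/-- The positive part of a Hermitian matrix. -/
noncomputable def matPos {m : ℕ} (A : Matrix (Fin m) (Fin m) ℂ) : Matrix (Fin m) (Fin m) ℂ :=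
  cfc (fun t : ℝ => max t 0) A

section MatrixFunctions

variable {m : ℕ}

lemma trFun_eq_sum (f : ℝ → ℝ) {A : Matrix (Fin m) (Fin m) ℂ} (hA : A.IsHermitian) :
    trFun f A = ∑ i, f (hA.eigenvalues i) := by
  rw [trFun, hA.cfc_eq, Matrix.IsHermitian.cfc, Unitary.conjStarAlgAut_apply, Matrix.trace_mul_comm,
    ← Matrix.mul_assoc]
  simp [Matrix.trace, Matrix.diag]

lemma trPow_eq_sum (p : ℝ) {A : Matrix (Fin m) (Fin m) ℂ} (hA : A.IsHermitian) :
    trPow p A = ∑ i, max (hA.eigenvalues i) 0 ^ p := trFun_eq_sum _ hA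

lemma traceRpow_eq_trPow (p : ℝ) {A : Matrix (Fin m) (Fin m) ℂ} (hA : A.PosSemidef) :
    traceRpow A hA.1 p = trPow p A := by
  rw [trPow_eq_sum p hA.1, traceRpow]
  exact Finset.sum_congr rfl fun i _ => by rw [max_eq_left (hA.eigenvalues_nonneg i)]

lemma trPow_nonneg (p : ℝ) {A : Matrix (Fin m) (Fin m) ℂ} (hA : A.IsHermitian) :
    0 ≤ trPow p A := by
  rw [trPow_eq_sum p hA]; positivity

open scoped Matrix.Norms.L2Operator in
lemma continuous_cfc_matrix {X : Type*} [TopologicalSpace X] {f : ℝ → ℝ} (hf : Continuous f)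
    {A : X → Matrix (Fin m) (Fin m) ℂ} (hA : Continuous A) (hH : ∀ x, (A x).IsHermitian) :
    Continuous fun x => cfc f (A x) := by
  exact Continuous.cfc_of_mem_nhdsSet (s := Set.univ) f Filter.univ_mem hA hH hf.continuousOn

lemma continuous_trFun {X : Type*} [TopologicalSpace X] {f : ℝ → ℝ} (hf : Continuous f)
    {A : X → Matrix (Fin m) (Fin m) ℂ} (hA : Continuous A) (hH : ∀ x, (A x).IsHermitian) :
    Continuous fun x => trFun f (A x) :=
  Complex.continuous_re.comp (continuous_cfc_matrix hf hA hH).matrix_trace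

lemma trFun_matPos {f : ℝ → ℝ} (hf : Continuous f) {A : Matrix (Fin m) (Fin m) ℂ}
    (hA : A.IsHermitian) : trFun f (matPos A) = trFun (fun t => f (max t 0)) A := by
  rw [trFun, matPos, ← cfc_comp' f (fun t => max t 0) A]; rfl

lemma cfc_posSemidef {f : ℝ → ℝ} (hf : ∀ t, 0 ≤ f t) {A : Matrix (Fin m) (Fin m) ℂ}
    (hA : A.IsHermitian) : (cfc f A).PosSemidef := by
  rw [hA.cfc_eq, Matrix.IsHermitian.cfc, Unitary.conjStarAlgAut_apply]
  rw [Matrix.star_eq_conjTranspose]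
  have h : (Matrix.diagonal (RCLike.ofReal ∘ f ∘ hA.eigenvalues) :
      Matrix (Fin m) (Fin m) ℂ).PosSemidef :=
    Matrix.PosSemidef.diagonal fun i => by simpa using hf _
  exact h.mul_mul_conjTranspose_same _

lemma matPos_posSemidef {A : Matrix (Fin m) (Fin m) ℂ} (hA : A.IsHermitian) :
    (matPos A).PosSemidef :=
  cfc_posSemidef (fun _ => le_max_right _ _) hA

lemma matPos_sub_posSemidef {A : Matrix (Fin m) (Fin m) ℂ} (hA : A.IsHermitian) :
    (matPos A - A).PosSemidef := by
  have h : matPos A - A = cfc (fun t : ℝ => max t 0 - t) A := by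
    conv_lhs => rhs; rw [hA.spectral_theorem]
    rw [matPos, hA.cfc_eq, hA.cfc_eq]
    simp only [Matrix.IsHermitian.cfc]
    rw [← map_sub, Matrix.diagonal_sub]
    congr 2
    ext i; simp
  rw [h]
  exact cfc_posSemidef (fun t => sub_nonneg.2 (le_max_left _ _)) hA

lemma matPos_eq_zero {A : Matrix (Fin m) (Fin m) ℂ} (hA : (-A).PosSemidef) : matPos A = 0 := by
  have hH : A.IsHermitian := by simpa using hA.1.neg
  have h : ∀ i, hH.eigenvalues i ≤ 0 := fun i => by
    have := hA.re_dotProduct_nonneg (hH.eigenvectorBasis i)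
    rw [hH.eigenvalues_eq]
    simp [Matrix.neg_mulVec] at this
    simpa using this
  rw [matPos, hH.cfc_eq, Matrix.IsHermitian.cfc]
  have : (RCLike.ofReal ∘ (fun t : ℝ => max t 0) ∘ hH.eigenvalues : Fin m → ℂ) = 0 := by
    ext i; simp [h i]
  rw [this]; simp

lemma exists_sqrt {X : Type*} [TopologicalSpace X] {A : X → Matrix (Fin m) (Fin m) ℂ}
    (hA : Continuous A) (hH : ∀ x, (A x).PosSemidef) :
    ∃ Q : X → Matrix (Fin m) (Fin m) ℂ, Continuous Q ∧ (∀ x, (Q x).IsHermitian) ∧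
      (∀ x, Q x * Q x = A x) := by
  refine ⟨fun x => cfc Real.sqrt (A x), continuous_cfc_matrix Real.continuous_sqrt hA
    (fun x => (hH x).1), fun x => cfc_predicate _ _, fun x => ?_⟩
  rw [← cfc_mul Real.sqrt Real.sqrt (A x), (hH x).1.cfc_eq, Matrix.IsHermitian.cfc]
  conv_rhs => rw [(hH x).1.spectral_theorem]
  congr 2
  ext i; simp [Real.mul_self_sqrt ((hH x).eigenvalues_nonneg i)]

lemma trFun_unitary_conj {f : ℝ → ℝ} (hf : Continuous f) {A U : Matrix (Fin m) (Fin m) ℂ}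
    (hA : A.IsHermitian) (hU : Uᴴ * U = 1) : trFun f (Uᴴ * A * U) = trFun f A := by
  have hU' : U * Uᴴ = 1 := mul_eq_one_comm.1 hU
  let φ := Unitary.conjStarAlgAut ℝ (Matrix (Fin m) (Fin m) ℂ)
    (⟨Uᴴ, by simp [Matrix.mem_unitaryGroup_iff, Matrix.star_eq_conjTranspose, hU]⟩ :
      Matrix.unitaryGroup (Fin m) ℂ)
  have hφ : ∀ B, φ B = Uᴴ * B * U := fun B => by
    simp [φ, Unitary.conjStarAlgAut_apply, Matrix.star_eq_conjTranspose]
  have hc : Continuous φ := by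
    have : (φ : _ → _) = fun B => Uᴴ * B * U := funext hφ
    rw [this]; fun_prop
  have h := StarAlgHomClass.map_cfc φ f A hf.continuousOn hc hA
    (by rw [hφ]; exact Matrix.isHermitian_conjTranspose_mul_mul U hA)
  rw [hφ, hφ] at h
  rw [trFun, ← h, trFun, Matrix.trace_mul_comm, ← Matrix.mul_assoc, hU', Matrix.one_mul]

end MatrixFunctions

section CauchyKernel

open scoped FourierTransform

/-- The Fourier transform of `exp (-s |x|)`. -/
noncomputable def cauchyKer (s p : ℝ) : ℝ := 2 * s / (s ^ 2 + (2 * Real.pi * p) ^ 2)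

lemma cauchyKer_nonneg {s : ℝ} (hs : 0 < s) (p : ℝ) : 0 ≤ cauchyKer s p := by
  unfold cauchyKer; positivity

lemma integrable_cauchyKer {s : ℝ} (hs : 0 < s) : Integrable (cauchyKer s) := by
  have h := ((integrable_inv_one_add_sq.comp_mul_left' (R := 2 * Real.pi / s)
    (by positivity)).const_mul (2 / s))
  refine h.congr (Filter.Eventually.of_forall fun p => ?_)
  simp only [cauchyKer]
  field_simp

lemma continuous_cauchyKer {s : ℝ} (hs : 0 < s) : Continuous (cauchyKer s) := by
  unfold cauchyKer
  exact Continuous.div (by fun_prop) (by fun_prop) fun p => by positivity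

lemma integrable_exp_neg_mul_abs {s : ℝ} (hs : 0 < s) :
    Integrable fun x : ℝ => (Real.exp (-s * |x|) : ℂ) := by
  have h : Integrable fun x : ℝ => Real.exp (-s * |x|) := by
    rw [← integrableOn_univ, ← Set.Iic_union_Ioi (a := (0:ℝ))]
    refine IntegrableOn.union ?_ ?_
    · exact (integrableOn_exp_mul_Iic hs 0).congr_fun
        (fun x hx => by simp [abs_of_nonpos (Set.mem_Iic.1 hx)]) measurableSet_Iic
    · exact (integrableOn_exp_mul_Ioi (neg_lt_zero.2 hs) 0).congr_fun
        (fun x hx => by simp [abs_of_pos (Set.mem_Ioi.1 hx)]) measurableSet_Ioi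
  exact h.ofReal

lemma fourier_exp_neg_mul_abs {s : ℝ} (hs : 0 < s) (p : ℝ) :
    𝓕 (fun x : ℝ => (Real.exp (-s * |x|) : ℂ)) p = cauchyKer s p := by
  rw [Real.fourier_real_eq_integral_exp_smul]
  have hi : Integrable fun v : ℝ =>
      Complex.exp (↑(-2 * Real.pi * v * p) * Complex.I) • (Real.exp (-s * |v|) : ℂ) := by
    refine (integrable_exp_neg_mul_abs hs).bdd_mul (c := 1)
      (Continuous.aestronglyMeasurable (by fun_prop)) (Filter.Eventually.of_forall fun x => ?_)
    rw [Complex.norm_exp_ofReal_mul_I]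
  rw [← intervalIntegral.integral_Iic_add_Ioi hi.integrableOn hi.integrableOn (b := 0)]
  have h1 : ∫ v in Set.Iic (0:ℝ), Complex.exp (↑(-2 * Real.pi * v * p) * Complex.I) •
      (Real.exp (-s * |v|) : ℂ) = ∫ v in Set.Iic (0:ℝ),
        Complex.exp ((s - 2 * Real.pi * p * Complex.I) * v) := by
    refine setIntegral_congr_fun measurableSet_Iic fun x hx => ?_
    simp only [abs_of_nonpos (Set.mem_Iic.1 hx), smul_eq_mul, Complex.ofReal_exp]
    rw [← Complex.exp_add]; congr 1; push_cast; ring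
  have h2 : ∫ v in Set.Ioi (0:ℝ), Complex.exp (↑(-2 * Real.pi * v * p) * Complex.I) •
      (Real.exp (-s * |v|) : ℂ) = ∫ v in Set.Ioi (0:ℝ),
        Complex.exp ((-s - 2 * Real.pi * p * Complex.I) * v) := by
    refine setIntegral_congr_fun measurableSet_Ioi fun x hx => ?_
    simp only [abs_of_pos (Set.mem_Ioi.1 hx), smul_eq_mul, Complex.ofReal_exp]
    rw [← Complex.exp_add]; congr 1; push_cast; ring
  rw [h1, h2, integral_exp_mul_complex_Iic (by simpa using hs),
    integral_exp_mul_complex_Ioi (by simpa using hs)]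
  have ha : (s - 2 * Real.pi * p * Complex.I : ℂ) ≠ 0 := fun h => by
    have := congrArg Complex.re h; simp at this; exact hs.ne' this
  have hb : (-s - 2 * Real.pi * p * Complex.I : ℂ) ≠ 0 := fun h => by
    have := congrArg Complex.re h; simp at this; exact hs.ne' this
  have hc : (s ^ 2 + (2 * Real.pi * p) ^ 2 : ℂ) ≠ 0 := by
    have : (s ^ 2 + (2 * Real.pi * p) ^ 2 : ℝ) ≠ 0 := by positivity
    exact_mod_cast this
  have hI := Complex.I_sq
  simp only [Complex.ofReal_zero, mul_zero, Complex.exp_zero, cauchyKer]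
  push_cast
  rw [div_add_div _ _ ha hb, div_eq_div_iff (mul_ne_zero ha hb) hc]
  ring_nf
  simp only [hI]
  ring

/-- `exp (-s |t|)` is the characteristic function of a probability density. -/
lemma integral_exp_mul_cauchyKer {s : ℝ} (hs : 0 < s) (t : ℝ) :
    ∫ p : ℝ, Complex.exp ((2 * Real.pi * p * t : ℝ) * Complex.I) * (cauchyKer s p : ℂ)
      = Real.exp (-s * |t|) := by
  have hF : 𝓕 (fun x : ℝ => (Real.exp (-s * |x|) : ℂ)) = fun p => (cauchyKer s p : ℂ) :=
    funext (fourier_exp_neg_mul_abs hs)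
  have h := Continuous.fourierInv_fourier_eq (f := fun x : ℝ => (Real.exp (-s * |x|) : ℂ))
    (by fun_prop) (integrable_exp_neg_mul_abs hs) (by rw [hF]; exact (integrable_cauchyKer hs).ofReal)
  have h' := congrFun h t
  rw [hF, Real.fourierInv_eq'] at h'
  rw [← h']
  refine integral_congr_ae (Filter.Eventually.of_forall fun p => ?_)
  simp only [smul_eq_mul]
  congr 3
  simp
  ring

end CauchyKernel

/-- The squared Euclidean length of a complex vector. -/
def vsq {m : ℕ} (v : Fin m → ℂ) : ℝ := ∑ i, Complex.normSq (v i)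

/-- The quadratic form of a matrix. -/
def qform {m : ℕ} (W : Matrix (Fin m) (Fin m) ℂ) (v : Fin m → ℂ) : ℝ := (star v ⬝ᵥ W *ᵥ v).re

section Vectors

variable {m : ℕ}

lemma vsq_eq_re (v : Fin m → ℂ) : vsq v = (star v ⬝ᵥ v).re := by
  simp only [vsq, dotProduct, Complex.re_sum, Pi.star_apply, RCLike.star_def]
  refine Finset.sum_congr rfl fun i _ => ?_
  rw [← Complex.normSq_eq_conj_mul_self, Complex.ofReal_re]

lemma dotProduct_self_eq (v : Fin m → ℂ) : star v ⬝ᵥ v = (vsq v : ℂ) := by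
  simp only [vsq, dotProduct, Pi.star_apply, RCLike.star_def, Complex.ofReal_sum]
  refine Finset.sum_congr rfl fun i _ => ?_
  rw [← Complex.normSq_eq_conj_mul_self]

lemma vsq_nonneg (v : Fin m → ℂ) : 0 ≤ vsq v := Finset.sum_nonneg fun _ _ => Complex.normSq_nonneg _

lemma vsq_eq_zero {v : Fin m → ℂ} : vsq v = 0 ↔ v = 0 := by
  rw [vsq, Finset.sum_eq_zero_iff_of_nonneg fun _ _ => Complex.normSq_nonneg _]
  simp [funext_iff]

@[simp] lemma vsq_zero : vsq (0 : Fin m → ℂ) = 0 := vsq_eq_zero.2 rfl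

@[simp] lemma qform_zero (W : Matrix (Fin m) (Fin m) ℂ) : qform W 0 = 0 := by simp [qform]

lemma star_dotProduct_comm (v w : Fin m → ℂ) :
    (starRingEnd ℂ) (star v ⬝ᵥ w) = star w ⬝ᵥ v := by
  simp only [dotProduct, map_sum, map_mul, Pi.star_apply, RCLike.star_def, Complex.conj_conj]
  exact Finset.sum_congr rfl fun i _ => mul_comm _ _

lemma re_dotProduct_comm (v w : Fin m → ℂ) : (star v ⬝ᵥ w).re = (star w ⬝ᵥ v).re := by
  rw [← star_dotProduct_comm v w, Complex.conj_re]

lemma vsq_smul (c : ℂ) (v : Fin m → ℂ) : vsq (c • v) = Complex.normSq c * vsq v := by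
  simp [vsq, Finset.mul_sum]

lemma vsq_sub (v w : Fin m → ℂ) : vsq (v - w) = vsq v + vsq w - 2 * (star v ⬝ᵥ w).re := by
  simp only [vsq_eq_re, star_sub, sub_dotProduct, dotProduct_sub, Complex.sub_re,
    re_dotProduct_comm w v]
  ring

lemma continuous_vsq : Continuous (vsq : (Fin m → ℂ) → ℝ) := by
  unfold vsq
  exact continuous_finsetSum _ fun i _ => Complex.continuous_normSq.comp (continuous_apply i)

lemma qform_nonneg {W : Matrix (Fin m) (Fin m) ℂ} (hW : W.PosSemidef) (v : Fin m → ℂ) :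
    0 ≤ qform W v := hW.re_dotProduct_nonneg v

lemma qform_sub (W W' : Matrix (Fin m) (Fin m) ℂ) (v : Fin m → ℂ) :
    qform (W - W') v = qform W v - qform W' v := by
  simp [qform, Matrix.sub_mulVec, dotProduct_sub]

lemma qform_smul (W : Matrix (Fin m) (Fin m) ℂ) (c : ℂ) (v : Fin m → ℂ) :
    qform W (c • v) = Complex.normSq c * qform W v := by
  have : star (c • v) ⬝ᵥ W *ᵥ (c • v) = (Complex.normSq c : ℂ) * (star v ⬝ᵥ W *ᵥ v) := by
    rw [star_smul, Matrix.mulVec_smul, smul_dotProduct, dotProduct_smul,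
      Complex.normSq_eq_conj_mul_self]
    simp [mul_assoc]
  rw [qform, this, Complex.re_ofReal_mul, qform]

lemma qform_sq {Q : Matrix (Fin m) (Fin m) ℂ} (hQ : Q.IsHermitian) (v : Fin m → ℂ) :
    qform (Q * Q) v = vsq (Q *ᵥ v) := by
  rw [qform, vsq_eq_re, Matrix.star_mulVec, hQ.eq, ← Matrix.dotProduct_mulVec, Matrix.mulVec_mulVec]

@[fun_prop]
lemma Continuous.vsq' {X : Type*} [TopologicalSpace X] {f : X → Fin m → ℂ} (hf : Continuous f) :
    Continuous fun x => vsq (f x) := continuous_vsq.comp hf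

@[fun_prop]
lemma Continuous.qform' {X : Type*} [TopologicalSpace X] {W : X → Matrix (Fin m) (Fin m) ℂ}
    {f : X → Fin m → ℂ} (hW : Continuous W) (hf : Continuous f) :
    Continuous fun x => qform (W x) (f x) :=
  Complex.continuous_re.comp ((hf.star).dotProduct (hW.matrix_mulVec hf))

end Vectors

section Pairing

variable {Ω : Type*} [MeasurableSpace Ω] {m : ℕ}

/-- The `L²` pairing of vector valued functions. -/
noncomputable def pair (μ : Measure Ω) (f g : Ω → Fin m → ℂ) : ℂ := ∫ x, star (f x) ⬝ᵥ g x ∂μ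

/-- The space of vector valued functions with square integrable components. -/
def sqInt (μ : Measure Ω) (m : ℕ) : Submodule ℂ (Ω → Fin m → ℂ) where
  carrier := {f | ∀ i, MemLp (fun x => f x i) 2 μ}
  zero_mem' := fun _ => MemLp.zero
  add_mem' := fun hf hg i => (hf i).add (hg i)
  smul_mem' := fun c _ hf i => (hf i).const_mul c

variable {μ : Measure Ω}

lemma integrable_pair {f g : Ω → Fin m → ℂ} (hf : f ∈ sqInt μ m) (hg : g ∈ sqInt μ m) :
    Integrable (fun x => star (f x) ⬝ᵥ g x) μ := by
  simp only [dotProduct]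
  exact integrable_finsetSum _ fun i _ => MemLp.integrable_mul ((hf i).star) (hg i)

lemma pair_self (f : Ω → Fin m → ℂ) : pair μ f f = ((∫ x, vsq (f x) ∂μ : ℝ) : ℂ) := by
  simp only [pair, dotProduct_self_eq]
  exact integral_ofReal

lemma pair_conj (f g : Ω → Fin m → ℂ) : (starRingEnd ℂ) (pair μ f g) = pair μ g f := by
  rw [pair, ← integral_conj]
  simp only [star_dotProduct_comm]; rfl

/-- The `L²` inner product structure on square integrable functions. -/
@[reducible] noncomputable def sqIntCore (μ : Measure Ω) (m : ℕ) :
    PreInnerProductSpace.Core ℂ (sqInt μ m) where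
  inner f g := pair μ f.1 g.1
  conj_inner_symm f g := pair_conj _ _
  re_inner_nonneg f := by
    change 0 ≤ (pair μ f.1 f.1).re
    rw [pair_self, Complex.ofReal_re]
    exact integral_nonneg fun x => vsq_nonneg _
  add_left f g h := by
    simp only [pair, Submodule.coe_add, Pi.add_apply, star_add, add_dotProduct]
    exact integral_add (integrable_pair f.2 h.2) (integrable_pair g.2 h.2)
  smul_left f g c := by
    simp only [pair, Submodule.coe_smul, Pi.smul_apply, star_smul, smul_dotProduct, smul_eq_mul]
    exact integral_const_mul _ _

/-- Bessel's inequality. -/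
lemma bessel_pair {ι : Type*} [Fintype ι] [DecidableEq ι] {f : ι → Ω → Fin m → ℂ} (hf : ∀ i, f i ∈ sqInt μ m)
    (ho : ∀ i j, pair μ (f i) (f j) = if i = j then 1 else 0)
    {w : Ω → Fin m → ℂ} (hw : w ∈ sqInt μ m) :
    ∑ i, Complex.normSq (pair μ (f i) w) ≤ ∫ x, vsq (w x) ∂μ := by
  let c := sqIntCore μ m
  let : SeminormedAddCommGroup (sqInt μ m) := InnerProductSpace.Core.toSeminormedAddCommGroup (𝕜 := ℂ)
  let : InnerProductSpace ℂ (sqInt μ m) := InnerProductSpace.ofCore c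
  have ho' : Orthonormal ℂ (fun i => (⟨f i, hf i⟩ : sqInt μ m)) := by
    rw [orthonormal_iff_ite]
    exact ho
  have h := ho'.sum_inner_products_le (x := (⟨w, hw⟩ : sqInt μ m)) (s := Finset.univ)
  have h2 : ‖(⟨w, hw⟩ : sqInt μ m)‖ ^ 2 = ∫ x, vsq (w x) ∂μ := by
    rw [← inner_self_eq_norm_sq (𝕜 := ℂ)]
    change (pair μ w w).re = _
    rw [pair_self, Complex.ofReal_re]
  rw [h2] at h
  refine le_trans (le_of_eq (Finset.sum_congr rfl fun i _ => ?_)) h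
  rw [Complex.normSq_eq_norm_sq]; rfl

end Pairing

section ExpForm

variable {m : ℕ}

/-- Lebesgue measure on `(-R, R]`. -/
noncomputable abbrev volIoc (R : ℝ) : Measure ℝ := volume.restrict (Set.Ioc (-R) R)

lemma integrable_volIoc_prod (R : ℝ) {G : Type*} [NormedAddCommGroup G]
    {F : ℝ × ℝ → G} (hF : Continuous F) : Integrable F ((volIoc R).prod (volIoc R)) := by
  rw [Measure.prod_restrict]
  exact (hF.continuousOn.integrableOn_compact (isCompact_Icc.prod isCompact_Icc)).mono_set
    (Set.prod_mono Set.Ioc_subset_Icc_self Set.Ioc_subset_Icc_self)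

lemma integrable_volIoc (R : ℝ) {G : Type*} [NormedAddCommGroup G]
    {F : ℝ → G} (hF : Continuous F) : Integrable F (volIoc R) :=
  hF.integrableOn_Ioc

lemma mem_sqInt_volIoc (R : ℝ) {f : ℝ → Fin m → ℂ} (hf : Continuous f) :
    f ∈ sqInt (volIoc R) m := fun i => by
  have hc : Continuous fun x => f x i := (continuous_apply i).comp hf
  obtain ⟨C, hC⟩ := (isCompact_Icc (a := -R) (b := R)).exists_bound_of_continuousOn hc.continuousOn
  refine MemLp.of_bound hc.aestronglyMeasurable C ?_
  filter_upwards [ae_restrict_mem measurableSet_Ioc] with x hx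
  exact hC x (Set.Ioc_subset_Icc_self hx)

/-- The quadratic form on `(-R, R]` of the operator with kernel `exp (-κ |x - y|)`. -/
noncomputable def expForm (R κ : ℝ) (h : ℝ → Fin m → ℂ) : ℝ :=
  ∫ z, Real.exp (-κ * |z.1 - z.2|) * (star (h z.1) ⬝ᵥ h z.2).re ∂((volIoc R).prod (volIoc R))

/-- Multiplication by a unimodular character. -/
noncomputable def modulate (p : ℝ) (h : ℝ → Fin m → ℂ) : ℝ → Fin m → ℂ :=
  fun x => Complex.exp ((2 * Real.pi * p * x : ℝ) * Complex.I) • h x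

lemma continuous_modulate (p : ℝ) {h : ℝ → Fin m → ℂ} (hh : Continuous h) :
    Continuous (modulate p h) := by
  unfold modulate; fun_prop

lemma modulate_dotProduct (p : ℝ) (f g : ℝ → Fin m → ℂ) (x y : ℝ) :
    star (modulate p f x) ⬝ᵥ modulate p g y =
      Complex.exp ((2 * Real.pi * p * (y - x) : ℝ) * Complex.I) * (star (f x) ⬝ᵥ g y) := by
  simp only [modulate, star_smul, smul_dotProduct, dotProduct_smul, smul_eq_mul, RCLike.star_def,
    ← Complex.exp_conj, ← mul_assoc, ← Complex.exp_add]
  congr 2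
  rw [map_mul, Complex.conj_ofReal, Complex.conj_I]
  push_cast; ring

lemma pair_modulate (μ : Measure ℝ) (p : ℝ) (f g : ℝ → Fin m → ℂ) :
    pair μ (modulate p f) (modulate p g) = pair μ f g := by
  simp only [pair, modulate_dotProduct]; simp

lemma expForm_eq_integral {R κ κ' : ℝ} (hκ : κ < κ') {h : ℝ → Fin m → ℂ} (hh : Continuous h) :
    Integrable (fun p => cauchyKer (κ' - κ) p * expForm R κ (modulate p h)) ∧
    expForm R κ' h = ∫ p, cauchyKer (κ' - κ) p * expForm R κ (modulate p h) := by
  have hs : 0 < κ' - κ := sub_pos.2 hκ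
  let ν := (volIoc R).prod (volIoc R)
  let F : ℝ → ℝ × ℝ → ℝ := fun p z => cauchyKer (κ' - κ) p *
    (Real.exp (-κ * |z.1 - z.2|) * (star (modulate p h z.1) ⬝ᵥ modulate p h z.2).re)
  have hFc : Continuous (Function.uncurry F) := by
    have := continuous_cauchyKer hs
    simp only [F, Function.uncurry_def, modulate_dotProduct]
    simp only [dotProduct]
    fun_prop
  have hFi : Integrable (Function.uncurry F) ((volume : Measure ℝ).prod ν) := by
    have hC : Integrable (fun z : ℝ × ℝ => Real.exp (-κ * |z.1 - z.2|) *
        ‖star (h z.1) ⬝ᵥ h z.2‖) ν := integrable_volIoc_prod R (by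
          simp only [dotProduct]; fun_prop)
    refine ((integrable_cauchyKer hs).mul_prod hC).mono' hFc.aestronglyMeasurable
      (Filter.Eventually.of_forall fun z => ?_)
    simp only [Function.uncurry, F, norm_mul, Real.norm_eq_abs, abs_of_nonneg (cauchyKer_nonneg hs _),
      Real.abs_exp]
    have : |(star (modulate z.1 h z.2.1) ⬝ᵥ modulate z.1 h z.2.2).re| ≤
        ‖star (h z.2.1) ⬝ᵥ h z.2.2‖ := by
      refine (Complex.abs_re_le_norm _).trans (le_of_eq ?_)
      rw [modulate_dotProduct, norm_mul, Complex.norm_exp_ofReal_mul_I, one_mul]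
    gcongr
    exact cauchyKer_nonneg hs _
  have h1 : ∀ p, ∫ z, F p z ∂ν = cauchyKer (κ' - κ) p * expForm R κ (modulate p h) := fun p => by
    simp only [F, expForm]; exact integral_const_mul _ _
  refine ⟨?_, ?_⟩
  · have h2 := hFi.integral_prod_left
    simp only [Function.uncurry, h1] at h2
    exact h2
  · simp only [← h1]
    rw [integral_integral_swap hFi]
    refine integral_congr_ae (Filter.Eventually.of_forall fun z => ?_)
    simp only [F]
    have h2 := integral_exp_mul_cauchyKer hs (z.2 - z.1)
    have h3 : ∀ p : ℝ, cauchyKer (κ' - κ) p * (Real.exp (-κ * |z.1 - z.2|) *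
        (star (modulate p h z.1) ⬝ᵥ modulate p h z.2).re) =
        ((Complex.exp ((2 * Real.pi * p * (z.2 - z.1) : ℝ) * Complex.I) * (cauchyKer (κ' - κ) p : ℂ)) *
          (Real.exp (-κ * |z.1 - z.2|) * (star (h z.1) ⬝ᵥ h z.2))).re := fun p => by
      rw [modulate_dotProduct, ← Complex.re_ofReal_mul, ← Complex.re_ofReal_mul]
      congr 1; ring
    simp only [h3]
    have h4 : Integrable fun p : ℝ => (Complex.exp ((2 * Real.pi * p * (z.2 - z.1) : ℝ) * Complex.I) *
        (cauchyKer (κ' - κ) p : ℂ)) := by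
      refine (integrable_cauchyKer hs).ofReal.bdd_mul (c := 1)
        (Continuous.aestronglyMeasurable (by fun_prop)) (Filter.Eventually.of_forall fun x => ?_)
      rw [Complex.norm_exp_ofReal_mul_I]
    have h5 := integral_re (h4.mul_const (Real.exp (-κ * |z.1 - z.2|) * (star (h z.1) ⬝ᵥ h z.2)))
    refine Eq.trans ?_ h5.symm
    rw [integral_mul_const, h2]
    simp only [RCLike.re_to_complex]
    rw [← mul_assoc, ← Complex.ofReal_mul, ← Real.exp_add, Complex.re_ofReal_mul]
    congr 2
    rw [abs_sub_comm z.2 z.1]; ring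

/-- For every `n`-element orthonormal family, the sum of the values of the form with kernel
`Q(x) exp (-κ |x - y|) Q(y)` is at most `s`. -/
def UpperBound (R : ℝ) (Q : ℝ → Matrix (Fin m) (Fin m) ℂ) (n : ℕ) (κ s : ℝ) : Prop :=
  ∀ f : Fin n → ℝ → Fin m → ℂ, (∀ i, Continuous (f i)) →
    (∀ i j, pair (volIoc R) (f i) (f j) = if i = j then 1 else 0) →
    ∑ i, expForm R κ (fun x => Q x *ᵥ f i x) ≤ s

lemma UpperBound.mono {R : ℝ} {Q : ℝ → Matrix (Fin m) (Fin m) ℂ} (hQ : Continuous Q) {n : ℕ}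
    {κ κ' s : ℝ} (h : UpperBound R Q n κ s) (hκ : κ ≤ κ') : UpperBound R Q n κ' s := by
  rcases hκ.eq_or_lt with rfl | hκ
  · exact h
  intro f hf ho
  have hs : 0 < κ' - κ := sub_pos.2 hκ
  have hc : ∀ i, Continuous fun x => Q x *ᵥ f i x := fun i => hQ.matrix_mulVec (hf i)
  have hm : ∀ p i, (modulate p fun x => Q x *ᵥ f i x) = fun x => Q x *ᵥ modulate p (f i) x :=
    fun p i => funext fun x => by simp only [modulate, Matrix.mulVec_smul]
  rw [Finset.sum_congr rfl fun i _ => (expForm_eq_integral hκ (hc i)).2,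
    ← integral_finsetSum _ fun i _ => (expForm_eq_integral hκ (hc i)).1]
  have h1 : ∫ p, cauchyKer (κ' - κ) p * s = s := by
    rw [integral_mul_const]
    have := integral_exp_mul_cauchyKer hs 0
    simp only [mul_zero, Complex.ofReal_zero, zero_mul, Complex.exp_zero, one_mul, abs_zero,
      Real.exp_zero, integral_complex_ofReal] at this
    rw [show ∫ p, cauchyKer (κ' - κ) p = 1 by exact_mod_cast this, one_mul]
  rw [← h1]
  refine integral_mono (integrable_finsetSum _ fun i _ => (expForm_eq_integral hκ (hc i)).1)
    ((integrable_cauchyKer hs).mul_const _) fun p => ?_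
  simp only [← Finset.mul_sum, hm]
  refine mul_le_mul_of_nonneg_left (h _ (fun i => continuous_modulate p (hf i)) fun i j => ?_)
    (cauchyKer_nonneg hs p)
  rw [pair_modulate, ho]

lemma upperBound_zero {R : ℝ} {W Q : ℝ → Matrix (Fin m) (Fin m) ℂ} (hQ : Continuous Q)
    (hH : ∀ x, (Q x).IsHermitian) (hW : ∀ x, Q x * Q x = W x) (n : ℕ) :
    UpperBound R Q n 0 (∫ x, (trace (W x)).re ∂volIoc R) := by
  intro f hf ho
  have hc : ∀ i, Continuous fun x => Q x *ᵥ f i x := fun i => hQ.matrix_mulVec (hf i)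
  let w : Fin m → ℝ → Fin m → ℂ := fun k x j => Q x j k
  have hw : ∀ k, Continuous (w k) := fun k => continuous_pi fun j => hQ.matrix_elem j k
  have h1 : ∀ i, expForm R 0 (fun x => Q x *ᵥ f i x) =
      ∑ k, Complex.normSq (pair (volIoc R) (f i) (w k)) := fun i => by
    have hk : ∀ k, ∫ x, (Q x *ᵥ f i x) k ∂volIoc R = (starRingEnd ℂ) (pair (volIoc R) (f i) (w k)) :=
      fun k => by
        rw [pair_conj]
        refine integral_congr_ae (Filter.Eventually.of_forall fun x => ?_)
        simp only [Matrix.mulVec, dotProduct, w, Pi.star_apply]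
        refine Finset.sum_congr rfl fun j _ => ?_
        rw [← (hH x).apply k j]
    have : (fun z : ℝ × ℝ => Real.exp (-0 * |z.1 - z.2|) *
        (star (Q z.1 *ᵥ f i z.1) ⬝ᵥ (Q z.2 *ᵥ f i z.2)).re) = fun z => RCLike.re
        (∑ k, star ((Q z.1 *ᵥ f i z.1) k) * (Q z.2 *ᵥ f i z.2) k) := by
      ext z; simp [dotProduct]
    rw [expForm, this, integral_re]
    · rw [integral_finsetSum]
      · simp only [RCLike.re_to_complex, Complex.re_sum]
        refine Finset.sum_congr rfl fun k _ => ?_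
        rw [integral_prod_mul (fun x => star ((Q x *ᵥ f i x) k)) (fun x => (Q x *ᵥ f i x) k), hk]
        have := integral_conj (μ := volIoc R) (𝕜 := ℂ) (f := fun x => (Q x *ᵥ f i x) k)
        rw [hk, Complex.conj_conj] at this
        simp only [RCLike.star_def]
        rw [this, Complex.mul_conj, Complex.ofReal_re]
      · intro k _
        have := hc i
        exact integrable_volIoc_prod R (by fun_prop)
    · have := hc i
      exact integrable_volIoc_prod R (by fun_prop)
  simp only [h1]
  rw [Finset.sum_comm]
  refine (Finset.sum_le_sum fun k _ => bessel_pair (fun i => mem_sqInt_volIoc R (hf i)) ho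
    (mem_sqInt_volIoc R (hw k))).trans (le_of_eq ?_)
  rw [← integral_finsetSum]
  · refine integral_congr_ae (Filter.Eventually.of_forall fun x => ?_)
    simp only [← hW, vsq, w, Matrix.trace, Matrix.diag, Matrix.mul_apply, Complex.re_sum]
    refine Finset.sum_congr rfl fun k _ => Finset.sum_congr rfl fun j _ => ?_
    rw [← (hH x).apply k j, RCLike.star_def, ← Complex.normSq_eq_conj_mul_self, Complex.ofReal_re]
  · intro k _
    exact integrable_volIoc R (hw k).vsq'

end ExpForm

/-- The linear combination of a family of vector valued functions. -/
def comb {ι X : Type*} [Fintype ι] {m : ℕ} (c : ι → ℂ) (u : ι → X → Fin m → ℂ) : X → Fin m → ℂ :=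
  fun x => ∑ j, c j • u j x

/-- A family `u` is a flag of trial functions for the energies `-E` if the form `q` is below
`-E i` times the mass on the span of those `u j` with `E i ≤ E j`. -/
def IsFlag {ι X : Type*} [Fintype ι] {m : ℕ} (q mass : (X → Fin m → ℂ) → ℝ)
    (u : ι → X → Fin m → ℂ) (E : ι → ℝ) : Prop :=
  ∀ i, ∀ c : ι → ℂ, c ≠ 0 → (∀ j, E j < E i → c j = 0) →
    q (comb c u) + E i * mass (comb c u) < 0

/-- The squared `L²` norm. -/
noncomputable def mass {X : Type*} [MeasureSpace X] {m : ℕ} (u : X → Fin m → ℂ) : ℝ :=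
  ∫ x, vsq (u x)

/-- The form of the one-dimensional operator `-d²/dx² - W`. -/
noncomputable def form1 {m : ℕ} (W : ℝ → Matrix (Fin m) (Fin m) ℂ) (u : ℝ → Fin m → ℂ) : ℝ :=
  (∫ x, vsq (deriv u x)) - ∫ x, qform (W x) (u x)

section Calculus

variable {m : ℕ}

lemma HasDerivAt.star_dotProduct {f g : ℝ → Fin m → ℂ} {f' g' : Fin m → ℂ} {x : ℝ}
    (hf : HasDerivAt f f' x) (hg : HasDerivAt g g' x) :
    HasDerivAt (fun x => star (f x) ⬝ᵥ g x) (star f' ⬝ᵥ g x + star (f x) ⬝ᵥ g') x := by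
  rw [hasDerivAt_pi] at hf hg
  simp only [dotProduct, ← Finset.sum_add_distrib, Pi.star_apply]
  exact HasDerivAt.fun_sum fun i _ => ((hf i).star.mul (hg i))

lemma HasDerivAt.re' {f : ℝ → ℂ} {f' : ℂ} {x : ℝ} (hf : HasDerivAt f f' x) :
    HasDerivAt (fun x => (f x).re) f'.re x :=
  Complex.reCLM.hasFDerivAt.comp_hasDerivAt x hf

lemma integral_eq_intervalIntegral {G : Type*} [NormedAddCommGroup G] [NormedSpace ℝ G]
    {f : ℝ → G} {R : ℝ} (hf : ∀ x, R ≤ |x| → f x = 0) : ∫ x, f x = ∫ x in -R..R, f x := by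
  refine (intervalIntegral.integral_eq_integral_of_support_subset fun x hx => ?_).symm
  by_contra h
  refine hx (hf x ?_)
  rw [Set.mem_Ioc, not_and_or, not_lt, not_le] at h
  rcases h with h | h
  · exact le_abs.2 (Or.inr (by linarith))
  · exact le_abs.2 (Or.inl h.le)

lemma deriv_eq_zero_of_abs_ge {G : Type*} [NormedAddCommGroup G] [NormedSpace ℝ G]
    {f : ℝ → G} {R : ℝ} (hf : ∀ x, R ≤ |x| → f x = 0) (hd : ContDiff ℝ 1 f) {x : ℝ} (hx : R ≤ |x|) :
    deriv f x = 0 := by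
  have hc : Continuous (deriv f) := hd.continuous_deriv le_rfl
  have h1 : ∀ y, R < |y| → deriv f y = 0 := fun y hy => by
    have : f =ᶠ[nhds y] fun _ => 0 := by
      filter_upwards [(isOpen_lt continuous_const continuous_abs).mem_nhds hy] with z hz
      exact hf z (le_of_lt hz)
    rw [this.deriv_eq]; simp
  rcases hx.lt_or_eq with h | h
  · exact h1 x h
  · have hcl : x ∈ closure {y : ℝ | R < |y|} := by
      rw [Metric.mem_closure_iff]
      intro ε hε
      rcases le_or_gt 0 x with h0 | h0
      · refine ⟨x + ε / 2, ?_, ?_⟩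
        · rw [abs_of_nonneg h0] at h
          have := le_abs_self (x + ε / 2)
          simp only [Set.mem_ofPred_eq]; linarith
        · rw [dist_comm, Real.dist_eq, add_sub_cancel_left, abs_of_pos (by linarith)]; linarith
      · refine ⟨x - ε / 2, ?_, ?_⟩
        · rw [abs_of_neg h0] at h
          have := neg_le_abs (x - ε / 2)
          simp only [Set.mem_ofPred_eq]; linarith
        · rw [Real.dist_eq, sub_sub_cancel, abs_of_pos (by linarith)]; linarith
    exact closure_minimal h1 (isClosed_eq hc continuous_const) hcl

lemma exists_pos_abs_ge_eq_zero {ι G : Type*} [Fintype ι] [Zero G]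
    {f : ι → ℝ → G} (hf : ∀ i, HasCompactSupport (f i)) :
    ∃ R : ℝ, 0 < R ∧ ∀ i x, R ≤ |x| → f i x = 0 := by
  have h : ∀ i, ∃ R : ℝ, ∀ x, R ≤ |x| → f i x = 0 := fun i => by
    obtain ⟨R, hR⟩ := (hf i).isCompact.isBounded.subset_ball (0 : ℝ)
    refine ⟨R, fun x hx => ?_⟩
    by_contra h0
    have := hR (subset_tsupport _ h0)
    rw [mem_ball_zero_iff, Real.norm_eq_abs] at this
    linarith
  choose R hR using h
  refine ⟨1 + ∑ i, |R i|, by positivity, fun i x hx => hR i x ?_⟩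
  have := Finset.single_le_sum (f := fun i => |R i|) (fun _ _ => abs_nonneg _) (Finset.mem_univ i)
  have := le_abs_self (R i)
  linarith

end Calculus

section LowerBound

variable {m : ℕ}

lemma expForm_smul (R κ : ℝ) (c : ℂ) (h : ℝ → Fin m → ℂ) :
    expForm R κ (fun x => c • h x) = Complex.normSq c * expForm R κ h := by
  simp only [expForm, ← integral_const_mul]
  refine integral_congr_ae (Filter.Eventually.of_forall fun z => ?_)
  have : star (c • h z.1) ⬝ᵥ (c • h z.2) = (Complex.normSq c : ℂ) * (star (h z.1) ⬝ᵥ h z.2) := by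
    rw [star_smul, smul_dotProduct, dotProduct_smul, Complex.normSq_eq_conj_mul_self]
    simp [mul_assoc]
  simp only [this, Complex.re_ofReal_mul]
  ring

lemma le_expForm {R κ : ℝ} (hR : 0 < R) (hκ : 0 < κ) {u g : ℝ → Fin m → ℂ} (hu : ContDiff ℝ 1 u)
    (huR : u R = 0) (huR' : u (-R) = 0) (hg : Continuous g)
    (hF : (∫ x in -R..R, (vsq (deriv u x) + κ ^ 2 * vsq (u x))) ≤
      ∫ x in -R..R, (star (g x) ⬝ᵥ u x).re) :
    2 * κ * (∫ x in -R..R, (star (g x) ⬝ᵥ u x).re) ≤ expForm R κ g := by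
  let P : ℝ → Fin m → ℂ := fun x => ∫ y in -R..x, Real.exp (κ * y) • g y
  let S : ℝ → Fin m → ℂ := fun x => ∫ y in x..R, Real.exp (-κ * y) • g y
  have hPd : ∀ x, HasDerivAt P (Real.exp (κ * x) • g x) x := fun x =>
    intervalIntegral.integral_hasDerivAt_right ((by fun_prop : Continuous fun y =>
      Real.exp (κ * y) • g y).intervalIntegrable _ _)
      (Continuous.stronglyMeasurableAtFilter (by fun_prop) _ _) (by fun_prop)
  have hSd : ∀ x, HasDerivAt S (-(Real.exp (-κ * x) • g x)) x := fun x =>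
    intervalIntegral.integral_hasDerivAt_left ((by fun_prop : Continuous fun y =>
      Real.exp (-κ * y) • g y).intervalIntegrable _ _)
      (Continuous.stronglyMeasurableAtFilter (by fun_prop) _ _) (by fun_prop)
  have hPc : Continuous P := continuous_iff_continuousAt.2 fun x => (hPd x).continuousAt
  have hSc : Continuous S := continuous_iff_continuousAt.2 fun x => (hSd x).continuousAt
  let v : ℝ → Fin m → ℂ := fun x =>
    (1 / (2 * κ)) • (Real.exp (-κ * x) • P x + Real.exp (κ * x) • S x)
  let w : ℝ → Fin m → ℂ := fun x =>
    (1 / 2 : ℝ) • (Real.exp (κ * x) • S x - Real.exp (-κ * x) • P x)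
  have hvc : Continuous v := by fun_prop
  have hwc : Continuous w := by fun_prop
  have he : ∀ s x : ℝ, HasDerivAt (fun x => Real.exp (s * x)) (s * Real.exp (s * x)) x := fun s x => by
    have := ((hasDerivAt_id x).const_mul s).exp
    simpa [mul_comm] using this
  have hee : ∀ x : ℝ, Real.exp (-κ * x) * Real.exp (κ * x) = 1 := fun x => by
    rw [← Real.exp_add]; simp
  have hv : ∀ x, HasDerivAt v (w x) x := fun x => by
    have := (((he (-κ) x).smul (hPd x)).add ((he κ x).smul (hSd x))).const_smul (1 / (2 * κ))
    refine this.congr_deriv ?_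
    simp only [w, smul_neg, smul_smul, hee, mul_comm (Real.exp (κ * x)) (Real.exp (-κ * x))]
    ext i
    simp only [Pi.smul_apply, Pi.add_apply, Pi.sub_apply, Pi.neg_apply, Complex.real_smul]
    push_cast
    have : (κ : ℂ) ≠ 0 := by exact_mod_cast hκ.ne'
    field_simp; ring
  have hw : ∀ x, HasDerivAt w ((κ ^ 2) • v x - g x) x := fun x => by
    have := (((he κ x).smul (hSd x)).sub ((he (-κ) x).smul (hPd x))).const_smul (1 / 2 : ℝ)
    refine this.congr_deriv ?_
    simp only [v, smul_neg, smul_smul, hee, mul_comm (Real.exp (κ * x)) (Real.exp (-κ * x))]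
    ext i
    simp only [Pi.smul_apply, Pi.add_apply, Pi.sub_apply, Pi.neg_apply, Complex.real_smul]
    push_cast
    have : (κ : ℂ) ≠ 0 := by exact_mod_cast hκ.ne'
    field_simp; ring
  have hud : ∀ x, HasDerivAt u (deriv u x) x := fun x =>
    (hu.differentiable (by norm_num) x).hasDerivAt
  have hdc : Continuous (deriv u) := hu.continuous_deriv le_rfl
  have huc : Continuous u := hu.continuous
  have hPhi := intervalIntegral.integral_eq_sub_of_hasDerivAt (a := -R) (b := R)
    (fun x _ => (((hw x).star_dotProduct (hv x)).re'.sub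
      (((hw x).star_dotProduct (hud x)).re'.const_mul 2)))
    (Continuous.intervalIntegrable (by simp only [dotProduct]; fun_prop) _ _)
  have hend : ((star (w R) ⬝ᵥ v R).re - 2 * (star (w R) ⬝ᵥ u R).re) -
      ((star (w (-R)) ⬝ᵥ v (-R)).re - 2 * (star (w (-R)) ⬝ᵥ u (-R)).re) ≤ 0 := by
    have h1 : w R = (-κ) • v R := by
      have : S R = 0 := intervalIntegral.integral_same
      simp only [w, v, this, smul_zero, zero_sub, add_zero, smul_smul, ← neg_smul]
      congr 1; field_simp
    have h2 : w (-R) = κ • v (-R) := by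
      have : P (-R) = 0 := intervalIntegral.integral_same
      simp only [w, v, this, smul_zero, sub_zero, zero_add, smul_smul]
      congr 1; field_simp
    rw [huR, huR', h1, h2]
    simp only [star_smul, smul_dotProduct, star_trivial, dotProduct_zero, Complex.zero_re,
      dotProduct_self_eq, Complex.real_smul, ← Complex.ofReal_mul, Complex.ofReal_re]
    nlinarith [mul_nonneg hκ.le (vsq_nonneg (v R)), mul_nonneg hκ.le (vsq_nonneg (v (-R)))]
  have h_int : ∫ x in -R..R, (star (g x) ⬝ᵥ v x).re = (1 / (2 * κ)) * expForm R κ g := by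
    have hi : Integrable (fun z : ℝ × ℝ =>
      Real.exp (-κ * |z.1 - z.2|) * (star (g z.1) ⬝ᵥ g z.2).re) ((volIoc R).prod (volIoc R)) :=
      integrable_volIoc_prod R (by simp only [dotProduct]; fun_prop)
    rw [expForm, integral_prod _ hi, intervalIntegral.integral_of_le (by linarith),
      ← integral_const_mul]
    refine setIntegral_congr_fun measurableSet_Ioc fun x hx => ?_
    simp only
    rw [← intervalIntegral.integral_of_le (by linarith)]
    let L : (Fin m → ℂ) →L[ℝ] ℝ := LinearMap.toContinuousLinearMap
      { toFun := fun y => (star (g x) ⬝ᵥ y).re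
        map_add' := fun a b => by simp [dotProduct_add]
        map_smul' := fun c a => by simp [dotProduct_smul] }
    have hL : ∀ y, L y = (star (g x) ⬝ᵥ y).re := fun _ => rfl
    have hci : ∀ a b, IntervalIntegrable (fun y => Real.exp (-κ * |x - y|) * L (g y)) volume a b :=
      fun a b => Continuous.intervalIntegrable (by fun_prop) _ _
    simp only [← hL]
    rw [← intervalIntegral.integral_add_adjacent_intervals (hci (-R) x) (hci x R)]
    have e1 : ∫ y in -R..x, Real.exp (-κ * |x - y|) * L (g y) = L (Real.exp (-κ * x) • P x) := by
      rw [map_smul, ← L.intervalIntegral_comp_comm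
        (Continuous.intervalIntegrable (by fun_prop) _ _), smul_eq_mul,
        ← intervalIntegral.integral_const_mul]
      refine intervalIntegral.integral_congr fun y hy => ?_
      rw [Set.uIcc_of_le hx.1.le] at hy
      simp only [map_smul, smul_eq_mul]
      rw [← mul_assoc, ← Real.exp_add, abs_of_nonneg (by linarith [hy.2])]
      congr 2; ring
    have e2 : ∫ y in x..R, Real.exp (-κ * |x - y|) * L (g y) = L (Real.exp (κ * x) • S x) := by
      rw [map_smul, ← L.intervalIntegral_comp_comm
        (Continuous.intervalIntegrable (by fun_prop) _ _), smul_eq_mul,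
        ← intervalIntegral.integral_const_mul]
      refine intervalIntegral.integral_congr fun y hy => ?_
      rw [Set.uIcc_of_le hx.2] at hy
      simp only [map_smul, smul_eq_mul]
      rw [← mul_assoc, ← Real.exp_add, abs_of_nonpos (by linarith [hy.1])]
      congr 2; ring
    rw [e1, e2, ← map_add, ← smul_eq_mul, ← map_smul]
  have hkey : ∫ x in -R..R, (2 * (star (g x) ⬝ᵥ u x).re - (star (g x) ⬝ᵥ v x).re -
      (vsq (deriv u x) + κ ^ 2 * vsq (u x))) ≤ 0 := by
    refine le_trans ?_ (hPhi.le.trans hend)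
    refine intervalIntegral.integral_mono_on (by linarith)
      (Continuous.intervalIntegrable (by simp only [dotProduct]; fun_prop) _ _)
      (Continuous.intervalIntegrable (by simp only [dotProduct]; fun_prop) _ _) fun x _ => ?_
    have h1 := vsq_nonneg (w x - deriv u x)
    have h2 := mul_nonneg (sq_nonneg κ) (vsq_nonneg (v x - u x))
    rw [vsq_sub] at h1 h2
    simp only [star_sub, star_smul, sub_dotProduct, smul_dotProduct, Complex.add_re, Complex.sub_re,
      star_trivial, Complex.smul_re, smul_eq_mul, ← vsq_eq_re]
    linarith
  rw [intervalIntegral.integral_sub, intervalIntegral.integral_sub,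
    intervalIntegral.integral_const_mul, h_int] at hkey
  · have : 1 / (2 * κ) * expForm R κ g ≥ ∫ x in -R..R, (star (g x) ⬝ᵥ u x).re := by linarith
    rw [ge_iff_le, one_div, inv_mul_eq_div, le_div_iff₀ (by positivity)] at this
    linarith
  all_goals exact Continuous.intervalIntegrable (by try simp only [dotProduct]
                                                    fun_prop) _ _

end LowerBound

section HLT

variable {m : ℕ}

lemma exists_comb_orthogonal {R : ℝ} {n : ℕ} {f : Fin n → ℝ → Fin m → ℂ}
    {g : Fin (n + 1) → ℝ → Fin m → ℂ} (hf : ∀ i, Continuous (f i)) (hg : ∀ i, Continuous (g i)) :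
    ∃ c : Fin (n + 1) → ℂ, c ≠ 0 ∧ ∀ i, pair (volIoc R) (f i) (comb c g) = 0 := by
  let L : (Fin (n + 1) → ℂ) →ₗ[ℂ] (Fin n → ℂ) :=
    Matrix.mulVecLin (Matrix.of fun i j => pair (volIoc R) (f i) (g j))
  obtain ⟨c, hc, hc0⟩ := L.ker.ne_bot_iff.1 (LinearMap.ker_ne_bot_of_finrank_lt (by simp))
  refine ⟨c, hc0, fun i => ?_⟩
  have h := congrFun (LinearMap.mem_ker.1 hc) i
  simp only [L, Matrix.mulVecLin_apply, Matrix.mulVec, dotProduct, Matrix.of_apply,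
    Pi.zero_apply] at h
  rw [← h, pair]
  have : ∀ x, star (f i x) ⬝ᵥ comb c g x = ∑ j, (star (f i x) ⬝ᵥ g j x) * c j := fun x => by
    simp [comb, dotProduct_sum, dotProduct_smul, mul_comm]
  simp only [this]
  rw [integral_finsetSum]
  · exact Finset.sum_congr rfl fun j _ => integral_mul_const _ _
  · exact fun j _ => (integrable_pair (mem_sqInt_volIoc R (hf i))
      (mem_sqInt_volIoc R (hg j))).mul_const _

lemma UpperBound.pred {R κ s : ℝ} (hR : 0 < R) (hκ : 0 < κ) {W Q : ℝ → Matrix (Fin m) (Fin m) ℂ}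
    (hQ : Continuous Q) (hH : ∀ x, (Q x).IsHermitian) (hW : ∀ x, Q x * Q x = W x) {n : ℕ}
    {u : Fin (n + 1) → ℝ → Fin m → ℂ} (hu : ∀ i, ContDiff ℝ 1 (u i))
    (huR : ∀ i x, R ≤ |x| → u i x = 0)
    (hflag : ∀ c : Fin (n + 1) → ℂ, c ≠ 0 → form1 W (comb c u) + κ ^ 2 * mass (comb c u) < 0)
    (h : UpperBound R Q (n + 1) κ s) : UpperBound R Q n κ (s - 2 * κ) := by
  intro f hf ho
  obtain ⟨c, hc0, hc⟩ := exists_comb_orthogonal (R := R) hf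
    (fun i => hQ.matrix_mulVec (hu i).continuous)
  have hWc : Continuous W := by rw [← funext hW]; fun_prop
  let v := comb c u
  have hv : ContDiff ℝ 1 v := by
    unfold v comb; exact ContDiff.sum fun i _ => (hu i).const_smul (c i)
  have hvc := hv.continuous
  have hvd : Continuous (deriv v) := hv.continuous_deriv le_rfl
  have hvR : ∀ x, R ≤ |x| → v x = 0 := fun x hx => by simp [v, comb, huR _ x hx]
  let g : ℝ → Fin m → ℂ := fun x => Q x *ᵥ v x
  have hg : Continuous g := hQ.matrix_mulVec hvc
  have hgc : comb c (fun i x => Q x *ᵥ u i x) = g := by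
    ext1 x; simp [g, v, comb, Matrix.mulVec_sum, Matrix.mulVec_smul]
  rw [hgc] at hc
  have hfl := hflag c hc0
  change form1 W v + κ ^ 2 * mass v < 0 at hfl
  have hq : ∀ x, qform (W x) (v x) = vsq (g x) := fun x => by rw [← hW, qform_sq (hH x)]
  have hq' : ∀ x, (star (Q x *ᵥ g x) ⬝ᵥ v x).re = vsq (g x) := fun x => by
    rw [Matrix.star_mulVec, (hH x).eq, ← Matrix.dotProduct_mulVec, vsq_eq_re]
  rw [form1, mass, integral_eq_intervalIntegral (R := R) (f := fun x => vsq (deriv v x))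
      (fun x hx => by rw [deriv_eq_zero_of_abs_ge hvR hv hx, vsq_zero]),
    integral_eq_intervalIntegral (R := R) (f := fun x => qform (W x) (v x))
      (fun x hx => by rw [hvR x hx, qform_zero]),
    integral_eq_intervalIntegral (R := R) (f := fun x => vsq (v x))
      (fun x hx => by rw [hvR x hx, vsq_zero])] at hfl
  simp only [hq] at hfl
  have hle : (∫ x in -R..R, (vsq (deriv v x) + κ ^ 2 * vsq (v x))) ≤ ∫ x in -R..R, vsq (g x) := by
    rw [intervalIntegral.integral_add (Continuous.intervalIntegrable (by fun_prop) _ _)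
      (Continuous.intervalIntegrable (by fun_prop) _ _), intervalIntegral.integral_const_mul]
    linarith
  have hpos : 0 < ∫ x in -R..R, vsq (g x) := by
    have h1 : 0 ≤ ∫ x in -R..R, vsq (deriv v x) :=
      intervalIntegral.integral_nonneg (by linarith) fun x _ => vsq_nonneg _
    have h2 : 0 ≤ ∫ x in -R..R, vsq (v x) :=
      intervalIntegral.integral_nonneg (by linarith) fun x _ => vsq_nonneg _
    nlinarith [mul_nonneg (sq_nonneg κ) h2]
  set F := ∫ x in -R..R, vsq (g x) with hF
  have hlow := le_expForm hR hκ hv (hvR R (le_abs_self R)) (hvR (-R) (by simp [le_abs_self]))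
    (g := fun x => Q x *ᵥ g x) (hQ.matrix_mulVec hg) (by simpa only [hq'] using hle)
  simp only [hq', ← hF] at hlow
  let a : ℂ := ((Real.sqrt F)⁻¹ : ℝ)
  have ha : Complex.normSq a = F⁻¹ := by
    rw [Complex.normSq_ofReal, ← mul_inv, Real.mul_self_sqrt hpos.le]
  let f' : Fin (n + 1) → ℝ → Fin m → ℂ := Fin.snoc (α := fun _ => ℝ → Fin m → ℂ) f (fun x => a • g x)
  have hf' : ∀ i, Continuous (f' i) := fun i => by
    refine Fin.lastCases ?_ (fun i => ?_) i
    · simp only [f', Fin.snoc_last]; fun_prop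
    · simp only [f', Fin.snoc_castSucc]; exact hf i
  have hgg : pair (volIoc R) (fun x => a • g x) (fun x => a • g x) = 1 := by
    rw [pair_self]
    simp only [vsq_smul, integral_const_mul, ha]
    rw [← intervalIntegral.integral_of_le (by linarith), ← hF, inv_mul_cancel₀ hpos.ne',
      Complex.ofReal_one]
  have hfg : ∀ i, pair (volIoc R) (f i) (fun x => a • g x) = 0 := fun i => by
    have : pair (volIoc R) (f i) (fun x => a • g x) = a * pair (volIoc R) (f i) g := by
      simp only [pair, dotProduct_smul, smul_eq_mul]
      exact integral_const_mul _ _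
    rw [this, hc, mul_zero]
  have hgf : ∀ i, pair (volIoc R) (fun x => a • g x) (f i) = 0 := fun i => by
    rw [← pair_conj, hfg, map_zero]
  have hsum := h f' hf' (fun i j => by
    refine Fin.lastCases ?_ (fun i => ?_) i <;> refine Fin.lastCases ?_ (fun j => ?_) j
    · simp [f', hgg]
    · simp [f', hgf, (Fin.castSucc_lt_last j).ne']
    · simp [f', hfg, (Fin.castSucc_lt_last i).ne]
    · simp [f', ho])
  rw [Fin.sum_univ_castSucc] at hsum
  simp only [f', Fin.snoc_castSucc, Fin.snoc_last, Matrix.mulVec_smul, expForm_smul, ha] at hsum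
  have : 2 * κ ≤ F⁻¹ * expForm R κ (fun x => Q x *ᵥ g x) := by
    rw [inv_mul_eq_div, le_div_iff₀ hpos]; exact hlow
  linarith

lemma sum_le_of_upperBound {R : ℝ} (hR : 0 < R) {W Q : ℝ → Matrix (Fin m) (Fin m) ℂ}
    (hQ : Continuous Q) (hH : ∀ x, (Q x).IsHermitian) (hW : ∀ x, Q x * Q x = W x) (n : ℕ) :
    ∀ (u : Fin n → ℝ → Fin m → ℂ) (κ : Fin n → ℝ) (_ : ∀ i, ContDiff ℝ 1 (u i))
    (_ : ∀ i x, R ≤ |x| → u i x = 0) (_ : Antitone κ) (_ : ∀ i, 0 < κ i)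
    (_ : ∀ i, ∀ c : Fin n → ℂ, c ≠ 0 → (∀ j, i < j → c j = 0) →
      form1 W (comb c u) + κ i ^ 2 * mass (comb c u) < 0)
    (κ₀ s : ℝ) (_ : ∀ i, κ₀ ≤ κ i) (_ : UpperBound R Q n κ₀ s), ∑ i, 2 * κ i ≤ s := by
  induction n with
  | zero =>
    intro u κ _ _ _ _ _ κ₀ s _ h
    simpa using h (fun i => i.elim0) (fun i => i.elim0) (fun i => i.elim0)
  | succ n ih =>
    intro u κ hu huR hκ hκ0 hflag κ₀ s hκ₀ h
    rw [Fin.sum_univ_castSucc]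
    have h1 := (h.mono hQ (hκ₀ (Fin.last n))).pred hR (hκ0 _) hQ hH hW hu huR
      (fun c hc => hflag (Fin.last n) c hc fun j hj => absurd hj (Fin.le_last j).not_gt)
    have h2 := ih (fun i => u i.castSucc) (fun i => κ i.castSucc) (fun i => hu _) (fun i => huR _)
      (fun i j hij => hκ (Fin.castSucc_le_castSucc_iff.2 hij)) (fun i => hκ0 _) (fun i c hc hcj => ?_)
      (κ (Fin.last n)) _ (fun i => hκ (Fin.le_last _)) h1
    · linarith
    · have h3 := hflag i.castSucc (Fin.snoc (α := fun _ => ℂ) c 0) (fun h0 => hc (funext fun k => by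
        have := congrFun h0 k.castSucc
        simpa using this)) (fun j => by
          refine Fin.lastCases ?_ (fun j => ?_) j
          · simp
          · simpa using hcj j)
      have h4 : comb (Fin.snoc (α := fun _ => ℂ) c 0) u = comb c fun i => u i.castSucc := by
        ext1 x; simp [comb, Fin.sum_univ_castSucc]
      rwa [h4] at h3

/-- Families indexed by a finite type can be sorted by energy. -/
lemma exists_equiv_antitone {ι : Type} [Fintype ι] (E : ι → ℝ) :
    ∃ e : Fin (Fintype.card ι) ≃ ι, Antitone (E ∘ e) := by
  let e := (Fintype.equivFin ι).symm
  refine ⟨(Tuple.sort fun i => -E (e i)).trans e, ?_⟩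
  have h := Tuple.monotone_sort fun i => -E (e i)
  intro i j hij
  have := h hij
  simp only [Function.comp, neg_le_neg_iff] at this
  exact this

lemma comb_comp_equiv {ι κ X : Type*} [Fintype ι] [Fintype κ] (e : κ ≃ ι) (c : κ → ℂ)
    (u : ι → X → Fin m → ℂ) : comb c (u ∘ e) = comb (c ∘ e.symm) u := by
  ext1 x
  simp only [comb, Function.comp]
  rw [← e.sum_comp]; simp

lemma IsFlag.reindex {ι κ X : Type*} [Fintype ι] [Fintype κ] {q ms : (X → Fin m → ℂ) → ℝ}
    {u : ι → X → Fin m → ℂ} {E : ι → ℝ} (h : IsFlag q ms u E) (e : κ ≃ ι) :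
    IsFlag q ms (u ∘ e) (E ∘ e) := by
  intro i c hc hcj
  rw [comb_comp_equiv]
  refine h (e i) _ (fun h0 => hc ?_) fun j hj => hcj _ (by simpa using hj)
  ext k; simpa using congrFun h0 (e k)

/-- The one-dimensional Lieb–Thirring bound with exponent `γ` and constant `C`, for
matrix-valued potentials. -/
def LT1' (γ C : ℝ) : Prop :=
  ∀ (m : ℕ) (W : ℝ → Matrix (Fin m) (Fin m) ℂ), Continuous W → (∀ x, (W x).PosSemidef) →
    HasCompactSupport W → ∀ (ι : Type) [Fintype ι] (u : ι → ℝ → Fin m → ℂ) (E : ι → ℝ),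
    (∀ i, 0 < E i) → (∀ i, ContDiff ℝ 1 (u i)) → (∀ i, HasCompactSupport (u i)) →
    IsFlag (form1 W) mass u E → ∑ i, E i ^ γ ≤ C * ∫ x, trPow (γ + 1 / 2) (W x)

lemma trPow_one {A : Matrix (Fin m) (Fin m) ℂ} (hA : A.PosSemidef) :
    trPow 1 A = (trace A).re := by
  rw [trPow_eq_sum 1 hA.1, hA.1.trace_eq_sum_eigenvalues, Complex.re_sum]
  refine Finset.sum_congr rfl fun i _ => ?_
  rw [max_eq_left (hA.eigenvalues_nonneg i), Real.rpow_one]; simp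

/-- The Hundertmark–Laptev–Thomas bound. -/
theorem lt1'_half : LT1' (1 / 2) (1 / 2) := by
  intro m W hW hpos hsupp ι _ u E hE hu hus hflag
  obtain ⟨e, he⟩ := exists_equiv_antitone E
  obtain ⟨Q, hQ, hH, hQW⟩ := exists_sqrt hW hpos
  obtain ⟨R₁, hR₁, hR₁u⟩ := exists_pos_abs_ge_eq_zero hus
  obtain ⟨R₂, hR₂, hR₂W⟩ := exists_pos_abs_ge_eq_zero (ι := Unit) (f := fun _ => W) (fun _ => hsupp)
  have h := sum_le_of_upperBound (R := max R₁ R₂) (lt_max_of_lt_left hR₁) hQ hH hQW _ (u ∘ e)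
    (fun i => Real.sqrt (E (e i))) (fun i => hu _) (fun i x hx => hR₁u _ x ((le_max_left _ _).trans hx))
    (fun i j hij => Real.sqrt_le_sqrt (he hij)) (fun i => Real.sqrt_pos.2 (hE _))
    (fun i c hc hcj => ?_) 0 _ (fun i => Real.sqrt_nonneg _) (upperBound_zero hQ hH hQW _)
  · have h1 : ∫ x, trPow (1 / 2 + 1 / 2) (W x) = ∫ x, (trace (W x)).re ∂volIoc (max R₁ R₂) := by
      rw [← intervalIntegral.integral_of_le (by linarith [lt_max_of_lt_left hR₁ (c := R₂)]),
        ← integral_eq_intervalIntegral (f := fun x => (trace (W x)).re)]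
      · norm_num
        exact integral_congr_ae (Filter.Eventually.of_forall fun x => trPow_one (hpos x))
      · intro x hx
        rw [hR₂W () x ((le_max_right _ _).trans hx)]; simp
    rw [h1, ← e.sum_comp]
    simp only [← Real.sqrt_eq_rpow]
    rw [← Finset.mul_sum] at h
    linarith
  · simp only [Real.sq_sqrt (hE _).le]
    exact hflag.reindex e i c hc fun j hj => hcj j (lt_of_not_ge fun hji => by
      exact absurd (he hji) (not_le.2 hj))

end HLT

section AbstractEigen

variable {H : Type*} [NormedAddCommGroup H] [InnerProductSpace ℂ H] [CompleteSpace H]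

lemma norm_sq_le_of_form_nonneg {B : H →L[ℂ] H} (hs : ∀ f g, inner ℂ (B f) g = inner ℂ f (B g))
    (hp : ∀ f, 0 ≤ (inner ℂ f (B f)).re) (f : H) :
    ‖B f‖ ^ 2 ≤ (‖B‖ + 1) * (inner ℂ f (B f)).re := by
  set t : ℝ := (‖B‖ + 1)⁻¹ with ht
  have hb : 0 < ‖B‖ + 1 := by positivity
  have htpos : 0 < t := inv_pos.2 hb
  have h1 := hp (f - (t : ℂ) • B f)
  have h2 : (inner ℂ (B f) (B (B f))).re ≤ ‖B‖ * ‖B f‖ ^ 2 := by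
    calc (inner ℂ (B f) (B (B f))).re ≤ ‖B f‖ * ‖B (B f)‖ := re_inner_le_norm (𝕜 := ℂ) _ _
      _ ≤ ‖B f‖ * (‖B‖ * ‖B f‖) := by gcongr; exact B.le_opNorm _
      _ = _ := by ring
  have h3 : (inner ℂ (B f) (B f)).re = ‖B f‖ ^ 2 := inner_self_eq_norm_sq (𝕜 := ℂ) _
  simp only [map_sub, map_smul, inner_sub_left, inner_sub_right, inner_smul_left, inner_smul_right,
    Complex.conj_ofReal, ← hs f (B f), Complex.sub_re, Complex.re_ofReal_mul, h3] at h1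
  have h4 : t * (‖B‖ + 1) = 1 := inv_mul_cancel₀ hb.ne'
  have h5 : t * ‖B f‖ ^ 2 ≤ (inner ℂ f (B f)).re := by
    have : t * (t * (inner ℂ (B f) (B (B f))).re) ≤ t * (t * (‖B‖ * ‖B f‖ ^ 2)) := by gcongr
    have h6 : t * (t * (‖B‖ * ‖B f‖ ^ 2)) = t * ‖B f‖ ^ 2 - t * t * ‖B f‖ ^ 2 := by
      linear_combination (t * ‖B f‖ ^ 2) * h4
    have := mul_nonneg (mul_nonneg htpos.le htpos.le) (sq_nonneg ‖B f‖)
    linarith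
  calc ‖B f‖ ^ 2 = (‖B‖ + 1) * (t * ‖B f‖ ^ 2) := by rw [← mul_assoc, mul_comm _ t, h4, one_mul]
    _ ≤ _ := by gcongr

/-- Existence of a ground state for the form `‖f‖² - (1 - E) ‖J f‖² - ⟨J f, K J f⟩`. -/
theorem exists_ground_state (J K : H →L[ℂ] H) (hJ : ∀ f, ‖J f‖ ≤ ‖f‖)
    (hK : ∀ f g, inner ℂ (K f) g = inner ℂ f (K g)) (hc : IsCompactOperator (K ∘L J))
    {E₀ : ℝ} (hE₀ : 0 < E₀) {f₀ : H}
    (hf₀ : ‖f₀‖ ^ 2 - ‖J f₀‖ ^ 2 - (inner ℂ (J f₀) (K (J f₀))).re + E₀ * ‖J f₀‖ ^ 2 < 0) :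
    ∃ E, E₀ ≤ E ∧ ∃ f, f ≠ 0 ∧
      f = ContinuousLinearMap.adjoint J (((1 - E : ℝ) : ℂ) • J f + K (J f)) := by
  let b : ℝ → H → ℝ := fun E f => ‖f‖ ^ 2 - ‖J f‖ ^ 2 - (inner ℂ (J f) (K (J f))).re + E * ‖J f‖ ^ 2
  have hbE : ∀ E E' f, b E f = b E' f + (E - E') * ‖J f‖ ^ 2 := fun E E' f => by simp only [b]; ring
  let S : Set ℝ := {E | E₀ ≤ E ∧ ∃ f, b E f < 0}
  have hS0 : E₀ ∈ S := ⟨le_rfl, f₀, hf₀⟩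
  have hSb : BddAbove S := by
    refine ⟨1 + ‖K‖, fun E hE => ?_⟩
    obtain ⟨f, hf⟩ := hE.2
    by_contra hlt
    have h1 : (inner ℂ (J f) (K (J f))).re ≤ ‖K‖ * ‖J f‖ ^ 2 :=
      calc (inner ℂ (J f) (K (J f))).re ≤ ‖J f‖ * ‖K (J f)‖ := re_inner_le_norm (𝕜 := ℂ) _ _
        _ ≤ ‖J f‖ * (‖K‖ * ‖J f‖) := by gcongr; exact K.le_opNorm _
        _ = _ := by ring
    have h2 : (1 + ‖K‖) * ‖J f‖ ^ 2 ≤ E * ‖J f‖ ^ 2 := by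
      have := not_le.1 hlt
      gcongr
    simp only [b] at hf
    nlinarith [sq_nonneg ‖f‖]
  set Es := sSup S with hEs
  have hE0s : E₀ ≤ Es := le_csSup hSb hS0
  have hnn : ∀ f, 0 ≤ b Es f := fun f => by
    by_contra hlt
    rw [not_le] at hlt
    have hd : 0 < ‖J f‖ ^ 2 + 1 := by positivity
    let ε := -b Es f / (2 * (‖J f‖ ^ 2 + 1))
    have hε : 0 < ε := by simp only [ε]; apply div_pos <;> linarith
    have : Es + ε ∈ S := by
      refine ⟨by linarith, f, ?_⟩
      rw [hbE _ Es]
      have h1 : ε * (‖J f‖ ^ 2 + 1) = -b Es f / 2 := by simp only [ε]; field_simp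
      have : ε * ‖J f‖ ^ 2 = -b Es f / 2 - ε := by linarith
      rw [add_sub_cancel_left, this]; linarith
    have := le_csSup hSb this
    linarith
  have hseq : ∀ k : ℕ, ∃ f, ‖f‖ = 1 ∧ b Es f ≤ 1 / ((k : ℝ) + 1) := fun k => by
    have hk : (0 : ℝ) < 1 / ((k : ℝ) + 1) := by positivity
    obtain ⟨E, ⟨hE, f, hf⟩, hlt⟩ := exists_lt_of_lt_csSup ⟨E₀, hS0⟩
      (show Es - 1 / ((k : ℝ) + 1) < sSup S by linarith)
    have hf0 : ‖f‖ ≠ 0 := fun h0 => by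
      have : f = 0 := norm_eq_zero.1 h0
      simp [b, this] at hf
    have hfpos : 0 < ‖f‖ := lt_of_le_of_ne (norm_nonneg f) (Ne.symm hf0)
    refine ⟨((‖f‖⁻¹ : ℝ) : ℂ) • f, ?_, ?_⟩
    · rw [norm_smul, Complex.norm_real, Real.norm_of_nonneg (by positivity), inv_mul_cancel₀ hf0]
    · have h1 : b Es f ≤ 1 / ((k : ℝ) + 1) * ‖f‖ ^ 2 := by
        rw [hbE Es E]
        have h2 : ‖J f‖ ^ 2 ≤ ‖f‖ ^ 2 := by gcongr; exact hJ f
        have h3 : (Es - E) * ‖J f‖ ^ 2 ≤ 1 / ((k : ℝ) + 1) * ‖f‖ ^ 2 := by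
          rcases le_or_gt 0 (Es - E) with h | h
          · exact mul_le_mul (by linarith) h2 (sq_nonneg _) hk.le
          · have := mul_nonneg hk.le (sq_nonneg ‖f‖)
            nlinarith [sq_nonneg ‖J f‖]
        linarith
      have h2 : b Es (((‖f‖⁻¹ : ℝ) : ℂ) • f) = ‖f‖⁻¹ ^ 2 * b Es f := by
        simp only [b, map_smul, norm_smul, Complex.norm_real, Real.norm_of_nonneg
          (inv_nonneg.2 (norm_nonneg f)), inner_smul_left, inner_smul_right, Complex.conj_ofReal,
          Complex.re_ofReal_mul]
        ring
      rw [h2]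
      calc ‖f‖⁻¹ ^ 2 * b Es f ≤ ‖f‖⁻¹ ^ 2 * (1 / ((k : ℝ) + 1) * ‖f‖ ^ 2) := by gcongr
        _ = _ := by field_simp
  choose f hf1 hfb using hseq
  let A := ContinuousLinearMap.adjoint J
  let C : H →L[ℂ] H := A ∘L (K ∘L J)
  let T : H →L[ℂ] H := ContinuousLinearMap.id ℂ H - ((1 - Es : ℝ) : ℂ) • (A ∘L J)
  let B : H →L[ℂ] H := T - C
  have hBs : ∀ f g, inner ℂ (B f) g = inner ℂ f (B g) := fun f g => by
    simp only [B, T, C, A, _root_.sub_apply, _root_.smul_apply,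
      ContinuousLinearMap.comp_apply, ContinuousLinearMap.id_apply, inner_sub_left, inner_sub_right,
      inner_smul_left, inner_smul_right, ContinuousLinearMap.adjoint_inner_left,
      ContinuousLinearMap.adjoint_inner_right, Complex.conj_ofReal, hK]
  have hTf : ∀ f, (inner ℂ f (T f)).re = ‖f‖ ^ 2 - (1 - Es) * ‖J f‖ ^ 2 := fun f => by
    simp only [T, A, _root_.sub_apply, _root_.smul_apply,
      ContinuousLinearMap.comp_apply, ContinuousLinearMap.id_apply, inner_sub_right,
      inner_smul_right, ContinuousLinearMap.adjoint_inner_right, Complex.sub_re,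
      Complex.re_ofReal_mul]
    rw [show (inner ℂ f f).re = ‖f‖ ^ 2 from inner_self_eq_norm_sq (𝕜 := ℂ) f,
      show (inner ℂ (J f) (J f)).re = ‖J f‖ ^ 2 from inner_self_eq_norm_sq (𝕜 := ℂ) (J f)]
  have hBf : ∀ f, (inner ℂ f (B f)).re = b Es f := fun f => by
    simp only [B, _root_.sub_apply, inner_sub_right, Complex.sub_re, hTf, C, A,
      ContinuousLinearMap.comp_apply, ContinuousLinearMap.adjoint_inner_right, b]
    ring
  have hB0 : Filter.Tendsto (fun k => B (f k)) Filter.atTop (nhds 0) := by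
    have h1 : ∀ k, ‖B (f k)‖ ^ 2 ≤ (‖B‖ + 1) * (1 / ((k : ℝ) + 1)) := fun k =>
      (norm_sq_le_of_form_nonneg hBs (fun f => by rw [hBf]; exact hnn f) (f k)).trans
        (by rw [hBf]; gcongr; exact hfb k)
    have h2 : Filter.Tendsto (fun k : ℕ => (‖B‖ + 1) * (1 / ((k : ℝ) + 1))) Filter.atTop (nhds 0) := by
      simpa using tendsto_one_div_add_atTop_nhds_zero_nat.const_mul (‖B‖ + 1)
    have h3 : Filter.Tendsto (fun k => ‖B (f k)‖ ^ 2) Filter.atTop (nhds 0) :=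
      squeeze_zero (fun k => sq_nonneg _) h1 h2
    rw [tendsto_zero_iff_norm_tendsto_zero]
    have := (Real.continuous_sqrt.tendsto 0).comp h3
    simpa [Function.comp_def, Real.sqrt_sq (norm_nonneg _)] using this
  have hCc : IsCompactOperator C := hc.clm_comp A
  obtain ⟨g, -, φ, hφ, hg⟩ := (hCc.isCompact_closure_image_closedBall 1).tendsto_subseq
    (x := fun k => C (f k)) (fun k => subset_closure ⟨f k, by simp [hf1 k], rfl⟩)
  have hT : Filter.Tendsto (fun k => T (f (φ k))) Filter.atTop (nhds g) := by
    have := (hB0.comp hφ.tendsto_atTop).add hg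
    simpa [B, Function.comp_def] using this
  let c := min 1 Es
  have hcpos : 0 < c := lt_min one_pos (by linarith)
  have hcoer : ∀ f, c * ‖f‖ ≤ ‖T f‖ := fun f => by
    have h1 : c * ‖f‖ ^ 2 ≤ ‖f‖ * ‖T f‖ := by
      refine le_trans ?_ (re_inner_le_norm (𝕜 := ℂ) f (T f))
      change _ ≤ (inner ℂ f (T f)).re
      rw [hTf]
      have h2 : ‖J f‖ ^ 2 ≤ ‖f‖ ^ 2 := by gcongr; exact hJ f
      rcases le_total 1 Es with h | h
      · have : c ≤ 1 := min_le_left _ _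
        nlinarith [sq_nonneg ‖f‖, sq_nonneg ‖J f‖]
      · have : c ≤ Es := min_le_right _ _
        nlinarith [sq_nonneg ‖f‖, sq_nonneg ‖J f‖]
    rcases (norm_nonneg f).eq_or_lt with h | h
    · rw [← h, mul_zero]; exact norm_nonneg _
    · nlinarith
  have hcau : CauchySeq fun k => f (φ k) := by
    rw [Metric.cauchySeq_iff']
    intro ε hε
    obtain ⟨N, hN⟩ := Metric.cauchySeq_iff'.1 hT.cauchySeq (c * ε) (by positivity)
    refine ⟨N, fun n hn => ?_⟩
    have h1 := hN n hn
    rw [dist_eq_norm, ← map_sub] at h1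
    rw [dist_eq_norm]
    have := (hcoer _).trans_lt h1
    exact lt_of_mul_lt_mul_left this hcpos.le
  obtain ⟨F, hF⟩ := cauchySeq_tendsto_of_complete hcau
  refine ⟨Es, hE0s, F, ?_, ?_⟩
  · rintro rfl
    have h1 := hF.norm
    simp only [hf1, norm_zero] at h1
    exact one_ne_zero (tendsto_nhds_unique tendsto_const_nhds h1)
  · have h1 : B F = 0 := tendsto_nhds_unique ((B.continuous.tendsto F).comp hF)
      (hB0.comp hφ.tendsto_atTop)
    simp only [B, T, C, _root_.sub_apply, _root_.smul_apply,
      ContinuousLinearMap.comp_apply, ContinuousLinearMap.id_apply] at h1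
    rw [map_add, map_smul]
    rw [sub_sub, sub_eq_zero] at h1
    exact h1

end AbstractEigen

section AbstractBoundStates

variable {H : Type*} [NormedAddCommGroup H] [InnerProductSpace ℂ H]

/-- The form `‖f‖² - ‖J f‖² - ⟨J f, K J f⟩`. -/
noncomputable def bsForm (J K : H →L[ℂ] H) (f : H) : ℝ :=
  ‖f‖ ^ 2 - ‖J f‖ ^ 2 - (inner ℂ (J f) (K (J f))).re

/-- The finite rank operator `∑ e_l |g_l⟩⟨g_l|` over a finite set of indices. -/
noncomputable def deflation {ι : Type*} (s : Finset ι) (e : ι → ℝ) (g : ι → H) : H →L[ℂ] H :=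
  ∑ l ∈ s, (e l : ℂ) • (innerSL ℂ (g l)).smulRight (g l)

lemma deflation_apply {ι : Type*} (s : Finset ι) (e : ι → ℝ) (g : ι → H) (f : H) :
    deflation s e g f = ∑ l ∈ s, (e l : ℂ) • inner ℂ (g l) f • g l := by
  simp [deflation]

lemma isCompactOperator_deflation {ι : Type*} (s : Finset ι) (e : ι → ℝ) (g : ι → H) :
    IsCompactOperator (deflation s e g) := by
  classical
  induction s using Finset.induction_on with
  | empty =>
    have : (deflation ∅ e g : H →L[ℂ] H) = 0 := by simp [deflation]
    rw [this]; exact isCompactOperator_zero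
  | insert a s ha ih =>
    have : deflation (insert a s) e g = (e a : ℂ) • (innerSL ℂ (g a)).smulRight (g a) +
        deflation s e g := by simp [deflation, Finset.sum_insert ha]
    rw [this]
    refine IsCompactOperator.add ?_ ih
    refine IsCompactOperator.smul ?_ _
    have h : IsCompactOperator (ContinuousLinearMap.toSpanSingleton ℂ (g a)) :=
      isCompactOperator_of_locallyCompactSpace_rng _
    exact h.comp_clm (innerSL ℂ (g a))

lemma deflation_symm {ι : Type*} (s : Finset ι) (e : ι → ℝ) (g : ι → H) (x y : H) :
    inner ℂ (deflation s e g x) y = inner ℂ x (deflation s e g y) := by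
  simp only [deflation_apply, sum_inner, inner_sum, inner_smul_left, inner_smul_right,
    Complex.conj_ofReal, inner_conj_symm]
  exact Finset.sum_congr rfl fun l _ => by ring

/-- Existence of bound states below a flag of trial vectors. -/
theorem exists_bound_states [CompleteSpace H] (J K : H →L[ℂ] H) (hJ : ∀ f, ‖J f‖ ≤ ‖f‖)
    (hK : ∀ f g, inner ℂ (K f) g = inner ℂ f (K g)) (hc : IsCompactOperator (K ∘L J)) {N : ℕ}
    {E : Fin N → ℝ} (hE : ∀ i, 0 < E i) (hanti : Antitone E) (v : Fin N → H)
    (hv : ∀ i, ∀ c : Fin N → ℂ, c ≠ 0 → (∀ j, E j < E i → c j = 0) →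
      bsForm J K (∑ j, c j • v j) + E i * ‖J (∑ j, c j • v j)‖ ^ 2 < 0) :
    ∃ (e : Fin N → ℝ) (f : Fin N → H), (∀ i, E i ≤ e i) ∧ Orthonormal ℂ (fun i => J (f i)) ∧
      ∀ i, f i = ContinuousLinearMap.adjoint J (((1 - e i : ℝ) : ℂ) • J (f i) + K (J (f i))) := by
  classical
  suffices h : ∀ k ≤ N, ∃ (e : Fin N → ℝ) (f : Fin N → H), ∀ i : Fin N, i.val < k → E i ≤ e i ∧
      f i = ContinuousLinearMap.adjoint J (((1 - e i : ℝ) : ℂ) • J (f i) + K (J (f i))) ∧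
      ∀ j : Fin N, j.val ≤ i.val → inner ℂ (J (f j)) (J (f i)) = if j = i then 1 else 0 by
    obtain ⟨e, f, h⟩ := h N le_rfl
    refine ⟨e, f, fun i => (h i i.2).1, ?_, fun i => (h i i.2).2.1⟩
    rw [orthonormal_iff_ite]
    intro i j
    rcases le_total i j with hij | hij
    · exact (h j j.2).2.2 i hij
    · have := (h i i.2).2.2 j hij
      rw [← inner_conj_symm, this]
      by_cases h' : j = i
      · simp [h']
      · simp [h', Ne.symm h']
  intro k
  induction k with
  | zero => exact fun _ => ⟨0, 0, fun i hi => absurd hi (Nat.not_lt_zero _)⟩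
  | succ k ih =>
    intro hk
    obtain ⟨e, f, h⟩ := ih (by omega)
    let κ : Fin N := ⟨k, by omega⟩
    let s : Finset (Fin N) := Finset.univ.filter fun i => i.val < k
    have hs : ∀ i, i ∈ s ↔ i.val < k := by simp [s]
    let K' : H →L[ℂ] H := K - deflation s e fun i => J (f i)
    have hK' : ∀ w, K' w = K w - ∑ l ∈ s, (e l : ℂ) • inner ℂ (J (f l)) w • J (f l) := fun w => by
      simp only [K', _root_.sub_apply, deflation_apply]
    have hKz : ∀ w, (∀ l ∈ s, inner ℂ (J (f l)) w = 0) → K' w = K w := fun w hw => by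
      rw [hK', Finset.sum_eq_zero (s := s) fun l hl => by rw [hw l hl, zero_smul, smul_zero], sub_zero]
    -- the trial vector
    let L : ({j : Fin N // j.val ≤ k} → ℂ) →ₗ[ℂ] ({i : Fin N // i.val < k} → ℂ) :=
      Matrix.mulVecLin (Matrix.of fun i j => inner ℂ (J (f i)) (J (v j)))
    have hcard : Fintype.card {i : Fin N // i.val < k} < Fintype.card {j : Fin N // j.val ≤ k} := by
      refine Fintype.card_lt_of_injective_of_notMem (b := ⟨κ, le_rfl⟩)
        (fun i => ⟨i.1, i.2.le⟩) (fun i j hij => ?_) ?_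
      · simpa [Subtype.ext_iff] using hij
      · rintro ⟨i, hi⟩
        have := congrArg (fun z => z.1.val) hi
        have h2 := i.2
        simp only [κ] at this
        omega
    obtain ⟨c', hc', hc0'⟩ := L.ker.ne_bot_iff.1 (LinearMap.ker_ne_bot_of_finrank_lt (by simpa using hcard))
    let c : Fin N → ℂ := fun j => if h : j.val ≤ k then c' ⟨j, h⟩ else 0
    have hc0 : c ≠ 0 := fun h0 => hc0' <| funext fun j => by
      have := congrFun h0 j.1
      simpa [c, j.2] using this
    have hcE : ∀ j, E j < E κ → c j = 0 := fun j hj => by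
      have : ¬ j.val ≤ k := fun hle => absurd (hanti (show j ≤ κ from hle)) (not_le.2 hj)
      simp [c, this]
    have horth : ∀ l ∈ s, inner ℂ (J (f l)) (J (∑ j, c j • v j)) = 0 := fun l hl => by
      have h1 := congrFun (LinearMap.mem_ker.1 hc') ⟨l, (hs l).1 hl⟩
      simp only [L, Matrix.mulVecLin_apply, Matrix.mulVec, dotProduct, Matrix.of_apply,
        Pi.zero_apply] at h1
      rw [map_sum, inner_sum, ← h1]
      simp only [map_smul, inner_smul_right]
      rw [← Fintype.sum_subtype_add_sum_subtype fun j : Fin N => j.val ≤ k,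
        Finset.sum_eq_zero fun (j : {j : Fin N // ¬ j.val ≤ k}) _ => by simp [c, j.2], add_zero]
      exact Finset.sum_congr rfl fun j _ => by simp [c, j.2, mul_comm]
    have hflag := hv κ c hc0 hcE
    obtain ⟨e₀, he₀, w, hw0, hw⟩ := exists_ground_state J K' hJ (fun x y => by
        simp only [K', _root_.sub_apply, inner_sub_left, inner_sub_right, hK, deflation_symm]) (by
        have : K' ∘L J = K ∘L J - (deflation s e fun i => J (f i)) ∘L J := by
          simp only [K', ContinuousLinearMap.sub_comp]
        rw [this]
        exact hc.sub ((isCompactOperator_deflation s e _).comp_clm J)) (hE κ)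
      (f₀ := ∑ j, c j • v j) (by
        rw [hKz _ horth]
        exact hflag)
    -- the new state is orthogonal to the previous ones
    have hwo : ∀ l ∈ s, inner ℂ (J (f l)) (J w) = 0 := fun l hl => by
      obtain ⟨hEl, hfl, hol⟩ := h l ((hs l).1 hl)
      have h1 : inner ℂ (f l) w = inner ℂ (J (f l)) (((1 - e₀ : ℝ) : ℂ) • J w + K' (J w)) := by
        conv_lhs => rw [hw]
        rw [ContinuousLinearMap.adjoint_inner_right]
      have h2 : inner ℂ (f l) w = inner ℂ (((1 - e l : ℝ) : ℂ) • J (f l) + K (J (f l))) (J w) := by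
        conv_lhs => rw [hfl]
        rw [ContinuousLinearMap.adjoint_inner_left]
      have h3 : ∑ x ∈ s, (e x : ℂ) * (inner ℂ (J (f x)) (J w) * inner ℂ (J (f l)) (J (f x))) =
          e l * inner ℂ (J (f l)) (J w) := by
        rw [Finset.sum_eq_single l]
        · rw [hol l le_rfl]; simp
        · intro x hx hxl
          have : inner ℂ (J (f l)) (J (f x)) = 0 := by
            rcases le_total x l with hle | hle
            · rw [← inner_conj_symm, hol x hle, if_neg hxl, map_zero]
            · rw [(h x ((hs x).1 hx)).2.2 l hle, if_neg (Ne.symm hxl)]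
          rw [this]; simp
        · exact fun h => absurd hl h
      rw [h2, hK', inner_add_left, inner_add_right, inner_sub_right, inner_sum, hK] at h1
      simp only [inner_smul_left, inner_smul_right, Complex.conj_ofReal] at h1
      rw [h3] at h1
      push_cast at h1
      have h4 : (e₀ : ℂ) * inner ℂ (J (f l)) (J w) = 0 := by linear_combination h1
      have : (e₀ : ℂ) ≠ 0 := by
        have := (hE κ).trans_le he₀
        exact_mod_cast this.ne'
      exact (mul_eq_zero.1 h4).resolve_left this
    rw [hKz _ hwo] at hw
    have hJw : J w ≠ 0 := fun h0 => hw0 <| by rw [hw, h0]; simp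
    have hnn : (‖J w‖ : ℂ) ≠ 0 := by simpa using hJw
    have hκ : ∀ i : Fin N, i.val < k → i ≠ κ := fun i hi h0 => by
      rw [h0] at hi; exact lt_irrefl _ hi
    refine ⟨Function.update e κ e₀, Function.update f κ ((‖J w‖ : ℂ)⁻¹ • w), fun i hi => ?_⟩
    rcases Nat.lt_succ_iff_lt_or_eq.1 hi with hi | hi
    · rw [Function.update_of_ne (hκ i hi), Function.update_of_ne (hκ i hi)]
      obtain ⟨h1, h2, h3⟩ := h i hi
      refine ⟨h1, h2, fun j hj => ?_⟩
      rw [Function.update_of_ne (hκ j (by omega)), h3 j hj]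
    · obtain rfl : i = κ := Fin.ext hi
      rw [Function.update_self, Function.update_self]
      refine ⟨he₀, ?_, fun j hj => ?_⟩
      · have h5 := congrArg (fun z => (‖J w‖ : ℂ)⁻¹ • z) hw
        simp only [map_add, map_smul, smul_add] at h5 ⊢
        rw [smul_comm ((1 - e₀ : ℝ) : ℂ)]
        exact h5
      · rcases eq_or_ne j κ with rfl | hjk
        · rw [Function.update_self, if_pos rfl, map_smul, inner_smul_left, inner_smul_right,
            inner_self_eq_norm_sq_to_K, map_inv₀, Complex.conj_ofReal]
          simp only [Complex.coe_algebraMap]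
          field_simp
        · have hjk' : j.val < k := lt_of_le_of_ne hj fun h0 => hjk (Fin.ext h0)
          rw [Function.update_of_ne hjk, if_neg hjk, map_smul, inner_smul_right,
            hwo j ((hs j).2 hjk'), mul_zero]

end AbstractBoundStates

/-- The exponential distribution. -/
noncomputable def expMeas : Measure ℝ :=
  (volume.restrict (Set.Ioi 0)).withDensity fun s => ENNReal.ofReal (Real.exp (-s))

instance isProbabilityMeasure_expMeas : IsProbabilityMeasure expMeas := by
  refine ⟨?_⟩
  rw [expMeas, withDensity_apply _ MeasurableSet.univ, Measure.restrict_univ,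
    ← ofReal_integral_eq_lintegral_ofReal, integral_exp_neg_Ioi_zero, ENNReal.ofReal_one]
  · exact (integrableOn_exp_neg_Ioi 0)
  · exact Filter.Eventually.of_forall fun x => (Real.exp_pos _).le

lemma integral_expMeas {G : Type*} [NormedAddCommGroup G] [NormedSpace ℝ G] (g : ℝ → G) :
    ∫ s, g s ∂expMeas = ∫ s in Set.Ioi 0, Real.exp (-s) • g s := by
  rw [expMeas, integral_withDensity_eq_integral_toReal_smul (by fun_prop)
    (Filter.Eventually.of_forall fun _ => ENNReal.ofReal_lt_top)]
  simp_rw [ENNReal.toReal_ofReal (Real.exp_pos _).le]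

lemma measurePreserving_shear (σ : ℝ) : MeasurePreserving (fun p : ℝ × ℝ => (p.1, p.2 + σ * p.1))
    (expMeas.prod volume) (expMeas.prod volume) := by
  refine MeasurePreserving.skew_product (MeasurePreserving.id _)
    (g := fun s x => x + σ * s) (by fun_prop) (Filter.Eventually.of_forall fun s => ?_)
  exact (measurePreserving_add_right volume (σ * s)).map_eq

lemma measurePreserving_shift (σ : ℝ) : MeasurePreserving (fun p : ℝ × ℝ => p.2 + σ * p.1)
    (expMeas.prod volume) volume :=
  measurePreserving_snd.comp (measurePreserving_shear σ)

section Resolvent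

variable {F : Type*} [NormedAddCommGroup F] [InnerProductSpace ℂ F] [CompleteSpace F]

/-- The isometry `f ↦ ((s, x) ↦ f (x + σ s))`. -/
noncomputable def shiftLp (F : Type*) [NormedAddCommGroup F] [InnerProductSpace ℂ F] (σ : ℝ) :
    Lp F 2 (volume : Measure ℝ) →L[ℂ] Lp F 2 (expMeas.prod (volume : Measure ℝ)) :=
  (Lp.compMeasurePreservingₗᵢ ℂ _ (measurePreserving_shift σ)).toContinuousLinearMap

lemma norm_shiftLp (σ : ℝ) (f : Lp F 2 (volume : Measure ℝ)) : ‖shiftLp F σ f‖ = ‖f‖ :=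
  (Lp.compMeasurePreservingₗᵢ ℂ _ (measurePreserving_shift σ)).norm_map f

lemma coeFn_shiftLp (σ : ℝ) (f : Lp F 2 (volume : Measure ℝ)) :
    shiftLp F σ f =ᵐ[expMeas.prod volume] fun p => f (p.2 + σ * p.1) :=
  Lp.coeFn_compMeasurePreserving f (measurePreserving_shift σ)

/-- The operator of averaging `s ↦ f (x + σ s)` over the exponential distribution. -/
noncomputable def expAvg (F : Type*) [NormedAddCommGroup F] [InnerProductSpace ℂ F]
    [CompleteSpace F] (σ : ℝ) : Lp F 2 (volume : Measure ℝ) →L[ℂ] Lp F 2 (volume : Measure ℝ) :=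
  ContinuousLinearMap.adjoint (shiftLp F 0) ∘L shiftLp F σ

lemma norm_expAvg_le (σ : ℝ) (f : Lp F 2 (volume : Measure ℝ)) : ‖expAvg F σ f‖ ≤ ‖f‖ := by
  have h1 : ‖shiftLp F 0‖ ≤ 1 := ContinuousLinearMap.opNorm_le_bound _ zero_le_one fun f => by
    rw [norm_shiftLp, one_mul]
  calc ‖expAvg F σ f‖ ≤ ‖ContinuousLinearMap.adjoint (shiftLp F 0)‖ * ‖shiftLp F σ f‖ :=
        (ContinuousLinearMap.adjoint (shiftLp F 0)).le_opNorm (shiftLp F σ f)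
    _ ≤ 1 * ‖f‖ := by rw [norm_shiftLp, LinearIsometryEquiv.norm_map]; gcongr
    _ = ‖f‖ := one_mul _

lemma inner_shiftLp (σ τ : ℝ) (f g : Lp F 2 (volume : Measure ℝ)) :
    inner ℂ (shiftLp F σ f) (shiftLp F τ g) =
      ∫ p, inner ℂ (f (p.2 + σ * p.1)) (g (p.2 + τ * p.1)) ∂(expMeas.prod volume) := by
  rw [L2.inner_def]
  refine integral_congr_ae ?_
  filter_upwards [coeFn_shiftLp σ f, coeFn_shiftLp τ g] with p h1 h2
  rw [h1, h2]

lemma adjoint_expAvg (σ : ℝ) : ContinuousLinearMap.adjoint (expAvg F σ) = expAvg F (-σ) := by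
  refine ContinuousLinearMap.ext fun f => ext_inner_left ℂ fun g => ?_
  rw [ContinuousLinearMap.adjoint_inner_right, expAvg, expAvg, ContinuousLinearMap.comp_apply,
    ContinuousLinearMap.comp_apply, ContinuousLinearMap.adjoint_inner_right,
    ContinuousLinearMap.adjoint_inner_left, inner_shiftLp, inner_shiftLp]
  have hm : ∀ (τ : ℝ) (f : Lp F 2 (volume : Measure ℝ)), AEStronglyMeasurable
      (fun p : ℝ × ℝ => f (p.2 + τ * p.1)) (expMeas.prod volume) := fun τ f =>
    (Lp.aestronglyMeasurable f).comp_measurePreserving (measurePreserving_shift τ)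
  have h := integral_map (measurePreserving_shear σ).measurable.aemeasurable
    (f := fun p : ℝ × ℝ => inner ℂ (g (p.2 + 0 * p.1)) (f (p.2 + -σ * p.1)))
    (by rw [(measurePreserving_shear σ).map_eq]; exact (hm 0 g).inner (hm (-σ) f))
  rw [(measurePreserving_shear σ).map_eq] at h
  rw [h]
  refine integral_congr_ae (Filter.Eventually.of_forall fun p => ?_)
  dsimp only
  congr 2 <;> ring

/-- Pointwise formula for the averaging operator. -/
lemma coeFn_expAvg (σ : ℝ) (f : Lp F 2 (volume : Measure ℝ)) :
    expAvg F σ f =ᵐ[volume] fun x => ∫ s, f (x + σ * s) ∂expMeas := by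
  have hm : AEStronglyMeasurable (fun p : ℝ × ℝ => f (p.2 + σ * p.1)) (expMeas.prod volume) :=
    (Lp.aestronglyMeasurable f).comp_measurePreserving (measurePreserving_shift σ)
  have hL : MemLp (fun p : ℝ × ℝ => f (p.2 + σ * p.1)) 2 (expMeas.prod volume) :=
    (Lp.memLp f).comp_measurePreserving (measurePreserving_shift σ)
  have hI : ∀ s : Set ℝ, MeasurableSet s → volume s < ⊤ →
      Integrable (fun p : ℝ × ℝ => f (p.2 + σ * p.1)) (expMeas.prod (volume.restrict s)) := by
    intro s hs hμ
    have : IsFiniteMeasure (volume.restrict s) := ⟨by simpa using hμ⟩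
    refine MemLp.integrable (q := 2) (by norm_num) (hL.mono_measure ?_)
    exact Measure.prod_mono le_rfl Measure.restrict_le_self
  refine ae_eq_of_forall_setIntegral_eq_of_sigmaFinite
    (fun s hs hμ => integrableOn_Lp_of_measure_ne_top _ (by norm_num) hμ.ne)
    (fun s hs hμ => ?_) fun s hs hμ => ?_
  · exact (hI s hs hμ).integral_prod_right
  · refine ext_inner_left ℂ fun c => ?_
    rw [← L2.inner_indicatorConstLp_eq_inner_setIntegral ℂ hs hμ.ne, expAvg,
      ContinuousLinearMap.comp_apply, ContinuousLinearMap.adjoint_inner_right, inner_shiftLp]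
    have h1 : ∫ p, inner ℂ (indicatorConstLp 2 hs hμ.ne c (p.2 + 0 * p.1)) (f (p.2 + σ * p.1))
        ∂(expMeas.prod volume) =
        ∫ p, inner ℂ c (f (p.2 + σ * p.1)) ∂(expMeas.prod (volume.restrict s)) := by
      have h2 : expMeas.prod (volume.restrict s) = (expMeas.prod volume).restrict (Set.univ ×ˢ s) := by
        rw [← Measure.prod_restrict, Measure.restrict_univ]
      rw [h2, ← integral_indicator (MeasurableSet.univ.prod hs)]
      refine integral_congr_ae ?_
      filter_upwards [(measurePreserving_shift 0).quasiMeasurePreserving.ae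
        (indicatorConstLp_coeFn (p := 2) (hs := hs) (hμs := hμ.ne) (c := c))] with p hp
      rw [hp]
      by_cases h : p.2 ∈ s <;> simp [h, Set.indicator]
    rw [h1, integral_inner (hI s hs hμ), integral_prod_symm _ (hI s hs hμ)]

end Resolvent

section Pointwise

variable {F : Type*} [NormedAddCommGroup F] [InnerProductSpace ℂ F] [CompleteSpace F]

/-- The solution `u` of `u' = f - u` decaying at `-∞`. -/
noncomputable def lowerAvg (f : ℝ → F) (x : ℝ) : F := ∫ s, f (x + -1 * s) ∂expMeas

/-- The solution `u` of `u' = u - f` decaying at `∞`. -/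
noncomputable def upperAvg (f : ℝ → F) (x : ℝ) : F := ∫ s, f (x + 1 * s) ∂expMeas

lemma upperAvg_eq (f : ℝ → F) (x : ℝ) : upperAvg f x = lowerAvg (fun y => f (-y)) (-x) := by
  simp only [upperAvg, lowerAvg]
  congr 1
  ext s
  congr 1
  ring

lemma lowerAvg_eq (f : ℝ → F) (x : ℝ) :
    lowerAvg f x = ∫ y in Set.Iic x, Real.exp (y - x) • f y := by
  rw [lowerAvg, integral_expMeas, integral_Iic_eq_integral_Iio, ← integral_indicator measurableSet_Ioi,
    ← integral_indicator measurableSet_Iio,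
    ← integral_sub_left_eq_self ((Set.Iio x).indicator fun y => Real.exp (y - x) • f y) volume x]
  congr 1
  ext s
  have : x - s ∈ Set.Iio x ↔ s ∈ Set.Ioi 0 := by simp
  by_cases h : s ∈ Set.Ioi (0 : ℝ)
  · rw [Set.indicator_of_mem h, Set.indicator_of_mem (this.2 h), sub_sub_cancel_left, neg_one_mul,
      sub_eq_add_neg]
  · rw [Set.indicator_of_notMem h, Set.indicator_of_notMem (mt this.1 h)]

lemma memLp_exp_Iic (x : ℝ) : MemLp (fun y => Real.exp (y - x)) 2 (volume.restrict (Set.Iic x)) := by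
  rw [memLp_two_iff_integrable_sq (by fun_prop)]
  have h : ∀ y, Real.exp (y - x) ^ 2 = Real.exp (-(2 * x)) * Real.exp (2 * y) := fun y => by
    rw [← Real.exp_nat_mul, ← Real.exp_add]; congr 1; push_cast; ring
  simp_rw [h]
  exact (integrableOn_exp_mul_Iic (by norm_num) x).const_mul _

lemma integral_exp_sq_Iic (x : ℝ) : ∫ y in Set.Iic x, Real.exp (y - x) ^ 2 = 1 / 2 := by
  have h : ∀ y, Real.exp (y - x) ^ 2 = Real.exp (-(2 * x)) * Real.exp (2 * y) := fun y => by
    rw [← Real.exp_nat_mul, ← Real.exp_add]; congr 1; push_cast; ring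
  simp_rw [h]
  rw [integral_const_mul, integral_exp_mul_Iic (by norm_num), mul_div_assoc', ← Real.exp_add]
  simp

variable {f : ℝ → F}

lemma integrableOn_exp_smul_Iic (hf : MemLp f 2) (x : ℝ) :
    IntegrableOn (fun y => Real.exp (y - x) • f y) (Set.Iic x) :=
  memLp_one_iff_integrable.1 (MemLp.smul (𝕜 := ℝ) (p := 2) (q := 2) (r := 1)
    (hf.restrict (Set.Iic x)) (memLp_exp_Iic x))

lemma norm_lowerAvg_le (hf : MemLp f 2) (x : ℝ) : ‖lowerAvg f x‖ ≤ 1 + ∫ y, ‖f y‖ ^ 2 := by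
  have hi := (memLp_two_iff_integrable_sq_norm hf.1).1 hf
  rw [lowerAvg_eq]
  calc ‖∫ y in Set.Iic x, Real.exp (y - x) • f y‖
      ≤ ∫ y in Set.Iic x, ‖Real.exp (y - x) • f y‖ := norm_integral_le_integral_norm _
    _ ≤ ∫ y in Set.Iic x, (Real.exp (y - x) ^ 2 + ‖f y‖ ^ 2) := by
        refine integral_mono (integrableOn_exp_smul_Iic hf x).norm
          ((memLp_two_iff_integrable_sq (by fun_prop)).1 (memLp_exp_Iic x) |>.add hi.integrableOn) fun y => ?_
        dsimp only
        rw [norm_smul, Real.norm_of_nonneg (Real.exp_pos _).le]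
        nlinarith [sq_nonneg (Real.exp (y - x) - ‖f y‖), sq_nonneg (Real.exp (y - x)), sq_nonneg ‖f y‖]
    _ ≤ 1 + ∫ y, ‖f y‖ ^ 2 := by
        rw [integral_add ((memLp_two_iff_integrable_sq (by fun_prop)).1 (memLp_exp_Iic x))
          hi.integrableOn, integral_exp_sq_Iic]
        refine add_le_add (by norm_num) (setIntegral_le_integral hi ?_)
        exact Filter.Eventually.of_forall fun y => sq_nonneg _

lemma locallyIntegrable_of_memLp_two (hf : MemLp f 2) : LocallyIntegrable f :=
  hf.locallyIntegrable (by norm_num)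

lemma lowerAvg_eq_add (hf : MemLp f 2) (x x' : ℝ) :
    lowerAvg f x' = Real.exp (-x') • (Real.exp x • lowerAvg f x + ∫ y in x..x', Real.exp y • f y) := by
  have h : ∀ x, Real.exp x • lowerAvg f x = ∫ y in Set.Iic x, Real.exp y • f y := fun x => by
    rw [lowerAvg_eq, ← integral_smul]
    simp_rw [smul_smul, ← Real.exp_add]
    ring_nf
  have hi : ∀ x, IntegrableOn (fun y => Real.exp y • f y) (Set.Iic x) := fun x => by
    have := (integrableOn_exp_smul_Iic hf x).smul (Real.exp x)
    refine this.congr (Filter.Eventually.of_forall fun y => ?_)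
    simp only [Pi.smul_apply, smul_smul, ← Real.exp_add]
    ring_nf
  have h2 := intervalIntegral.integral_Iic_sub_Iic (hi x) (hi x')
  rw [h x, ← h2, add_sub_cancel, ← h x', smul_smul, ← Real.exp_add]
  simp

lemma norm_lowerAvg_sub_le (hf : MemLp f 2) {x x' : ℝ} (hx : x < x') :
    ‖lowerAvg f x' - lowerAvg f x‖ ≤ (1 + ∫ y, ‖f y‖ ^ 2) * (x' - x + Real.sqrt (x' - x)) := by
  have hi := (memLp_two_iff_integrable_sq_norm hf.1).1 hf
  set M := ∫ y, ‖f y‖ ^ 2 with hM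
  have hM0 : 0 ≤ M := integral_nonneg fun y => sq_nonneg _
  set δ := x' - x with hδ
  have hδ0 : 0 < δ := by linarith
  set t := Real.sqrt δ with ht
  have ht0 : 0 < t := Real.sqrt_pos.2 hδ0
  have htt : t * t = δ := Real.mul_self_sqrt hδ0.le
  have h1 : lowerAvg f x' - lowerAvg f x = (Real.exp (-δ) - 1) • lowerAvg f x +
      ∫ y in x..x', Real.exp (y - x') • f y := by
    rw [lowerAvg_eq_add hf x x', smul_add, smul_smul, ← Real.exp_add, ← intervalIntegral.integral_smul,
      sub_smul, one_smul, hδ]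
    simp_rw [smul_smul, ← Real.exp_add]
    ring_nf
    abel
  have h2 : ‖∫ y in x..x', Real.exp (y - x') • f y‖ ≤ t * (1 + M) := by
    rw [intervalIntegral.integral_of_le hx.le]
    calc ‖∫ y in Set.Ioc x x', Real.exp (y - x') • f y‖
        ≤ ∫ y in Set.Ioc x x', ‖Real.exp (y - x') • f y‖ := norm_integral_le_integral_norm _
      _ ≤ ∫ y in Set.Ioc x x', (t⁻¹ + t * ‖f y‖ ^ 2) := by
          refine setIntegral_mono_on ?_ ?_ measurableSet_Ioc fun y hy => ?_
          · exact ((integrableOn_exp_smul_Iic hf x').mono_set Set.Ioc_subset_Iic_self).norm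
          · exact (integrable_const _).add (hi.integrableOn.const_mul _)
          · rw [norm_smul, Real.norm_of_nonneg (Real.exp_pos _).le]
            have h3 : Real.exp (y - x') ≤ 1 := Real.exp_le_one_iff.2 (by linarith [hy.2])
            have h4 : Real.exp (y - x') * ‖f y‖ ≤ 1 * ‖f y‖ := by gcongr
            have h5 : t⁻¹ * t = 1 := inv_mul_cancel₀ ht0.ne'
            have h6 : 0 < t⁻¹ := inv_pos.2 ht0
            have h7 : 0 ≤ t⁻¹ * (t * ‖f y‖ - 1 / 2) ^ 2 := by positivity
            have h8 : t⁻¹ * (t * ‖f y‖ - 1 / 2) ^ 2 = t * ‖f y‖ ^ 2 - ‖f y‖ + t⁻¹ / 4 := by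
              linear_combination (t * ‖f y‖ ^ 2 - ‖f y‖) * h5
            linarith
      _ ≤ t * (1 + M) := by
          rw [integral_add (integrable_const _) (hi.integrableOn.const_mul _), integral_const,
            integral_const_mul]
          have h9 : (∫ y in Set.Ioc x x', ‖f y‖ ^ 2) ≤ M := setIntegral_le_integral hi
            (Filter.Eventually.of_forall fun y => sq_nonneg _)
          have h10 : (volume.restrict (Set.Ioc x x')).real Set.univ • t⁻¹ = t := by
            simp only [measureReal_restrict_apply_univ, Real.volume_real_Ioc_of_le hx.le, smul_eq_mul]
            rw [← hδ, ← htt, mul_assoc, mul_inv_cancel₀ ht0.ne', mul_one]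
          rw [h10, mul_add, mul_one]
          gcongr
  have h3 : |Real.exp (-δ) - 1| ≤ δ := by
    rw [abs_le]
    have := Real.add_one_le_exp (-δ)
    have := Real.exp_le_one_iff.2 (by linarith : -δ ≤ 0)
    constructor <;> linarith
  rw [h1]
  calc _ ≤ ‖(Real.exp (-δ) - 1) • lowerAvg f x‖ + ‖∫ y in x..x', Real.exp (y - x') • f y‖ := norm_add_le _ _
    _ ≤ δ * (1 + M) + t * (1 + M) := by
        rw [norm_smul, Real.norm_eq_abs]
        gcongr
        exact norm_lowerAvg_le hf x
    _ = _ := by ring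

lemma hasDerivAt_lowerAvg (hf : MemLp f 2) (hc : Continuous f) (x : ℝ) :
    HasDerivAt (lowerAvg f) (f x - lowerAvg f x) x := by
  have h : lowerAvg f = fun x' => Real.exp (-x') • (Real.exp 0 • lowerAvg f 0 +
      ∫ y in (0:ℝ)..x', Real.exp y • f y) := funext fun x' => lowerAvg_eq_add hf 0 x'
  have h1 : HasDerivAt (fun x' => Real.exp 0 • lowerAvg f 0 + ∫ y in (0:ℝ)..x', Real.exp y • f y)
      (Real.exp x • f x) x := by
    refine HasDerivAt.const_add _ ?_
    have hc' : Continuous fun y => Real.exp y • f y := by fun_prop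
    exact intervalIntegral.integral_hasDerivAt_right (hc'.intervalIntegrable _ _)
      (hc'.stronglyMeasurableAtFilter _ _) hc'.continuousAt
  have h2 : HasDerivAt (fun x' : ℝ => Real.exp (-x')) (-Real.exp (-x)) x := by
    simpa using (hasDerivAt_neg x).exp
  have h3 := h2.smul h1
  rw [show ((fun x' : ℝ => Real.exp (-x')) • fun x' => Real.exp 0 • lowerAvg f 0 +
    ∫ y in (0:ℝ)..x', Real.exp y • f y) = lowerAvg f from h.symm] at h3
  convert h3 using 1
  rw [smul_smul, ← Real.exp_add, neg_add_cancel, neg_smul, ← lowerAvg_eq_add hf 0 x,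
    Real.exp_zero, one_smul, sub_eq_add_neg]

lemma hasDerivAt_upperAvg (hf : MemLp f 2) (hc : Continuous f) (x : ℝ) :
    HasDerivAt (upperAvg f) (upperAvg f x - f x) x := by
  have hf' : MemLp (fun y => f (-y)) 2 :=
    hf.comp_measurePreserving (Measure.measurePreserving_neg volume)
  have h := (hasDerivAt_lowerAvg hf' (by fun_prop) (-x)).scomp x (hasDerivAt_neg x)
  have h2 : upperAvg f = lowerAvg (fun y => f (-y)) ∘ Neg.neg := funext fun x => upperAvg_eq f x
  rw [h2]
  convert h using 1
  simp

lemma norm_upperAvg_le (hf : MemLp f 2) (x : ℝ) : ‖upperAvg f x‖ ≤ 1 + ∫ y, ‖f y‖ ^ 2 := by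
  have hf' : MemLp (fun y => f (-y)) 2 :=
    hf.comp_measurePreserving (Measure.measurePreserving_neg volume)
  rw [upperAvg_eq]
  refine (norm_lowerAvg_le hf' _).trans_eq ?_
  rw [integral_neg_eq_self (fun y => ‖f y‖ ^ 2)]

lemma continuous_lowerAvg (hf : MemLp f 2) : Continuous (lowerAvg f) := by
  rw [show lowerAvg f = fun x' => Real.exp (-x') • (Real.exp 0 • lowerAvg f 0 +
      ∫ y in (0:ℝ)..x', Real.exp y • f y) from funext fun x' => lowerAvg_eq_add hf 0 x']
  have h := intervalIntegral.continuous_primitive (μ := volume) (f := fun y => Real.exp y • f y)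
    (fun a b => (((locallyIntegrable_of_memLp_two hf).integrableOn_isCompact isCompact_uIcc).continuousOn_smul
      Real.continuous_exp.continuousOn isCompact_uIcc).intervalIntegrable) 0
  fun_prop

end Pointwise

section Compactness

variable {F : Type*} [NormedAddCommGroup F] [InnerProductSpace ℂ F]

lemma memLp_clm_apply {W : ℝ → F →L[ℂ] F} (hW : Continuous W) {C : ℝ} (hC : ∀ x, ‖W x‖ ≤ C)
    {f : ℝ → F} (hf : MemLp f 2) : MemLp (fun x => W x (f x)) 2 := by
  have hm : AEStronglyMeasurable (fun x => W x (f x)) volume :=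
    (isBoundedBilinearMap_apply (𝕜 := ℂ) (E := F) (F := F)).continuous.comp_aestronglyMeasurable
      (hW.aestronglyMeasurable.prodMk hf.1)
  exact hf.of_le_mul hm (Filter.Eventually.of_forall fun x =>
    ((W x).le_opNorm _).trans (mul_le_mul_of_nonneg_right (hC x) (norm_nonneg _)))

/-- Multiplication by a bounded continuous operator valued function. -/
noncomputable def mulLp (W : ℝ → F →L[ℂ] F) (hW : Continuous W) (C : ℝ) (hC : ∀ x, ‖W x‖ ≤ C) :
    Lp F 2 (volume : Measure ℝ) →L[ℂ] Lp F 2 (volume : Measure ℝ) :=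
  LinearMap.mkContinuous
    { toFun := fun f => (memLp_clm_apply hW hC (Lp.memLp f)).toLp
      map_add' := fun f g => by
        rw [← MemLp.toLp_add]
        refine MemLp.toLp_congr _ _ ?_
        filter_upwards [Lp.coeFn_add f g] with x hx
        change W x ((f + g : Lp F 2 (volume : Measure ℝ)) x) = W x (f x) + W x (g x)
        rw [hx, Pi.add_apply, map_add]
      map_smul' := fun c f => by
        rw [RingHom.id_apply, ← MemLp.toLp_const_smul]
        refine MemLp.toLp_congr _ _ ?_
        filter_upwards [Lp.coeFn_smul c f] with x hx
        simp [hx] } C fun f => by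
    refine Lp.norm_le_mul_norm_of_ae_le_mul ?_
    filter_upwards [(memLp_clm_apply hW hC (Lp.memLp f)).coeFn_toLp] with x hx
    exact hx ▸ ((W x).le_opNorm _).trans (mul_le_mul_of_nonneg_right (hC x) (norm_nonneg _))

lemma coeFn_mulLp {W : ℝ → F →L[ℂ] F} (hW : Continuous W) {C : ℝ} (hC : ∀ x, ‖W x‖ ≤ C)
    (f : Lp F 2 (volume : Measure ℝ)) : mulLp W hW C hC f =ᵐ[volume] fun x => W x (f x) :=
  (memLp_clm_apply hW hC (Lp.memLp f)).coeFn_toLp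

lemma norm_sq_Lp_eq (f : Lp F 2 (volume : Measure ℝ)) : ‖f‖ ^ 2 = ∫ x, ‖f x‖ ^ 2 := by
  have h := inner_self_eq_norm_sq (𝕜 := ℂ) f
  rw [← h, L2.inner_def, ← integral_re]
  · exact integral_congr_ae (Filter.Eventually.of_forall fun x => inner_self_eq_norm_sq (𝕜 := ℂ) _)
  · exact L2.integrable_inner f f

variable [FiniteDimensional ℂ F]

lemma isCompactOperator_mulLp_comp_expAvg {W : ℝ → F →L[ℂ] F} (hW : Continuous W) {C : ℝ}
    (hC : ∀ x, ‖W x‖ ≤ C) (hs : HasCompactSupport W) : 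
    have := FiniteDimensional.complete ℂ F
    IsCompactOperator (mulLp W hW C hC ∘L expAvg F (-1)) := by
  have := FiniteDimensional.complete ℂ F
  have := FiniteDimensional.proper ℂ F
  obtain ⟨L, hL, hLW⟩ := exists_pos_abs_ge_eq_zero (ι := Unit) (f := fun _ => W) (fun _ => hs)
  have hLW' := hLW ()
  let I := Set.Icc (-L) L
  have hle : -L ≤ L := by linarith
  let proj : ℝ → I := Set.projIcc (-L) L hle
  have hproj : Continuous proj := continuous_projIcc
  have hG : ∀ φ : BoundedContinuousFunction I F, MemLp (fun x => W x (φ (proj x))) 2 := fun φ => by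
    refine Continuous.memLp_of_hasCompactSupport (by fun_prop) ?_
    exact hs.mono fun x hx h0 => hx (by simp [h0])
  have hN : MemLp (fun x => ‖W x‖) 2 := hW.norm.memLp_of_hasCompactSupport hs.norm
  let G : BoundedContinuousFunction I F → Lp F 2 (volume : Measure ℝ) := fun φ => (hG φ).toLp
  have hGc : Continuous G := by
    refine (LipschitzWith.of_dist_le_mul (K := ‖hN.toLp‖₊) fun φ φ' => ?_).continuous
    rw [dist_eq_norm, coe_nnnorm, mul_comm]
    refine Lp.norm_le_mul_norm_of_ae_le_mul ?_
    rw [← MemLp.toLp_sub]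
    filter_upwards [((hG φ).sub (hG φ')).coeFn_toLp, hN.coeFn_toLp] with x hx hx'
    rw [hx, hx', Pi.sub_apply, ← map_sub, norm_norm, mul_comm]
    refine ((W x).le_opNorm _).trans ?_
    gcongr
    rw [← dist_eq_norm]
    exact BoundedContinuousFunction.dist_coe_le_dist _
  let R : Lp F 2 (volume : Measure ℝ) → BoundedContinuousFunction I F := fun f =>
    BoundedContinuousFunction.mkOfCompact
      ⟨fun x : I => lowerAvg f x, (continuous_lowerAvg (Lp.memLp f)).comp continuous_subtype_val⟩
  have hGR : ∀ f, mulLp W hW C hC (expAvg F (-1) f) = G (R f) := fun f => by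
    refine Lp.ext ?_
    filter_upwards [coeFn_mulLp hW hC (expAvg F (-1) f), coeFn_expAvg (-1) f,
      (hG (R f)).coeFn_toLp] with x h1 h2 h3
    rw [h1, h2]
    refine Eq.trans ?_ h3.symm
    by_cases hx : x ∈ Set.Icc (-L) L
    · simp only [R, BoundedContinuousFunction.mkOfCompact_apply, ContinuousMap.coe_mk, proj,
        Set.projIcc_of_mem hle hx]
      rfl
    · have : W x = 0 := hLW' x (by
        by_contra h
        exact hx (abs_le.1 (not_le.1 h).le))
      simp [this]
  have hball : ∀ f ∈ Metric.closedBall (0 : Lp F 2 (volume : Measure ℝ)) 1, ∫ x, ‖f x‖ ^ 2 ≤ 1 := by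
    intro f hf
    rw [← norm_sq_Lp_eq]
    have := mem_closedBall_zero_iff.1 hf
    exact pow_le_one₀ (norm_nonneg _) this
  have hA : IsCompact (closure (R '' Metric.closedBall 0 1)) := by
    refine BoundedContinuousFunction.arzela_ascoli (Metric.closedBall 0 2) (isCompact_closedBall _ _)
      _ ?_ ?_
    · rintro _ x ⟨f, hf, rfl⟩
      rw [mem_closedBall_zero_iff]
      exact (norm_lowerAvg_le (Lp.memLp f) x).trans (by linarith [hball f hf])
    · refine Metric.equicontinuous_of_continuity_modulus (fun t => 2 * (t + Real.sqrt t)) ?_ _ ?_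
      · have : Continuous fun t : ℝ => 2 * (t + Real.sqrt t) := by fun_prop
        simpa using this.tendsto 0
      · rintro x y ⟨_, f, hf, rfl⟩
        have key : ∀ x y : ℝ, x < y → dist (lowerAvg f x) (lowerAvg f y) ≤
            2 * (dist x y + Real.sqrt (dist x y)) := fun x y hxy => by
          have hd : dist x y = y - x := by rw [dist_comm, Real.dist_eq, abs_of_pos (by linarith)]
          rw [hd, dist_comm, dist_eq_norm]
          refine (norm_lowerAvg_sub_le (Lp.memLp f) hxy).trans ?_
          have : 0 ≤ y - x := by linarith
          gcongr
          linarith [hball f hf]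
        change dist (lowerAvg f x) (lowerAvg f y) ≤ 2 * (dist (x : ℝ) y + Real.sqrt (dist (x : ℝ) y))
        rcases lt_trichotomy (x : ℝ) y with h | h | h
        · exact key _ _ h
        · rw [h]; simp
        · rw [dist_comm (lowerAvg f x), dist_comm (x : ℝ)]; exact key _ _ h
  refine ⟨G '' closure (R '' Metric.closedBall 0 1), hA.image hGc, ?_⟩
  refine Filter.mem_of_superset (Metric.closedBall_mem_nhds 0 one_pos) fun f hf => ?_
  exact ⟨R f, subset_closure ⟨f, hf, rfl⟩, (hGR f).symm⟩

end Compactness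

section BoundStates

variable {F : Type*} [NormedAddCommGroup F] [InnerProductSpace ℂ F]

lemma lowerAvg_congr [CompleteSpace F] {f g : ℝ → F} (h : f =ᵐ[volume] g) :
    lowerAvg f = lowerAvg g := by
  funext x
  rw [lowerAvg_eq, lowerAvg_eq]
  refine integral_congr_ae (ae_restrict_of_ae ?_)
  filter_upwards [h] with y hy
  rw [hy]

lemma upperAvg_congr [CompleteSpace F] {f g : ℝ → F} (h : f =ᵐ[volume] g) :
    upperAvg f = upperAvg g := by
  funext x
  rw [upperAvg_eq, upperAvg_eq]
  refine congrFun (lowerAvg_congr ?_) _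
  exact (Measure.measurePreserving_neg volume).quasiMeasurePreserving.ae_eq_comp h

lemma lowerAvg_add_deriv [CompleteSpace F] {u : ℝ → F} (hu : ContDiff ℝ 1 u)
    (hs : HasCompactSupport u) : lowerAvg (fun x => u x + deriv u x) = u := by
  funext x
  have hd : ∀ y, HasDerivAt (fun y => Real.exp (y - x) • u y)
      (Real.exp (y - x) • (u y + deriv u y)) y := fun y => by
    have h1 : HasDerivAt (fun y => Real.exp (y - x)) (Real.exp (y - x)) y := by
      simpa using ((hasDerivAt_id y).sub_const x).exp
    refine (h1.fun_smul (hu.differentiable one_ne_zero y).hasDerivAt).congr_deriv ?_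
    rw [smul_add, add_comm]
  have hc : Continuous (deriv u) := hu.continuous_deriv le_rfl
  have hcs : HasCompactSupport fun y => Real.exp (y - x) • (u y + deriv u y) :=
    (hs.add hs.deriv).smul_left
  have hcs' : HasCompactSupport fun y => Real.exp (y - x) • u y := hs.smul_left
  have hlim : Filter.Tendsto (fun y => Real.exp (y - x) • u y) Filter.atBot (nhds 0) :=
    hcs'.is_zero_at_infty.mono_left atBot_le_cocompact
  have huc := hu.continuous
  have hcont : Continuous fun y => Real.exp (y - x) • (u y + deriv u y) := by fun_prop
  rw [lowerAvg_eq, integral_Iic_of_hasDerivAt_of_tendsto' (fun y _ => hd y)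
    (hcont.integrable_of_hasCompactSupport hcs).integrableOn hlim]
  simp

lemma integral_norm_add_deriv_sq {u : ℝ → F} (hu : ContDiff ℝ 1 u)
    (hs : HasCompactSupport u) :
    ∫ x, ‖u x + deriv u x‖ ^ 2 = (∫ x, ‖u x‖ ^ 2) + ∫ x, ‖deriv u x‖ ^ 2 := by
  have hc : Continuous (deriv u) := hu.continuous_deriv le_rfl
  have huc := hu.continuous
  have hi1 : Integrable fun x => ‖u x‖ ^ 2 :=
    Continuous.integrable_of_hasCompactSupport (by fun_prop)
      (hs.comp_left (g := fun v => ‖v‖ ^ 2) (by simp))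
  have hi2 : Integrable fun x => ‖deriv u x‖ ^ 2 :=
    Continuous.integrable_of_hasCompactSupport (by fun_prop)
      (hs.deriv.comp_left (g := fun v => ‖v‖ ^ 2) (by simp))
  have hi3 : Integrable fun x => 2 * (inner ℂ (u x) (deriv u x)).re :=
    Continuous.integrable_of_hasCompactSupport (by fun_prop)
      (hs.mono fun x hx h0 => hx (by simp [h0]))
  have hz : ∫ x, 2 * (inner ℂ (u x) (deriv u x)).re = 0 := by
    refine integral_eq_zero_of_hasDerivAt_of_integrable (f := fun x => ‖u x‖ ^ 2) (fun x => ?_)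
      hi3 hi1
    have hd := (hu.differentiable one_ne_zero x).hasDerivAt
    have h1 : HasDerivAt (fun x => (inner ℂ (u x) (u x)).re)
        (inner ℂ (u x) (deriv u x) + inner ℂ (deriv u x) (u x)).re x :=
      HasDerivAt.re' (HasDerivAt.inner ℂ hd hd)
    rw [show (fun x => ‖u x‖ ^ 2) = fun x => (inner ℂ (u x) (u x)).re from
      funext fun y => (inner_self_eq_norm_sq (𝕜 := ℂ) (u y)).symm]
    refine h1.congr_deriv ?_
    rw [Complex.add_re, ← inner_conj_symm (deriv u x), Complex.conj_re]
    ring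
  calc ∫ x, ‖u x + deriv u x‖ ^ 2 =
      ∫ x, ((‖u x‖ ^ 2 + ‖deriv u x‖ ^ 2) + 2 * (inner ℂ (u x) (deriv u x)).re) := by
        congr 1; funext x
        rw [norm_add_sq (𝕜 := ℂ)]
        change ‖u x‖ ^ 2 + 2 * (inner ℂ (u x) (deriv u x)).re + _ = _
        ring
    _ = _ := by
        have hi12 : Integrable fun x => ‖u x‖ ^ 2 + ‖deriv u x‖ ^ 2 := hi1.add hi2
        rw [integral_add hi12 hi3, integral_add hi1 hi2, hz, add_zero]

variable [FiniteDimensional ℂ F]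

/-- The min-max principle for `-d²/dx² - W`: a flag of trial functions produces an orthonormal
family of eigenfunctions. -/
theorem exists_eigenfunctions {W : ℝ → F →L[ℂ] F} (hW : Continuous W) (hs : HasCompactSupport W)
    (hsymm : ∀ x v w, inner ℂ (W x v) w = inner ℂ v (W x w)) {N : ℕ} {E : Fin N → ℝ}
    (hE : ∀ i, 0 < E i) (hanti : Antitone E) (u : Fin N → ℝ → F) (hu : ∀ i, ContDiff ℝ 1 (u i))
    (hus : ∀ i, HasCompactSupport (u i))
    (hflag : ∀ i, ∀ c : Fin N → ℂ, c ≠ 0 → (∀ j, E j < E i → c j = 0) →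
      ((∫ x, ‖deriv (fun x => ∑ j, c j • u j x) x‖ ^ 2) -
        ∫ x, (inner ℂ (∑ j, c j • u j x) (W x (∑ j, c j • u j x))).re) +
        E i * ∫ x, ‖∑ j, c j • u j x‖ ^ 2 < 0) :
    ∃ (e : Fin N → ℝ) (ψ φ : Fin N → ℝ → F), (∀ i, E i ≤ e i) ∧
      (∀ i x, HasDerivAt (ψ i) (φ i x) x) ∧
      (∀ i x, HasDerivAt (φ i) ((e i : ℂ) • ψ i x - W x (ψ i x)) x) ∧
      (∀ i, MemLp (ψ i) 2) ∧
      (∀ i j, ∫ x, inner ℂ (ψ i x) (ψ j x) = if i = j then (1 : ℂ) else 0) ∧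
      ∀ i, ∃ B, ∀ x, ‖ψ i x‖ ≤ B ∧ ‖φ i x‖ ≤ B := by
  have := FiniteDimensional.complete ℂ F
  obtain ⟨C, hC⟩ := hs.exists_bound_of_continuous hW
  let J := expAvg F (-1)
  let K := mulLp W hW C hC
  have hJ : ∀ f, ‖J f‖ ≤ ‖f‖ := norm_expAvg_le _
  have hK : ∀ f g, inner ℂ (K f) g = inner ℂ f (K g) := fun f g => by
    rw [L2.inner_def, L2.inner_def]
    refine integral_congr_ae ?_
    filter_upwards [coeFn_mulLp hW hC f, coeFn_mulLp hW hC g] with x h1 h2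
    rw [h1, h2, hsymm]
  have hvm : ∀ {w : ℝ → F}, ContDiff ℝ 1 w → HasCompactSupport w →
      MemLp (fun x => w x + deriv w x) 2 := fun {w} hw hws => by
    have hc : Continuous (deriv w) := hw.continuous_deriv le_rfl
    have huc := hw.continuous
    exact Continuous.memLp_of_hasCompactSupport (by fun_prop) (hws.add hws.deriv)
  let v : Fin N → Lp F 2 (volume : Measure ℝ) := fun i => (hvm (hu i) (hus i)).toLp
  have hv : ∀ i, ∀ c : Fin N → ℂ, c ≠ 0 → (∀ j, E j < E i → c j = 0) →
      bsForm J K (∑ j, c j • v j) + E i * ‖J (∑ j, c j • v j)‖ ^ 2 < 0 := by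
    intro i c hc hcE
    let U : ℝ → F := fun x => ∑ j, c j • u j x
    have hU : ContDiff ℝ 1 U := ContDiff.sum fun j _ => (hu j).const_smul (c j)
    have hUs : HasCompactSupport U := by
      obtain ⟨R, -, hR⟩ := exists_pos_abs_ge_eq_zero hus
      refine HasCompactSupport.intro (isCompact_Icc (a := -R) (b := R)) fun x hx => ?_
      have hx' : R ≤ |x| := by
        by_contra h
        exact hx (abs_le.1 (not_le.1 h).le)
      simp [U, fun j => hR j x hx']
    have hdU : ∀ x, deriv U x = ∑ j, c j • deriv (u j) x := fun x =>
      (HasDerivAt.fun_sum fun j _ =>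
        ((hu j).differentiable one_ne_zero x).hasDerivAt.const_smul (c j)).deriv
    have hf : (∑ j, c j • v j : Lp F 2 (volume : Measure ℝ)) =ᵐ[volume]
        fun x => U x + deriv U x := by
      have h1 : ∀ᵐ x, ∀ j, (c j • v j : Lp F 2 (volume : Measure ℝ)) x =
          c j • (u j x + deriv (u j) x) := by
        refine ae_all_iff.2 fun j => ?_
        filter_upwards [Lp.coeFn_smul (c j) (v j), (hvm (hu j) (hus j)).coeFn_toLp] with x h1 h2
        rw [h1, Pi.smul_apply, h2]
      filter_upwards [Lp.coeFn_finsetSum Finset.univ fun j => c j • v j, h1] with x h2 h3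
      rw [h2, Finset.sum_apply, hdU]
      simp only [h3, smul_add, Finset.sum_add_distrib, U]
    set f := (∑ j, c j • v j : Lp F 2 (volume : Measure ℝ)) with hfdef
    have hJf : J f =ᵐ[volume] U := by
      refine (coeFn_expAvg (-1) f).trans (Filter.Eventually.of_forall fun x => ?_)
      exact congrFun ((lowerAvg_congr hf).trans (lowerAvg_add_deriv hU hUs)) x
    have e1 : ‖f‖ ^ 2 = (∫ x, ‖U x‖ ^ 2) + ∫ x, ‖deriv U x‖ ^ 2 := by
      rw [norm_sq_Lp_eq, ← integral_norm_add_deriv_sq hU hUs]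
      refine integral_congr_ae ?_
      filter_upwards [hf] with x hx
      rw [hx]
    have e2 : ‖J f‖ ^ 2 = ∫ x, ‖U x‖ ^ 2 := by
      rw [norm_sq_Lp_eq]
      refine integral_congr_ae ?_
      filter_upwards [hJf] with x hx
      rw [hx]
    have e3 : (inner ℂ (J f) (K (J f))).re = ∫ x, (inner ℂ (U x) (W x (U x))).re := by
      rw [L2.inner_def]
      refine (integral_re (L2.integrable_inner (𝕜 := ℂ) _ _)).symm.trans ?_
      refine integral_congr_ae ?_
      filter_upwards [hJf, coeFn_mulLp hW hC (J f)] with x hx hx'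
      simp only [K]
      rw [hx', hx]
      rfl
    have := hflag i c hc hcE
    rw [bsForm, e1, e2, e3]
    simp only [U] at *
    linarith
  obtain ⟨e, f, he, hon, hf⟩ := exists_bound_states J K hJ hK
    (isCompactOperator_mulLp_comp_expAvg hW hC hs) hE hanti v hv
  let ψ : Fin N → ℝ → F := fun i => lowerAvg (f i)
  let h : Fin N → ℝ → F := fun i x => ((1 - e i : ℝ) : ℂ) • ψ i x + W x (ψ i x)
  have hψJ : ∀ i, J (f i) =ᵐ[volume] ψ i := fun i => coeFn_expAvg (-1) (f i)
  have hψm : ∀ i, MemLp (ψ i) 2 := fun i => (Lp.memLp (J (f i))).ae_eq (hψJ i)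
  have hψc : ∀ i, Continuous (ψ i) := fun i => continuous_lowerAvg (Lp.memLp _)
  have hhm : ∀ i, MemLp (h i) 2 := fun i =>
    ((hψm i).const_smul _).add (memLp_clm_apply hW hC (hψm i))
  have hhc : ∀ i, Continuous (h i) := fun i => by
    have := hψc i
    fun_prop
  let g : Fin N → ℝ → F := fun i => upperAvg (h i)
  have hfg : ∀ i, f i =ᵐ[volume] g i := fun i => by
    have h1 : f i = expAvg F 1 (((1 - e i : ℝ) : ℂ) • J (f i) + K (J (f i))) := by
      conv_lhs => rw [hf i]
      simp only [J]
      rw [adjoint_expAvg, neg_neg]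
    have h2 : (((1 - e i : ℝ) : ℂ) • J (f i) + K (J (f i)) : Lp F 2 (volume : Measure ℝ))
        =ᵐ[volume] h i := by
      filter_upwards [Lp.coeFn_add (((1 - e i : ℝ) : ℂ) • J (f i)) (K (J (f i))),
        Lp.coeFn_smul (((1 - e i : ℝ) : ℂ)) (J (f i)), hψJ i, coeFn_mulLp hW hC (J (f i))]
        with x h1 h2 h3 h4
      rw [h1, Pi.add_apply, h2, Pi.smul_apply, h4, h3]
    have h3 := coeFn_expAvg 1 (((1 - e i : ℝ) : ℂ) • J (f i) + K (J (f i)))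
    rw [← h1] at h3
    exact h3.trans (Filter.Eventually.of_forall fun x => congrFun (upperAvg_congr h2) x)
  have hψg : ∀ i, ψ i = lowerAvg (g i) := fun i => lowerAvg_congr (hfg i)
  have hgm : ∀ i, MemLp (g i) 2 := fun i => (Lp.memLp (f i)).ae_eq (hfg i)
  have hgd : ∀ i x, HasDerivAt (g i) (g i x - h i x) x := fun i x =>
    hasDerivAt_upperAvg (hhm i) (hhc i) x
  have hgc : ∀ i, Continuous (g i) := fun i =>
    continuous_iff_continuousAt.2 fun x => (hgd i x).continuousAt
  have hψd : ∀ i x, HasDerivAt (ψ i) (g i x - ψ i x) x := fun i x => by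
    rw [hψg i]
    exact hasDerivAt_lowerAvg (hgm i) (hgc i) x
  refine ⟨e, ψ, fun i x => g i x - ψ i x, he, hψd, fun i x => ?_, hψm, fun i j => ?_, fun i => ?_⟩
  · refine ((hgd i x).fun_sub (hψd i x)).congr_deriv ?_
    change g i x - (((1 - e i : ℝ) : ℂ) • ψ i x + W x (ψ i x)) - (g i x - ψ i x) = _
    push_cast
    module
  · rw [← orthonormal_iff_ite.1 hon i j, L2.inner_def]
    refine integral_congr_ae ?_
    filter_upwards [hψJ i, hψJ j] with x h1 h2
    rw [h1, h2]
  · have h1 := norm_lowerAvg_le (Lp.memLp (f i))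
    have h2 := norm_upperAvg_le (hhm i)
    have p1 : (0:ℝ) ≤ ∫ y, ‖f i y‖ ^ 2 := integral_nonneg fun y => sq_nonneg _
    have p2 : (0:ℝ) ≤ ∫ y, ‖h i y‖ ^ 2 := integral_nonneg fun y => sq_nonneg _
    refine ⟨(1 + ∫ y, ‖h i y‖ ^ 2) + (1 + ∫ y, ‖f i y‖ ^ 2), fun x => ⟨?_, ?_⟩⟩
    · exact (h1 x).trans (by linarith)
    · exact (norm_sub_le _ _).trans (add_le_add (h2 x) (h1 x))

end BoundStates

section HalfLine

lemma eq_neg_mul_of_bounded {f g : ℝ → ℂ} {κ L B : ℝ} (hκ : 0 < κ)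
    (hf : ∀ x, L ≤ x → HasDerivAt f (g x) x)
    (hg : ∀ x, L ≤ x → HasDerivAt g ((κ : ℂ) ^ 2 * f x) x)
    (hB : ∀ x, ‖f x‖ ≤ B ∧ ‖g x‖ ≤ B) {x : ℝ} (hx : L ≤ x) : g x = -(κ : ℂ) * f x := by
  have hd : ∀ y, L ≤ y → HasDerivAt (fun y => (Real.exp (-κ * y) : ℂ) * (g y + κ * f y)) 0 y := by
    intro y hy
    have h1 : HasDerivAt (fun y : ℝ => (Real.exp (-κ * y) : ℂ)) ((Real.exp (-κ * y) * (-κ * 1) : ℝ) : ℂ) y :=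
      (((hasDerivAt_id y).const_mul (-κ)).exp).ofReal_comp
    refine (h1.fun_mul ((hg y hy).fun_add ((hf y hy).const_mul (κ : ℂ)))).congr_deriv ?_
    push_cast
    ring
  have hlim : Filter.Tendsto (fun y => (Real.exp (-κ * y) : ℂ) * (g y + κ * f y)) Filter.atTop
      (nhds 0) := by
    have h1 : Filter.Tendsto (fun y => Real.exp (-κ * y) * (B + κ * B)) Filter.atTop (nhds 0) := by
      rw [← zero_mul (B + κ * B)]
      refine Filter.Tendsto.mul_const _ (Real.tendsto_exp_atBot.comp ?_)
      exact Filter.tendsto_id.const_mul_atTop_of_neg (by linarith)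
    refine squeeze_zero_norm (fun y => ?_) h1
    rw [norm_mul, Complex.norm_real, Real.norm_of_nonneg (Real.exp_pos _).le]
    gcongr
    refine (norm_add_le _ _).trans (add_le_add (hB y).2 ?_)
    rw [norm_mul, Complex.norm_real, Real.norm_of_nonneg hκ.le]
    gcongr
    exact (hB y).1
  have h := integral_Ioi_of_hasDerivAt_of_tendsto' (a := x) (fun y hy => hd y (hx.trans hy))
    (by simp) hlim
  rw [integral_zero, zero_sub, eq_comm, neg_eq_zero, mul_eq_zero] at h
  have h' := h.resolve_left (by exact_mod_cast (Real.exp_pos _).ne')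
  linear_combination h'

lemma eq_exp_mul_of_bounded {f g : ℝ → ℂ} {κ L B : ℝ} (hκ : 0 < κ)
    (hf : ∀ x, L ≤ x → HasDerivAt f (g x) x)
    (hg : ∀ x, L ≤ x → HasDerivAt g ((κ : ℂ) ^ 2 * f x) x)
    (hB : ∀ x, ‖f x‖ ≤ B ∧ ‖g x‖ ≤ B) {x : ℝ} (hx : L ≤ x) :
    f x = Real.exp (-κ * (x - L)) * f L := by
  have hd : ∀ y, L ≤ y → HasDerivAt (fun y => (Real.exp (κ * y) : ℂ) * f y) 0 y := by
    intro y hy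
    have h1 : HasDerivAt (fun y : ℝ => (Real.exp (κ * y) : ℂ)) ((Real.exp (κ * y) * (κ * 1) : ℝ) : ℂ) y :=
      (((hasDerivAt_id y).const_mul κ).exp).ofReal_comp
    refine (h1.fun_mul (hf y hy)).congr_deriv ?_
    rw [eq_neg_mul_of_bounded hκ hf hg hB hy]
    push_cast
    ring
  have h := intervalIntegral.integral_eq_sub_of_hasDerivAt (a := L) (b := x)
    (fun y hy => hd y (by rw [Set.uIcc_of_le hx] at hy; exact hy.1)) (by simp)
  rw [intervalIntegral.integral_zero, eq_comm, sub_eq_zero] at h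
  have h2 : (Real.exp (-κ * (x - L)) : ℂ) = Real.exp (κ * L) * Real.exp (-(κ * x)) := by
    rw [← Complex.ofReal_mul, ← Real.exp_add]
    congr 2
    ring
  have h3 : (Real.exp (κ * x) : ℂ) * Real.exp (-(κ * x)) = 1 := by
    rw [← Complex.ofReal_mul, ← Real.exp_add, add_neg_cancel, Real.exp_zero, Complex.ofReal_one]
  rw [h2]
  linear_combination (-(f x)) * h3 + (Real.exp (-(κ * x)) : ℂ) * h

lemma tendsto_zero_of_bounded {f g : ℝ → ℂ} {κ L B : ℝ} (hκ : 0 < κ)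
    (hf : ∀ x, L ≤ x → HasDerivAt f (g x) x)
    (hg : ∀ x, L ≤ x → HasDerivAt g ((κ : ℂ) ^ 2 * f x) x)
    (hB : ∀ x, ‖f x‖ ≤ B ∧ ‖g x‖ ≤ B) :
    Filter.Tendsto f Filter.atTop (nhds 0) ∧ Filter.Tendsto g Filter.atTop (nhds 0) := by
  have h1 : Filter.Tendsto (fun x => (Real.exp (-κ * (x - L)) : ℂ) * f L) Filter.atTop
      (nhds 0) := by
    rw [← zero_mul (f L), ← Complex.ofReal_zero]
    refine Filter.Tendsto.mul_const _ ((Complex.continuous_ofReal.tendsto 0).comp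
      (Real.tendsto_exp_atBot.comp ?_))
    exact (Filter.tendsto_atTop_add_const_right _ _ Filter.tendsto_id).const_mul_atTop_of_neg
      (by linarith)
  have h2 : Filter.Tendsto f Filter.atTop (nhds 0) := h1.congr' <| by
    filter_upwards [Filter.eventually_ge_atTop L] with x hx
    exact (eq_exp_mul_of_bounded hκ hf hg hB hx).symm
  refine ⟨h2, ?_⟩
  have h3 := h2.const_mul (-(κ : ℂ))
  rw [mul_zero] at h3
  refine h3.congr' ?_
  filter_upwards [Filter.eventually_ge_atTop L] with x hx
  exact (eq_neg_mul_of_bounded hκ hf hg hB hx).symm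

lemma tendsto_zero_atBot_of_bounded {f g : ℝ → ℂ} {κ L B : ℝ} (hκ : 0 < κ)
    (hf : ∀ x, x ≤ -L → HasDerivAt f (g x) x)
    (hg : ∀ x, x ≤ -L → HasDerivAt g ((κ : ℂ) ^ 2 * f x) x)
    (hB : ∀ x, ‖f x‖ ≤ B ∧ ‖g x‖ ≤ B) :
    Filter.Tendsto f Filter.atBot (nhds 0) ∧ Filter.Tendsto g Filter.atBot (nhds 0) := by
  have h := tendsto_zero_of_bounded (f := fun x => f (-x)) (g := fun x => -g (-x)) (κ := κ) (L := L)
    (B := B) hκ (fun x hx => ?_) (fun x hx => ?_) (fun x => ?_)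
  · refine ⟨?_, ?_⟩
    · simpa [Function.comp_def] using h.1.comp Filter.tendsto_neg_atBot_atTop
    · simpa [Function.comp_def] using (h.2.comp Filter.tendsto_neg_atBot_atTop).neg
  · have := (hf (-x) (by linarith)).scomp x (hasDerivAt_neg x)
    exact this.congr_deriv (by simp)
  · have := ((hg (-x) (by linarith)).scomp x (hasDerivAt_neg x)).neg
    exact this.congr_deriv (by simp)
  · rw [norm_neg]; exact hB (-x)

end HalfLine

section EntrywiseDerivative

variable {l m n : Type*}

/-- Entrywise differentiability of a matrix valued function. -/
def MDerivAt (A : ℝ → Matrix l m ℂ) (A' : Matrix l m ℂ) (x : ℝ) : Prop :=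
  ∀ i j, HasDerivAt (fun x => A x i j) (A' i j) x

lemma MDerivAt.congr_deriv {A : ℝ → Matrix l m ℂ} {A' A'' : Matrix l m ℂ} {x : ℝ}
    (h : MDerivAt A A' x) (e : A' = A'') : MDerivAt A A'' x := e ▸ h

lemma MDerivAt.add {A B : ℝ → Matrix l m ℂ} {A' B' : Matrix l m ℂ} {x : ℝ}
    (hA : MDerivAt A A' x) (hB : MDerivAt B B' x) :
    MDerivAt (fun x => A x + B x) (A' + B') x := fun i j => (hA i j).fun_add (hB i j)

lemma MDerivAt.sub {A B : ℝ → Matrix l m ℂ} {A' B' : Matrix l m ℂ} {x : ℝ}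
    (hA : MDerivAt A A' x) (hB : MDerivAt B B' x) :
    MDerivAt (fun x => A x - B x) (A' - B') x := fun i j => (hA i j).fun_sub (hB i j)

lemma mDerivAt_const (A : Matrix l m ℂ) (x : ℝ) : MDerivAt (fun _ => A) 0 x :=
  fun i j => hasDerivAt_const x (A i j)

lemma MDerivAt.mul [Fintype m] {A : ℝ → Matrix l m ℂ} {B : ℝ → Matrix m n ℂ}
    {A' : Matrix l m ℂ} {B' : Matrix m n ℂ} {x : ℝ} (hA : MDerivAt A A' x) (hB : MDerivAt B B' x) :
    MDerivAt (fun x => A x * B x) (A' * B x + A x * B') x := fun i j => by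
  simp only [Matrix.mul_apply, Matrix.add_apply, ← Finset.sum_add_distrib]
  exact HasDerivAt.fun_sum fun k _ => (hA i k).fun_mul (hB k j)

lemma MDerivAt.conjTranspose {A : ℝ → Matrix l m ℂ} {A' : Matrix l m ℂ} {x : ℝ}
    (hA : MDerivAt A A' x) : MDerivAt (fun x => (A x)ᴴ) A'ᴴ x := fun i j => (hA j i).star

lemma MDerivAt.trace [Fintype m] {A : ℝ → Matrix m m ℂ} {A' : Matrix m m ℂ} {x : ℝ}
    (hA : MDerivAt A A' x) : HasDerivAt (fun x => (A x).trace) A'.trace x :=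
  HasDerivAt.fun_sum fun i _ => hA i i

lemma MDerivAt.inv [Fintype m] [DecidableEq m] {A : ℝ → Matrix m m ℂ} {A' : Matrix m m ℂ} {x : ℝ}
    (hA : MDerivAt A A' x) (hx : IsUnit (A x)) :
    MDerivAt (fun x => (A x)⁻¹) (-((A x)⁻¹ * A' * (A x)⁻¹)) x := by
  let _ : NormedRing (Matrix m m ℂ) := Matrix.linftyOpNormedRing
  let _ : NormedAlgebra ℝ (Matrix m m ℂ) := Matrix.linftyOpNormedAlgebra
  have h1 : HasDerivAt A A' x := hasDerivAt_pi.2 fun i => hasDerivAt_pi.2 fun j => hA i j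
  obtain ⟨u, hu⟩ := hx
  have h2 := hasFDerivAt_ringInverse (𝕜 := ℝ) u
  rw [hu] at h2
  have h3 := h2.comp_hasDerivAt x h1
  have h4 : HasDerivAt (fun x => (A x)⁻¹) (-((A x)⁻¹ * A' * (A x)⁻¹)) x := by
    have e : (fun x => (A x)⁻¹) = Ring.inverse ∘ A := funext fun y =>
      Matrix.nonsing_inv_eq_ringInverse (A y)
    rw [e]
    refine h3.congr_deriv ?_
    simp [← hu, ← Matrix.coe_units_inv]
  exact fun i j => hasDerivAt_pi.1 (hasDerivAt_pi.1 h4 i) j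

end EntrywiseDerivative

section DoubleCommutation

variable {m N : Type*} [Fintype m] [Fintype N] [DecidableEq N]

/-- The derivative of `Ψ G Ψᴴ` when `G' = G Ψᴴ Ψ G` and `Ψ' = Φ`. -/
def kDer (Ψ Φ : Matrix m N ℂ) (G : Matrix N N ℂ) : Matrix m m ℂ :=
  Φ * G * Ψᴴ + Ψ * G * Φᴴ + Ψ * G * (Ψᴴ * Ψ) * G * Ψᴴ

/-- The boundary term in the double commutation identity. -/
noncomputable def boundaryTerm (Λ G S R Q T : Matrix N N ℂ) : ℂ :=
  (G * T).trace + 1 / 2 * ((G * (R + Q)) * (G * S)).trace +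
    1 / 3 * ((G * S) * (G * S) * (G * S)).trace - 1 / 2 * (G * (Λ * S + S * Λ)).trace

lemma trace_mul_kDer (V : Matrix m m ℂ) (Ψ Φ : Matrix m N ℂ) (G : Matrix N N ℂ) :
    (V * kDer Ψ Φ G).trace = (G * (Ψᴴ * V * Φ)).trace + (G * (Φᴴ * V * Ψ)).trace +
      ((G * (Ψᴴ * Ψ)) * (G * (Ψᴴ * V * Ψ))).trace := by
  simp only [kDer, Matrix.mul_add, Matrix.trace_add]
  congr 1
  · congr 1
    · rw [← Matrix.mul_assoc, Matrix.trace_mul_comm (V * (Φ * G)), ← Matrix.mul_assoc,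
        Matrix.trace_mul_comm G]
      simp only [Matrix.mul_assoc]
    · rw [← Matrix.mul_assoc, Matrix.trace_mul_comm (V * (Ψ * G)), ← Matrix.mul_assoc,
        Matrix.trace_mul_comm G]
      simp only [Matrix.mul_assoc]
  · rw [Matrix.trace_mul_comm V]
    simp only [Matrix.mul_assoc]
    rw [Matrix.trace_mul_comm Ψ]
    simp only [Matrix.mul_assoc]

lemma trace_kDer_sq (Ψ Φ : Matrix m N ℂ) (G : Matrix N N ℂ) :
    (kDer Ψ Φ G * kDer Ψ Φ G).trace =
      ((G * (Ψᴴ * Φ)) * (G * (Ψᴴ * Φ))).trace + ((G * (Φᴴ * Ψ)) * (G * (Φᴴ * Ψ))).trace +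
      2 * ((G * (Φᴴ * Φ)) * (G * (Ψᴴ * Ψ))).trace +
      2 * ((G * (Ψᴴ * Φ)) * ((G * (Ψᴴ * Ψ)) * (G * (Ψᴴ * Ψ)))).trace +
      2 * ((G * (Φᴴ * Ψ)) * ((G * (Ψᴴ * Ψ)) * (G * (Ψᴴ * Ψ)))).trace +
      ((G * (Ψᴴ * Ψ)) * ((G * (Ψᴴ * Ψ)) * ((G * (Ψᴴ * Ψ)) * (G * (Ψᴴ * Ψ))))).trace := by
  have key : (kDer Ψ Φ G * kDer Ψ Φ G).trace =
      ((G * (Ψᴴ * Φ)) * (G * (Ψᴴ * Φ))).trace + ((G * (Ψᴴ * Ψ)) * (G * (Φᴴ * Φ))).trace +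
      ((G * (Ψᴴ * Ψ)) * ((G * (Ψᴴ * Ψ)) * (G * (Ψᴴ * Φ)))).trace +
      (((G * (Φᴴ * Φ)) * (G * (Ψᴴ * Ψ))).trace + ((G * (Φᴴ * Ψ)) * (G * (Φᴴ * Ψ))).trace +
      ((G * (Φᴴ * Ψ)) * ((G * (Ψᴴ * Ψ)) * (G * (Ψᴴ * Ψ)))).trace) +
      (((G * (Ψᴴ * Ψ)) * ((G * (Ψᴴ * Φ)) * (G * (Ψᴴ * Ψ)))).trace +
      ((G * (Ψᴴ * Ψ)) * ((G * (Ψᴴ * Ψ)) * (G * (Φᴴ * Ψ)))).trace +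
      ((G * (Ψᴴ * Ψ)) * ((G * (Ψᴴ * Ψ)) * ((G * (Ψᴴ * Ψ)) * (G * (Ψᴴ * Ψ))))).trace) := by
    simp only [kDer, Matrix.mul_add, Matrix.add_mul, Matrix.trace_add]
    simp only [Matrix.mul_assoc]
    simp only [Matrix.trace_mul_comm Φ, Matrix.trace_mul_comm Ψ]
    simp only [Matrix.mul_assoc]
    ring
  rw [key]
  set s := G * (Ψᴴ * Ψ)
  set r := G * (Ψᴴ * Φ)
  set q := G * (Φᴴ * Ψ)
  set t := G * (Φᴴ * Φ)
  have h1 : (s * t).trace = (t * s).trace := Matrix.trace_mul_comm _ _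
  have h2 : (s * (s * r)).trace = (r * (s * s)).trace := by
    rw [← Matrix.mul_assoc, Matrix.trace_mul_comm]
  have h3 : (s * (s * q)).trace = (q * (s * s)).trace := by
    rw [← Matrix.mul_assoc, Matrix.trace_mul_comm]
  have h4 : (s * (r * s)).trace = (r * (s * s)).trace := by
    rw [Matrix.trace_mul_comm, Matrix.mul_assoc]
  rw [h1, h2, h3, h4]
  ring

lemma trace_gauge_identity {Λ M G R Q : Matrix N N ℂ} (hMG : M * G = 1) (hGM : G * M = 1)
    (hZ : R - Q = Λ * M - M * Λ) :
    (G * (Λ * R + Q * Λ)).trace - 1 / 2 * (G * (Λ * (R + Q) + (R + Q) * Λ)).trace +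
      1 / 2 * ((G * (R + Q)) * (G * (R + Q))).trace =
      ((G * R) * (G * R)).trace + ((G * Q) * (G * Q)).trace := by
  have h1 : ((G * (R - Q)) * (G * (R - Q))).trace =
      (G * (Λ * (R - Q))).trace - (G * ((R - Q) * Λ)).trace := by
    have e : G * (R - Q) = G * Λ * M - Λ := by
      rw [hZ, Matrix.mul_sub, ← Matrix.mul_assoc, ← Matrix.mul_assoc, hGM, Matrix.one_mul]
    have e2 : (G * (R - Q) * (G * Λ * M)).trace = (G * (Λ * (R - Q))).trace := by
      rw [← Matrix.mul_assoc, Matrix.trace_mul_comm _ M]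
      simp only [← Matrix.mul_assoc]
      rw [hMG, Matrix.one_mul, Matrix.trace_mul_comm, ← Matrix.mul_assoc, Matrix.trace_mul_comm,
        ← Matrix.mul_assoc, Matrix.trace_mul_comm, ← Matrix.mul_assoc]
    nth_rewrite 2 [e]
    rw [Matrix.mul_sub, Matrix.trace_sub, e2, Matrix.mul_assoc G]
  simp only [Matrix.mul_add, Matrix.mul_sub, Matrix.add_mul, Matrix.sub_mul, Matrix.trace_add,
    Matrix.trace_sub] at h1 ⊢
  linear_combination (-1 / 2) * h1

lemma hasDerivAt_boundaryTerm {Λ : Matrix N N ℂ} {W : Matrix m m ℂ} {Ψ Φ : ℝ → Matrix m N ℂ}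
    {M : ℝ → Matrix N N ℂ} {x : ℝ} (hΨ : MDerivAt Ψ (Φ x) x)
    (hΦ : MDerivAt Φ (W * Ψ x + Ψ x * Λ) x) (hW : Wᴴ = W) (hΛ : Λᴴ = Λ)
    (hM : MDerivAt M (-((Ψ x)ᴴ * Ψ x)) x) (hu : IsUnit (M x))
    (hZ : (Ψ x)ᴴ * Φ x - (Φ x)ᴴ * Ψ x = Λ * M x - M x * Λ) :
    HasDerivAt (fun x => boundaryTerm Λ (M x)⁻¹ ((Ψ x)ᴴ * Ψ x) ((Ψ x)ᴴ * Φ x) ((Φ x)ᴴ * Ψ x)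
      ((Φ x)ᴴ * Φ x))
      ((W * kDer (Ψ x) (Φ x) (M x)⁻¹).trace +
        (kDer (Ψ x) (Φ x) (M x)⁻¹ * kDer (Ψ x) (Φ x) (M x)⁻¹).trace) x := by
  have hMG : M x * (M x)⁻¹ = 1 := Matrix.mul_nonsing_inv _ ((Matrix.isUnit_iff_isUnit_det _).1 hu)
  have hGM : (M x)⁻¹ * M x = 1 := Matrix.nonsing_inv_mul _ ((Matrix.isUnit_iff_isUnit_det _).1 hu)
  have hG : MDerivAt (fun x => (M x)⁻¹) ((M x)⁻¹ * ((Ψ x)ᴴ * Ψ x) * (M x)⁻¹) x :=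
    (hM.inv hu).congr_deriv (by simp)
  have hS := hΨ.conjTranspose.mul hΨ
  have hR := hΨ.conjTranspose.mul hΦ
  have hQ := hΦ.conjTranspose.mul hΨ
  have hT := hΦ.conjTranspose.mul hΦ
  have hL := mDerivAt_const Λ x
  have hs := hG.mul hS
  have h1 := (hG.mul hT).trace
  have h2 := ((hG.mul (hR.add hQ)).mul hs).trace
  have h3 := ((hs.mul hs).mul hs).trace
  have h4 := (hG.mul ((hL.mul hS).add (hS.mul hL))).trace
  have h := ((h1.fun_add (h2.const_mul (1 / 2))).fun_add (h3.const_mul (1 / 3))).fun_sub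
    (h4.const_mul (1 / 2))
  refine h.congr_deriv ?_
  rw [trace_mul_kDer, trace_kDer_sq]
  have hid := trace_gauge_identity hMG hGM hZ
  rw [Matrix.conjTranspose_add, Matrix.conjTranspose_mul, Matrix.conjTranspose_mul, hW, hΛ]
  set G := (M x)⁻¹
  have eR : (Ψ x)ᴴ * (W * Ψ x + Ψ x * Λ) = (Ψ x)ᴴ * W * Ψ x + (Ψ x)ᴴ * Ψ x * Λ := by
    simp only [Matrix.mul_add, Matrix.mul_assoc]
  have eQ : ((Ψ x)ᴴ * W + Λ * (Ψ x)ᴴ) * Ψ x = (Ψ x)ᴴ * W * Ψ x + Λ * ((Ψ x)ᴴ * Ψ x) := by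
    simp only [Matrix.add_mul, Matrix.mul_assoc]
  have eT1 : ((Ψ x)ᴴ * W + Λ * (Ψ x)ᴴ) * Φ x = (Ψ x)ᴴ * W * Φ x + Λ * ((Ψ x)ᴴ * Φ x) := by
    simp only [Matrix.add_mul, Matrix.mul_assoc]
  have eT2 : (Φ x)ᴴ * (W * Ψ x + Ψ x * Λ) = (Φ x)ᴴ * W * Ψ x + (Φ x)ᴴ * Ψ x * Λ := by
    simp only [Matrix.mul_add, Matrix.mul_assoc]
  rw [eR, eQ, eT1, eT2]
  generalize (Ψ x)ᴴ * W * Ψ x = P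
  generalize (Ψ x)ᴴ * W * Φ x = Y
  generalize (Φ x)ᴴ * W * Ψ x = Y'
  generalize (Ψ x)ᴴ * Ψ x = S at *
  generalize (Ψ x)ᴴ * Φ x = R at *
  generalize (Φ x)ᴴ * Ψ x = Q at *
  generalize (Φ x)ᴴ * Φ x = T at *
  have c2 : ∀ A B : Matrix N N ℂ, (G * (A * (G * B))).trace = (G * (B * (G * A))).trace :=
    fun A B => by
      rw [← Matrix.mul_assoc, Matrix.trace_mul_comm, Matrix.mul_assoc]
  have c3 : ∀ A B C : Matrix N N ℂ, (G * (A * (G * (B * (G * C))))).trace =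
      (G * (B * (G * (C * (G * A))))).trace := fun A B C => by
    rw [← Matrix.mul_assoc, Matrix.trace_mul_comm]
    simp only [Matrix.mul_assoc]
  have d1 := c2 S T
  have d2 := c2 S P
  have d3 := c2 S (Λ * S)
  have d4 := c2 S (S * Λ)
  have d5 := c3 S S R
  have d6 := c3 S R S
  have d7 := c3 S S Q
  have d8 := c3 S Q S
  simp only [Matrix.mul_add, Matrix.add_mul, Matrix.mul_assoc, Matrix.trace_add, Matrix.zero_mul,
    Matrix.mul_zero, zero_add, add_zero] at d1 d2 d3 d4 d5 d6 d7 d8 hid ⊢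
  linear_combination hid + d1 - d2 - 1 / 2 * d3 - 1 / 2 * d4 + 1 / 3 * d5 + 7 / 6 * d6 + 1 / 3 * d7 +
    7 / 6 * d8

end DoubleCommutation

section Trace

variable {N : Type*} [Fintype N] [DecidableEq N]

lemma boundaryTerm_of_decay {K M G : Matrix N N ℂ} (hMG : M * G = 1) (hGM : G * M = 1) :
    boundaryTerm (K * K) G (K * M + M * K) (-((K * M + M * K) * K)) (-(K * (K * M + M * K)))
      (K * (K * M + M * K) * K) = -(4 / 3) * (K * K * K).trace := by
  have hGM' : ∀ X : Matrix N N ℂ, G * (M * X) = X := fun X => by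
    rw [← Matrix.mul_assoc, hGM, Matrix.one_mul]
  have hMG' : ∀ X : Matrix N N ℂ, M * (G * X) = X := fun X => by
    rw [← Matrix.mul_assoc, hMG, Matrix.one_mul]
  obtain ⟨A, hA⟩ : ∃ A, A = G * (K * M) := ⟨_, rfl⟩
  have hS : G * (K * M + M * K) = A + K := by rw [Matrix.mul_add, hGM', hA]
  have hA2 : G * (K * (K * M)) = A * A := by
    rw [hA]; simp only [Matrix.mul_assoc, hMG']
  have hA3 : G * (K * (K * (K * M))) = A * (A * A) := by
    rw [hA]; simp only [Matrix.mul_assoc, hMG']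
  have hK3 : (A * (A * A)).trace = (K * (K * K)).trace := by
    rw [← hA3, Matrix.trace_mul_comm]
    simp only [Matrix.mul_assoc, hMG, Matrix.mul_one]
  have hGA : ∀ X : Matrix N N ℂ, G * (K * (M * X)) = A * X := fun X => by
    rw [hA]; simp only [Matrix.mul_assoc]
  have hGA2 : ∀ X : Matrix N N ℂ, G * (K * (K * (M * X))) = A * (A * X) := fun X => by
    rw [← Matrix.mul_assoc A, ← hA2]; simp only [Matrix.mul_assoc]
  rw [boundaryTerm, hS]
  simp only [Matrix.mul_add, Matrix.add_mul, Matrix.mul_neg, Matrix.neg_mul, Matrix.mul_assoc,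
    hGM', hGA, hGA2, hA2, hA3, Matrix.trace_add, Matrix.trace_neg, hK3]
  have c1 : (A * (K * A)).trace = (A * (A * K)).trace := by
    rw [← Matrix.mul_assoc, Matrix.trace_mul_comm]
  have c2 : (K * (A * A)).trace = (A * (A * K)).trace := by
    rw [Matrix.trace_mul_comm, Matrix.mul_assoc]
  have c3 : (K * (A * K)).trace = (A * (K * K)).trace := by
    rw [Matrix.trace_mul_comm, Matrix.mul_assoc]
  have c4 : (K * (K * A)).trace = (A * (K * K)).trace := by
    rw [← Matrix.mul_assoc, Matrix.trace_mul_comm]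
  rw [c1, c2, c3, c4]
  ring

lemma tendsto_boundaryTerm {l : Filter ℝ} {Λ : Matrix N N ℂ} {M S R Q T : ℝ → Matrix N N ℂ}
    (hM : Filter.Tendsto M l (nhds 1)) (hS : Filter.Tendsto S l (nhds 0))
    (hR : Filter.Tendsto R l (nhds 0)) (hQ : Filter.Tendsto Q l (nhds 0))
    (hT : Filter.Tendsto T l (nhds 0)) :
    Filter.Tendsto (fun x => boundaryTerm Λ (M x)⁻¹ (S x) (R x) (Q x) (T x)) l (nhds 0) := by
  have hG : Filter.Tendsto (fun x => (M x)⁻¹) l (nhds 1) := by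
    let _ : NormedRing (Matrix N N ℂ) := Matrix.linftyOpNormedRing
    let _ : NormedAlgebra ℝ (Matrix N N ℂ) := Matrix.linftyOpNormedAlgebra
    have h : ContinuousAt Ring.inverse (1 : Matrix N N ℂ) := by
      exact NormedRing.inverse_continuousAt (1 : (Matrix N N ℂ)ˣ)
    have h2 := h.tendsto.comp hM
    rw [Ring.inverse_one] at h2
    refine h2.congr fun x => ?_
    exact (Matrix.nonsing_inv_eq_ringInverse (M x)).symm
  have hc : Continuous fun p : Matrix N N ℂ × Matrix N N ℂ × Matrix N N ℂ × Matrix N N ℂ ×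
      Matrix N N ℂ => boundaryTerm Λ p.1 p.2.1 p.2.2.1 p.2.2.2.1 p.2.2.2.2 := by
    unfold boundaryTerm
    fun_prop
  have h := (hc.tendsto (1, 0, 0, 0, 0)).comp
    (hG.prodMk_nhds (hS.prodMk_nhds (hR.prodMk_nhds (hQ.prodMk_nhds hT))))
  simpa [boundaryTerm, Function.comp_def] using h

end Trace

lemma hasDerivAt_integral_Ioi {f : ℝ → ℂ} (hf : Continuous f) (hi : Integrable f) (x : ℝ) :
    HasDerivAt (fun x => ∫ y in Set.Ioi x, f y) (-f x) x := by
  have e : (fun x => ∫ y in Set.Ioi x, f y) =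
      fun x => (∫ y in Set.Ioi 0, f y) - ∫ y in (0:ℝ)..x, f y := by
    funext x
    rw [eq_sub_iff_add_eq, add_comm, intervalIntegral.integral_interval_add_Ioi hi.integrableOn
      hi.integrableOn]
  rw [e]
  exact (intervalIntegral.integral_hasDerivAt_right (hf.intervalIntegrable _ _)
    (hf.stronglyMeasurableAtFilter _ _) hf.continuousAt).const_sub _

lemma eq_zero_of_second_order_ode {m : ℕ} {W : ℝ → Matrix (Fin m) (Fin m) ℂ} (hW : Continuous W)
    (hs : HasCompactSupport W) {μ : ℂ} {f g : ℝ → Fin m → ℂ} (hf : ∀ x, HasDerivAt f (g x) x)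
    (hg : ∀ x, HasDerivAt g (μ • f x - W x *ᵥ f x) x) {x₀ : ℝ} (hf0 : f x₀ = 0)
    (hg0 : g x₀ = 0) : f = 0 := by
  let _ : NormedRing (Matrix (Fin m) (Fin m) ℂ) := Matrix.linftyOpNormedRing
  obtain ⟨C, hC⟩ := hs.exists_bound_of_continuous hW
  have hC0 : 0 ≤ C := (norm_nonneg _).trans (hC 0)
  let v : ℝ → (Fin m → ℂ) × (Fin m → ℂ) → (Fin m → ℂ) × (Fin m → ℂ) :=
    fun t p => (p.2, μ • p.1 - W t *ᵥ p.1)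
  have hv : ∀ t, LipschitzOnWith (Real.toNNReal (1 + ‖μ‖ + C)) (v t) Set.univ := fun t => by
    refine LipschitzOnWith.of_dist_le_mul fun p _ q _ => ?_
    rw [Real.coe_toNNReal _ (by positivity), dist_eq_norm, dist_eq_norm]
    have e : v t p - v t q = (p.2 - q.2, μ • (p.1 - q.1) - W t *ᵥ (p.1 - q.1)) := by
      simp only [v, Prod.mk_sub_mk, Matrix.mulVec_sub, smul_sub]
      congr 1
      abel
    have h1 : ‖p.1 - q.1‖ ≤ ‖p - q‖ := norm_fst_le (p - q)
    have h2 : ‖p.2 - q.2‖ ≤ ‖p - q‖ := norm_snd_le (p - q)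
    rw [e, Prod.norm_mk]
    refine max_le ?_ ?_
    · nlinarith [norm_nonneg (p - q), norm_nonneg μ]
    · refine (norm_sub_le _ _).trans ?_
      rw [norm_smul]
      have h3 := (Matrix.linfty_opNorm_mulVec (W t) (p.1 - q.1)).trans
        (mul_le_mul (hC t) h1 (norm_nonneg _) hC0)
      have h4 : ‖μ‖ * ‖p.1 - q.1‖ ≤ ‖μ‖ * ‖p - q‖ := by gcongr
      nlinarith [norm_nonneg (p - q)]
  have h := ODE_solution_unique_univ (f := fun t => (f t, g t)) (g := fun _ => 0) (t₀ := x₀) hv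
    (fun t => ⟨(hf t).prodMk (hg t), trivial⟩)
    (fun t => ⟨(hasDerivAt_const t (0 : (Fin m → ℂ) × (Fin m → ℂ))).congr_deriv (by simp [v]; rfl),
      trivial⟩)
    (by simp [hf0, hg0])
  funext t
  exact congrArg Prod.fst (congrFun h t)

section

variable {m N : ℕ}

lemma MDerivAt.mulVec {p q : ℕ} {A : ℝ → Matrix (Fin p) (Fin q) ℂ} {A' : Matrix (Fin p) (Fin q) ℂ}
    {x : ℝ} (h : MDerivAt A A' x) (c : Fin q → ℂ) : HasDerivAt (fun y => A y *ᵥ c) (A' *ᵥ c) x := by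
  refine hasDerivAt_pi.2 fun a => ?_
  have := HasDerivAt.fun_sum (u := Finset.univ) fun j _ => (h a j).mul_const (c j)
  exact this

/-- Eigenfunctions `Ψ` (the columns) of `-d²/dx² - W` with eigenvalues `-κ j ^ 2` that are
orthonormal in `L²`. -/
structure IsBoundStates (W : ℝ → Matrix (Fin m) (Fin m) ℂ) (κ : Fin N → ℝ)
    (Ψ Φ : ℝ → Matrix (Fin m) (Fin N) ℂ) : Prop where
  pos : ∀ j, 0 < κ j
  deriv₁ : ∀ x, MDerivAt Ψ (Φ x) x
  deriv₂ : ∀ x, MDerivAt Φ (-W x * Ψ x + Ψ x * Matrix.diagonal fun j => (κ j : ℂ) ^ 2) x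
  integrable : ∀ i j, Integrable fun x => ((Ψ x)ᴴ * Ψ x) i j
  orthonormal : ∀ i j, ∫ x, ((Ψ x)ᴴ * Ψ x) i j = (1 : Matrix (Fin N) (Fin N) ℂ) i j
  bounded : ∀ a j, ∃ B, ∀ x, ‖Ψ x a j‖ ≤ B ∧ ‖Φ x a j‖ ≤ B

namespace IsBoundStates

variable {W : ℝ → Matrix (Fin m) (Fin m) ℂ} {κ : Fin N → ℝ} {Ψ Φ : ℝ → Matrix (Fin m) (Fin N) ℂ}

/-- The Gram matrix of the bound states on a half line. -/
noncomputable def gram (Ψ : ℝ → Matrix (Fin m) (Fin N) ℂ) (x : ℝ) : Matrix (Fin N) (Fin N) ℂ :=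
  Matrix.of fun i j => ∫ y in Set.Ioi x, ((Ψ y)ᴴ * Ψ y) i j

lemma continuous_Ψ (h : IsBoundStates W κ Ψ Φ) : Continuous Ψ :=
  continuous_matrix fun i j => continuous_iff_continuousAt.2 fun x => (h.deriv₁ x i j).continuousAt

lemma continuous_entry (h : IsBoundStates W κ Ψ Φ) (i j : Fin N) :
    Continuous fun x => ((Ψ x)ᴴ * Ψ x) i j := by
  have := h.continuous_Ψ
  exact Continuous.matrix_elem (by fun_prop) i j

lemma mDerivAt_gram (h : IsBoundStates W κ Ψ Φ) (x : ℝ) :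
    MDerivAt (gram Ψ) (-((Ψ x)ᴴ * Ψ x)) x := fun i j =>
  hasDerivAt_integral_Ioi (h.continuous_entry i j) (h.integrable i j) x

lemma hasDerivAt_Φ (h : IsBoundStates W κ Ψ Φ) {x : ℝ} (hx : W x = 0) (a : Fin m) (j : Fin N) :
    HasDerivAt (fun x => Φ x a j) ((κ j : ℂ) ^ 2 * Ψ x a j) x :=
  (h.deriv₂ x a j).congr_deriv (by simp [hx, Matrix.mul_diagonal, mul_comm])

lemma Φ_eq (h : IsBoundStates W κ Ψ Φ) {L : ℝ} (hL : ∀ x, L ≤ |x| → W x = 0) {x : ℝ}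
    (hx : L ≤ x) : Φ x = -(Ψ x * Matrix.diagonal fun j => (κ j : ℂ)) := by
  ext a j
  obtain ⟨B, hB⟩ := h.bounded a j
  rw [eq_neg_mul_of_bounded (h.pos j) (fun x _ => h.deriv₁ x a j)
    (fun x hx => h.hasDerivAt_Φ (hL x (hx.trans (le_abs_self x))) a j) hB hx]
  simp [Matrix.mul_diagonal, mul_comm]

lemma tendsto_atTop (h : IsBoundStates W κ Ψ Φ) {L : ℝ} (hL : ∀ x, L ≤ |x| → W x = 0) :
    Filter.Tendsto Ψ Filter.atTop (nhds 0) := by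
  refine tendsto_pi_nhds.2 fun a => tendsto_pi_nhds.2 fun j => ?_
  obtain ⟨B, hB⟩ := h.bounded a j
  exact (tendsto_zero_of_bounded (h.pos j) (fun x _ => h.deriv₁ x a j)
    (fun x hx => h.hasDerivAt_Φ (hL x (hx.trans (le_abs_self x))) a j) hB).1

lemma tendsto_atBot (h : IsBoundStates W κ Ψ Φ) {L : ℝ} (hL : ∀ x, L ≤ |x| → W x = 0) :
    Filter.Tendsto Ψ Filter.atBot (nhds 0) ∧ Filter.Tendsto Φ Filter.atBot (nhds 0) := by
  have key : ∀ a j, Filter.Tendsto (fun x => Ψ x a j) Filter.atBot (nhds 0) ∧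
      Filter.Tendsto (fun x => Φ x a j) Filter.atBot (nhds 0) := fun a j => by
    obtain ⟨B, hB⟩ := h.bounded a j
    exact tendsto_zero_atBot_of_bounded (h.pos j) (fun x _ => h.deriv₁ x a j)
      (fun x hx => h.hasDerivAt_Φ (hL x ((le_neg.1 hx).trans (neg_le_abs x))) a j) hB
  exact ⟨tendsto_pi_nhds.2 fun a => tendsto_pi_nhds.2 fun j => (key a j).1,
    tendsto_pi_nhds.2 fun a => tendsto_pi_nhds.2 fun j => (key a j).2⟩

lemma tendsto_gram (h : IsBoundStates W κ Ψ Φ) :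
    Filter.Tendsto (gram Ψ) Filter.atBot (nhds 1) := by
  refine tendsto_pi_nhds.2 fun i => tendsto_pi_nhds.2 fun j => ?_
  rw [← h.orthonormal i j]
  exact (aecover_Ioi (μ := volume) Filter.tendsto_id).integral_tendsto_of_countably_generated
    (h.integrable i j)

lemma gram_eq (h : IsBoundStates W κ Ψ Φ) {L : ℝ} (hL : ∀ x, L ≤ |x| → W x = 0) :
    (Ψ L)ᴴ * Ψ L = (Matrix.diagonal fun j => (κ j : ℂ)) * gram Ψ L +
      gram Ψ L * Matrix.diagonal fun j => (κ j : ℂ) := by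
  have hdiag : (Matrix.diagonal fun j => (κ j : ℂ))ᴴ = Matrix.diagonal fun j => (κ j : ℂ) := by
    rw [Matrix.diagonal_conjTranspose]
    congr 1
    ext j
    simp
  ext i j
  have hd : ∀ x ∈ Set.Ici L, HasDerivAt (fun x => ((Ψ x)ᴴ * Ψ x) i j)
      (-((κ i : ℂ) + κ j) * ((Ψ x)ᴴ * Ψ x) i j) x := fun x hx => by
    refine ((h.deriv₁ x).conjTranspose.mul (h.deriv₁ x) i j).congr_deriv ?_
    rw [h.Φ_eq hL hx, Matrix.conjTranspose_neg, Matrix.conjTranspose_mul, hdiag, Matrix.neg_mul,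
      Matrix.mul_neg, Matrix.mul_assoc, ← Matrix.mul_assoc (Ψ x)ᴴ, Matrix.add_apply,
      Matrix.neg_apply, Matrix.neg_apply, Matrix.diagonal_mul, Matrix.mul_diagonal]
    ring
  have hlim : Filter.Tendsto (fun x => ((Ψ x)ᴴ * Ψ x) i j) Filter.atTop (nhds 0) := by
    have hc : Continuous fun A : Matrix (Fin m) (Fin N) ℂ => (Aᴴ * A) i j :=
      Continuous.matrix_elem (by fun_prop) i j
    simpa [Function.comp_def] using (hc.tendsto 0).comp (h.tendsto_atTop hL)
  have := integral_Ioi_of_hasDerivAt_of_tendsto' hd ((h.integrable i j).const_mul _).integrableOn hlim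
  rw [integral_const_mul] at this
  rw [Matrix.add_apply, Matrix.diagonal_mul, Matrix.mul_diagonal]
  change _ = (κ i : ℂ) * (∫ y in Set.Ioi L, ((Ψ y)ᴴ * Ψ y) i j) +
    (∫ y in Set.Ioi L, ((Ψ y)ᴴ * Ψ y) i j) * (κ j : ℂ)
  linear_combination this

lemma isUnit_gram (h : IsBoundStates W κ Ψ Φ) (hW : Continuous W) (hs : HasCompactSupport W)
    (x : ℝ) : IsUnit (gram Ψ x) := by
  obtain ⟨L, -, hL⟩ := exists_pos_abs_ge_eq_zero (ι := Unit) (f := fun _ => W) (fun _ => hs)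
  replace hL := hL ()
  rw [Matrix.isUnit_iff_isUnit_det, isUnit_iff_ne_zero]
  intro hdet
  obtain ⟨c, hc, hc0⟩ := Matrix.exists_mulVec_eq_zero_iff.2 hdet
  have hquad : ∀ (c : Fin N → ℂ) (s : Set ℝ), ∫ y in s, vsq (Ψ y *ᵥ c) =
      (∑ i, ∑ j, star (c i) * (∫ y in s, ((Ψ y)ᴴ * Ψ y) i j) * c j).re := fun c s => by
    have hv : ∀ y, ((vsq (Ψ y *ᵥ c) : ℝ) : ℂ) =
        ∑ i, ∑ j, star (c i) * ((Ψ y)ᴴ * Ψ y) i j * c j := fun y => by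
      rw [← dotProduct_self_eq, Matrix.star_mulVec, ← Matrix.dotProduct_mulVec,
        Matrix.mulVec_mulVec]
      simp only [dotProduct, Matrix.mulVec, Finset.mul_sum, Pi.star_apply, mul_assoc]
    rw [← Complex.ofReal_re (∫ y in s, vsq (Ψ y *ᵥ c)), ← integral_complex_ofReal]
    simp only [hv]
    rw [integral_finsetSum _ fun i _ => integrable_finsetSum _ fun j _ =>
      (((h.integrable i j).const_mul _).mul_const _).integrableOn]
    congr 1
    refine Finset.sum_congr rfl fun i _ => ?_
    rw [integral_finsetSum _ fun j _ => (((h.integrable i j).const_mul _).mul_const _).integrableOn]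
    refine Finset.sum_congr rfl fun j _ => ?_
    rw [integral_mul_const, integral_const_mul]
  have hΨc := h.continuous_Ψ
  have h_int : ∀ c : Fin N → ℂ, Integrable fun y => vsq (Ψ y *ᵥ c) := fun c => by
    have : ∀ y, vsq (Ψ y *ᵥ c) = (∑ i, ∑ j, star (c i) * ((Ψ y)ᴴ * Ψ y) i j * c j).re := fun y => by
      rw [vsq_eq_re, Matrix.star_mulVec, ← Matrix.dotProduct_mulVec, Matrix.mulVec_mulVec]
      simp only [dotProduct, Matrix.mulVec, Finset.mul_sum, Pi.star_apply, mul_assoc]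
    simp only [this]
    exact (integrable_finsetSum _ fun i _ => integrable_finsetSum _ fun j _ =>
      ((h.integrable i j).const_mul _).mul_const _).re
  have hzero : ∀ y ∈ Set.Ioi x, Ψ y *ᵥ c = 0 := by
    have h1 : ∫ y in Set.Ioi x, vsq (Ψ y *ᵥ c) = 0 := by
      rw [hquad]
      have : ∀ i, ∑ j, star (c i) * (∫ y in Set.Ioi x, ((Ψ y)ᴴ * Ψ y) i j) * c j = 0 := fun i => by
        have h2 := congrFun hc0 i
        simp only [Matrix.mulVec, dotProduct, gram, Matrix.of_apply, Pi.zero_apply] at h2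
        simp only [mul_assoc, ← Finset.mul_sum]
        rw [h2, mul_zero]
      rw [Finset.sum_eq_zero fun i _ => this i, Complex.zero_re]
    rw [setIntegral_eq_zero_iff_of_nonneg_ae (Filter.Eventually.of_forall fun y => vsq_nonneg _)
      (h_int c).integrableOn] at h1
    have hcv : Continuous fun y => vsq (Ψ y *ᵥ c) := by fun_prop
    have h2 := Measure.eqOn_open_of_ae_eq h1 isOpen_Ioi hcv.continuousOn continuousOn_const
    exact fun y hy => vsq_eq_zero.1 (h2 hy)
  let D : Matrix (Fin N) (Fin N) ℂ := Matrix.diagonal fun j => (κ j : ℂ)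
  let Z : Submodule ℂ (Fin N → ℂ) :=
    { carrier := {c | ∀ y, max x L < y → Ψ y *ᵥ c = 0}
      add_mem' := fun {a b} ha hb y hy => by rw [Matrix.mulVec_add, ha y hy, hb y hy, add_zero]
      zero_mem' := fun y _ => Matrix.mulVec_zero _
      smul_mem' := fun r a ha y hy => by rw [Matrix.mulVec_smul, ha y hy, smul_zero] }
  have hder : ∀ (c : Fin N → ℂ) y, HasDerivAt (fun y => Ψ y *ᵥ c) (Φ y *ᵥ c) y := fun c y =>
    (h.deriv₁ y).mulVec c
  have hZΦ : ∀ c ∈ Z, ∀ y, max x L < y → Φ y *ᵥ c = 0 := fun c hc y hy => by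
    have h1 : (fun y => Ψ y *ᵥ c) =ᶠ[nhds y] fun _ => 0 := by
      filter_upwards [isOpen_Ioi.mem_nhds hy] with z hz using hc z hz
    exact (hder c y).unique ((hasDerivAt_const y 0).congr_of_eventuallyEq h1)
  have hZ : ∀ c ∈ Z, Matrix.mulVecLin D c ∈ Z := fun c hc y hy => by
    have h1 := hZΦ c hc y hy
    rw [h.Φ_eq hL ((le_max_right x L).trans hy.le), Matrix.neg_mulVec, neg_eq_zero,
      ← Matrix.mulVec_mulVec] at h1
    exact h1
  have hcZ : c ∈ Z := fun y hy => hzero y ((le_max_left x L).trans_lt hy)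
  have : Nontrivial Z := ⟨⟨⟨c, hcZ⟩, 0, fun h0 => hc (congrArg Subtype.val h0)⟩⟩
  obtain ⟨μ, hμ⟩ := Module.End.exists_eigenvalue ((Matrix.mulVecLin D).restrict hZ)
  obtain ⟨⟨w, hwZ⟩, hw⟩ := hμ.exists_hasEigenvector
  have hw0 : w ≠ 0 := fun h0 => hw.2 (Subtype.ext h0)
  have hwμ : D *ᵥ w = μ • w := congrArg Subtype.val hw.apply_eq_smul
  have hD2 : (Matrix.diagonal fun j => (κ j : ℂ) ^ 2) *ᵥ w = μ ^ 2 • w := by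
    have : (Matrix.diagonal fun j => (κ j : ℂ) ^ 2) = D * D := by
      rw [Matrix.diagonal_mul_diagonal]
      congr 1
      ext j
      ring
    rw [this, ← Matrix.mulVec_mulVec, hwμ, Matrix.mulVec_smul, hwμ, smul_smul, sq]
  have hode := eq_zero_of_second_order_ode hW hs (μ := μ ^ 2) (f := fun y => Ψ y *ᵥ w)
    (g := fun y => Φ y *ᵥ w) (hder w) (fun y => by
      have h1 : HasDerivAt (fun y => Φ y *ᵥ w)
          ((-W y * Ψ y + Ψ y * Matrix.diagonal fun j => (κ j : ℂ) ^ 2) *ᵥ w) y :=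
        (h.deriv₂ y).mulVec w
      refine h1.congr_deriv ?_
      rw [Matrix.add_mulVec, ← Matrix.mulVec_mulVec _ (Ψ y), hD2, Matrix.mulVec_smul, Matrix.neg_mul,
        Matrix.neg_mulVec, Matrix.mulVec_mulVec]
      abel) (x₀ := max x L + 1) (hwZ _ (by linarith)) (hZΦ w hwZ _ (by linarith))
  have h1 := hquad w Set.univ
  have h2 : ∀ y, vsq (Ψ y *ᵥ w) = 0 := fun y => vsq_eq_zero.2 (congrFun hode y)
  simp only [h2, integral_zero, setIntegral_univ, h.orthonormal] at h1
  have h3 : vsq w = 0 := by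
    rw [h1, vsq_eq_re]
    simp [dotProduct, Matrix.one_apply]
  exact hw0 (vsq_eq_zero.1 h3)

end IsBoundStates

end

section

variable {m N : ℕ} {W : ℝ → Matrix (Fin m) (Fin m) ℂ} {κ : Fin N → ℝ}
  {Ψ Φ : ℝ → Matrix (Fin m) (Fin N) ℂ}

lemma re_trace_sq_nonneg {A : Matrix (Fin m) (Fin m) ℂ} (hA : Aᴴ = A) : 0 ≤ (A * A).trace.re := by
  have h := (Matrix.posSemidef_conjTranspose_mul_self A).trace_nonneg
  rw [hA] at h
  exact (Complex.le_def.1 h).1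

namespace IsBoundStates

lemma conjTranspose_diagonal (κ : Fin N → ℝ) :
    (Matrix.diagonal fun j => (κ j : ℂ))ᴴ = Matrix.diagonal fun j => (κ j : ℂ) := by
  rw [Matrix.diagonal_conjTranspose]
  congr 1
  ext j
  simp

lemma diagonal_sq (κ : Fin N → ℝ) : (Matrix.diagonal fun j => (κ j : ℂ) ^ 2) =
    (Matrix.diagonal fun j => (κ j : ℂ)) * Matrix.diagonal fun j => (κ j : ℂ) := by
  rw [Matrix.diagonal_mul_diagonal]
  congr 1
  ext j
  ring

lemma conjTranspose_gram (Ψ : ℝ → Matrix (Fin m) (Fin N) ℂ) (x : ℝ) :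
    (gram Ψ x)ᴴ = gram Ψ x := by
  ext i j
  simp only [gram, Matrix.conjTranspose_apply, Matrix.of_apply]
  rw [RCLike.star_def, ← integral_conj]
  congr 1
  ext y
  rw [← RCLike.star_def, ← Matrix.conjTranspose_apply, Matrix.conjTranspose_mul,
    Matrix.conjTranspose_conjTranspose]

lemma wronskian_eq (h : IsBoundStates W κ Ψ Φ) (hH : ∀ x, (W x)ᴴ = W x) {L : ℝ}
    (hL : ∀ x, L ≤ |x| → W x = 0) (x : ℝ) :
    (Ψ x)ᴴ * Φ x - (Φ x)ᴴ * Ψ x = (Matrix.diagonal fun j => (κ j : ℂ) ^ 2) * gram Ψ x -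
      gram Ψ x * Matrix.diagonal fun j => (κ j : ℂ) ^ 2 := by
  set K := Matrix.diagonal fun j => (κ j : ℂ) with hK
  have hKK : Kᴴ = K := conjTranspose_diagonal κ
  rw [diagonal_sq, ← hK]
  let Z : ℝ → Matrix (Fin N) (Fin N) ℂ := fun x =>
    (Ψ x)ᴴ * Φ x - (Φ x)ᴴ * Ψ x - (K * K * gram Ψ x - gram Ψ x * (K * K))
  have hZ : ∀ x, MDerivAt Z 0 x := fun x => by
    have d1 := h.deriv₁ x
    have d2 := h.deriv₂ x
    rw [diagonal_sq, ← hK] at d2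
    have dg := h.mDerivAt_gram x
    have dc := mDerivAt_const (K * K) x
    refine (((d1.conjTranspose.mul d2).sub (d2.conjTranspose.mul d1)).sub
      ((dc.mul dg).sub (dg.mul dc))).congr_deriv ?_
    simp only [Matrix.conjTranspose_add, Matrix.conjTranspose_mul, Matrix.conjTranspose_neg, hH, hKK,
      Matrix.mul_add, Matrix.add_mul, Matrix.neg_mul, Matrix.mul_neg, Matrix.mul_assoc,
      Matrix.zero_mul, Matrix.mul_zero]
    abel
  have hZL : Z L = 0 := by
    have e := h.gram_eq hL
    rw [← hK] at e
    simp only [Z]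
    rw [h.Φ_eq hL le_rfl, ← hK, Matrix.conjTranspose_neg, Matrix.conjTranspose_mul, hKK,
      Matrix.mul_neg, Matrix.neg_mul, ← Matrix.mul_assoc, Matrix.mul_assoc K (Ψ L)ᴴ, e]
    simp only [Matrix.mul_add, Matrix.add_mul, Matrix.mul_assoc]
    abel
  have hc : Z x = Z L := by
    ext i j
    exact is_const_of_deriv_eq_zero (fun y => (hZ y i j).differentiableAt)
      (fun y => (hZ y i j).deriv) x L
  rw [hZL] at hc
  exact sub_eq_zero.1 hc

/-- The sharp Lieb–Thirring bound for the third powers of the momenta of bound states. -/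
theorem sum_cube_le (h : IsBoundStates W κ Ψ Φ) (hW : Continuous W) (hs : HasCompactSupport W)
    (hH : ∀ x, (W x)ᴴ = W x) : ∑ j, κ j ^ 3 ≤ 3 / 16 * ∫ x, (W x * W x).trace.re := by
  obtain ⟨L, -, hL⟩ := exists_pos_abs_ge_eq_zero (ι := Unit) (f := fun _ => W) (fun _ => hs)
  replace hL := hL ()
  set K := Matrix.diagonal fun j => (κ j : ℂ) with hK
  have hKK : Kᴴ = K := conjTranspose_diagonal κ
  let b : ℝ → ℂ := fun x => boundaryTerm (K * K) (gram Ψ x)⁻¹ ((Ψ x)ᴴ * Ψ x) ((Ψ x)ᴴ * Φ x)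
    ((Φ x)ᴴ * Ψ x) ((Φ x)ᴴ * Φ x)
  let k : ℝ → Matrix (Fin m) (Fin m) ℂ := fun x => kDer (Ψ x) (Φ x) (gram Ψ x)⁻¹
  let w : ℝ → ℝ := fun x => (W x * W x).trace.re
  have hw : Continuous w := Complex.continuous_re.comp (hW.mul hW).matrix_trace
  have hw0 : ∀ x, 0 ≤ w x := fun x => re_trace_sq_nonneg (hH x)
  have hwi : Integrable w := hw.integrable_of_hasCompactSupport
    (hs.mono fun x hx h0 => hx (by simp [w, h0]))
  have hb : ∀ x, HasDerivAt b ((-W x * k x).trace + (k x * k x).trace) x := fun x => by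
    have d2 := h.deriv₂ x
    rw [diagonal_sq, ← hK] at d2
    refine hasDerivAt_boundaryTerm (h.deriv₁ x) d2 (by rw [Matrix.conjTranspose_neg, hH])
      (by rw [Matrix.conjTranspose_mul, hKK]) (h.mDerivAt_gram x) (h.isUnit_gram hW hs x) ?_
    rw [h.wronskian_eq hH hL, diagonal_sq]
  have hkH : ∀ x, (k x)ᴴ = k x := fun x => by
    simp only [k, kDer, Matrix.conjTranspose_add, Matrix.conjTranspose_mul,
      Matrix.conjTranspose_conjTranspose, Matrix.conjTranspose_nonsing_inv, conjTranspose_gram,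
      Matrix.mul_assoc]
    abel
  have hb' : ∀ x, 0 ≤ ((-W x * k x).trace + (k x * k x).trace).re + 1 / 4 * w x := fun x => by
    have h1 := re_trace_sq_nonneg (A := -W x + (k x + k x)) (by simp [hkH, hH])
    have h2 : (k x * W x).trace = (W x * k x).trace := Matrix.trace_mul_comm _ _
    simp only [Matrix.mul_add, Matrix.add_mul, Matrix.neg_mul, Matrix.mul_neg, Matrix.trace_add,
      Matrix.trace_neg, Complex.add_re, Complex.neg_re, h2] at h1 ⊢
    simp only [w]
    linarith
  have hbL : (b L).re = -(4 / 3) * ∑ j, κ j ^ 3 := by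
    have hu := (Matrix.isUnit_iff_isUnit_det _).1 (h.isUnit_gram hW hs L)
    have e := boundaryTerm_of_decay (K := K) (Matrix.mul_nonsing_inv _ hu)
      (Matrix.nonsing_inv_mul _ hu)
    rw [← h.gram_eq hL] at e
    have hΦ := h.Φ_eq hL le_rfl
    rw [← hK] at hΦ
    have e2 : b L = -(4 / 3) * (K * K * K).trace := by
      rw [← e]
      simp only [b]
      rw [hΦ]
      simp only [Matrix.conjTranspose_neg, Matrix.conjTranspose_mul, hKK, Matrix.mul_neg,
        Matrix.neg_mul, Matrix.mul_assoc, neg_neg]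
    rw [e2, hK, Matrix.diagonal_mul_diagonal, Matrix.diagonal_mul_diagonal, Matrix.trace_diagonal]
    have e3 : (-(4 / 3) * ∑ i, (κ i : ℂ) * κ i * κ i) = ((-(4 / 3) * ∑ j, κ j ^ 3 : ℝ) : ℂ) := by
      push_cast
      congr 1
      exact Finset.sum_congr rfl fun i _ => by ring
    rw [e3, Complex.ofReal_re]
  have hlim : Filter.Tendsto (fun x => (b x).re) Filter.atBot (nhds 0) := by
    obtain ⟨t1, t2⟩ := h.tendsto_atBot hL
    have hc : ∀ {A B : ℝ → Matrix (Fin m) (Fin N) ℂ}, Filter.Tendsto A Filter.atBot (nhds 0) →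
        Filter.Tendsto B Filter.atBot (nhds 0) →
        Filter.Tendsto (fun x => (A x)ᴴ * B x) Filter.atBot (nhds 0) := fun {A B} hA hB => by
      have hm : Continuous fun p : Matrix (Fin m) (Fin N) ℂ × Matrix (Fin m) (Fin N) ℂ =>
        p.1ᴴ * p.2 := by fun_prop
      simpa [Function.comp_def] using (hm.tendsto (0, 0)).comp (hA.prodMk_nhds hB)
    have := tendsto_boundaryTerm (Λ := K * K) h.tendsto_gram (hc t1 t1) (hc t1 t2) (hc t2 t1)
      (hc t2 t2)
    exact (Complex.continuous_re.tendsto 0).comp this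
  let g : ℝ → ℝ := fun x => (b x).re + 1 / 4 * ∫ y in L..x, w y
  have hg : Monotone g := by
    have hd : ∀ x, HasDerivAt g (((-W x * k x).trace + (k x * k x).trace).re + 1 / 4 * w x) x :=
      fun x => ((hb x).re').fun_add ((intervalIntegral.integral_hasDerivAt_right
        (hw.intervalIntegrable _ _) (hw.stronglyMeasurableAtFilter _ _) hw.continuousAt).const_mul _)
    exact monotone_of_deriv_nonneg (fun x => (hd x).differentiableAt) fun x => by
      rw [(hd x).deriv]; exact hb' x
  have hbound : ∀ x ≤ L, (b x).re ≤ -(4 / 3) * ∑ j, κ j ^ 3 + 1 / 4 * ∫ x, w x := fun x hx => by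
    have h1 := hg hx
    simp only [g, intervalIntegral.integral_same, hbL] at h1
    rw [intervalIntegral.integral_symm] at h1
    have h2 : ∫ y in x..L, w y ≤ ∫ x, w x := by
      rw [intervalIntegral.integral_of_le hx]
      exact setIntegral_le_integral hwi (Filter.Eventually.of_forall hw0)
    linarith
  have := le_of_tendsto hlim (Filter.eventually_atBot.2 ⟨L, hbound⟩)
  change _ ≤ 3 / 16 * ∫ x, w x
  linarith

end IsBoundStates

lemma trPow_two {A : Matrix (Fin m) (Fin m) ℂ} (hA : A.PosSemidef) :
    trPow 2 A = (A * A).trace.re := by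
  rw [trPow_eq_sum 2 hA.1]
  have h1 : (A * A).trace = ∑ i, (hA.1.eigenvalues i : ℂ) ^ 2 := by
    conv_lhs => rw [hA.1.spectral_theorem]
    rw [← map_mul, Matrix.diagonal_mul_diagonal, Unitary.conjStarAlgAut_apply,
      Matrix.trace_mul_cycle]
    simp [Matrix.trace_diagonal, sq]
  rw [h1, Complex.re_sum]
  refine Finset.sum_congr rfl fun i _ => ?_
  rw [max_eq_left (hA.eigenvalues_nonneg i), Real.rpow_two, ← Complex.ofReal_pow,
    Complex.ofReal_re]

/-- The sharp one-dimensional Lieb–Thirring bound for `γ = 3 / 2`. -/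
theorem lt1'_three_half : LT1' (3 / 2) (3 / 16) := by
  intro m W hW hpos hsupp ι _ u E hE hu hus hflag
  obtain ⟨σ, hσ⟩ := exists_equiv_antitone E
  let T : (Fin m → ℂ) ≃L[ℂ] EuclideanSpace ℂ (Fin m) := (EuclideanSpace.equiv (Fin m) ℂ).symm
  let W' : ℝ → EuclideanSpace ℂ (Fin m) →L[ℂ] EuclideanSpace ℂ (Fin m) := fun x =>
    (Matrix.toEuclideanCLM (𝕜 := ℂ) (n := Fin m)) (W x)
  have hinner : ∀ v w : Fin m → ℂ, inner ℂ (T v) (T w) = star v ⬝ᵥ w := fun v w => by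
    rw [dotProduct_comm]; rfl
  have hnorm : ∀ v : Fin m → ℂ, ‖T v‖ ^ 2 = vsq v := fun v => by
    rw [← inner_self_eq_norm_sq (𝕜 := ℂ), hinner, vsq_eq_re]; rfl
  have hW'T : ∀ x v, W' x (T v) = T (W x *ᵥ v) := fun x v => rfl
  have hW' : Continuous W' := by
    let l : Matrix (Fin m) (Fin m) ℂ →ₗ[ℂ] _ :=
      (Matrix.toEuclideanCLM (𝕜 := ℂ) (n := Fin m)).toAlgEquiv.toLinearMap
    exact (LinearMap.continuous_of_finiteDimensional l).comp hW
  have hW's : HasCompactSupport W' := hsupp.comp_left (map_zero _)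
  have hsymm : ∀ x v w, inner ℂ (W' x v) w = inner ℂ v (W' x w) := fun x v w => by
    obtain ⟨v, rfl⟩ := T.surjective v
    obtain ⟨w, rfl⟩ := T.surjective w
    rw [hW'T, hW'T, hinner, hinner, Matrix.star_mulVec, (hpos x).1.eq, Matrix.dotProduct_mulVec]
  have hflag' := hflag.reindex σ
  obtain ⟨e, ψ, φ, he, h1, h2, h3, h4, h5⟩ := exists_eigenfunctions hW' hW's hsymm
    (E := E ∘ σ) (fun i => hE _) hσ (fun i x => T (u (σ i) x))
    (fun i => (T.toContinuousLinearMap.restrictScalars ℝ).contDiff.comp (hu _)) (fun i => (hus _).comp_left (map_zero T))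
    (fun i c hc hcj => by
      have h := hflag' i c hc hcj
      have e1 : ∀ x, ∑ j, c j • T (u (σ j) x) = T (comb c (u ∘ σ) x) := fun x => by
        simp [comb]
      have hcd : Differentiable ℝ (comb c (u ∘ σ)) := fun x => by
        unfold comb
        exact DifferentiableAt.fun_sum fun j _ =>
          (((hu (σ j)).differentiable one_ne_zero) x).const_smul (c j)
      have e2 : ∀ x, deriv (fun x => T (comb c (u ∘ σ) x)) x = T (deriv (comb c (u ∘ σ)) x) :=
        fun x => ((T.toContinuousLinearMap.restrictScalars ℝ).hasFDerivAt.comp_hasDerivAt x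
          (hcd x).hasDerivAt).deriv
      simp only [e1, e2, hW'T, hnorm, hinner]
      exact h)
  have hpe : ∀ i, 0 < e i := fun i => (hE _).trans_le (he i)
  let Ψ : ℝ → Matrix (Fin m) (Fin (Fintype.card ι)) ℂ := fun x => Matrix.of fun a j => ψ j x a
  let Φ : ℝ → Matrix (Fin m) (Fin (Fintype.card ι)) ℂ := fun x => Matrix.of fun a j => φ j x a
  have hΨ : ∀ x i j, ((Ψ x)ᴴ * Ψ x) i j = inner ℂ (ψ i x) (ψ j x) := fun x i j => by
    obtain ⟨v, hv⟩ := T.surjective (ψ i x)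
    obtain ⟨w, hw⟩ := T.surjective (ψ j x)
    have hv' : ∀ a, ψ i x a = v a := fun a => by rw [← hv]; rfl
    have hw' : ∀ a, ψ j x a = w a := fun a => by rw [← hw]; rfl
    rw [← hv, ← hw, hinner]
    simp [Ψ, Matrix.mul_apply, dotProduct, hv', hw']
  have hproj : ∀ {f : ℝ → EuclideanSpace ℂ (Fin m)} {f' : EuclideanSpace ℂ (Fin m)} {x : ℝ},
      HasDerivAt f f' x → ∀ a, HasDerivAt (fun x => f x a) (f' a) x := fun {f f' x} h a =>
    ((EuclideanSpace.proj (𝕜 := ℂ) a).restrictScalars ℝ).hasFDerivAt.comp_hasDerivAt x h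
  have hbs : IsBoundStates W (fun i => Real.sqrt (e i)) Ψ Φ :=
    { pos := fun j => Real.sqrt_pos.2 (hpe j)
      deriv₁ := fun x a j => hproj (h1 j x) a
      deriv₂ := fun x a j => by
        refine (hproj (h2 j x) a).congr_deriv ?_
        obtain ⟨v, hv⟩ := T.surjective (ψ j x)
        have hv' : ∀ a, ψ j x a = v a := fun a => by rw [← hv]; rfl
        have hs : ((Real.sqrt (e j) : ℝ) : ℂ) ^ 2 = e j := by
          rw [← Complex.ofReal_pow, Real.sq_sqrt (hpe j).le]
        have hWv : (W' x (ψ j x)) a = (W x *ᵥ v) a := by rw [← hv, hW'T]; rfl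
        rw [Matrix.add_apply, Matrix.mul_diagonal, hs, Matrix.neg_mul, Matrix.neg_apply,
          Matrix.mul_apply, PiLp.sub_apply, PiLp.smul_apply, hWv]
        simp only [Ψ, Matrix.of_apply, hv', Matrix.mulVec, dotProduct, smul_eq_mul]
        ring
      integrable := fun i j => by
        simp only [hΨ]
        refine (L2.integrable_inner (𝕜 := ℂ) (h3 i).toLp (h3 j).toLp).congr ?_
        filter_upwards [(h3 i).coeFn_toLp, (h3 j).coeFn_toLp] with x hx hx'
        rw [hx, hx']
      orthonormal := fun i j => by
        simp only [hΨ, h4, Matrix.one_apply]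
      bounded := fun a j => by
        obtain ⟨B, hB⟩ := h5 j
        exact ⟨B, fun x => ⟨(PiLp.norm_apply_le _ a).trans (hB x).1,
          (PiLp.norm_apply_le _ a).trans (hB x).2⟩⟩ }
  have hfin := hbs.sum_cube_le hW hsupp fun x => (hpos x).1.eq
  rw [← σ.sum_comp]
  have e1 : ∀ x, trPow (3 / 2 + 1 / 2) (W x) = (W x * W x).trace.re := fun x => by
    rw [← trPow_two (hpos x)]; norm_num
  simp only [e1]
  refine le_trans (Finset.sum_le_sum fun i _ => ?_) hfin
  calc E (σ i) ^ (3 / 2 : ℝ) ≤ e i ^ (3 / 2 : ℝ) :=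
        Real.rpow_le_rpow (hE _).le (he i) (by norm_num)
    _ = Real.sqrt (e i) ^ 3 := by
        rw [Real.sqrt_eq_rpow, ← Real.rpow_mul_natCast (hpe i).le]
        norm_num

end

section AizenmanLieb

variable {m : ℕ}

lemma lintegral_rpow_mul_rpow {a b : ℝ} (ha : 0 < a) (hb : 0 < b) (s : ℝ) :
    ∫⁻ t in Set.Ioi (0:ℝ), ENNReal.ofReal (t ^ (a - 1)) * ENNReal.ofReal (max (s - t) 0 ^ b) =
      ENNReal.ofReal (ProbabilityTheory.beta a (b + 1) * max s 0 ^ (a + b)) := by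
  rcases le_or_gt s 0 with hs | hs
  · rw [setLIntegral_congr_fun (g := fun _ => 0) measurableSet_Ioi fun t ht => ?_]
    · simp [max_eq_right hs, Real.zero_rpow (add_pos ha hb).ne']
    · have ht : 0 < t := ht
      simp only
      rw [max_eq_right (by linarith : s - t ≤ 0), Real.zero_rpow hb.ne', ENNReal.ofReal_zero,
        mul_zero]
  · have hB := ProbabilityTheory.beta_pos ha (by linarith : 0 < b + 1)
    rw [← lintegral_indicator measurableSet_Ioi]
    nth_rw 1 [← Real.smul_map_volume_mul_left hs.ne']
    rw [lintegral_smul_measure, show (fun x => s * x) = Homeomorph.mulLeft₀ s hs.ne' from rfl,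
      (Homeomorph.mulLeft₀ s hs.ne').measurableEmbedding.lintegral_map]
    have h : ∀ x, (Set.Ioi (0:ℝ)).indicator (fun t => ENNReal.ofReal (t ^ (a - 1)) *
        ENNReal.ofReal (max (s - t) 0 ^ b)) (Homeomorph.mulLeft₀ s hs.ne' x) =
        ENNReal.ofReal (ProbabilityTheory.beta a (b + 1) * s ^ (a - 1 + b)) *
          ProbabilityTheory.betaPDF a (b + 1) x := fun x => by
      rw [Homeomorph.coe_mulLeft₀]
      rcases le_or_gt x 0 with hx | hx
      · rw [ProbabilityTheory.betaPDF_eq_zero_of_nonpos hx, mul_zero, Set.indicator_of_notMem]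
        exact fun h0 => absurd (show 0 < s * x from h0) (by nlinarith)
      · rw [Set.indicator_of_mem (show s * x ∈ Set.Ioi 0 from Set.mem_Ioi.2 (by positivity))]
        rcases le_or_gt 1 x with hx1 | hx1
        · rw [ProbabilityTheory.betaPDF_eq_zero_of_one_le hx1, mul_zero,
            max_eq_right (by nlinarith), Real.zero_rpow hb.ne', ENNReal.ofReal_zero, mul_zero]
        · rw [ProbabilityTheory.betaPDF_of_pos_lt_one hx hx1, max_eq_left (by nlinarith),
            ← ENNReal.ofReal_mul (by positivity), ← ENNReal.ofReal_mul (by positivity)]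
          congr 1
          have e1 : s - s * x = s * (1 - x) := by ring
          rw [e1, Real.mul_rpow hs.le hx.le, Real.mul_rpow hs.le (by linarith), Real.rpow_add hs,
            add_sub_cancel_right]
          field_simp
    simp_rw [h]
    rw [lintegral_const_mul' _ _ ENNReal.ofReal_ne_top,
      ProbabilityTheory.lintegral_betaPDF_eq_one ha (by linarith), mul_one, abs_of_pos hs,
      smul_eq_mul, ← ENNReal.ofReal_mul hs.le, max_eq_left hs.le]
    congr 1
    have : a + b = 1 + (a - 1 + b) := by ring
    rw [this, Real.rpow_add hs 1, Real.rpow_one]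
    ring

lemma beta_div_beta {γ₀ γ : ℝ} (h₀ : 0 < γ₀) (h : γ₀ < γ) :
    ProbabilityTheory.beta (γ - γ₀) (γ₀ + 1 / 2 + 1) =
      ProbabilityTheory.beta (γ - γ₀) (γ₀ + 1) * (Lcl γ 1 / Lcl γ₀ 1) := by
  simp only [ProbabilityTheory.beta, Lcl, Nat.cast_one]
  have e1 : γ - γ₀ + (γ₀ + 1 / 2 + 1) = γ + 1 / 2 + 1 := by ring
  have e2 : γ - γ₀ + (γ₀ + 1) = γ + 1 := by ring
  rw [e1, e2]
  have g1 := Real.Gamma_pos_of_pos (by linarith : 0 < γ + 1 / 2 + 1)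
  have g2 := Real.Gamma_pos_of_pos (by linarith : 0 < γ + 1)
  have g3 := Real.Gamma_pos_of_pos (by linarith : 0 < γ₀ + 1)
  have g4 := Real.Gamma_pos_of_pos (by linarith : 0 < γ₀ + 1 / 2 + 1)
  have g5 : 0 < Real.pi ^ (1 / 2 : ℝ) := Real.rpow_pos_of_pos Real.pi_pos _
  field_simp

lemma cfc_sub_smul_one {A : Matrix (Fin m) (Fin m) ℂ} (hA : A.IsHermitian) (t : ℝ) :
    cfc (fun r : ℝ => r - t) A = A - t • 1 := by
  have hA' : IsSelfAdjoint A := hA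
  rw [cfc_sub (fun r : ℝ => r) (fun _ => t) A, cfc_id' ℝ A, cfc_const t A,
    Algebra.algebraMap_eq_smul_one]

lemma isHermitian_sub_smul_one {A : Matrix (Fin m) (Fin m) ℂ} (hA : A.IsHermitian) (t : ℝ) :
    (A - t • 1).IsHermitian := by
  rw [← cfc_sub_smul_one hA]
  exact cfc_predicate _ _

lemma trPow_matPos_sub {p : ℝ} (hp : 0 < p) {A : Matrix (Fin m) (Fin m) ℂ} (hA : A.IsHermitian)
    (t : ℝ) : trPow p (matPos (A - t • 1)) = ∑ i, max (hA.eigenvalues i - t) 0 ^ p := by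
  have hA' : IsSelfAdjoint A := hA
  have hc : Continuous fun r : ℝ => max r 0 ^ p :=
    (continuous_id.max continuous_const).rpow_const fun _ => Or.inr hp.le
  rw [trPow, trFun_matPos hc (isHermitian_sub_smul_one hA t), ← cfc_sub_smul_one hA, trFun,
    ← cfc_comp' (fun t => max (max t 0) 0 ^ p) (fun r => r - t) A
      (Continuous.continuousOn (by simpa using hc))]
  change trFun _ A = _
  rw [trFun_eq_sum _ hA]
  simp

lemma qform_matPos_sub_ge {A : Matrix (Fin m) (Fin m) ℂ} (hA : A.IsHermitian) (t : ℝ)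
    (v : Fin m → ℂ) : qform A v - t * vsq v ≤ qform (matPos (A - t • 1)) v := by
  have h := qform_nonneg (matPos_sub_posSemidef (isHermitian_sub_smul_one hA t)) v
  rw [qform_sub, qform_sub] at h
  have : qform (t • (1 : Matrix (Fin m) (Fin m) ℂ)) v = t * vsq v := by
    rw [qform, Matrix.smul_mulVec, Matrix.one_mulVec, vsq_eq_re]
    simp
  linarith

lemma IsFlag.subtype {ι X : Type*} [Fintype ι] {q ms : (X → Fin m → ℂ) → ℝ}
    {u : ι → X → Fin m → ℂ} {E : ι → ℝ} (h : IsFlag q ms u E) (t : ℝ) :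
    IsFlag q ms (fun i : {i // t < E i} => u i) (fun i => E i) := by
  intro i c hc hcj
  let c' : ι → ℂ := fun j => if h : t < E j then c ⟨j, h⟩ else 0
  have e : comb c (fun i : {i // t < E i} => u i) = comb c' u := by
    funext x
    simp only [comb]
    rw [← Finset.sum_filter_of_ne (p := fun j => t < E j) (fun j _ hj => by
      by_contra h'
      exact hj (by simp [c', h'])), Finset.sum_subtype (p := fun j => t < E j) _ (by simp)]
    exact Finset.sum_congr rfl fun j _ => by simp [c', j.2]
  rw [e]
  refine h i c' (fun h0 => hc ?_) fun j hj => ?_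
  · ext j
    have := congrFun h0 j
    simpa [c', j.2] using this
  · by_cases h' : t < E j
    · simp only [c', h', dif_pos]
      exact hcj ⟨j, h'⟩ hj
    · simp [c', h']

lemma IsFlag.mono {ι X : Type*} [Fintype ι] {q q' ms : (X → Fin m → ℂ) → ℝ}
    {u : ι → X → Fin m → ℂ} {E : ι → ℝ} (h : IsFlag q ms u E) (t : ℝ)
    (hq : ∀ c, q' (comb c u) ≤ q (comb c u) + t * ms (comb c u)) :
    IsFlag q' ms u (fun i => E i - t) := by
  intro i c hc hcj
  have h1 := h i c hc fun j hj => hcj j (by linarith)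
  have h2 := hq c
  simp only
  linarith

lemma continuous_comb {ι : Type*} [Fintype ι] {u : ι → ℝ → Fin m → ℂ} (hu : ∀ i, Continuous (u i))
    (c : ι → ℂ) : Continuous (comb c u) := by
  unfold comb
  fun_prop

lemma hasCompactSupport_comb {ι X : Type*} [TopologicalSpace X] [R1Space X] [Fintype ι]
    {u : ι → X → Fin m → ℂ} (hu : ∀ i, HasCompactSupport (u i)) (c : ι → ℂ) :
    HasCompactSupport (comb c u) := by
  refine HasCompactSupport.intro (isCompact_iUnion hu) fun x hx => ?_
  refine Finset.sum_eq_zero fun j _ => ?_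
  rw [image_eq_zero_of_notMem_tsupport fun h => hx (Set.mem_iUnion.2 ⟨j, h⟩), smul_zero]

lemma trPow_zero {p : ℝ} (hp : 0 < p) : trPow p (0 : Matrix (Fin m) (Fin m) ℂ) = 0 := by
  rw [trPow, trFun, cfc_apply_zero, max_self, Real.zero_rpow hp.ne', map_zero, Matrix.trace_zero,
    Complex.zero_re]

lemma continuous_max_rpow {p : ℝ} (hp : 0 ≤ p) : Continuous fun r : ℝ => max r 0 ^ p :=
  (continuous_id.max continuous_const).rpow_const fun _ => Or.inr hp

lemma integrable_trPow {X : Type*} [TopologicalSpace X] [MeasurableSpace X] [BorelSpace X]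
    [R1Space X] {μ : Measure X} [IsFiniteMeasureOnCompacts μ]
    {p : ℝ} (hp : 0 < p) {W : X → Matrix (Fin m) (Fin m) ℂ} (hW : Continuous W)
    (hH : ∀ x, (W x).IsHermitian) (hs : HasCompactSupport W) :
    Integrable (fun x => trPow p (W x)) μ :=
  (continuous_trFun (continuous_max_rpow hp.le) hW hH).integrable_of_hasCompactSupport
    (hs.comp_left (g := trPow p) (trPow_zero hp))

lemma hasCompactSupport_matPos_sub {W : ℝ → Matrix (Fin m) (Fin m) ℂ} (hs : HasCompactSupport W)
    {t : ℝ} (ht : 0 ≤ t) : HasCompactSupport fun x => matPos (W x - t • 1) := by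
  refine hs.mono fun x hx h0 => hx ?_
  refine matPos_eq_zero ?_
  rw [h0, zero_sub, neg_neg]
  have h1 : (1 : Matrix (Fin m) (Fin m) ℂ).PosSemidef := Matrix.PosSemidef.one
  exact h1.smul ht

lemma form1_matPos_sub_le {W : ℝ → Matrix (Fin m) (Fin m) ℂ} (hW : Continuous W)
    (hH : ∀ x, (W x).IsHermitian) (t : ℝ) {w : ℝ → Fin m → ℂ} (hw : Continuous w)
    (hws : HasCompactSupport w) :
    form1 (fun x => matPos (W x - t • 1)) w ≤ form1 W w + t * mass w := by
  have hc : Continuous fun x => matPos (W x - t • 1) :=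
    continuous_cfc_matrix (by fun_prop) (by fun_prop) fun z => isHermitian_sub_smul_one (hH z) t
  have i1 : Integrable fun x => vsq (w x) := Continuous.integrable_of_hasCompactSupport
    (by fun_prop) (hws.mono fun x hx h0 => hx (by simp [h0]))
  have i2 : ∀ {V : ℝ → Matrix (Fin m) (Fin m) ℂ}, Continuous V →
      Integrable fun x => qform (V x) (w x) := fun {V} hV =>
    Continuous.integrable_of_hasCompactSupport (by fun_prop)
      (hws.mono fun x hx h0 => hx (by simp [h0]))
  have : (∫ x, qform (W x) (w x)) - t * ∫ x, vsq (w x) ≤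
      ∫ x, qform (matPos (W x - t • 1)) (w x) := by
    rw [← integral_const_mul, ← integral_sub (i2 hW) (i1.const_mul _)]
    exact integral_mono ((i2 hW).sub (i1.const_mul _)) (i2 hc)
      fun x => qform_matPos_sub_ge (hH x) t _
  simp only [form1, mass]
  linarith

/-- The lifting of Lieb–Thirring bounds to higher moments. -/
theorem LT1'.lift {γ₀ γ C : ℝ} (h₀ : 0 < γ₀) (hC : 0 ≤ C) (h : LT1' γ₀ C) (hγ : γ₀ < γ) :
    LT1' γ (C * (Lcl γ 1 / Lcl γ₀ 1)) := by
  intro m W hW hpos hsupp ι _ u E hE hu hus hflag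
  have hp : 0 < γ₀ + 1 / 2 := by linarith
  have ha : 0 < γ - γ₀ := by linarith
  let Wt : ℝ → ℝ → Matrix (Fin m) (Fin m) ℂ := fun t x => matPos (W x - t • 1)
  have hWtc2 : Continuous fun z : ℝ × ℝ => Wt z.1 z.2 :=
    continuous_cfc_matrix (by fun_prop) (by fun_prop)
      fun z => isHermitian_sub_smul_one (hpos z.2).1 z.1
  have hWtc : ∀ t, Continuous (Wt t) := fun t => hWtc2.comp (by fun_prop : Continuous fun x => (t, x))
  have hWtp : ∀ t x, (Wt t x).PosSemidef := fun t x =>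
    matPos_posSemidef (isHermitian_sub_smul_one (hpos x).1 t)
  have hWts : ∀ t, 0 < t → HasCompactSupport (Wt t) := fun t ht =>
    hasCompactSupport_matPos_sub hsupp ht.le
  have h_int : ∀ t, 0 < t → Integrable fun x => trPow (γ₀ + 1 / 2) (Wt t x) := fun t ht =>
    integrable_trPow hp (hWtc t) (fun x => (hWtp t x).1) (hWts t ht)
  have hstep : ∀ t, 0 < t → ∑ i, max (E i - t) 0 ^ γ₀ ≤ C * ∫ x, trPow (γ₀ + 1 / 2) (Wt t x) :=
    fun t ht => by
      classical
      have hfl : IsFlag (form1 (Wt t)) mass (fun i : {i // t < E i} => u i) (fun i => E i - t) := by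
        exact (hflag.subtype t).mono t fun c => form1_matPos_sub_le hW (fun x => (hpos x).1) t
          (continuous_comb (fun i : {i // t < E i} => (hu i).continuous) c)
          (hasCompactSupport_comb (fun i : {i // t < E i} => hus i) c)
      refine le_trans (le_of_eq ?_) (h m (Wt t) (hWtc t) (hWtp t) (hWts t ht) {i // t < E i}
        (fun i => u i) (fun i => E i - t) (fun i => sub_pos.2 i.2) (fun i => hu i) (fun i => hus i)
        hfl)
      rw [← Finset.sum_filter_add_sum_filter_not Finset.univ (fun i => t < E i),
        Finset.sum_eq_zero (s := Finset.univ.filter fun i => ¬ t < E i) fun i hi => ?_, add_zero,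
        Finset.sum_subtype (p := fun i => t < E i) _ (by simp)]
      · exact Finset.sum_congr rfl fun i _ => by rw [max_eq_left (sub_pos.2 i.2).le]
      · rw [max_eq_right (by simpa using hi), Real.zero_rpow h₀.ne']
  have hB := ProbabilityTheory.beta_pos ha (by linarith : 0 < γ₀ + 1)
  have hintW : Integrable fun x => trPow (γ + 1 / 2) (W x) :=
    integrable_trPow (by linarith) hW (fun x => (hpos x).1) hsupp
  have hL : ENNReal.ofReal (ProbabilityTheory.beta (γ - γ₀) (γ₀ + 1) * ∑ i, E i ^ γ) =
      ∫⁻ t in Set.Ioi (0:ℝ), ENNReal.ofReal (t ^ (γ - γ₀ - 1)) *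
        ENNReal.ofReal (∑ i, max (E i - t) 0 ^ γ₀) := by
    simp_rw [ENNReal.ofReal_sum_of_nonneg fun i _ => Real.rpow_nonneg (le_max_right _ _) γ₀,
      Finset.mul_sum]
    rw [lintegral_finsetSum' _ fun i _ => by fun_prop, ENNReal.ofReal_sum_of_nonneg fun i _ =>
      mul_nonneg hB.le (Real.rpow_nonneg (hE i).le _)]
    refine Finset.sum_congr rfl fun i _ => ?_
    rw [lintegral_rpow_mul_rpow ha h₀, max_eq_left (hE i).le, sub_add_cancel]
  have hR : ∫⁻ t in Set.Ioi (0:ℝ), ENNReal.ofReal (t ^ (γ - γ₀ - 1)) *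
      ENNReal.ofReal (∫ x, trPow (γ₀ + 1 / 2) (Wt t x)) =
      ENNReal.ofReal (ProbabilityTheory.beta (γ - γ₀) (γ₀ + 1 / 2 + 1) *
        ∫ x, trPow (γ + 1 / 2) (W x)) := by
    calc _ = ∫⁻ t in Set.Ioi (0:ℝ), ∫⁻ x, ENNReal.ofReal (t ^ (γ - γ₀ - 1)) *
          ENNReal.ofReal (trPow (γ₀ + 1 / 2) (Wt t x)) := by
          refine setLIntegral_congr_fun measurableSet_Ioi fun t ht => ?_
          rw [ofReal_integral_eq_lintegral_ofReal (h_int t ht) (Filter.Eventually.of_forall fun x =>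
            trPow_nonneg _ (hWtp t x).1), lintegral_const_mul' _ _ ENNReal.ofReal_ne_top]
      _ = ∫⁻ x, ∫⁻ t in Set.Ioi (0:ℝ), ENNReal.ofReal (t ^ (γ - γ₀ - 1)) *
          ENNReal.ofReal (trPow (γ₀ + 1 / 2) (Wt t x)) := by
          refine lintegral_lintegral_swap (Measurable.aemeasurable ?_)
          have hm : Continuous fun z : ℝ × ℝ => trPow (γ₀ + 1 / 2) (Wt z.1 z.2) :=
            continuous_trFun (continuous_max_rpow hp.le) hWtc2 fun z => (hWtp z.1 z.2).1
          exact (by fun_prop : Measurable fun z : ℝ × ℝ =>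
            ENNReal.ofReal (z.1 ^ (γ - γ₀ - 1))).mul hm.measurable.ennreal_ofReal
      _ = ∫⁻ x, ENNReal.ofReal (ProbabilityTheory.beta (γ - γ₀) (γ₀ + 1 / 2 + 1) *
          trPow (γ + 1 / 2) (W x)) := by
          refine lintegral_congr fun x => ?_
          simp only [Wt, trPow_matPos_sub hp (hpos x).1]
          simp_rw [ENNReal.ofReal_sum_of_nonneg fun i _ =>
            Real.rpow_nonneg (le_max_right _ _) (γ₀ + 1 / 2), Finset.mul_sum]
          rw [lintegral_finsetSum' _ fun i _ => by fun_prop, trPow_eq_sum _ (hpos x).1,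
            Finset.mul_sum, ENNReal.ofReal_sum_of_nonneg fun i _ => mul_nonneg
              (ProbabilityTheory.beta_pos ha (by linarith)).le
              (Real.rpow_nonneg (le_max_right _ _) _)]
          refine Finset.sum_congr rfl fun i _ => ?_
          rw [lintegral_rpow_mul_rpow ha hp]
          rw [show γ - γ₀ + (γ₀ + 1 / 2) = γ + 1 / 2 by ring]
      _ = _ := by
          rw [← integral_const_mul, ofReal_integral_eq_lintegral_ofReal (hintW.const_mul _)
            (Filter.Eventually.of_forall fun x => mul_nonneg
              (ProbabilityTheory.beta_pos ha (by linarith)).le (trPow_nonneg _ (hpos x).1))]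
  have hfin : ENNReal.ofReal (ProbabilityTheory.beta (γ - γ₀) (γ₀ + 1) * ∑ i, E i ^ γ) ≤
      ENNReal.ofReal C * ENNReal.ofReal (ProbabilityTheory.beta (γ - γ₀) (γ₀ + 1 / 2 + 1) *
        ∫ x, trPow (γ + 1 / 2) (W x)) := by
    rw [hL, ← hR, ← lintegral_const_mul' _ _ ENNReal.ofReal_ne_top]
    refine setLIntegral_mono' measurableSet_Ioi fun t ht => ?_
    rw [mul_left_comm, ← ENNReal.ofReal_mul hC]
    gcongr
    exact hstep t ht
  rw [← ENNReal.ofReal_mul hC, ENNReal.ofReal_le_ofReal_iff (mul_nonneg hC (mul_nonneg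
    (ProbabilityTheory.beta_pos ha (by linarith)).le
    (integral_nonneg fun x => trPow_nonneg _ (hpos x).1))), beta_div_beta h₀ hγ] at hfin
  refine le_of_mul_le_mul_left (hfin.trans (le_of_eq ?_)) hB
  ring

end AizenmanLieb

section ODE

variable {E : Type*} [NormedAddCommGroup E] [NormedSpace ℝ E]

/-- The radial retraction onto the unit ball. -/
noncomputable def ballRetraction (y : E) : E := (max 1 ‖y‖)⁻¹ • y

lemma norm_ballRetraction_le (y : E) : ‖ballRetraction y‖ ≤ 1 := by
  have h1 : 0 < max 1 ‖y‖ := lt_max_of_lt_left one_pos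
  rw [ballRetraction, norm_smul, norm_inv, Real.norm_of_nonneg h1.le, inv_mul_le_iff₀ h1, mul_one]
  exact le_max_right _ _

lemma norm_ballRetraction_sub_le (x y : E) :
    ‖ballRetraction x - ballRetraction y‖ ≤ 2 * ‖x - y‖ := by
  set p := max 1 ‖x‖ with hp
  set q := max 1 ‖y‖ with hq
  have hp0 : 1 ≤ p := le_max_left _ _
  have hq0 : 1 ≤ q := le_max_left _ _
  have hqy : ‖y‖ ≤ q := le_max_right _ _
  have h1 : ballRetraction x - ballRetraction y = p⁻¹ • (x - y) + (p⁻¹ - q⁻¹) • y := by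
    simp only [ballRetraction, ← hp, ← hq, smul_sub, sub_smul]; abel
  have h2 : ‖p⁻¹ • (x - y)‖ ≤ ‖x - y‖ := by
    rw [norm_smul, norm_inv, Real.norm_of_nonneg (by linarith)]
    exact mul_le_of_le_one_left (norm_nonneg _) (inv_le_one_of_one_le₀ hp0)
  have h4 : |q - p| ≤ ‖x - y‖ := by
    rw [hp, hq, max_comm 1 ‖y‖, max_comm 1 ‖x‖]
    refine (abs_max_sub_max_le_abs _ _ _).trans ?_
    rw [abs_sub_comm]; exact abs_norm_sub_norm_le _ _
  have h3 : ‖(p⁻¹ - q⁻¹) • y‖ ≤ ‖x - y‖ := by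
    rw [norm_smul, inv_sub_inv (by linarith) (by linarith), Real.norm_eq_abs, abs_div,
      abs_of_pos (by positivity : 0 < p * q), div_mul_eq_mul_div, div_le_iff₀ (by positivity)]
    calc |q - p| * ‖y‖ ≤ ‖x - y‖ * q := mul_le_mul h4 hqy (norm_nonneg _) (norm_nonneg _)
      _ ≤ ‖x - y‖ * (p * q) := by
        refine mul_le_mul_of_nonneg_left ?_ (norm_nonneg _)
        nlinarith
  rw [h1]
  linarith [norm_add_le (p⁻¹ • (x - y)) ((p⁻¹ - q⁻¹) • y)]

lemma exists_hasDerivWithinAt_ballRetraction [CompleteSpace E] {B : ℝ → E →ₗ[ℝ] E} {L M : ℝ}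
    (hL : 0 ≤ L) (hM : 0 ≤ M) (hB : ∀ t ∈ Set.Icc (-L) L, ∀ y, ‖B t y‖ ≤ M * ‖y‖)
    (hBc : ∀ y, Continuous fun t => B t y) (x₀ : E) :
    ∃ α : ℝ → E, α 0 = x₀ ∧ ∀ t ∈ Set.Icc (-L) L,
      HasDerivWithinAt α (B t (ballRetraction (α t))) (Set.Icc (-L) L) t := by
  have h : IsPicardLindelof (fun t y => B t (ballRetraction y)) (tmin := -L) (tmax := L)
      ⟨0, by simp [hL]⟩ x₀ (M * L).toNNReal 0 M.toNNReal (2 * M).toNNReal := by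
    refine ⟨fun t ht => LipschitzWith.lipschitzOnWith (LipschitzWith.of_dist_le_mul fun x y => ?_),
      fun x _ => (hBc _).continuousOn, fun t ht x _ => ?_, ?_⟩
    · rw [dist_eq_norm, dist_eq_norm, ← map_sub, Real.coe_toNNReal _ (by positivity)]
      refine (hB t ht _).trans ?_
      have := mul_le_mul_of_nonneg_left (norm_ballRetraction_sub_le x y) hM
      linarith
    · rw [Real.coe_toNNReal _ hM]
      exact (hB t ht _).trans (mul_le_of_le_one_right hM (norm_ballRetraction_le _))
    · rw [Real.coe_toNNReal _ hM, Real.coe_toNNReal _ (by positivity)]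
      simp
  exact h.exists_eq_forall_mem_Icc_hasDerivWithinAt₀

end ODE

section Gauge

variable {m : ℕ}

lemma vsq_eq_one_of_ode {A : ℝ → Matrix (Fin m) (Fin m) ℂ} (hH : ∀ x, (A x).IsHermitian) {L : ℝ}
    (hL : 0 ≤ L) {y z : ℝ → Fin m → ℂ} {h : ℝ → ℝ}
    (hy : ∀ t ∈ Set.Icc (-L) L, HasDerivWithinAt y (h t • Complex.I • (A t *ᵥ y t)) (Set.Icc (-L) L) t)
    (hz : ∀ t ∈ Set.Icc (-L) L, HasDerivWithinAt z (h t • Complex.I • (A t *ᵥ z t)) (Set.Icc (-L) L) t)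
    {t : ℝ} (ht : t ∈ Set.Icc (-L) L) : star (y t) ⬝ᵥ z t = star (y 0) ⬝ᵥ z 0 := by
  have hd : ∀ t ∈ Set.Icc (-L) L,
      HasDerivWithinAt (fun t => star (y t) ⬝ᵥ z t) 0 (Set.Icc (-L) L) t := fun t ht => by
    have h1 := hy t ht
    have h2 := hz t ht
    have h3 : star (h t • Complex.I • (A t *ᵥ y t)) ⬝ᵥ z t
        + star (y t) ⬝ᵥ (h t • Complex.I • (A t *ᵥ z t)) = 0 := by
      have h4 : star (A t *ᵥ y t) ⬝ᵥ z t = star (y t) ⬝ᵥ (A t *ᵥ z t) := by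
        rw [star_mulVec, (hH t).eq, dotProduct_mulVec]
      simp only [star_smul, smul_dotProduct, dotProduct_smul, h4]
      simp
    rw [hasDerivWithinAt_pi] at h1 h2
    rw [← h3]
    simp only [dotProduct, ← Finset.sum_add_distrib, Pi.star_apply]
    exact HasDerivWithinAt.fun_sum fun i _ => ((h1 i).star.mul (h2 i))
  have hI : Convex ℝ (Set.Icc (-L) L) := convex_Icc _ _
  have := hI.norm_image_sub_le_of_norm_hasDerivWithin_le (C := 0) hd (fun x _ => by simp)
    (show (0 : ℝ) ∈ Set.Icc (-L) L by simp [hL]) ht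
  rw [zero_mul] at this
  exact sub_eq_zero.1 (norm_le_zero_iff.1 this)

lemma norm_le_one_of_vsq {v : Fin m → ℂ} (h : vsq v = 1) : ‖v‖ ≤ 1 := by
  refine (pi_norm_le_iff_of_nonneg zero_le_one).2 fun i => ?_
  have h1 : Complex.normSq (v i) ≤ 1 := by
    rw [← h]
    exact Finset.single_le_sum (f := fun i => Complex.normSq (v i))
      (fun _ _ => Complex.normSq_nonneg _) (Finset.mem_univ i)
  rw [Complex.normSq_eq_norm_sq] at h1
  exact abs_le_one_iff_mul_self_le_one.2 (by nlinarith) |> (le_abs_self _).trans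

/-- Parallel transport for a continuous Hermitian gauge field. -/
lemma exists_unitary_transport {A : ℝ → Matrix (Fin m) (Fin m) ℂ} (hA : Continuous A)
    (hH : ∀ x, (A x).IsHermitian) {L : ℝ} (hL : 0 ≤ L) :
    ∃ U : ℝ → Matrix (Fin m) (Fin m) ℂ, (∀ t ∈ Set.Icc (-L) L, (U t)ᴴ * U t = 1) ∧
      ∀ t ∈ Set.Icc (-L) L, ∀ i j,
        HasDerivWithinAt (fun t => U t i j) (Complex.I * (A t * U t) i j) (Set.Icc (-L) L) t := by
  let : NormedAddCommGroup (Matrix (Fin m) (Fin m) ℂ) := Matrix.linftyOpNormedAddCommGroup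
  obtain ⟨M, hM⟩ := isCompact_Icc.exists_bound_of_continuousOn (hA.continuousOn (s := Set.Icc (-L) L))
  have hM0 : 0 ≤ M := (norm_nonneg _).trans (hM 0 (by simp [hL]))
  let B : ℝ → (Fin m → ℂ) →ₗ[ℝ] (Fin m → ℂ) := fun t =>
    { toFun := fun y => Complex.I • (A t *ᵥ y)
      map_add' := fun y z => by simp [mulVec_add]
      map_smul' := fun c y => by
        simp only [mulVec_smul, RingHom.id_apply]; rw [smul_comm] }
  have hex := fun j : Fin m => exists_hasDerivWithinAt_ballRetraction (B := B) hL hM0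
    (fun t ht y => by
      simp only [B, LinearMap.coe_mk, AddHom.coe_mk, norm_smul, Complex.norm_I, one_mul]
      exact (linfty_opNorm_mulVec _ _).trans (mul_le_mul_of_nonneg_right (hM t ht) (norm_nonneg _)))
    (fun y => by
      simp only [B, LinearMap.coe_mk, AddHom.coe_mk]; fun_prop) (Pi.single j 1)
  choose y hy0 hy using hex
  have hy1 : ∀ j, ∀ t ∈ Set.Icc (-L) L, HasDerivWithinAt (y j)
      ((max 1 ‖y j t‖)⁻¹ • Complex.I • (A t *ᵥ y j t)) (Set.Icc (-L) L) t := fun j t ht => by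
    refine (hy j t ht).congr_deriv ?_
    simp only [ballRetraction, map_smul]; rfl
  have hn : ∀ j, ∀ t ∈ Set.Icc (-L) L, ‖y j t‖ ≤ 1 := fun j t ht => by
    refine norm_le_one_of_vsq ?_
    have := vsq_eq_one_of_ode hH hL (hy1 j) (hy1 j) ht
    rw [dotProduct_self_eq, hy0] at this
    have h2 : star (Pi.single j 1 : Fin m → ℂ) ⬝ᵥ Pi.single j 1 = 1 := by simp
    rw [h2] at this
    exact_mod_cast this
  have hy2 : ∀ j, ∀ t ∈ Set.Icc (-L) L, HasDerivWithinAt (y j)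
      ((1 : ℝ) • Complex.I • (A t *ᵥ y j t)) (Set.Icc (-L) L) t := fun j t ht => by
    refine (hy1 j t ht).congr_deriv ?_
    rw [max_eq_left (hn j t ht), inv_one]
  refine ⟨fun t => of fun i j => y j t i, fun t ht => ?_, fun t ht i j => ?_⟩
  · ext i j
    have := vsq_eq_one_of_ode hH hL (h := fun _ => 1) (hy2 i) (hy2 j) ht
    rw [hy0, hy0] at this
    rw [mul_apply]
    simp only [conjTranspose_apply, of_apply]
    rw [dotProduct] at this
    simp only [Pi.star_apply] at this
    rw [this]
    simp [one_apply, Pi.single_apply, eq_comm]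
  · have := hasDerivWithinAt_pi.1 (hy2 j t ht) i
    refine this.congr_deriv ?_
    simp [mul_apply, mulVec, dotProduct]

end Gauge

section GaugeRemoval

variable {m : ℕ}

/-- The form of the operator `(i d/dx + A)² - W` on the line with a matrix-valued gauge field. -/
noncomputable def gaugeForm (A W : ℝ → Matrix (Fin m) (Fin m) ℂ) (u : ℝ → Fin m → ℂ) : ℝ :=
  (∫ x, vsq (Complex.I • deriv u x + A x *ᵥ u x)) - ∫ x, qform (W x) (u x)

/-- The one-dimensional Lieb–Thirring bound with exponent `γ` and constant `C` for
matrix-valued potentials and gauge fields. -/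
def LT1 (γ C : ℝ) : Prop :=
  ∀ (m : ℕ) (A W : ℝ → Matrix (Fin m) (Fin m) ℂ), Continuous A → (∀ x, (A x).IsHermitian) →
    Continuous W → (∀ x, (W x).PosSemidef) →
    HasCompactSupport W → ∀ (ι : Type) [Fintype ι] (u : ι → ℝ → Fin m → ℂ) (E : ι → ℝ),
    (∀ i, 0 < E i) → (∀ i, ContDiff ℝ 1 (u i)) → (∀ i, HasCompactSupport (u i)) →
    IsFlag (gaugeForm A W) mass u E → ∑ i, E i ^ γ ≤ C * ∫ x, trPow (γ + 1 / 2) (W x)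

lemma vsq_mulVec_of_unitary {U : Matrix (Fin m) (Fin m) ℂ} (hU : Uᴴ * U = 1) (v : Fin m → ℂ) :
    vsq (U *ᵥ v) = vsq v := by
  rw [vsq_eq_re, vsq_eq_re, star_mulVec, dotProduct_mulVec, vecMul_vecMul, hU, vecMul_one]

lemma qform_conj (W U : Matrix (Fin m) (Fin m) ℂ) (v : Fin m → ℂ) :
    qform (Uᴴ * W * U) v = qform W (U *ᵥ v) := by
  rw [qform, qform, star_mulVec, ← mulVec_mulVec, ← mulVec_mulVec, dotProduct_mulVec]

lemma exists_unitary_extension {A : ℝ → Matrix (Fin m) (Fin m) ℂ} (hA : Continuous A)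
    (hH : ∀ x, (A x).IsHermitian) {L : ℝ} (hL : 0 ≤ L) :
    ∃ U : ℝ → Matrix (Fin m) (Fin m) ℂ, Continuous U ∧ (∀ t, (U t)ᴴ * U t = 1) ∧
      ∀ t, |t| < L → ∀ i j, HasDerivAt (fun t => U t i j) (Complex.I * (A t * U t) i j) t := by
  obtain ⟨U, hU, hUd⟩ := exists_unitary_transport hA hH hL
  have hle : -L ≤ L := by linarith
  have hin : ∀ t, |t| < L → ((Set.projIcc (-L) L hle t : Set.Icc (-L) L) : ℝ) = t := fun t ht => by
    rw [Set.projIcc_of_mem hle ⟨(abs_le.1 ht.le).1, (abs_le.1 ht.le).2⟩]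
  refine ⟨fun t => U (Set.projIcc (-L) L hle t), ?_, fun t => hU _ (Subtype.mem _),
    fun t ht i j => ?_⟩
  · refine ContinuousOn.comp_continuous (s := Set.Icc (-L) L) ?_
      (continuous_subtype_val.comp continuous_projIcc) (fun t => Subtype.mem _)
    exact continuousOn_pi.2 fun i => continuousOn_pi.2 fun j t ht => (hUd t ht i j).continuousWithinAt
  · have h1 := (hUd t ⟨(abs_le.1 ht.le).1, (abs_le.1 ht.le).2⟩ i j).hasDerivAt
      (Icc_mem_nhds (abs_lt.1 ht).1 (abs_lt.1 ht).2)
    show HasDerivAt (fun t => U (Set.projIcc (-L) L hle t) i j)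
      (Complex.I * (A t * U (Set.projIcc (-L) L hle t)) i j) t
    rw [hin t ht]
    refine h1.congr_of_eventuallyEq ?_
    filter_upwards [(isOpen_lt continuous_abs continuous_const).mem_nhds ht] with s hs
    rw [hin s hs]

lemma hasDerivAt_conjTranspose_mulVec {A U : ℝ → Matrix (Fin m) (Fin m) ℂ}
    (hH : ∀ x, (A x).IsHermitian) {x : ℝ}
    (hU : ∀ i j, HasDerivAt (fun t => U t i j) (Complex.I * (A x * U x) i j) x)
    {u : ℝ → Fin m → ℂ} {u' : Fin m → ℂ} (hu : HasDerivAt u u' x) :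
    HasDerivAt (fun t => (U t)ᴴ *ᵥ u t)
      ((U x)ᴴ *ᵥ ((-Complex.I) • (Complex.I • u' + A x *ᵥ u x))) x := by
  rw [hasDerivAt_pi] at hu ⊢
  intro i
  have h1 : HasDerivAt (fun t => ∑ j, star (U t j i) * u t j)
      (∑ j, (star (Complex.I * (A x * U x) j i) * u x j + star (U x j i) * u' j)) x :=
    HasDerivAt.fun_sum fun j _ => (hU j i).star.mul (hu j)
  refine h1.congr_deriv ?_
  have h2 : (U x)ᴴ *ᵥ ((-Complex.I) • (Complex.I • u' + A x *ᵥ u x))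
      = (-Complex.I) • ((A x * U x)ᴴ *ᵥ u x) + (U x)ᴴ *ᵥ u' := by
    rw [smul_add, smul_smul, mulVec_add, conjTranspose_mul, (hH x).eq, mulVec_smul, mulVec_smul, mulVec_mulVec]
    simp [add_comm]
  rw [h2]
  simp only [Pi.add_apply, Pi.smul_apply, mulVec, dotProduct, conjTranspose_apply, smul_eq_mul,
    Finset.mul_sum, Finset.sum_add_distrib, star_mul']
  congr 1
  refine Finset.sum_congr rfl fun j _ => ?_
  simp [mul_assoc]

/-- In one dimension a gauge field can be removed by a unitary transformation. -/
theorem LT1'.gauge {γ C : ℝ} (hγ : 0 ≤ γ) (h : LT1' γ C) : LT1 γ C := by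
  intro m A W hA hH hW hpos hs ι _ u E hE hu hus hflag
  obtain ⟨R₁, hR₁, hR₁u⟩ := exists_pos_abs_ge_eq_zero hus
  obtain ⟨U, hUc, hU, hUd⟩ := exists_unitary_extension hA hH (L := R₁ + 1) (by linarith)
  have hU' : ∀ t, U t * (U t)ᴴ = 1 := fun t => mul_eq_one_comm.1 (hU t)
  have hUU : ∀ t, ((U t)ᴴ)ᴴ * (U t)ᴴ = 1 := fun t => by rw [conjTranspose_conjTranspose, hU']
  have hd : ∀ (w : ℝ → Fin m → ℂ), ContDiff ℝ 1 w → (∀ x, R₁ ≤ |x| → w x = 0) → ∀ x,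
      HasDerivAt (fun t => (U t)ᴴ *ᵥ w t)
        ((U x)ᴴ *ᵥ ((-Complex.I) • (Complex.I • deriv w x + A x *ᵥ w x))) x := fun w hw hwR x => by
    rcases lt_or_ge |x| (R₁ + 1) with hx | hx
    · exact hasDerivAt_conjTranspose_mulVec hH (hUd x hx)
        (hw.differentiable one_ne_zero x).hasDerivAt
    · have h0 : (fun t => (U t)ᴴ *ᵥ w t) =ᶠ[nhds x] fun _ => 0 := by
        filter_upwards [(isOpen_lt continuous_const continuous_abs).mem_nhds
          (show R₁ < |x| by linarith)] with t ht
        rw [hwR t (le_of_lt ht), mulVec_zero]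
      rw [hwR x (by linarith), deriv_eq_zero_of_abs_ge hwR hw (by linarith)]
      simp only [smul_zero, mulVec_zero, add_zero]
      exact (hasDerivAt_const x _).congr_of_eventuallyEq h0
  have hcd : ∀ (w : ℝ → Fin m → ℂ), ContDiff ℝ 1 w → (∀ x, R₁ ≤ |x| → w x = 0) →
      ContDiff ℝ 1 (fun t => (U t)ᴴ *ᵥ w t) := fun w hw hwR => by
    rw [contDiff_one_iff_deriv]
    refine ⟨fun x => (hd w hw hwR x).differentiableAt, ?_⟩
    rw [funext fun x => (hd w hw hwR x).deriv]
    have := hw.continuous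
    have := hw.continuous_deriv le_rfl
    fun_prop
  have hmain := h m (fun x => (U x)ᴴ * W x * U x) (by fun_prop)
    (fun x => (hpos x).conjTranspose_mul_mul_same _) (hs.mono fun x hx h0 => hx (by simp [h0])) ι
    (fun i x => (U x)ᴴ *ᵥ u i x) E hE (fun i => hcd _ (hu i) (hR₁u i))
    (fun i => (hus i).mono fun x hx h0 => hx (by simp [h0])) ?_
  · refine hmain.trans_eq ?_
    congr 1
    refine integral_congr_ae (Filter.Eventually.of_forall fun x => ?_)
    exact trFun_unitary_conj (continuous_max_rpow (by linarith)) (hpos x).1 (hU x)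
  · intro i c hc hcj
    have h1 := hflag i c hc hcj
    have hcomb : comb c (fun i x => (U x)ᴴ *ᵥ u i x) = fun x => (U x)ᴴ *ᵥ comb c u x := by
      funext x
      simp only [comb, mulVec_sum, mulVec_smul]
    have hw : ContDiff ℝ 1 (comb c u) :=
      by
      have h3 : ∀ j, ContDiff ℝ 1 fun x => c j • u j x := fun j => (hu j).const_smul (c j)
      exact ContDiff.sum fun j _ => h3 j
    have hwR : ∀ x, R₁ ≤ |x| → comb c u x = 0 := fun x hx => by
      simp [comb, hR₁u _ x hx]
    have hm : mass (fun x => (U x)ᴴ *ᵥ comb c u x) = mass (comb c u) := by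
      simp only [mass, vsq_mulVec_of_unitary (hUU _)]
    have hq : form1 (fun x => (U x)ᴴ * W x * U x) (fun x => (U x)ᴴ *ᵥ comb c u x)
        = gaugeForm A W (comb c u) := by
      simp only [form1, gaugeForm, qform_conj, mulVec_mulVec, hU', one_mulVec,
        (hd _ hw hwR _).deriv, vsq_mulVec_of_unitary (hUU _), vsq_smul]
      simp
    rw [hcomb, hm, hq]
    exact h1

end GaugeRemoval

section MagneticForm

variable {X : Type} [NormedAddCommGroup X] [NormedSpace ℝ X] [MeasureSpace X]
  {d m : ℕ}

/-- The energy density `∑ₖ |(i ∂_{e k} + a k) φ|² + ε |φ|² - ⟨φ, V φ⟩` as a function of the value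
`j.1` of `φ` and its directional derivatives `j.2`. -/
noncomputable def jetDensity (a : Fin d → X → ℝ) (V : X → Matrix (Fin m) (Fin m) ℂ) (ε : ℝ)
    (x : X) (j : (Fin m → ℂ) × (Fin d → Fin m → ℂ)) : ℝ :=
  ∑ k, vsq (Complex.I • j.2 k + (a k x : ℂ) • j.1) - qform (V x) j.1 + ε * vsq j.1

/-- The value of a function together with its derivatives in the directions `e`. -/
noncomputable def jet (e : Fin d → X) (φ : X → Fin m → ℂ) (x : X) :
    (Fin m → ℂ) × (Fin d → Fin m → ℂ) := (φ x, fun k => fderiv ℝ φ x (e k))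

/-- The quadratic form of `∑ₖ (i ∂_{e k} + a k)² - V`. -/
noncomputable def magForm (e : Fin d → X) (a : Fin d → X → ℝ) (V : X → Matrix (Fin m) (Fin m) ℂ)
    (φ : X → Fin m → ℂ) : ℝ := ∫ x, jetDensity a V 0 x (jet e φ x)

/-- The Lieb–Thirring bound with exponents `γ`, `p` and constant `C` for magnetic Schrödinger
operators with kinetic energy in the directions `e` and matrix-valued potentials. -/
def LTBound (e : Fin d → X) (γ p C : ℝ) : Prop :=
  ∀ (m : ℕ) (a : Fin d → X → ℝ) (V : X → Matrix (Fin m) (Fin m) ℂ), (∀ k, Continuous (a k)) →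
    Continuous V → (∀ x, (V x).PosSemidef) → HasCompactSupport V →
    ∀ (ι : Type) [Fintype ι] (φ : ι → X → Fin m → ℂ) (E : ι → ℝ),
    (∀ i, 0 < E i) → (∀ i, ContDiff ℝ 1 (φ i)) → (∀ i, HasCompactSupport (φ i)) →
    IsFlag (magForm e a V) mass φ E → ∑ i, E i ^ γ ≤ C * ∫ x, trPow p (V x)

variable {a : Fin d → X → ℝ} {V : X → Matrix (Fin m) (Fin m) ℂ} {e : Fin d → X}

lemma continuous_jetDensity (ha : ∀ k, Continuous (a k)) (hV : Continuous V) (ε : ℝ) :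
    Continuous fun z : X × ((Fin m → ℂ) × (Fin d → Fin m → ℂ)) => jetDensity a V ε z.1 z.2 := by
  unfold jetDensity
  have h1 : ∀ k, Continuous fun z : X × ((Fin m → ℂ) × (Fin d → Fin m → ℂ)) =>
      vsq (Complex.I • z.2.2 k + (a k z.1 : ℂ) • z.2.1) := fun k => by
    have := ha k
    fun_prop
  have h2 : Continuous fun z : X × ((Fin m → ℂ) × (Fin d → Fin m → ℂ)) =>
      qform (V z.1) z.2.1 := by fun_prop
  have h3 : Continuous fun z : X × ((Fin m → ℂ) × (Fin d → Fin m → ℂ)) => vsq z.2.1 := by fun_prop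
  exact ((continuous_finsetSum _ fun k _ => h1 k).sub h2).add (h3.const_mul ε)

@[simp] lemma jetDensity_zero_right (ε : ℝ) (x : X) : jetDensity a V ε x 0 = 0 := by
  simp [jetDensity, vsq, qform]

lemma jetDensity_smul (ε : ℝ) (x : X) (t : ℝ) (j : (Fin m → ℂ) × (Fin d → Fin m → ℂ)) :
    jetDensity a V ε x (t • j) = t ^ 2 * jetDensity a V ε x j := by
  have h : ∀ v : Fin m → ℂ, t • v = (t : ℂ) • v := fun v => by ext i; simp
  have h1 : ∀ k, vsq (Complex.I • (t • j).2 k + (a k x : ℂ) • (t • j).1)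
      = t ^ 2 * vsq (Complex.I • j.2 k + (a k x : ℂ) • j.1) := fun k => by
    have : Complex.I • (t • j).2 k + (a k x : ℂ) • (t • j).1
        = (t : ℂ) • (Complex.I • j.2 k + (a k x : ℂ) • j.1) := by
      simp only [Prod.smul_snd, Prod.smul_fst, Pi.smul_apply, h]
      rw [smul_add, smul_comm, smul_comm (a k x : ℂ)]
    rw [this, vsq_smul, Complex.normSq_ofReal, sq]
  simp only [jetDensity, h1, ← Finset.mul_sum]
  rw [Prod.smul_fst, h, vsq_smul, qform_smul, Complex.normSq_ofReal]
  ring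

lemma continuous_jet {φ : X → Fin m → ℂ} (hφ : ContDiff ℝ 1 φ) : Continuous (jet e φ) := by
  have h1 := hφ.continuous
  have h2 := hφ.continuous_fderiv one_ne_zero
  unfold jet
  fun_prop

lemma jet_eq_zero {φ : X → Fin m → ℂ} {K : Set X} (hK : IsClosed K) (h : ∀ x ∉ K, φ x = 0)
    {x : X} (hx : x ∉ K) : jet e φ x = 0 := by
  have h1 : φ =ᶠ[nhds x] fun _ => 0 := by
    filter_upwards [hK.isOpen_compl.mem_nhds hx] with y hy using h y hy
  rw [jet, h x hx, h1.fderiv_eq]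
  simp; rfl

lemma jet_comb {ι : Type} [Fintype ι] (c : ι → ℂ) {φ : ι → X → Fin m → ℂ}
    (hφ : ∀ i, ContDiff ℝ 1 (φ i)) (x : X) : jet e (comb c φ) x = ∑ i, c i • jet e (φ i) x := by
  have h1 : HasFDerivAt (comb c φ) (∑ i, c i • fderiv ℝ (φ i) x) x := by
    have h2 : ∀ i, HasFDerivAt (fun y => c i • φ i y) (c i • fderiv ℝ (φ i) x) x := fun i =>
      (((hφ i).differentiable one_ne_zero) x).hasFDerivAt.const_smul (c i)
    exact HasFDerivAt.fun_sum fun i _ => h2 i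
  rw [jet, h1.fderiv]
  refine Prod.ext ?_ ?_
  · simp [comb, jet, Prod.fst_sum]
  · funext k
    simp [jet, Prod.snd_sum, _root_.sum_apply]

variable [BorelSpace X] [IsFiniteMeasureOnCompacts (volume : Measure X)]

lemma hasCompactSupport_jet {φ : X → Fin m → ℂ} (hs : HasCompactSupport φ) :
    HasCompactSupport (jet e φ) :=
  HasCompactSupport.intro' hs.isCompact (isClosed_tsupport _) fun _ hx =>
    jet_eq_zero (isClosed_tsupport _) (fun _ => image_eq_zero_of_notMem_tsupport) hx

lemma integrable_jetDensity (ha : ∀ k, Continuous (a k)) (hV : Continuous V) (ε : ℝ)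
    {φ : X → Fin m → ℂ} (hφ : ContDiff ℝ 1 φ) (hs : HasCompactSupport φ) :
    Integrable fun x => jetDensity a V ε x (jet e φ x) :=
  ((continuous_jetDensity ha hV ε).comp (continuous_id.prodMk (continuous_jet hφ))
    ).integrable_of_hasCompactSupport
    ((hasCompactSupport_jet (e := e) hs).mono fun x hx h0 => hx (by simp [h0]))

lemma magForm_add_mass (ha : ∀ k, Continuous (a k)) (hV : Continuous V) (ε : ℝ)
    {φ : X → Fin m → ℂ} (hφ : ContDiff ℝ 1 φ) (hs : HasCompactSupport φ) :
    magForm e a V φ + ε * mass φ = ∫ x, jetDensity a V ε x (jet e φ x) := by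
  have h1 : Integrable fun x => ε * vsq (φ x) := by
    have := hφ.continuous
    exact (by fun_prop : Continuous fun x => ε * vsq (φ x)).integrable_of_hasCompactSupport
      (hs.mono fun x hx h0 => hx (by simp [h0, vsq]))
  rw [magForm, mass, ← integral_const_mul, ← integral_add (integrable_jetDensity ha hV 0 hφ hs) h1]
  refine integral_congr_ae (Filter.Eventually.of_forall fun x => ?_)
  simp [jetDensity, jet]

lemma contDiff_comb {ι : Type} [Fintype ι] (c : ι → ℂ) {φ : ι → X → Fin m → ℂ}
    (hφ : ∀ i, ContDiff ℝ 1 (φ i)) : ContDiff ℝ 1 (comb c φ) := by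
  have h3 : ∀ j, ContDiff ℝ 1 fun x => c j • φ j x := fun j => (hφ j).const_smul (c j)
  exact ContDiff.sum fun j _ => h3 j

lemma tendsto_integral_comb {ι G : Type} [Fintype ι] [NormedAddCommGroup G] [NormedSpace ℂ G]
    [ProperSpace G] {F : X → G → ℝ} (hF : Continuous fun z : X × G => F z.1 z.2)
    (hF0 : ∀ x, F x 0 = 0) {g : ι → X → G} {gN : ℕ → ι → X → G}
    (hgN : ∀ N i, Continuous (gN N i)) {K : Set X} (hK : IsCompact K)
    (hsN : ∀ᶠ N in Filter.atTop, ∀ i, ∀ x ∉ K, gN N i x = 0)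
    {M : ℝ} (hM : ∀ᶠ N in Filter.atTop, ∀ i x, ‖gN N i x‖ ≤ M)
    (hlim : ∀ i x, Filter.Tendsto (fun N => gN N i x) Filter.atTop (nhds (g i x)))
    {c : ι → ℂ} (hc : ‖c‖ = 1) :
    Filter.Tendsto (fun z : ℕ × (ι → ℂ) => ∫ x, F x (∑ j, z.2 j • gN z.1 j x))
      (Filter.atTop ×ˢ nhds c) (nhds (∫ x, F x (∑ j, c j • g j x))) := by
  let R : ℝ := ∑ _j : ι, 2 * M
  obtain ⟨B, hB⟩ := (hK.prod (isCompact_closedBall (0 : G) R)).exists_bound_of_continuousOn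
    hF.continuousOn
  have hc2 : ∀ᶠ z : ℕ × (ι → ℂ) in Filter.atTop ×ˢ nhds c, ‖z.2‖ < 2 := by
    have h1 : ∀ᶠ c' in nhds c, ‖c'‖ < 2 :=
      continuous_norm.continuousAt.eventually_lt_const (by simp only [hc]; norm_num)
    exact Filter.tendsto_snd.eventually h1
  refine tendsto_integral_filter_of_dominated_convergence (K.indicator fun _ => B) ?_ ?_ ?_ ?_
  · refine Filter.Eventually.of_forall fun z => ?_
    have : Continuous fun x => F x (∑ j, z.2 j • gN z.1 j x) :=
      hF.comp (continuous_id.prodMk (continuous_finsetSum _ fun j _ => (hgN z.1 j).const_smul (z.2 j)))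
    exact this.aestronglyMeasurable
  · filter_upwards [hc2, Filter.tendsto_fst.eventually hsN, Filter.tendsto_fst.eventually hM]
      with z hz hzs hzM
    refine Filter.Eventually.of_forall fun x => ?_
    by_cases hx : x ∈ K
    · rw [Set.indicator_of_mem hx]
      have h2 : ‖∑ j, z.2 j • gN z.1 j x‖ ≤ R := by
        refine norm_sum_le_of_le _ fun j _ => ?_
        rw [norm_smul]
        exact mul_le_mul ((norm_le_pi_norm _ j).trans hz.le) (hzM j x) (norm_nonneg _) (by norm_num)
      exact hB (x, ∑ j, z.2 j • gN z.1 j x) ⟨hx, mem_closedBall_zero_iff.2 h2⟩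
    · rw [Set.indicator_of_notMem hx]
      have : ∀ j, gN z.1 j x = 0 := fun j => hzs j x hx
      simp [this, hF0]
  · exact (integrable_indicator_iff hK.measurableSet).2 (integrableOn_const hK.measure_lt_top.ne)
  · refine Filter.Eventually.of_forall fun x => ?_
    have h3 : Continuous fun v => F x v := hF.comp (Continuous.prodMk_right x)
    refine h3.continuousAt.tendsto.comp ?_
    refine tendsto_finsetSum _ fun j _ => Filter.Tendsto.smul ?_ ((hlim j x).comp Filter.tendsto_fst)
    exact ((continuous_apply j).tendsto c).comp Filter.tendsto_snd

/-- Being a flag is stable under approximation of the trial functions. -/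
lemma IsFlag.eventually (ha : ∀ k, Continuous (a k)) (hV : Continuous V)
    {ι : Type} [Fintype ι] {φ : ι → X → Fin m → ℂ} {E : ι → ℝ} {φN : ℕ → ι → X → Fin m → ℂ}
    (hφ : ∀ i, ContDiff ℝ 1 (φ i)) (hs : ∀ i, HasCompactSupport (φ i))
    (hφN : ∀ N i, ContDiff ℝ 1 (φN N i)) {K : Set X} (hK : IsCompact K)
    (hsN : ∀ᶠ N in Filter.atTop, ∀ i, ∀ x ∉ K, φN N i x = 0)
    {M : ℝ} (hM : ∀ᶠ N in Filter.atTop, ∀ i x, ‖jet e (φN N i) x‖ ≤ M)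
    (hlim : ∀ i x, Filter.Tendsto (fun N => jet e (φN N i) x) Filter.atTop
      (nhds (jet e (φ i) x)))
    (h : IsFlag (magForm e a V) mass φ E) :
    ∀ᶠ N in Filter.atTop, IsFlag (magForm e a V) mass (φN N) E := by
  refine Filter.eventually_all.2 fun i => ?_
  let S : Set (ι → ℂ) := Metric.sphere 0 1 ∩ {c | ∀ j, E j < E i → c j = 0}
  have hS : IsCompact S := by
    refine (isCompact_sphere _ _).inter_right ?_
    have h1 : {c : ι → ℂ | ∀ j, E j < E i → c j = 0} = ⋂ j, ⋂ _ : E j < E i, {c | c j = 0} := by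
      ext c; simp
    rw [h1]
    exact isClosed_iInter fun j => isClosed_iInter fun _ =>
      isClosed_eq (continuous_apply j) continuous_const
  have hJ := continuous_jetDensity ha hV (E i)
  have key : ∀ᶠ N in Filter.atTop, ∀ c ∈ S,
      ∫ x, jetDensity a V (E i) x (∑ j, c j • jet e (φN N j) x) < 0 := by
    have h0 : {z : ℕ × (ι → ℂ) | ∫ x, jetDensity a V (E i) x (∑ j, z.2 j • jet e (φN z.1 j) x) < 0}
        ∈ Filter.atTop ×ˢ nhdsSet S := hS.mem_prod_nhdsSet_of_forall fun c hc => ?_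
    · exact (Filter.Eventually.curry h0).mono fun _ h => h.self_of_nhdsSet
    have hneg : ∫ x, jetDensity a V (E i) x (∑ j, c j • jet e (φ j) x) < 0 := by
      have h1 := h i c (fun h0 => by simp [S, h0] at hc) hc.2
      rw [magForm_add_mass ha hV _ (contDiff_comb c hφ) (hasCompactSupport_comb hs c)] at h1
      simpa only [jet_comb c hφ] using h1
    have hc1 : ‖c‖ = 1 := by simpa [S] using hc.1
    exact Filter.Tendsto.eventually_lt_const hneg (tendsto_integral_comb hJ
      (jetDensity_zero_right (E i)) (fun N j => continuous_jet (hφN N j)) hK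
      (hsN.mono fun N hN j x hx => jet_eq_zero hK.isClosed (hN j) hx) hM hlim hc1)
  filter_upwards [key, hsN] with N hN hsN c hc hcj
  have hc0 : 0 < ‖c‖ := norm_pos_iff.2 hc
  have h1 := hN (‖c‖⁻¹ • c) ⟨by simp [norm_smul, hc0.ne'], fun j hj => by simp [hcj j hj]⟩
  have hsN' : ∀ j, HasCompactSupport (φN N j) := fun j => HasCompactSupport.intro hK (fun {x} hx => hsN j x hx)
  rw [magForm_add_mass ha hV _ (contDiff_comb c (hφN N)) (hasCompactSupport_comb hsN' c)]
  simp only [jet_comb c (hφN N)]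
  have h2 : ∀ x, ∑ j, (‖c‖⁻¹ • c) j • jet e (φN N j) x = ‖c‖⁻¹ • ∑ j, c j • jet e (φN N j) x :=
    fun x => by simp only [Pi.smul_apply, smul_assoc, Finset.smul_sum]
  simp only [h2, jetDensity_smul, integral_const_mul] at h1
  exact neg_of_mul_neg_right h1 (by positivity)

end MagneticForm

section Spline

/-- The hat function. -/
noncomputable def hat (t : ℝ) : ℝ := max 0 (1 - |t|)

lemma hat_nonneg (t : ℝ) : 0 ≤ hat t := le_max_left _ _

@[fun_prop]
lemma continuous_hat : Continuous hat := by unfold hat; fun_prop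

lemma hat_eq_zero {t : ℝ} (h : 1 ≤ |t|) : hat t = 0 := max_eq_left (by linarith)

lemma sum_hat {K : ℤ} {t : ℝ} (h : |t| + 1 ≤ K) : ∑ k ∈ Finset.Icc (-K) K, hat (t - k) = 1 := by
  obtain ⟨h1, h2⟩ := abs_le.1 (show |t| ≤ K - 1 by linarith)
  have hf := Int.floor_le t
  have hf' := Int.lt_floor_add_one t
  have hsub : ({⌊t⌋, ⌊t⌋ + 1} : Finset ℤ) ⊆ Finset.Icc (-K) K := by
    intro k hk
    simp only [Finset.mem_insert, Finset.mem_singleton] at hk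
    rw [Finset.mem_Icc]
    have a1 : -K ≤ ⌊t⌋ := Int.le_floor.2 (by push_cast; linarith)
    have a2 : ⌊t⌋ + 1 ≤ K := by
      have : (⌊t⌋ : ℝ) + 1 ≤ K := by linarith
      exact_mod_cast this
    omega
  rw [← Finset.sum_subset hsub, Finset.sum_pair (by omega), hat, hat, abs_of_nonneg (by linarith),
    abs_of_nonpos (by push_cast; linarith), max_eq_right (by linarith),
    max_eq_right (by push_cast; linarith)]
  · push_cast; ring
  · intro k _ hk
    simp only [Finset.mem_insert, Finset.mem_singleton, not_or] at hk
    refine hat_eq_zero ?_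
    rcases lt_or_ge k ⌊t⌋ with h3 | h3
    · have : (k : ℝ) + 1 ≤ ⌊t⌋ := by exact_mod_cast h3
      exact le_abs.2 (Or.inl (by linarith))
    · have : (⌊t⌋ : ℝ) + 2 ≤ k := by
        have : ⌊t⌋ + 2 ≤ k := by omega
        exact_mod_cast this
      exact le_abs.2 (Or.inr (by linarith))

/-- The quadratic spline. -/
noncomputable def spline (t : ℝ) : ℝ := ∫ s in (t - 1)..t, hat s

lemma spline_nonneg (t : ℝ) : 0 ≤ spline t :=
  intervalIntegral.integral_nonneg (by linarith) fun _ _ => hat_nonneg _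

lemma spline_eq_zero {t : ℝ} (h : 2 ≤ |t|) : spline t = 0 := by
  rw [spline, intervalIntegral.integral_congr (g := fun _ => 0), intervalIntegral.integral_zero]
  intro s hs
  rw [Set.uIcc_of_le (by linarith), Set.mem_Icc] at hs
  refine hat_eq_zero ?_
  rcases le_abs.1 h with h | h
  · exact le_abs.2 (Or.inl (by linarith))
  · exact le_abs.2 (Or.inr (by linarith))

lemma hasDerivAt_spline (t : ℝ) : HasDerivAt spline (hat t - hat (t - 1)) t := by
  have hi : ∀ a b, IntervalIntegrable hat volume a b := fun a b => continuous_hat.intervalIntegrable a b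
  have h1 : ∀ t, spline t = (∫ s in (0 : ℝ)..t, hat s) - ∫ s in (0 : ℝ)..(t - 1), hat s := fun t => by
    rw [spline, intervalIntegral.integral_interval_sub_left (hi _ _) (hi _ _)]
  have h2 : ∀ t, HasDerivAt (fun t => ∫ s in (0 : ℝ)..t, hat s) (hat t) t := fun t =>
    intervalIntegral.integral_hasDerivAt_right (hi _ _)
      (continuous_hat.stronglyMeasurableAtFilter _ _) continuous_hat.continuousAt
  rw [funext h1]
  refine (h2 t).fun_sub ?_
  refine ((h2 (t - 1)).comp_of_eq t ((hasDerivAt_id' t).sub_const 1) rfl).congr_deriv ?_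
  simp

lemma contDiff_spline : ContDiff ℝ 1 spline := by
  rw [contDiff_one_iff_deriv]
  refine ⟨fun t => (hasDerivAt_spline t).differentiableAt, ?_⟩
  rw [funext fun t => (hasDerivAt_spline t).deriv]
  fun_prop

lemma sum_spline {K : ℤ} {t : ℝ} (h : |t| + 2 ≤ K) :
    ∑ k ∈ Finset.Icc (-K) K, spline (t - k) = 1 := by
  have h1 : ∀ k : ℤ, spline (t - k) = ∫ s in (t - 1)..t, hat (s - k) := fun k => by
    rw [spline, intervalIntegral.integral_comp_sub_right (fun s => hat s) (k : ℝ)]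
    congr 1; ring
  simp only [h1]
  rw [← intervalIntegral.integral_finsetSum (f := fun (k : ℤ) s => hat (s - k)) fun k _ =>
    (by fun_prop : Continuous fun s => hat (s - k)).intervalIntegrable _ _,
    intervalIntegral.integral_congr (g := fun _ => 1)]
  · simp
  · intro s hs
    rw [Set.uIcc_of_le (by linarith), Set.mem_Icc] at hs
    obtain ⟨h2, h3⟩ := abs_le.1 (show |t| ≤ K - 2 by linarith)
    refine sum_hat ?_
    have : |s| ≤ K - 1 := abs_le.2 ⟨by linarith, by linarith⟩
    linarith

lemma norm_sum_smul_sub_le {G : Type*} [NormedAddCommGroup G] [NormedSpace ℝ G] {α : Type*}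
    {s : Finset α} {w : α → ℝ} (hw : ∀ k, 0 ≤ w k) (h1 : ∑ k ∈ s, w k = 1) {g : α → G} {v : G}
    {ε : ℝ} (h : ∀ k ∈ s, w k ≠ 0 → ‖g k - v‖ ≤ ε) : ‖∑ k ∈ s, w k • g k - v‖ ≤ ε := by
  have h2 : ∑ k ∈ s, w k • g k - v = ∑ k ∈ s, w k • (g k - v) := by
    simp only [smul_sub, Finset.sum_sub_distrib, ← Finset.sum_smul, h1, one_smul]
  have h3 : ∀ k ∈ s, ‖w k • (g k - v)‖ ≤ w k * ε := fun k hk => by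
    rw [norm_smul, Real.norm_of_nonneg (hw k)]
    rcases eq_or_ne (w k) 0 with h0 | h0
    · simp [h0]
    · exact mul_le_mul_of_nonneg_left (h k hk h0) (hw k)
  rw [h2]
  refine (norm_sum_le_of_le s h3).trans ?_
  rw [← Finset.sum_mul, h1, one_mul]

lemma sum_Icc_shift {G : Type*} [AddCommGroup G] [TopologicalSpace G] [T2Space G] {K : ℤ}
    {f : ℤ → G} (hf : ∀ k, K ≤ |k| → f k = 0) :
    ∑ k ∈ Finset.Icc (-K) K, f k = ∑ k ∈ Finset.Icc (-K) K, f (k - 1) := by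
  rw [← tsum_eq_sum (L := .unconditional ℤ), ← tsum_eq_sum (L := .unconditional ℤ),
    ← (Equiv.subRight (1 : ℤ)).tsum_eq f]
  · rfl
  · intro k hk
    refine hf _ ?_
    rw [Finset.mem_Icc] at hk
    rw [le_abs]; omega
  · intro k hk
    refine hf _ ?_
    rw [Finset.mem_Icc] at hk
    rw [le_abs]; omega

end Spline

section Interpolation

variable {X : Type} [NormedAddCommGroup X] [NormedSpace ℝ X] {d m : ℕ}

/-- The directions on `ℝ × X` obtained from the directions `e` on `X`. -/
def consDir (e : Fin d → X) : Fin (d + 1) → ℝ × X := Fin.cons (1, 0) fun k => (0, e k)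

/-- The spline interpolation in the first variable. -/
noncomputable def interp (R N : ℕ) (φ : ℝ × X → Fin m → ℂ) (y : ℝ × X) : Fin m → ℂ :=
  ∑ k ∈ Finset.Icc (-(N * (R + 4) : ℤ)) (N * (R + 4)), spline (N * y.1 - k) • φ (k / N, y.2)

variable {φ : ℝ × X → Fin m → ℂ}

lemma hasFDerivAt_interp (hφ : ContDiff ℝ 1 φ) (R N : ℕ) (y : ℝ × X) :
    HasFDerivAt (interp R N φ) (∑ k ∈ Finset.Icc (-(N * (R + 4) : ℤ)) (N * (R + 4)),
      (spline (N * y.1 - k) • (fderiv ℝ φ (k / N, y.2)).comp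
        ((ContinuousLinearMap.inr ℝ ℝ X).comp (ContinuousLinearMap.snd ℝ ℝ X)) +
      ((hat (N * y.1 - k) - hat (N * y.1 - k - 1)) • (N : ℝ) • ContinuousLinearMap.fst ℝ ℝ X).smulRight
        (φ (k / N, y.2)))) y := by
  refine HasFDerivAt.fun_sum fun k _ => ?_
  have h1 : HasFDerivAt (fun z : ℝ × X => (N : ℝ) * z.1 - k)
      ((N : ℝ) • ContinuousLinearMap.fst ℝ ℝ X) y :=
    (hasFDerivAt_fst.const_mul (N : ℝ)).sub_const _
  have h2 := (hasDerivAt_spline (N * y.1 - k)).comp_hasFDerivAt y h1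
  have h3 : HasFDerivAt (fun z : ℝ × X => (((k : ℝ) / N, z.2) : ℝ × X))
      ((ContinuousLinearMap.inr ℝ ℝ X).comp (ContinuousLinearMap.snd ℝ ℝ X)) y := by
    have := (hasFDerivAt_const ((k : ℝ) / N) y).prodMk (hasFDerivAt_snd (𝕜 := ℝ) (p := y))
    exact this
  have h4 := ((hφ.differentiable one_ne_zero (k / N, y.2)).hasFDerivAt).comp y h3
  exact h2.smul h4

lemma contDiff_interp (hφ : ContDiff ℝ 1 φ) (R N : ℕ) : ContDiff ℝ 1 (interp R N φ) := by
  refine ContDiff.sum fun k _ => ?_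
  have h1 : ContDiff ℝ 1 fun y : ℝ × X => spline (N * y.1 - k) :=
    contDiff_spline.comp ((contDiff_const.mul contDiff_fst).sub contDiff_const)
  have h2 : ContDiff ℝ 1 fun y : ℝ × X => φ (k / N, y.2) :=
    hφ.comp (contDiff_const.prodMk contDiff_snd)
  exact h1.smul h2

lemma interp_eq_zero {R N : ℕ} (hN : 1 ≤ N) (h0 : ∀ y, (R : ℝ) ≤ ‖y‖ → φ y = 0) {y : ℝ × X}
    (hy : (R : ℝ) + 2 ≤ ‖y‖) : interp R N φ y = 0 := by
  have hN' : (1 : ℝ) ≤ N := by exact_mod_cast hN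
  refine Finset.sum_eq_zero fun k _ => ?_
  rcases le_or_gt 2 |N * y.1 - k| with h | h
  · rw [spline_eq_zero h, zero_smul]
  · rw [h0, smul_zero]
    rw [Prod.norm_def] at hy ⊢
    rcases le_max_iff.1 hy with h1 | h1
    · refine le_max_of_le_left ?_
      rw [Real.norm_eq_abs] at h1 ⊢
      have h2 : |y.1 - k / N| ≤ 2 := by
        have : y.1 - k / N = (N * y.1 - k) / N := by field_simp
        rw [this, abs_div, abs_of_pos (by linarith : (0 : ℝ) < N), div_le_iff₀ (by linarith)]
        nlinarith
      have h3 := abs_sub_abs_le_abs_sub y.1 (k / N)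
      show (R : ℝ) ≤ |(k : ℝ) / N|
      linarith
    · exact le_max_of_le_right (by show (R : ℝ) ≤ ‖y.2‖; linarith)

lemma fderiv_interp_inr (hφ : ContDiff ℝ 1 φ) (R N : ℕ) (y : ℝ × X) (e : X) :
    fderiv ℝ (interp R N φ) y (0, e) = ∑ k ∈ Finset.Icc (-(N * (R + 4) : ℤ)) (N * (R + 4)),
      spline (N * y.1 - k) • fderiv ℝ φ (k / N, y.2) (0, e) := by
  rw [(hasFDerivAt_interp hφ R N y).fderiv, _root_.sum_apply]
  refine Finset.sum_congr rfl fun k _ => ?_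
  simp

lemma fderiv_interp_inl (hφ : ContDiff ℝ 1 φ) {R N : ℕ} (hN : 1 ≤ N)
    (h0 : ∀ y, (R : ℝ) ≤ ‖y‖ → φ y = 0) (y : ℝ × X) :
    fderiv ℝ (interp R N φ) y (1, 0) = ∑ k ∈ Finset.Icc (-(N * (R + 4) : ℤ)) (N * (R + 4)),
      hat (N * y.1 - k) • (N : ℝ) • (φ (k / N, y.2) - φ ((k - 1) / N, y.2)) := by
  have hN' : (1 : ℝ) ≤ N := by exact_mod_cast hN
  have hs := sum_Icc_shift (K := N * (R + 4))
    (f := fun k : ℤ => hat (N * y.1 - k - 1) • (N : ℝ) • φ (k / N, y.2)) (fun k hk => by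
      rw [h0, smul_zero, smul_zero]
      rw [Prod.norm_def]
      refine le_max_of_le_left ?_
      rw [Real.norm_eq_abs, abs_div, abs_of_pos (by linarith : (0 : ℝ) < N),
        le_div_iff₀ (by linarith)]
      have : ((N * (R + 4) : ℤ) : ℝ) ≤ |(k : ℝ)| := by exact_mod_cast hk
      push_cast at this
      nlinarith)
  simp only [smul_sub, Finset.sum_sub_distrib]
  have hs' : ∑ k ∈ Finset.Icc (-(N * (R + 4) : ℤ)) (N * (R + 4)),
      hat (N * y.1 - k) • (N : ℝ) • φ ((k - 1) / N, y.2)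
      = ∑ k ∈ Finset.Icc (-(N * (R + 4) : ℤ)) (N * (R + 4)),
        hat (N * y.1 - k - 1) • (N : ℝ) • φ (k / N, y.2) := by
    rw [hs]
    refine Finset.sum_congr rfl fun k _ => ?_
    push_cast
    congr 2; ring
  rw [hs', ← Finset.sum_sub_distrib, (hasFDerivAt_interp hφ R N y).fderiv, _root_.sum_apply]
  refine Finset.sum_congr rfl fun k _ => ?_
  rw [← sub_smul]
  simp [mul_smul]
  right; exact map_zero _

lemma abs_sub_div_le {N : ℕ} (hN : 1 ≤ N) {x t b : ℝ} (h : |N * x - t| ≤ b) : |t / N - x| ≤ b / N := by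
  have hN' : (1 : ℝ) ≤ N := by exact_mod_cast hN
  have : t / N - x = -(N * x - t) / N := by field_simp; ring
  rw [this, abs_div, abs_neg, abs_of_pos (by linarith : (0 : ℝ) < N)]
  exact div_le_div_of_nonneg_right h (by linarith)

lemma norm_jet_interp_sub_le (e : Fin d → X) (hφ : ContDiff ℝ 1 φ) {R N : ℕ} (hN : 1 ≤ N)
    (h0 : ∀ y, (R : ℝ) ≤ ‖y‖ → φ y = 0) {y : ℝ × X} (hy : |y.1| ≤ R + 2)
    {J : (Fin m → ℂ) × (Fin (d + 1) → Fin m → ℂ)} {ε : ℝ}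
    (h : ∀ s, |s - y.1| ≤ 3 / N → ‖jet (consDir e) φ (s, y.2) - J‖ ≤ ε) :
    ‖jet (consDir e) (interp R N φ) y - J‖ ≤ ε := by
  have hN' : (1 : ℝ) ≤ N := by exact_mod_cast hN
  have hyN : |N * y.1| ≤ N * (R + 2) := by
    rw [abs_mul, Nat.abs_cast]
    exact mul_le_mul_of_nonneg_left hy (by positivity)
  have hε : 0 ≤ ε := (norm_nonneg _).trans (h y.1 (by simp; positivity))
  have hsp : ∑ k ∈ Finset.Icc (-(N * (R + 4) : ℤ)) (N * (R + 4)), spline (N * y.1 - k) = 1 :=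
    sum_spline (by push_cast; nlinarith)
  have hha : ∑ k ∈ Finset.Icc (-(N * (R + 4) : ℤ)) (N * (R + 4)), hat (N * y.1 - k) = 1 :=
    sum_hat (by push_cast; nlinarith)
  have hsn : ∀ k : ℤ, spline (N * y.1 - k) ≠ 0 → |(k : ℝ) / N - y.1| ≤ 3 / N := fun k hk => by
    refine (abs_sub_div_le hN (b := 2) ?_).trans (by gcongr; norm_num)
    exact (lt_of_not_ge fun h3 => hk (spline_eq_zero h3)).le
  have hfst : ∀ s, |s - y.1| ≤ 3 / N → ‖φ (s, y.2) - J.1‖ ≤ ε := fun s hs =>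
    (norm_fst_le _).trans (h s hs)
  have hsnd : ∀ s, |s - y.1| ≤ 3 / N → ∀ i, ‖fderiv ℝ φ (s, y.2) (consDir e i) - J.2 i‖ ≤ ε :=
    fun s hs i => (norm_le_pi_norm (fun i => fderiv ℝ φ (s, y.2) (consDir e i) - J.2 i) i).trans
      ((norm_snd_le (jet (consDir e) φ (s, y.2) - J)).trans (h s hs))
  rw [Prod.norm_def]
  refine max_le ?_ ((pi_norm_le_iff_of_nonneg hε).2 fun i => ?_)
  · exact norm_sum_smul_sub_le (fun k => spline_nonneg _) hsp fun k _ hk => hfst _ (hsn k hk)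
  · show ‖fderiv ℝ (interp R N φ) y (consDir e i) - J.2 i‖ ≤ ε
    refine Fin.cases ?_ (fun i => ?_) i
    · simp only [consDir, Fin.cons_zero]
      rw [fderiv_interp_inl hφ hN h0]
      refine norm_sum_smul_sub_le (fun k => hat_nonneg _) hha fun k _ hk => ?_
      have hk1 : |N * y.1 - k| ≤ 1 := (lt_of_not_ge fun h3 => hk (hat_eq_zero h3)).le
      have hk2 : |N * y.1 - (k - 1)| ≤ 2 := by
        rw [abs_le] at hk1 ⊢; constructor <;> linarith
      have b1 := (abs_sub_div_le hN hk1).trans (show 1 / (N : ℝ) ≤ 3 / N by gcongr; norm_num)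
      have b2 := (abs_sub_div_le hN hk2).trans (show 2 / (N : ℝ) ≤ 3 / N by gcongr; norm_num)
      have hd : ∀ s, HasDerivAt (fun s => φ (s, y.2) - s • J.2 0)
          (fderiv ℝ φ (s, y.2) (1, 0) - J.2 0) s := fun s => by
        have h3 : HasDerivAt (fun s : ℝ => ((s, y.2) : ℝ × X)) (1, 0) s :=
          (hasDerivAt_id s).prodMk (hasDerivAt_const s _)
        have h4 := ((hφ.differentiable one_ne_zero (s, y.2)).hasFDerivAt).comp_hasDerivAt s h3
        refine h4.fun_sub ?_
        simpa using (hasDerivAt_id s).smul_const (J.2 0)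
      have hmv := (convex_Icc (y.1 - 3 / N) (y.1 + 3 / N)).norm_image_sub_le_of_norm_hasDerivWithin_le
        (fun s _ => (hd s).hasDerivWithinAt) (C := ε) (fun s hs => ?_)
        (x := ((k : ℝ) - 1) / N) (y := (k : ℝ) / N) ?_ ?_
      · have h5 : ‖((k : ℝ) / N - ((k : ℝ) - 1) / N)‖ = 1 / N := by
          rw [← sub_div, sub_sub_cancel, Real.norm_of_nonneg (by positivity)]
        have h6 : (N : ℝ) • (φ (k / N, y.2) - φ ((k - 1) / N, y.2)) - J.2 0
            = (N : ℝ) • ((φ (k / N, y.2) - ((k : ℝ) / N) • J.2 0)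
              - (φ ((k - 1) / N, y.2) - (((k : ℝ) - 1) / N) • J.2 0)) := by
          have h7 : (N : ℝ) • ((φ (k / N, y.2) - ((k : ℝ) / N) • J.2 0)
              - (φ ((k - 1) / N, y.2) - (((k : ℝ) - 1) / N) • J.2 0))
              = (N : ℝ) • (φ (k / N, y.2) - φ ((k - 1) / N, y.2))
                - ((N : ℝ) * ((k : ℝ) / N - ((k : ℝ) - 1) / N)) • J.2 0 := by module
          rw [h7]
          have h8 : (N : ℝ) * ((k : ℝ) / N - ((k : ℝ) - 1) / N) = 1 := by field_simp; ring
          rw [h8, one_smul]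
        rw [h5] at hmv
        rw [h6, norm_smul, Real.norm_of_nonneg (by positivity)]
        calc _ ≤ (N : ℝ) * (ε * (1 / N)) := mul_le_mul_of_nonneg_left hmv (by positivity)
          _ = ε := by field_simp
      · have := hsnd s (abs_le.2 ⟨by linarith [hs.1], by linarith [hs.2]⟩) 0
        simpa [consDir] using this
      · exact ⟨by linarith [(abs_le.1 b2).1], by linarith [(abs_le.1 b2).2]⟩
      · exact ⟨by linarith [(abs_le.1 b1).1], by linarith [(abs_le.1 b1).2]⟩
    · simp only [consDir, Fin.cons_succ]
      rw [fderiv_interp_inr hφ]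
      refine norm_sum_smul_sub_le (fun k => spline_nonneg _) hsp fun k _ hk => ?_
      have := hsnd _ (hsn k hk) i.succ
      simpa [consDir] using this

end Interpolation

section TestFunctions

variable {X : Type} [NormedAddCommGroup X] [NormedSpace ℝ X] {m : ℕ}

/-- The space of continuously differentiable functions with compact support. -/
def testFunctions (X : Type) [NormedAddCommGroup X] [NormedSpace ℝ X] (m : ℕ) :
    Submodule ℂ (X → Fin m → ℂ) where
  carrier := {f | ContDiff ℝ 1 f ∧ HasCompactSupport f}
  zero_mem' := ⟨contDiff_const, HasCompactSupport.zero⟩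
  add_mem' := fun hf hg => ⟨hf.1.add hg.1, hf.2.add hg.2⟩
  smul_mem' := fun c _ hf => ⟨hf.1.const_smul c, hf.2.mono fun x hx h0 => hx (by simp [h0])⟩

variable [MeasureSpace X] [BorelSpace X] [IsFiniteMeasureOnCompacts (volume : Measure X)]

lemma mem_sqInt_of_continuous {f : X → Fin m → ℂ} (hf : Continuous f) (hs : HasCompactSupport f) :
    f ∈ sqInt (volume : Measure X) m := fun i =>
  Continuous.memLp_of_hasCompactSupport ((continuous_apply i).comp hf)
    (hs.mono fun x hx h0 => hx (by simp [h0]))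

lemma eq_zero_of_pair_self [(volume : Measure X).IsOpenPosMeasure] {f : X → Fin m → ℂ}
    (hf : Continuous f) (hs : HasCompactSupport f) (h : pair volume f f = 0) : f = 0 := by
  rw [pair_self, Complex.ofReal_eq_zero] at h
  have h1 : Continuous fun x => vsq (f x) := hf.vsq'
  rw [integral_eq_zero_iff_of_nonneg (fun x => vsq_nonneg _)
    (h1.integrable_of_hasCompactSupport (hs.mono fun x hx h0 => hx (by simp [h0, vsq]))),
    h1.ae_eq_iff_eq volume continuous_zero] at h
  funext x
  exact vsq_eq_zero.1 (congrFun h x)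

/-- A finite family of test functions is spanned by a finite orthonormal family of test functions. -/
lemma exists_orthonormal_test [(volume : Measure X).IsOpenPosMeasure] {κ : Type} [Finite κ]
    {g : κ → X → Fin m → ℂ} (hg : ∀ k, ContDiff ℝ 1 (g k)) (hs : ∀ k, HasCompactSupport (g k)) :
    ∃ (M : ℕ) (f : Fin M → X → Fin m → ℂ), (∀ a, ContDiff ℝ 1 (f a)) ∧
      (∀ a, HasCompactSupport (f a)) ∧
      (∀ a b, pair volume (f a) (f b) = if a = b then 1 else 0) ∧
      ∃ α : κ → Fin M → ℂ, ∀ k, g k = comb (α k) f := by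
  let F : Submodule ℂ (X → Fin m → ℂ) := Submodule.span ℂ (Set.range g)
  have hF : F ≤ testFunctions X m := Submodule.span_le.2 (by
    rintro _ ⟨k, rfl⟩; exact ⟨hg k, hs k⟩)
  have hfin : FiniteDimensional ℂ F := FiniteDimensional.span_of_finite ℂ (Set.finite_range g)
  have hmem : ∀ f : F, f.1 ∈ sqInt (volume : Measure X) m := fun f =>
    mem_sqInt_of_continuous (hF f.2).1.continuous (hF f.2).2
  let c : InnerProductSpace.Core ℂ F :=
    { inner f g := pair volume f.1 g.1
      conj_inner_symm f g := pair_conj _ _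
      re_inner_nonneg f := by
        change 0 ≤ (pair volume f.1 f.1).re
        rw [pair_self, Complex.ofReal_re]
        exact integral_nonneg fun x => vsq_nonneg _
      add_left f g h := by
        simp only [pair, Submodule.coe_add, Pi.add_apply, star_add, add_dotProduct]
        exact integral_add (integrable_pair (hmem f) (hmem h)) (integrable_pair (hmem g) (hmem h))
      smul_left f g c := by
        simp only [pair, Submodule.coe_smul, Pi.smul_apply, star_smul, smul_dotProduct, smul_eq_mul]
        exact integral_const_mul _ _
      definite f hf := Subtype.ext
        (eq_zero_of_pair_self (hF f.2).1.continuous (hF f.2).2 hf) }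
  let : NormedAddCommGroup F := c.toNormedAddCommGroup
  let : InnerProductSpace ℂ F := InnerProductSpace.ofCore c.toCore
  let b := stdOrthonormalBasis ℂ F
  refine ⟨Module.finrank ℂ F, fun a => (b a).1, fun a => (hF (b a).2).1, fun a => (hF (b a).2).2,
    fun i j => (orthonormal_iff_ite.1 b.orthonormal) i j, fun k a => inner ℂ (b a)
      (⟨g k, Submodule.subset_span ⟨k, rfl⟩⟩ : F), fun k => ?_⟩
  have h := congrArg Subtype.val (b.sum_repr' (⟨g k, Submodule.subset_span ⟨k, rfl⟩⟩ : F))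
  rw [← show _ = g k from h]
  funext x
  simp [comb]

end TestFunctions

section FlagInterpolation

variable {X : Type} [NormedAddCommGroup X] [NormedSpace ℝ X] [FiniteDimensional ℝ X]
  [MeasureSpace X] [BorelSpace X] [SecondCountableTopology X]
  [SigmaFinite (volume : Measure X)] [IsFiniteMeasureOnCompacts (volume : Measure X)] {d m : ℕ}

lemma IsFlag.exists_interp {e : Fin d → X} {a : Fin (d + 1) → ℝ × X → ℝ}
    {V : ℝ × X → Matrix (Fin m) (Fin m) ℂ} (ha : ∀ k, Continuous (a k)) (hV : Continuous V)
    {ι : Type} [Fintype ι] {φ : ι → ℝ × X → Fin m → ℂ} {E : ι → ℝ}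
    (hφ : ∀ i, ContDiff ℝ 1 (φ i)) (hs : ∀ i, HasCompactSupport (φ i))
    (h : IsFlag (magForm (consDir e) a V) mass φ E) :
    ∃ R N : ℕ, 1 ≤ N ∧ (∀ i y, (R : ℝ) ≤ ‖y‖ → φ i y = 0) ∧
      IsFlag (magForm (consDir e) a V) mass (fun i => interp R N (φ i)) E := by
  have : ProperSpace X := FiniteDimensional.proper_real X
  obtain ⟨R, hR⟩ : ∃ R : ℕ, ∀ i y, (R : ℝ) ≤ ‖y‖ → φ i y = 0 := by
    have h1 : IsCompact (⋃ i, tsupport (φ i)) := isCompact_iUnion hs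
    obtain ⟨r, hr⟩ := h1.isBounded.subset_ball (0 : ℝ × X)
    refine ⟨⌈r⌉₊, fun i y hy => image_eq_zero_of_notMem_tsupport fun h2 => ?_⟩
    have h3 := hr (Set.mem_iUnion.2 ⟨i, h2⟩)
    rw [mem_ball_zero_iff] at h3
    have := Nat.le_ceil r
    linarith
  have hbd : ∃ M, ∀ i y, ‖jet (consDir e) (φ i) y‖ ≤ M := by
    have h1 : ∀ i, ∃ M, ∀ y, ‖jet (consDir e) (φ i) y‖ ≤ M := fun i =>
      (hasCompactSupport_jet (hs i)).exists_bound_of_continuous (continuous_jet (hφ i))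
    choose M hM using h1
    refine ⟨∑ i, |M i|, fun i y => (hM i y).trans ((le_abs_self _).trans ?_)⟩
    exact Finset.single_le_sum (f := fun i => |M i|) (fun _ _ => abs_nonneg _) (Finset.mem_univ i)
  obtain ⟨M, hM⟩ := hbd
  let K : Set (ℝ × X) := Metric.closedBall 0 (R + 2)
  have hz : ∀ N : ℕ, 1 ≤ N → ∀ i, ∀ y ∉ K, interp R N (φ i) y = 0 := fun N hN i y hy => by
    refine interp_eq_zero hN (hR i) ?_
    rw [mem_closedBall_zero_iff] at hy
    linarith
  have hout : ∀ y : ℝ × X, ¬ |y.1| ≤ R + 2 → y ∉ K := fun y hy h => by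
    rw [mem_closedBall_zero_iff] at h
    exact hy ((norm_fst_le y).trans h)
  have hmain := IsFlag.eventually ha hV (φN := fun N i => interp R N (φ i)) hφ hs
    (fun N i => contDiff_interp (hφ i) R N) (isCompact_closedBall 0 ((R : ℝ) + 2))
    ((Filter.eventually_ge_atTop 1).mono hz) (M := M) ?_ ?_ h
  · obtain ⟨N, hN, hN1⟩ := (hmain.and (Filter.eventually_ge_atTop 1)).exists
    exact ⟨R, N, hN1, hR, hN⟩
  · filter_upwards [Filter.eventually_ge_atTop 1] with N hN i y
    by_cases hy : |y.1| ≤ R + 2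
    · have := norm_jet_interp_sub_le e (hφ i) hN (hR i) hy (J := 0) (ε := M)
        (fun s _ => by rw [sub_zero]; exact hM _ _)
      rwa [sub_zero] at this
    · rw [jet_eq_zero Metric.isClosed_closedBall (hz N hN i) (hout y hy), norm_zero]
      exact (norm_nonneg _).trans (hM i y)
  · intro i y
    by_cases hy : |y.1| ≤ R + 2
    · rw [Metric.tendsto_nhds]
      intro ε hε
      have hc : Continuous fun s : ℝ => jet (consDir e) (φ i) (s, y.2) :=
        (continuous_jet (hφ i)).comp (Continuous.prodMk_left y.2)
      obtain ⟨δ, hδ, hδε⟩ := Metric.continuousAt_iff.1 (hc.continuousAt (x := y.1)) (ε / 2) (half_pos hε)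
      have h3 : Filter.Tendsto (fun N : ℕ => 3 / (N : ℝ)) Filter.atTop (nhds 0) :=
        tendsto_const_div_atTop_nhds_zero_nat 3
      filter_upwards [Filter.eventually_ge_atTop 1, h3.eventually_lt_const hδ] with N hN hN3
      rw [dist_eq_norm]
      refine (norm_jet_interp_sub_le e (hφ i) hN (hR i) hy (ε := ε / 2) fun s hs => ?_).trans_lt
        (by linarith)
      have := hδε (x := s) (by rw [Real.dist_eq]; linarith)
      rw [dist_eq_norm] at this
      exact this.le
    · have h0 : ∀ x ∉ K, φ i x = 0 := fun x hx => hR i x (by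
        rw [mem_closedBall_zero_iff] at hx; linarith)
      rw [jet_eq_zero Metric.isClosed_closedBall h0 (hout y hy)]
      refine tendsto_const_nhds.congr' ?_
      filter_upwards [Filter.eventually_ge_atTop 1] with N hN
      rw [jet_eq_zero Metric.isClosed_closedBall (hz N hN i) (hout y hy)]

end FlagInterpolation

section TransverseMatrix

lemma integral_complex_re {Ω : Type*} [MeasurableSpace Ω] {μ : Measure Ω} {g : Ω → ℂ}
    (hg : Integrable g μ) : ∫ x, (g x).re ∂μ = (∫ x, g x ∂μ).re := integral_re hg

variable {X : Type} [NormedAddCommGroup X] [NormedSpace ℝ X] [MeasureSpace X]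
  {d m M : ℕ}

/-- The sesquilinear form polarizing `jetDensity`. -/
noncomputable def jetPair (a : Fin d → X → ℝ) (V : X → Matrix (Fin m) (Fin m) ℂ) (x : X)
    (j j' : (Fin m → ℂ) × (Fin d → Fin m → ℂ)) : ℂ :=
  ∑ k, star (Complex.I • j.2 k + (a k x : ℂ) • j.1) ⬝ᵥ (Complex.I • j'.2 k + (a k x : ℂ) • j'.1) -
    star j.1 ⬝ᵥ V x *ᵥ j'.1

/-- The matrix of the magnetic form in the family `f`. -/
noncomputable def transMat (e : Fin d → X) (a : Fin d → X → ℝ) (V : X → Matrix (Fin m) (Fin m) ℂ)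
    (f : Fin M → X → Fin m → ℂ) : Matrix (Fin M) (Fin M) ℂ :=
  Matrix.of fun b c => ∫ x, jetPair a V x (jet e (f b) x) (jet e (f c) x)

variable {a : Fin d → X → ℝ} {V : X → Matrix (Fin m) (Fin m) ℂ} {e : Fin d → X}

lemma jetDensity_eq_re (x : X) (j : (Fin m → ℂ) × (Fin d → Fin m → ℂ)) :
    jetDensity a V 0 x j = (jetPair a V x j j).re := by
  simp only [jetDensity, jetPair, vsq_eq_re, qform, Complex.sub_re, Complex.re_sum]
  ring

lemma jetPair_conj (hV : ∀ x, (V x).IsHermitian) (x : X)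
    (j j' : (Fin m → ℂ) × (Fin d → Fin m → ℂ)) :
    (starRingEnd ℂ) (jetPair a V x j j') = jetPair a V x j' j := by
  simp only [jetPair, map_sub, map_sum, star_dotProduct_comm]
  rw [star_mulVec, (hV x).eq, ← dotProduct_mulVec]

lemma jetPair_sum_right {ι : Type*} (s : Finset ι) (x : X) (j : (Fin m → ℂ) × (Fin d → Fin m → ℂ))
    (c : ι → ℂ) (g : ι → (Fin m → ℂ) × (Fin d → Fin m → ℂ)) :
    jetPair a V x j (∑ i ∈ s, c i • g i) = ∑ i ∈ s, c i * jetPair a V x j (g i) := by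
  let L : (Fin m → ℂ) × (Fin d → Fin m → ℂ) →ₗ[ℂ] ℂ :=
    { toFun := jetPair a V x j
      map_add' := fun p q => by
        simp only [jetPair, Prod.snd_add, Prod.fst_add, Pi.add_apply, smul_add, mulVec_add,
          dotProduct_add, Finset.sum_add_distrib]
        ring
      map_smul' := fun r p => by
        simp only [jetPair, Prod.smul_snd, Prod.smul_fst, Pi.smul_apply, smul_comm _ r, mulVec_smul,
          ← smul_add, dotProduct_smul, ← Finset.smul_sum, RingHom.id_apply, ← smul_sub] }
  have h := map_sum L (fun i => c i • g i) s
  simp only [map_smul, smul_eq_mul] at h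
  exact h

lemma jetPair_sum_sum {ι : Type*} (s : Finset ι) (hV : ∀ x, (V x).IsHermitian) (x : X) (c : ι → ℂ)
    (g : ι → (Fin m → ℂ) × (Fin d → Fin m → ℂ)) :
    jetPair a V x (∑ i ∈ s, c i • g i) (∑ i ∈ s, c i • g i)
      = ∑ i ∈ s, ∑ k ∈ s, (starRingEnd ℂ) (c i) * (c k * jetPair a V x (g i) (g k)) := by
  rw [jetPair_sum_right, Finset.sum_comm]
  refine Finset.sum_congr rfl fun k _ => ?_
  rw [← jetPair_conj hV, jetPair_sum_right, map_sum, Finset.mul_sum]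
  refine Finset.sum_congr rfl fun i _ => ?_
  rw [map_mul, jetPair_conj hV]
  ring

lemma continuous_jetPair {T : Type*} [TopologicalSpace T] {α : T → Fin d → X → ℝ}
    {U : T → X → Matrix (Fin m) (Fin m) ℂ} (ha : ∀ k, Continuous fun z : T × X => α z.1 k z.2)
    (hV : Continuous fun z : T × X => U z.1 z.2) {g h : X → (Fin m → ℂ) × (Fin d → Fin m → ℂ)}
    (hg : Continuous g) (hh : Continuous h) :
    Continuous fun z : T × X => jetPair (α z.1) (U z.1) z.2 (g z.2) (h z.2) := by
  unfold jetPair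
  have h1 : ∀ k, ∀ {g : X → (Fin m → ℂ) × (Fin d → Fin m → ℂ)}, Continuous g → Continuous
      fun z : T × X => Complex.I • (g z.2).2 k + (α z.1 k z.2 : ℂ) • (g z.2).1 := fun k g hg => by
    have := ha k
    fun_prop
  have h2 : ∀ {g : X → (Fin m → ℂ) × (Fin d → Fin m → ℂ)}, Continuous g → Continuous
      fun z : T × X => (g z.2).1 := fun hg => by fun_prop
  exact (continuous_finsetSum _ fun k _ => ((h1 k hg).star).dotProduct (h1 k hh)).sub
    (((h2 hg).star).dotProduct (hV.matrix_mulVec (h2 hh)))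

@[simp] lemma jetPair_zero_left (x : X) (j : (Fin m → ℂ) × (Fin d → Fin m → ℂ)) :
    jetPair a V x 0 j = 0 := by simp [jetPair]

variable [BorelSpace X] [IsFiniteMeasureOnCompacts (volume : Measure X)]
  {f : Fin M → X → Fin m → ℂ}

lemma integrable_jetPair (ha : ∀ k, Continuous (a k)) (hV : Continuous V)
    (hf : ∀ b, ContDiff ℝ 1 (f b)) (hs : ∀ b, HasCompactSupport (f b)) (b c : Fin M) :
    Integrable fun x => jetPair a V x (jet e (f b) x) (jet e (f c) x) := by
  have h := (continuous_jetPair (T := Unit) (α := fun _ => a) (U := fun _ => V)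
    (fun k => (ha k).comp continuous_snd) (hV.comp continuous_snd) (continuous_jet (e := e) (hf b))
    (continuous_jet (e := e) (hf c))).comp (Continuous.prodMk_right ())
  exact h.integrable_of_hasCompactSupport
    ((hasCompactSupport_jet (e := e) (hs b)).mono fun x hx h0 => hx (by simp [h0]))

lemma transMat_isHermitian (hVH : ∀ x, (V x).IsHermitian) : (transMat e a V f).IsHermitian := by
  ext b c
  rw [conjTranspose_apply, transMat, of_apply, of_apply, RCLike.star_def, ← integral_conj]
  simp only [jetPair_conj hVH]

lemma qform_transMat (ha : ∀ k, Continuous (a k)) (hV : Continuous V)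
    (hVH : ∀ x, (V x).IsHermitian) (hf : ∀ b, ContDiff ℝ 1 (f b))
    (hs : ∀ b, HasCompactSupport (f b)) (v : Fin M → ℂ) :
    magForm e a V (comb v f) = qform (transMat e a V f) v := by
  have hi := fun b c => integrable_jetPair (e := e) ha hV hf hs b c
  simp only [magForm, jetDensity_eq_re, jet_comb v hf, jetPair_sum_sum _ hVH]
  rw [integral_complex_re, integral_finsetSum, qform, dotProduct]
  · congr 1
    refine Finset.sum_congr rfl fun b _ => ?_
    rw [integral_finsetSum _ fun c _ => ((hi b c).const_mul _).const_mul _, mulVec, dotProduct,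
      Finset.mul_sum]
    refine Finset.sum_congr rfl fun c _ => ?_
    rw [integral_const_mul, integral_const_mul, transMat, of_apply, Pi.star_apply, RCLike.star_def]
    ring
  · exact fun b _ => integrable_finsetSum _ fun c _ => ((hi b c).const_mul _).const_mul _
  · exact integrable_finsetSum _ fun b _ => integrable_finsetSum _ fun c _ =>
      ((hi b c).const_mul _).const_mul _

lemma continuous_integral_of_compact [FiniteDimensional ℝ X] {T : Type*} [TopologicalSpace T] [FirstCountableTopology T]
    [LocallyCompactSpace T] {F : T → X → ℂ} (hF : Continuous fun z : T × X => F z.1 z.2)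
    {K : Set X} (hK : IsCompact K) (h : ∀ t, ∀ x ∉ K, F t x = 0) :
    Continuous fun t => ∫ x, F t x := by
  have : ProperSpace X := FiniteDimensional.proper_real X
  have h1 := continuous_parametric_integral_of_continuous (μ := (volume : Measure X)) (f := F) hF hK
  refine h1.congr fun t => ?_
  exact setIntegral_eq_integral_of_forall_compl_eq_zero fun x hx => h t x hx

lemma continuous_transMat [FiniteDimensional ℝ X] {T : Type*} [TopologicalSpace T] [FirstCountableTopology T]
    [LocallyCompactSpace T] {α : T → Fin d → X → ℝ} {U : T → X → Matrix (Fin m) (Fin m) ℂ}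
    (ha : ∀ k, Continuous fun z : T × X => α z.1 k z.2)
    (hV : Continuous fun z : T × X => U z.1 z.2) (hf : ∀ b, ContDiff ℝ 1 (f b))
    (hs : ∀ b, HasCompactSupport (f b)) : Continuous fun t => transMat e (α t) (U t) f := by
  refine continuous_matrix fun b c => ?_
  refine continuous_integral_of_compact (continuous_jetPair ha hV (continuous_jet (e := e) (hf b))
    (continuous_jet (e := e) (hf c))) (hs b).isCompact fun t x hx => ?_
  rw [jet_eq_zero (isClosed_tsupport _) (fun _ => image_eq_zero_of_notMem_tsupport) hx,
    jetPair_zero_left]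

lemma mass_comb_of_pair (hf : ∀ b, Continuous (f b)) (hs : ∀ b, HasCompactSupport (f b))
    (ho : ∀ b c, pair volume (f b) (f c) = if b = c then 1 else 0) (v : Fin M → ℂ) :
    mass (comb v f) = vsq v := by
  have hi : ∀ b c, Integrable fun x => star (f b x) ⬝ᵥ f c x := fun b c =>
    integrable_pair (mem_sqInt_of_continuous (hf b) (hs b)) (mem_sqInt_of_continuous (hf c) (hs c))
  have h1 : ∀ x, vsq (comb v f x)
      = (∑ b, ∑ c, star (v b) * (v c * (star (f b x) ⬝ᵥ f c x))).re := fun x => by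
    rw [vsq_eq_re, comb, star_sum, sum_dotProduct]
    congr 1
    refine Finset.sum_congr rfl fun b _ => ?_
    rw [dotProduct_sum]
    refine Finset.sum_congr rfl fun c _ => ?_
    rw [star_smul, smul_dotProduct, dotProduct_smul, smul_eq_mul, smul_eq_mul]
  simp only [mass, h1]
  rw [integral_complex_re, integral_finsetSum]
  · have h2 : ∀ b, ∫ x, ∑ c, star (v b) * (v c * (star (f b x) ⬝ᵥ f c x)) = star (v b) * v b := by
      intro b
      rw [integral_finsetSum _ fun c _ => ((hi b c).const_mul _).const_mul _]
      simp only [integral_const_mul]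
      have h3 : ∀ c, ∫ x, star (f b x) ⬝ᵥ f c x = if b = c then 1 else 0 := ho b
      simp [h3]
    simp only [h2]
    rw [vsq_eq_re]; rfl
  · exact fun b _ => integrable_finsetSum _ fun c _ => ((hi b c).const_mul _).const_mul _
  · exact integrable_finsetSum _ fun b _ => integrable_finsetSum _ fun c _ =>
      ((hi b c).const_mul _).const_mul _

end TransverseMatrix

section Lifting

variable {X : Type} [NormedAddCommGroup X] [NormedSpace ℝ X] {d m M : ℕ}

/-- The function with coefficients `w` depending on the first variable in the family `f` of functions
of the second variable. -/
def tensorComb (w : ℝ → Fin M → ℂ) (f : Fin M → X → Fin m → ℂ) (y : ℝ × X) : Fin m → ℂ :=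
  comb (w y.1) f y.2

variable {w : ℝ → Fin M → ℂ} {f : Fin M → X → Fin m → ℂ}

lemma contDiff_tensorComb (hw : ContDiff ℝ 1 w) (hf : ∀ b, ContDiff ℝ 1 (f b)) :
    ContDiff ℝ 1 (tensorComb w f) := by
  have h1 : ∀ b, ContDiff ℝ 1 fun y : ℝ × X => w y.1 b := fun b =>
    ((contDiff_pi.1 hw) b).comp contDiff_fst
  have h2 : ∀ b, ContDiff ℝ 1 fun y : ℝ × X => f b y.2 := fun b => (hf b).comp contDiff_snd
  have h3 : ∀ b, ContDiff ℝ 1 fun y : ℝ × X => w y.1 b • f b y.2 := fun b => (h1 b).smul (h2 b)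
  have h4 : ContDiff ℝ 1 fun y : ℝ × X => ∑ b, w y.1 b • f b y.2 := ContDiff.sum fun b _ => h3 b
  exact h4

lemma hasCompactSupport_tensorComb (hw : HasCompactSupport w) (hs : ∀ b, HasCompactSupport (f b)) :
    HasCompactSupport (tensorComb w f) := by
  refine HasCompactSupport.intro (K := tsupport w ×ˢ ⋃ b, tsupport (f b))
    (hw.isCompact.prod (isCompact_iUnion hs)) fun y hy => ?_
  rw [Set.mem_prod, not_and_or] at hy
  rw [tensorComb, comb]
  refine Finset.sum_eq_zero fun b _ => ?_
  rcases hy with hy | hy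
  · rw [image_eq_zero_of_notMem_tsupport hy]; simp
  · rw [image_eq_zero_of_notMem_tsupport fun h => hy (Set.mem_iUnion.2 ⟨b, h⟩), smul_zero]

variable [MeasureSpace X]

/-- The matrix of multiplication by `q` in the family `f`. -/
noncomputable def mulMat (q : X → ℝ) (f : Fin M → X → Fin m → ℂ) : Matrix (Fin M) (Fin M) ℂ :=
  Matrix.of fun b c => pair volume (f b) fun x => (q x : ℂ) • f c x

lemma mulMat_isHermitian (q : X → ℝ) : (mulMat q f).IsHermitian := by
  ext b c
  rw [conjTranspose_apply, mulMat, of_apply, of_apply, RCLike.star_def, pair_conj]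
  simp [pair]

lemma jet_tensorComb (e : Fin d → X) (hw : ContDiff ℝ 1 w) (hf : ∀ b, ContDiff ℝ 1 (f b)) (t : ℝ)
    (x : X) : jet (consDir e) (tensorComb w f) (t, x)
      = (comb (w t) f x, Fin.cons (comb (deriv w t) f x) (jet e (comb (w t) f) x).2) := by
  have hw' : ∀ b, HasDerivAt (fun t => w t b) (deriv w t b) t := fun b =>
    hasDerivAt_pi.1 ((hw.differentiable one_ne_zero) t).hasDerivAt b
  have hf' : ∀ b, HasFDerivAt (f b) (fderiv ℝ (f b) x) x := fun b =>
    (((hf b).differentiable one_ne_zero) x).hasFDerivAt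
  have h1 : ∀ b, HasFDerivAt (fun y : ℝ × X => w y.1 b • f b y.2) _ (t, x) := fun b =>
    (HasFDerivAt.comp (g := fun t => w t b) (t, x) (hw' b).hasFDerivAt hasFDerivAt_fst).fun_smul
      (HasFDerivAt.comp (g := f b) (t, x) (hf' b) hasFDerivAt_snd)
  have h2 : HasFDerivAt (fun y : ℝ × X => ∑ b, w y.1 b • f b y.2) _ (t, x) :=
    HasFDerivAt.fun_sum fun b _ => h1 b
  rw [jet, show tensorComb w f = fun y : ℝ × X => ∑ b, w y.1 b • f b y.2 from rfl, h2.fderiv]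
  refine Prod.ext rfl (funext fun k => ?_)
  rw [jet_comb _ hf]
  refine Fin.cases ?_ (fun k => ?_) k
  · simp [consDir, comb, _root_.sum_apply]
  · simp [consDir, jet, Prod.snd_sum, _root_.sum_apply]

variable [BorelSpace X] [IsFiniteMeasureOnCompacts (volume : Measure X)]

lemma pair_comb (ho : ∀ b c, pair volume (f b) (f c) = if b = c then 1 else 0)
    (hf : ∀ b, Continuous (f b)) (hs : ∀ b, HasCompactSupport (f b)) {q : X → ℝ}
    (hq : Continuous q) (v w : Fin M → ℂ) (b : Fin M) :
    pair volume (f b) (fun x => Complex.I • comb v f x + (q x : ℂ) • comb w f x)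
      = (Complex.I • v + mulMat q f *ᵥ w) b := by
  have hm : ∀ b, f b ∈ sqInt volume m := fun b => mem_sqInt_of_continuous (hf b) (hs b)
  have hm' : ∀ b, (fun x => (q x : ℂ) • f b x) ∈ sqInt volume m := fun b => by
    have := hf b
    exact mem_sqInt_of_continuous (by fun_prop) ((hs b).mono fun x hx h0 => hx (by simp [h0]))
  have h1 : ∀ x, star (f b x) ⬝ᵥ (Complex.I • comb v f x + (q x : ℂ) • comb w f x)
      = (∑ c, Complex.I * (v c * (star (f b x) ⬝ᵥ f c x))) +
        ∑ c, w c * (star (f b x) ⬝ᵥ (q x : ℂ) • f c x) := fun x => by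
    simp only [comb, dotProduct_add, dotProduct_smul, dotProduct_sum, smul_eq_mul, Finset.mul_sum]
    congr 1
    refine Finset.sum_congr rfl fun c _ => ?_
    ring
  have h3 : ∀ c, ∫ x, star (f b x) ⬝ᵥ f c x = if b = c then 1 else 0 := ho b
  rw [pair]
  simp only [h1]
  rw [integral_add, integral_finsetSum, integral_finsetSum]
  · simp only [integral_const_mul, h3]
    simp [mulMat, pair, mulVec, dotProduct, mul_comm]
  · exact fun c _ => (integrable_pair (hm b) (hm' c)).const_mul _
  · exact fun c _ => ((integrable_pair (hm b) (hm c)).const_mul _).const_mul _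
  · exact integrable_finsetSum _ fun c _ => ((integrable_pair (hm b) (hm c)).const_mul _).const_mul _
  · exact integrable_finsetSum _ fun c _ => (integrable_pair (hm b) (hm' c)).const_mul _

variable [FiniteDimensional ℝ X]

lemma continuous_mulMat {q : ℝ × X → ℝ} (hq : Continuous q) (hf : ∀ b, Continuous (f b))
    (hs : ∀ b, HasCompactSupport (f b)) : Continuous fun t => mulMat (fun x => q (t, x)) f := by
  refine continuous_matrix fun b c => ?_
  have h1 := hf b
  have h2 := hf c
  refine continuous_integral_of_compact (F := fun t x => star (f b x) ⬝ᵥ (q (t, x) : ℂ) • f c x) ?_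
    (hs b).isCompact fun t x hx => ?_
  · have h3 : Continuous fun z : ℝ × X => (q (z.1, z.2) : ℂ) • f c z.2 := by fun_prop
    have h4 : Continuous fun z : ℝ × X => star (f b z.2) := by fun_prop
    exact h4.dotProduct h3
  · rw [image_eq_zero_of_notMem_tsupport hx, star_zero, zero_dotProduct]

variable [SecondCountableTopology X] [SigmaFinite (volume : Measure X)]

lemma mass_tensorComb (hw : ContDiff ℝ 1 w) (hws : HasCompactSupport w)
    (hf : ∀ b, ContDiff ℝ 1 (f b)) (hs : ∀ b, HasCompactSupport (f b))
    (ho : ∀ b c, pair volume (f b) (f c) = if b = c then 1 else 0) :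
    mass (tensorComb w f) = mass w := by
  have h1 : Integrable fun y => vsq (tensorComb w f y) :=
    (contDiff_tensorComb hw hf).continuous.vsq'.integrable_of_hasCompactSupport
      ((hasCompactSupport_tensorComb hws hs).mono fun x hx h0 => hx (by simp [h0]))
  rw [mass, Measure.volume_eq_prod, integral_prod _ h1, mass]
  refine integral_congr_ae (Filter.Eventually.of_forall fun t => ?_)
  exact mass_comb_of_pair (fun b => (hf b).continuous) hs ho (w t)

lemma gaugeForm_le_magForm {e : Fin d → X} {a : Fin (d + 1) → ℝ × X → ℝ}
    {V : ℝ × X → Matrix (Fin m) (Fin m) ℂ} (ha : ∀ k, Continuous (a k)) (hV : Continuous V)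
    (hVH : ∀ y, (V y).IsHermitian) (hw : ContDiff ℝ 1 w) (hws : HasCompactSupport w)
    (hf : ∀ b, ContDiff ℝ 1 (f b)) (hs : ∀ b, HasCompactSupport (f b))
    (ho : ∀ b c, pair volume (f b) (f c) = if b = c then 1 else 0) :
    gaugeForm (fun t => mulMat (fun x => a 0 (t, x)) f)
      (fun t => matPos (-transMat e (fun k x => a k.succ (t, x)) (fun x => V (t, x)) f)) w
      ≤ magForm (consDir e) a V (tensorComb w f) := by
  have hfc := fun b => (hf b).continuous
  have hA := continuous_mulMat (ha 0) hfc hs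
  have hH : Continuous fun t => transMat e (fun k x => a k.succ (t, x)) (fun x => V (t, x)) f :=
    continuous_transMat (fun k => (ha k.succ).comp (continuous_fst.prodMk continuous_snd))
      (hV.comp (continuous_fst.prodMk continuous_snd)) hf hs
  have hHH : ∀ t, (-transMat e (fun k x => a k.succ (t, x)) (fun x => V (t, x)) f).IsHermitian :=
    fun t => (transMat_isHermitian fun x => hVH (t, x)).neg
  have hW : Continuous fun t => matPos (-transMat e (fun k x => a k.succ (t, x)) (fun x => V (t, x)) f) :=
    continuous_cfc_matrix (by fun_prop) hH.neg hHH
  have hwc := hw.continuous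
  have hwd := hw.continuous_deriv le_rfl
  have hwds := hws.deriv
  have h_int := integrable_jetDensity (e := consDir e) ha hV 0 (contDiff_tensorComb hw hf)
    (hasCompactSupport_tensorComb hws hs)
  rw [Measure.volume_eq_prod] at h_int
  have hi1 : Integrable fun t => vsq (Complex.I • deriv w t + mulMat (fun x => a 0 (t, x)) f *ᵥ w t) := by
    have h1 : Continuous fun t => mulMat (fun x => a 0 (t, x)) f *ᵥ w t := hA.matrix_mulVec hwc
    refine (by fun_prop : Continuous _).integrable_of_hasCompactSupport ?_
    refine HasCompactSupport.intro hws.isCompact fun t ht => ?_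
    rw [image_eq_zero_of_notMem_tsupport ht,
      image_eq_zero_of_notMem_tsupport fun h => ht (tsupport_deriv_subset h)]
    simp
  have hi2 : Integrable fun t => qform (matPos (-transMat e (fun k x => a k.succ (t, x))
      (fun x => V (t, x)) f)) (w t) :=
    (hW.qform' hwc).integrable_of_hasCompactSupport (hws.mono fun x hx h0 => hx (by simp [h0]))
  rw [gaugeForm, ← integral_sub hi1 hi2, magForm, Measure.volume_eq_prod, integral_prod _ h_int]
  refine integral_mono (hi1.sub hi2) h_int.integral_prod_left fun t => ?_
  have hat : Continuous fun x => a 0 (t, x) := (ha 0).comp (Continuous.prodMk_right t)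
  have hαt : ∀ k : Fin d, Continuous fun x => a k.succ (t, x) := fun k =>
    (ha k.succ).comp (Continuous.prodMk_right t)
  have hVt : Continuous fun x => V (t, x) := hV.comp (Continuous.prodMk_right t)
  have hc : ∀ v, ContDiff ℝ 1 (comb v f) := fun v => contDiff_comb v hf
  have hcs : ∀ v, HasCompactSupport (comb v f) := fun v => hasCompactSupport_comb hs v
  let g : X → Fin m → ℂ := fun x => Complex.I • comb (deriv w t) f x + (a 0 (t, x) : ℂ) • comb (w t) f x
  have hgc : Continuous g := by
    have h1 := (hc (deriv w t)).continuous
    have h2 := (hc (w t)).continuous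
    fun_prop
  have hgs : HasCompactSupport g := by
    refine HasCompactSupport.intro ((hcs (deriv w t)).isCompact.union (hcs (w t)).isCompact)
      fun x hx => ?_
    rw [Set.mem_union, not_or] at hx
    simp only [g, image_eq_zero_of_notMem_tsupport hx.1, image_eq_zero_of_notMem_tsupport hx.2,
      smul_zero, add_zero]
  have h1 : ∀ x, jetDensity a V 0 (t, x) (jet (consDir e) (tensorComb w f) (t, x))
      = vsq (g x) + jetDensity (fun k x => a k.succ (t, x)) (fun x => V (t, x)) 0 x
        (jet e (comb (w t) f) x) := fun x => by
    rw [jet_tensorComb e hw hf]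
    simp only [jetDensity, Fin.sum_univ_succ, Fin.cons_zero, Fin.cons_succ, g, jet]
    ring
  have h2 : Integrable fun x => vsq (g x) :=
    hgc.vsq'.integrable_of_hasCompactSupport (hgs.mono fun x hx h0 => hx (by simp [h0]))
  have h3 := bessel_pair (fun b => mem_sqInt_of_continuous (hfc b) (hs b)) ho
    (mem_sqInt_of_continuous hgc hgs)
  have h4 := qform_transMat (e := e) hαt hVt (fun x => hVH (t, x)) hf hs (w t)
  have h5 := qform_nonneg (matPos_sub_posSemidef (hHH t)) (w t)
  rw [qform_sub] at h5
  have h6 : ∀ (B : Matrix (Fin M) (Fin M) ℂ) v, qform (-B) v = -qform B v := fun B v => by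
    simp [qform, neg_mulVec]
  rw [h6] at h5
  simp only [h1]
  rw [integral_add h2 (integrable_jetDensity hαt hVt 0 (hc _) (hcs _))]
  have h7 : ∑ b, Complex.normSq (pair volume (f b) g)
      = vsq (Complex.I • deriv w t + mulMat (fun x => a 0 (t, x)) f *ᵥ w t) := by
    simp only [g, pair_comb ho hfc hs hat]; rfl
  rw [h7] at h3
  rw [magForm] at h4
  rw [h4]
  linarith

end Lifting

section LiftingBound

variable {X : Type} [NormedAddCommGroup X] [NormedSpace ℝ X] [MeasureSpace X]
  [BorelSpace X] [IsFiniteMeasureOnCompacts (volume : Measure X)] {d m M : ℕ}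

lemma comb_mulVec {n : ℕ} (U : Matrix (Fin M) (Fin n) ℂ) (c : Fin n → ℂ) (f : Fin M → X → Fin m → ℂ) :
    comb c (fun i => comb (fun b => U b i) f) = comb (U *ᵥ c) f := by
  funext x
  simp only [comb, Finset.smul_sum, mulVec, dotProduct, Finset.sum_smul, smul_smul]
  rw [Finset.sum_comm]
  simp only [mul_comm]

lemma qform_diagonal (l : Fin M → ℝ) (c : Fin M → ℂ) :
    qform (diagonal fun i => (l i : ℂ)) c = ∑ i, l i * Complex.normSq (c i) := by
  simp only [qform, mulVec_diagonal, dotProduct, Complex.re_sum, Pi.star_apply, RCLike.star_def]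
  refine Finset.sum_congr rfl fun i _ => ?_
  rw [mul_left_comm, ← Complex.normSq_eq_conj_mul_self, ← Complex.ofReal_mul, Complex.ofReal_re]

lemma sum_eq_sum_max_rpow {ι : Type*} [Fintype ι] {q : ℝ} (hq : 0 < q) (l : ι → ℝ) :
    ∑ i : {i // 0 < l i}, l i ^ q = ∑ i, max (l i) 0 ^ q := by
  rw [← Finset.sum_filter_of_ne (s := Finset.univ) (p := fun i => 0 < l i) (fun i _ hi => by
    by_contra h
    exact hi (by rw [max_eq_right (not_lt.1 h), Real.zero_rpow hq.ne'])),
    Finset.sum_subtype (p := fun i => 0 < l i) _ (by simp)]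
  exact Finset.sum_congr rfl fun i _ => by rw [max_eq_left i.2.le]

lemma LTBound.trPow_transMat_le {e : Fin d → X} {q p C : ℝ} (hq : 0 < q) (h : LTBound e q p C)
    {a : Fin d → X → ℝ} {V : X → Matrix (Fin m) (Fin m) ℂ} (ha : ∀ k, Continuous (a k))
    (hV : Continuous V) (hVp : ∀ x, (V x).PosSemidef) (hVs : HasCompactSupport V)
    {f : Fin M → X → Fin m → ℂ} (hf : ∀ b, ContDiff ℝ 1 (f b)) (hs : ∀ b, HasCompactSupport (f b))
    (ho : ∀ b c, pair volume (f b) (f c) = if b = c then 1 else 0) :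
    trPow q (matPos (-transMat e a V f)) ≤ C * ∫ x, trPow p (V x) := by
  have hB : (-transMat e a V f).IsHermitian := (transMat_isHermitian fun x => (hVp x).1).neg
  let U : Matrix (Fin M) (Fin M) ℂ := hB.eigenvectorUnitary
  have hU : Uᴴ * U = 1 := by
    have := Unitary.coe_star_mul_self hB.eigenvectorUnitary
    rwa [star_eq_conjTranspose] at this
  have hUU : U * Uᴴ = 1 := mul_eq_one_comm.1 hU
  have hdiag : Uᴴ * (-transMat e a V f) * U = diagonal fun i => (hB.eigenvalues i : ℂ) := by
    have h1 := hB.spectral_theorem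
    rw [Unitary.conjStarAlgAut_apply] at h1
    have h2 : -transMat e a V f = U * (diagonal fun i => (hB.eigenvalues i : ℂ)) * Uᴴ := h1
    calc Uᴴ * (-transMat e a V f) * U
        = Uᴴ * (U * (diagonal fun i => (hB.eigenvalues i : ℂ)) * Uᴴ) * U :=
          congrArg (fun B => Uᴴ * B * U) h2
      _ = (Uᴴ * U) * (diagonal fun i => (hB.eigenvalues i : ℂ)) * (Uᴴ * U) := by
          simp only [Matrix.mul_assoc]
      _ = _ := by rw [hU, Matrix.one_mul, Matrix.mul_one]
  let φ : Fin M → X → Fin m → ℂ := fun i => comb (fun b => U b i) f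
  have hδ : ∀ δ : ℝ, 0 < δ → ∑ i, max (hB.eigenvalues i - δ) 0 ^ q ≤ C * ∫ x, trPow p (V x) := by
    intro δ hδ
    have hflag : IsFlag (magForm e a V) mass φ (fun i => hB.eigenvalues i - δ) := by
      intro i c hc hcj
      rw [comb_mulVec, qform_transMat ha hV (fun x => (hVp x).1) hf hs,
        mass_comb_of_pair (fun b => (hf b).continuous) hs ho, vsq_mulVec_of_unitary hU]
      have h1 : qform (transMat e a V f) (U *ᵥ c)
          = -∑ i, hB.eigenvalues i * Complex.normSq (c i) := by
        rw [← qform_diagonal, ← hdiag, qform_conj]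
        simp [qform, neg_mulVec]
      rw [h1, vsq, Finset.mul_sum, neg_add_eq_sub, ← Finset.sum_sub_distrib]
      obtain ⟨j, hj⟩ := Function.ne_iff.1 hc
      have key : ∀ j, c j ≠ 0 → (hB.eigenvalues i - δ) * Complex.normSq (c j)
          - hB.eigenvalues j * Complex.normSq (c j) < 0 := fun j hj => by
        have h2 : ¬ hB.eigenvalues j - δ < hB.eigenvalues i - δ := fun h => hj (hcj j h)
        have h3 := Complex.normSq_pos.2 hj
        nlinarith
      refine Finset.sum_neg' (fun j _ => ?_) ⟨j, Finset.mem_univ _, key j hj⟩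
      by_cases hj : c j = 0
      · simp [hj]
      · exact (key j hj).le
    rw [← sum_eq_sum_max_rpow hq]
    exact h m a V ha hV hVp hVs {i // 0 < hB.eigenvalues i - δ} (fun i => φ i) _ (fun i => i.2)
      (fun i => contDiff_comb _ hf) (fun i => hasCompactSupport_comb hs _) (hflag.subtype 0)
  have hpos : trPow q (matPos (-transMat e a V f)) = ∑ i, max (hB.eigenvalues i) 0 ^ q := by
    rw [trPow, trFun_matPos (continuous_max_rpow hq.le) hB, ← trPow_eq_sum q hB, trPow]
    simp
  rw [hpos]
  have hcont : Continuous fun δ : ℝ => ∑ i, max (hB.eigenvalues i - δ) 0 ^ q :=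
    continuous_finsetSum _ fun i _ => (continuous_max_rpow hq.le).comp (continuous_const.sub continuous_id)
  have hlim := (hcont.tendsto 0).mono_left (nhdsWithin_le_nhds (s := Set.Ioi 0))
  simp only [sub_zero] at hlim
  exact le_of_tendsto hlim (Filter.eventually_of_mem self_mem_nhdsWithin hδ)

variable [FiniteDimensional ℝ X] [SecondCountableTopology X] [SigmaFinite (volume : Measure X)]
  [(volume : Measure X).IsOpenPosMeasure]

lemma exists_tensorComb {ι : Type} [Finite ι] {R N : ℕ} (hN : 1 ≤ N) {φ : ι → ℝ × X → Fin m → ℂ}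
    (hφ : ∀ i, ContDiff ℝ 1 (φ i)) (hs : ∀ i, HasCompactSupport (φ i)) :
    ∃ (M : ℕ) (f : Fin M → X → Fin m → ℂ) (w : ι → ℝ → Fin M → ℂ), (∀ b, ContDiff ℝ 1 (f b)) ∧
      (∀ b, HasCompactSupport (f b)) ∧
      (∀ b c, pair volume (f b) (f c) = if b = c then 1 else 0) ∧ (∀ i, ContDiff ℝ 1 (w i)) ∧
      (∀ i, HasCompactSupport (w i)) ∧ ∀ i, interp R N (φ i) = tensorComb (w i) f := by
  let S : Finset ℤ := Finset.Icc (-(N * (R + 4) : ℤ)) (N * (R + 4))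
  let g : ι × S → X → Fin m → ℂ := fun z x => φ z.1 (z.2.1 / N, x)
  have hg : ∀ z, ContDiff ℝ 1 (g z) := fun z => (hφ z.1).comp (contDiff_const.prodMk contDiff_id)
  have hgs : ∀ z, HasCompactSupport (g z) := fun z => by
    refine HasCompactSupport.intro ((hs z.1).isCompact.image continuous_snd) fun x hx => ?_
    exact image_eq_zero_of_notMem_tsupport (f := φ z.1) (x := (z.2.1 / N, x))
      fun h => hx ⟨_, h, rfl⟩
  obtain ⟨M, f, hf, hfs, ho, α, hα⟩ := exists_orthonormal_test hg hgs
  have hN' : (0 : ℝ) < N := by exact_mod_cast hN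
  have hsp : ∀ k : ℤ, ContDiff ℝ 1 fun t : ℝ => spline (N * t - k) := fun k =>
    contDiff_spline.comp ((contDiff_const.mul contDiff_id).sub contDiff_const)
  have hsps : ∀ k : ℤ, HasCompactSupport fun t : ℝ => spline (N * t - k) := fun k => by
    refine HasCompactSupport.intro (isCompact_Icc (a := ((k : ℝ) - 2) / N) (b := (k + 2) / N))
      fun t ht => spline_eq_zero ?_
    by_contra! h
    rw [abs_lt] at h
    refine ht ⟨?_, ?_⟩
    · rw [div_le_iff₀ hN']; linarith
    · rw [le_div_iff₀ hN']; linarith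
  refine ⟨M, f, fun i t => ∑ k : S, spline (N * t - k) • α (i, k), hf, hfs, ho, fun i => ?_,
    fun i => ?_, fun i => ?_⟩
  · have h1 : ∀ k : S, ContDiff ℝ 1 fun t : ℝ => spline (N * t - k) • α (i, k) := fun k =>
      (hsp k).smul contDiff_const
    exact ContDiff.sum fun k _ => h1 k
  · refine HasCompactSupport.intro (isCompact_iUnion fun k : S => hsps k) fun t ht => ?_
    refine Finset.sum_eq_zero fun k _ => ?_
    rw [image_eq_zero_of_notMem_tsupport fun h => ht (Set.mem_iUnion.2 ⟨k, h⟩), zero_smul]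
  · funext y
    have h1 : ∀ k : S, φ i (k / N, y.2) = comb (α (i, k)) f y.2 := fun k => congrFun (hα (i, k)) y.2
    rw [interp, ← Finset.sum_coe_sort]
    simp only [h1, tensorComb, comb, Finset.smul_sum, Finset.sum_apply, Pi.smul_apply,
      Finset.sum_smul]
    rw [Finset.sum_comm]
    simp only [smul_assoc]
    rfl

lemma comb_tensorComb {ι : Type} [Fintype ι] (c : ι → ℂ) (w : ι → ℝ → Fin M → ℂ)
    (f : Fin M → X → Fin m → ℂ) :
    comb c (fun i => tensorComb (w i) f) = tensorComb (comb c w) f := by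
  funext y
  simp only [comb, tensorComb, Finset.smul_sum, Finset.sum_apply, Pi.smul_apply, Finset.sum_smul,
    smul_assoc]
  rw [Finset.sum_comm]

/-- Lifting the Lieb–Thirring bound from dimension one and `X` to `ℝ × X`. -/
theorem LTBound.lift {e : Fin d → X} {γ p C₁ C₂ : ℝ} (hγ : 0 ≤ γ) (hp : 0 < p) (hC : 0 ≤ C₁)
    (h₁ : LT1 γ C₁) (h₂ : LTBound e (γ + 1 / 2) p C₂) : LTBound (consDir e) γ p (C₁ * C₂) := by
  intro m a V ha hV hVp hVs ι _ φ E hE hφ hs hflag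
  obtain ⟨R, N, hN, -, hflag⟩ := hflag.exists_interp ha hV hφ hs
  obtain ⟨M, f, w, hf, hfs, ho, hw, hws, he⟩ := exists_tensorComb (R := R) hN hφ hs
  rw [funext he] at hflag
  have hq : 0 < γ + 1 / 2 := by linarith
  let H : ℝ → Matrix (Fin M) (Fin M) ℂ := fun t =>
    transMat e (fun k x => a k.succ (t, x)) (fun x => V (t, x)) f
  have hfc := fun b => (hf b).continuous
  have hA : Continuous fun t => mulMat (fun x => a 0 (t, x)) f := continuous_mulMat (ha 0) hfc hfs
  have hH : Continuous H :=
    continuous_transMat (fun k => (ha k.succ).comp (continuous_fst.prodMk continuous_snd))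
      (hV.comp (continuous_fst.prodMk continuous_snd)) hf hfs
  have hHH : ∀ t, (-H t).IsHermitian :=
    fun t => (transMat_isHermitian fun x => (hVp (t, x)).1).neg
  have hW : Continuous fun t => matPos (-H t) := continuous_cfc_matrix (by fun_prop) hH.neg hHH
  have hat : ∀ t (k : Fin d), Continuous fun x => a k.succ (t, x) := fun t k =>
    (ha k.succ).comp (Continuous.prodMk_right t)
  have hVt : ∀ t, Continuous fun x => V (t, x) := fun t => hV.comp (Continuous.prodMk_right t)
  have hVts : ∀ t, HasCompactSupport fun x => V (t, x) := fun t => by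
    refine HasCompactSupport.intro (hVs.isCompact.image continuous_snd) fun x hx => ?_
    exact image_eq_zero_of_notMem_tsupport fun h => hx ⟨_, h, rfl⟩
  have hWs : HasCompactSupport fun t => matPos (-H t) := by
    refine HasCompactSupport.intro (hVs.isCompact.image continuous_fst) fun t ht => ?_
    have hz : ∀ x, V (t, x) = 0 := fun x =>
      image_eq_zero_of_notMem_tsupport fun h => ht ⟨_, h, rfl⟩
    refine matPos_eq_zero ?_
    rw [neg_neg]
    refine PosSemidef.of_dotProduct_mulVec_nonneg (by simpa using (hHH t).neg) fun v => ?_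
    have h1 := qform_transMat (e := e) (hat t) (hVt t) (fun x => (hVp (t, x)).1) hf hfs v
    have h2 : 0 ≤ qform (H t) v := by
      rw [← h1]
      refine integral_nonneg fun x => ?_
      simp only [jetDensity, hz, qform, zero_mulVec, dotProduct_zero, Complex.zero_re, Pi.zero_apply]
      have := Finset.sum_nonneg fun (k : Fin d) (_ : k ∈ Finset.univ) =>
        vsq_nonneg (Complex.I • (jet e (comb v f) x).2 k + (a k.succ (t, x) : ℂ) • (jet e (comb v f) x).1)
      linarith
    have h3 : (starRingEnd ℂ) (star v ⬝ᵥ H t *ᵥ v) = star v ⬝ᵥ H t *ᵥ v := by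
      rw [star_dotProduct_comm, star_mulVec, ← dotProduct_mulVec,
        show (H t)ᴴ = H t by simpa using (hHH t).neg.eq]
    rw [Complex.le_def]
    exact ⟨h2, (Complex.conj_eq_iff_im.1 h3).symm⟩
  have hmain := h₁ M (fun t => mulMat (fun x => a 0 (t, x)) f) (fun t => matPos (-H t)) hA
    (fun t => mulMat_isHermitian _) hW (fun t => matPos_posSemidef (hHH t)) hWs ι w E hE hw hws ?_
  · refine hmain.trans ?_
    rw [mul_assoc]
    refine mul_le_mul_of_nonneg_left ?_ hC
    have hi := integrable_trPow (μ := (volume : Measure (ℝ × X))) hp hV (fun y => (hVp y).1) hVs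
    rw [Measure.volume_eq_prod] at hi
    rw [Measure.volume_eq_prod, integral_prod _ hi, ← integral_const_mul]
    refine integral_mono (integrable_trPow hq hW (fun t => (matPos_posSemidef (hHH t)).1) hWs)
      (hi.integral_prod_left.const_mul _) fun t => ?_
    exact h₂.trPow_transMat_le hq (hat t) (hVt t) (fun x => hVp (t, x)) (hVts t) hf hfs ho
  · intro i c hc hcj
    have h1 := hflag i c hc hcj
    have hcw : ContDiff ℝ 1 (comb c w) := contDiff_comb c hw
    have hcs : HasCompactSupport (comb c w) := hasCompactSupport_comb hws c
    rw [comb_tensorComb, mass_tensorComb hcw hcs hf hfs ho] at h1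
    have h2 := gaugeForm_le_magForm (e := e) ha hV (fun y => (hVp y).1) hcw hcs hf hfs ho
    linarith

end LiftingBound

section Dimensions

variable {X Y : Type} [NormedAddCommGroup X] [NormedSpace ℝ X] [MeasureSpace X] [BorelSpace X]
  [NormedAddCommGroup Y] [NormedSpace ℝ Y] [MeasureSpace Y] [BorelSpace Y]
  [IsFiniteMeasureOnCompacts (volume : Measure Y)] {d : ℕ}

/-- Transport of Lieb–Thirring bounds along measure preserving linear equivalences. -/
lemma LTBound.transport {e : Fin d → X} {γ p C : ℝ} (T : Y ≃L[ℝ] X) (hT : MeasurePreserving T)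
    (h : LTBound e γ p C) : LTBound (fun k => T.symm (e k)) γ p C := by
  intro m a V ha hV hVp hVs ι _ φ E hE hφ hs hflag
  have h_int : ∀ g : Y → ℝ, ∫ x, g (T.symm x) = ∫ y, g y := fun g => by
    rw [← hT.integral_comp T.toHomeomorph.measurableEmbedding (fun x => g (T.symm x))]
    simp
  rw [← h_int]
  have hsupp : ∀ {Z : Type} [AddGroup Z] {g : Y → Z}, HasCompactSupport g →
      HasCompactSupport fun x => g (T.symm x) := fun hg =>
    hg.comp_homeomorph T.symm.toHomeomorph
  refine h m (fun k x => a k (T.symm x)) (fun x => V (T.symm x))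
    (fun k => (ha k).comp T.symm.continuous) (hV.comp T.symm.continuous) (fun x => hVp _) (hsupp hVs)
    ι (fun i x => φ i (T.symm x)) E hE (fun i => (hφ i).comp T.symm.contDiff) (fun i => hsupp (hs i))
    fun i c hc hcj => ?_
  have h1 := hflag i c hc hcj
  have h2 : ContDiff ℝ 1 (comb c φ) := contDiff_comb c hφ
  have h3 : comb c (fun i x => φ i (T.symm x)) = fun x => comb c φ (T.symm x) := rfl
  have h4 : ∀ x, jet e (fun x => comb c φ (T.symm x)) x
      = jet (fun k => T.symm (e k)) (comb c φ) (T.symm x) := fun x => by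
    have h5 := (((h2.differentiable one_ne_zero) (T.symm x)).hasFDerivAt).comp x
      (T.symm.hasFDerivAt (x := x))
    rw [jet, show (fun x => comb c φ (T.symm x)) = comb c φ ∘ T.symm from rfl, h5.fderiv]
    rfl
  have h6 : magForm e (fun k x => a k (T.symm x)) (fun x => V (T.symm x))
      (fun x => comb c φ (T.symm x)) = magForm (fun k => T.symm (e k)) a V (comb c φ) := by
    rw [magForm, magForm, ← h_int]
    simp only [h4, jetDensity]
  have h7 : mass (fun x => comb c φ (T.symm x)) = mass (comb c φ) := by
    rw [mass, mass, ← h_int]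
  rwa [h3, h6, h7]

lemma LT1.toLTBound {γ C : ℝ} (h : LT1 γ C) :
    LTBound (fun _ : Fin 1 => (1 : ℝ)) γ (γ + 1 / 2) C := by
  intro m a V ha hV hVp hVs ι _ φ E hE hφ hs hflag
  have hA : Continuous fun x => (a 0 x : ℂ) • (1 : Matrix (Fin m) (Fin m) ℂ) := by
    have := ha 0
    fun_prop
  refine h m (fun x => (a 0 x : ℂ) • 1) V hA (fun x => ?_) hV hVp hVs ι φ E hE hφ hs
    fun i c hc hcj => ?_
  · rw [IsHermitian, conjTranspose_smul, conjTranspose_one]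
    simp
  · have h1 := hflag i c hc hcj
    have h2 : ContDiff ℝ 1 (comb c φ) := contDiff_comb c hφ
    have h3 : HasCompactSupport (comb c φ) := hasCompactSupport_comb hs c
    have h4 := h2.continuous
    have h5 := h2.continuous_deriv le_rfl
    have h6 := ha 0
    have h7 : Integrable fun x => vsq (Complex.I • deriv (comb c φ) x + (a 0 x : ℂ) • comb c φ x) := by
      refine (by fun_prop : Continuous _).integrable_of_hasCompactSupport ?_
      refine HasCompactSupport.intro h3.isCompact fun t ht => ?_
      rw [image_eq_zero_of_notMem_tsupport ht,
        image_eq_zero_of_notMem_tsupport fun h => ht (tsupport_deriv_subset h)]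
      simp
    have h8 : Integrable fun x => qform (V x) (comb c φ x) :=
      (hV.qform' h4).integrable_of_hasCompactSupport (h3.mono fun x hx h0 => hx (by simp [h0]))
    have h9 : magForm (fun _ : Fin 1 => (1 : ℝ)) a V (comb c φ)
        = gaugeForm (fun x => (a 0 x : ℂ) • 1) V (comb c φ) := by
      simp only [gaugeForm, smul_mulVec, one_mulVec]
      rw [← integral_sub h7 h8, magForm]
      refine integral_congr_ae (Filter.Eventually.of_forall fun x => ?_)
      simp [jetDensity, jet]
    rwa [← h9]

end Dimensions

section Constants

lemma Lcl_pos {γ : ℝ} (hγ : 0 < γ) (d : ℕ) : 0 < Lcl γ d := by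
  have h1 := Real.Gamma_pos_of_pos (show 0 < γ + 1 by linarith)
  have h2 := Real.Gamma_pos_of_pos (show 0 < γ + d / 2 + 1 by positivity)
  have := Real.pi_pos
  rw [Lcl]
  positivity

lemma Lcl_mul {γ : ℝ} (hγ : 0 < γ) (d : ℕ) : Lcl γ 1 * Lcl (γ + 1 / 2) d = Lcl γ (d + 1) := by
  have h1 := Real.Gamma_pos_of_pos (show 0 < γ + 1 / 2 + 1 by linarith)
  have h3 := Real.pi_pos
  have h4 : Real.pi ^ (((d + 1 : ℕ) : ℝ) / 2) = Real.pi ^ (((1 : ℕ) : ℝ) / 2) * Real.pi ^ ((d : ℝ) / 2) := by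
    rw [← Real.rpow_add h3]
    congr 1
    push_cast
    ring
  have h5 : γ + ((d + 1 : ℕ) : ℝ) / 2 + 1 = γ + 1 / 2 + d / 2 + 1 := by push_cast; ring
  have h2 := Real.Gamma_pos_of_pos (show 0 < γ + 1 / 2 + d / 2 + 1 by positivity)
  rw [Lcl, Lcl, Lcl, h4, h5]
  simp only [Nat.cast_one]
  field_simp
  ring

lemma Lcl_half : Lcl (1 / 2) 1 = 1 / 4 := by
  have h1 : Real.pi ^ ((1 : ℝ) / 2) = √Real.pi := (Real.sqrt_eq_rpow _).symm
  have h2 : Real.Gamma (1 / 2 + 1) = 1 / 2 * √Real.pi := by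
    rw [Real.Gamma_add_one (by norm_num), Real.Gamma_one_half_eq]
  have h3 : Real.Gamma (1 / 2 + 1 / 2 + 1) = 1 := by norm_num
  have h4 : 0 < √Real.pi := Real.sqrt_pos.2 Real.pi_pos
  rw [Lcl, Nat.cast_one, h1, h2, h3]
  field_simp
  norm_num

lemma Lcl_three_half : Lcl (3 / 2) 1 = 3 / 16 := by
  have h1 : Real.pi ^ ((1 : ℝ) / 2) = √Real.pi := (Real.sqrt_eq_rpow _).symm
  have h2 : Real.Gamma (3 / 2 + 1) = 3 / 4 * √Real.pi := by
    rw [Real.Gamma_add_one (by norm_num), show (3 / 2 : ℝ) = 1 / 2 + 1 by norm_num,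
      Real.Gamma_add_one (by norm_num), Real.Gamma_one_half_eq]
    ring
  have h3 : Real.Gamma (3 / 2 + 1 / 2 + 1) = 2 := by
    rw [show (3 / 2 + 1 / 2 + 1 : ℝ) = ((2 : ℕ) : ℝ) + 1 by norm_num, Real.Gamma_nat_eq_factorial]
    norm_num
  have h4 : 0 < √Real.pi := Real.sqrt_pos.2 Real.pi_pos
  rw [Lcl, Nat.cast_one, h1, h2, h3]
  field_simp
  norm_num

lemma lt1_two_mul {γ : ℝ} (hγ : 1 / 2 ≤ γ) : LT1 γ (2 * Lcl γ 1) := by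
  refine LT1'.gauge (by linarith) ?_
  rcases hγ.eq_or_lt with rfl | h
  · rw [Lcl_half]
    convert lt1'_half using 1
    norm_num
  · convert lt1'_half.lift (by norm_num) (by norm_num) h using 1
    rw [Lcl_half]
    ring

lemma lt1_classical {γ : ℝ} (hγ : 3 / 2 ≤ γ) : LT1 γ (Lcl γ 1) := by
  refine LT1'.gauge (by linarith) ?_
  rcases hγ.eq_or_lt with rfl | h
  · rw [Lcl_three_half]
    exact lt1'_three_half
  · convert lt1'_three_half.lift (by norm_num) (by norm_num) h using 1
    rw [Lcl_three_half]
    ring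

end Constants

section Pi

lemma LT1.toLTBound_pi {γ C : ℝ} (h : LT1 γ C) :
    LTBound (fun k : Fin 1 => (Pi.single k 1 : Fin 1 → ℝ)) γ (γ + 1 / 2) C := by
  have h1 := h.toLTBound.transport (ContinuousLinearEquiv.funUnique (Fin 1) ℝ ℝ)
    (volume_preserving_funUnique (Fin 1) ℝ)
  convert h1 using 1
  funext k i
  rw [Subsingleton.elim i 0, Subsingleton.elim k 0]
  simp

lemma LTBound.lift_pi {d : ℕ} {γ p C₁ C₂ : ℝ} (hγ : 0 ≤ γ) (hp : 0 < p) (hC : 0 ≤ C₁)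
    (h₁ : LT1 γ C₁)
    (h₂ : LTBound (fun k : Fin d => (Pi.single k 1 : Fin d → ℝ)) (γ + 1 / 2) p C₂) :
    LTBound (fun k : Fin (d + 1) => (Pi.single k 1 : Fin (d + 1) → ℝ)) γ p (C₁ * C₂) := by
  let T : (Fin (d + 1) → ℝ) ≃L[ℝ] ℝ × (Fin d → ℝ) := (Fin.consEquivL ℝ fun _ => ℝ).symm
  have hT : MeasurePreserving T := by
    have := volume_preserving_piFinSuccAbove (fun _ : Fin (d + 1) => ℝ) 0
    convert this using 1
    funext v
    refine Prod.ext rfl (funext fun i => ?_)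
    simp [T, Fin.tail]
  have h3 := (LTBound.lift hγ hp hC h₁ h₂).transport T hT
  convert h3 using 1
  funext k
  rw [eq_comm, ContinuousLinearEquiv.symm_apply_eq]
  refine Fin.cases ?_ (fun k => ?_) k
  · refine Prod.ext rfl (funext fun i => ?_)
    change (0 : ℝ) = (Pi.single 0 1 : Fin (d + 1) → ℝ) i.succ
    simp
  · refine Prod.ext ?_ (funext fun i => ?_)
    · change (0 : ℝ) = (Pi.single k.succ 1 : Fin (d + 1) → ℝ) 0
      simp
    · change (Pi.single k 1 : Fin d → ℝ) i = (Pi.single k.succ 1 : Fin (d + 1) → ℝ) i.succ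
      simp [Pi.single_apply]

lemma exponent_eq (γ : ℝ) (d : ℕ) : γ + 1 / 2 + (d : ℝ) / 2 = γ + ((d + 1 : ℕ) : ℝ) / 2 := by
  push_cast
  ring

lemma ltBound_classical (d : ℕ) : ∀ {γ : ℝ}, 3 / 2 ≤ γ →
    LTBound (fun k : Fin (d + 1) => (Pi.single k 1 : Fin (d + 1) → ℝ)) γ
      (γ + ((d + 1 : ℕ) : ℝ) / 2) (Lcl γ (d + 1)) := by
  induction d with
  | zero =>
    intro γ hγ
    simpa using (lt1_classical hγ).toLTBound_pi
  | succ d ih =>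
    intro γ hγ
    rw [← Lcl_mul (by linarith), ← exponent_eq]
    exact LTBound.lift_pi (by linarith) (by positivity) (Lcl_pos (by linarith) 1).le
      (lt1_classical hγ) (ih (by linarith))

lemma ltBound_two_mul (d : ℕ) {γ : ℝ} (hγ : 1 ≤ γ) :
    LTBound (fun k : Fin (d + 1) => (Pi.single k 1 : Fin (d + 1) → ℝ)) γ
      (γ + ((d + 1 : ℕ) : ℝ) / 2) (2 * Lcl γ (d + 1)) := by
  cases d with
  | zero => simpa using (lt1_two_mul (by linarith)).toLTBound_pi
  | succ d =>
    rw [← Lcl_mul (by linarith), ← exponent_eq, ← mul_assoc]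
    exact LTBound.lift_pi (by linarith) (by positivity)
      (mul_nonneg zero_le_two (Lcl_pos (by linarith) 1).le)
      (lt1_two_mul (by linarith)) (ltBound_classical d (by linarith))

lemma ltBound_four_mul (d : ℕ) {γ : ℝ} (hγ : 1 / 2 ≤ γ) :
    LTBound (fun k : Fin (d + 2) => (Pi.single k 1 : Fin (d + 2) → ℝ)) γ
      (γ + ((d + 2 : ℕ) : ℝ) / 2) (4 * Lcl γ (d + 2)) := by
  rw [← Lcl_mul (by linarith), ← exponent_eq,
    show 4 * (Lcl γ 1 * Lcl (γ + 1 / 2) (d + 1)) = 2 * Lcl γ 1 * (2 * Lcl (γ + 1 / 2) (d + 1)) by ring]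
  exact LTBound.lift_pi (by linarith) (by positivity)
    (mul_nonneg zero_le_two (Lcl_pos (by linarith) 1).le)
    (lt1_two_mul hγ) (ltBound_two_mul d (by linarith))

lemma ltBound_euclidean {d : ℕ} (hd : 2 ≤ d) {γ : ℝ} (hγ : 1 / 2 ≤ γ) :
    LTBound (fun k : Fin d => EuclideanSpace.single k (1 : ℝ)) γ (γ + d / 2) (4 * Lcl γ d) := by
  obtain ⟨d, rfl⟩ := Nat.exists_eq_add_of_le' hd
  exact (ltBound_four_mul d hγ).transport (EuclideanSpace.equiv (Fin (d + 2)) ℝ)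
    (PiLp.volume_preserving_ofLp (Fin (d + 2)))

end Pi

section Localization

variable {d : ℕ} {a : EuclideanSpace ℝ (Fin d) → EuclideanSpace ℝ (Fin d)}

lemma contDiff_magD (ha : ContDiff ℝ 1 a) (k : Fin d) {f : EuclideanSpace ℝ (Fin d) → ℂ}
    (hf : ContDiff ℝ 2 f) : ContDiff ℝ 1 (magD a k f) := by
  have h1 : ContDiff ℝ 1 fun x => fderiv ℝ f x (EuclideanSpace.single k (1 : ℝ)) :=
    (hf.fderiv_right (m := 1) le_rfl).clm_apply contDiff_const
  have h2 : ContDiff ℝ 1 fun x => (a x k : ℂ) :=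
    Complex.ofRealCLM.contDiff.comp ((EuclideanSpace.proj (𝕜 := ℝ) k).contDiff.comp ha)
  exact (contDiff_const.mul h1).add (h2.mul (hf.of_le one_le_two))

/-- The flux whose divergence enters the localization formula. -/
noncomputable def magFlux (a : EuclideanSpace ℝ (Fin d) → EuclideanSpace ℝ (Fin d)) (k : Fin d)
    (χ : EuclideanSpace ℝ (Fin d) → ℝ) (f : EuclideanSpace ℝ (Fin d) → ℂ)
    (x : EuclideanSpace ℝ (Fin d)) : ℂ :=
  -Complex.I * ((χ x : ℂ) * ((χ x : ℂ) * ((starRingEnd ℂ) (f x) * magD a k f x)))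

lemma contDiff_magFlux (ha : ContDiff ℝ 1 a) (k : Fin d) {χ : EuclideanSpace ℝ (Fin d) → ℝ}
    (hχ : ContDiff ℝ 1 χ) {f : EuclideanSpace ℝ (Fin d) → ℂ} (hf : ContDiff ℝ 2 f) :
    ContDiff ℝ 1 (magFlux a k χ f) := by
  have h1 : ContDiff ℝ 1 fun x => (χ x : ℂ) := Complex.ofRealCLM.contDiff.comp hχ
  have h2 : ContDiff ℝ 1 fun x => (starRingEnd ℂ) (f x) :=
    Complex.conjCLE.contDiff.comp (hf.of_le one_le_two)
  exact contDiff_const.mul (h1.mul (h1.mul (h2.mul (contDiff_magD ha k hf))))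

/-- The pointwise form of the IMS localization formula. -/
lemma normSq_magD_mul (ha : ContDiff ℝ 1 a) (k : Fin d) {χ : EuclideanSpace ℝ (Fin d) → ℝ}
    (hχ : ContDiff ℝ 1 χ) {f : EuclideanSpace ℝ (Fin d) → ℂ} (hf : ContDiff ℝ 2 f)
    (x : EuclideanSpace ℝ (Fin d)) :
    Complex.normSq (magD a k (fun y => (χ y : ℂ) * f y) x)
      = fderiv ℝ χ x (EuclideanSpace.single k (1 : ℝ)) ^ 2 * Complex.normSq (f x)
        + χ x ^ 2 * ((starRingEnd ℂ) (f x) * magD a k (magD a k f) x).re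
        + (fderiv ℝ (magFlux a k χ f) x (EuclideanSpace.single k (1 : ℝ))).re := by
  have hf' := ((hf.differentiable two_ne_zero) x).hasFDerivAt
  have hg' := (((contDiff_magD ha k hf).differentiable one_ne_zero) x).hasFDerivAt
  have hχ' := Complex.ofRealCLM.hasFDerivAt.comp x ((hχ.differentiable one_ne_zero) x).hasFDerivAt
  have hc' := (Complex.conjCLE : ℂ →L[ℝ] ℂ).hasFDerivAt.comp x hf'
  have h1 := hχ'.mul hf'
  have h2 := (hχ'.mul (hχ'.mul (hc'.mul hg'))).const_mul (-Complex.I)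
  have h3 : fderiv ℝ (fun y => (χ y : ℂ) * f y) x = _ := h1.fderiv
  have h4 : fderiv ℝ (magFlux a k χ f) x = _ := h2.fderiv
  rw [h4, magD, h3]
  simp [magD, Complex.normSq_apply]
  ring

lemma integral_fderiv_eq_zero {F : EuclideanSpace ℝ (Fin d) → ℂ} (hF : ContDiff ℝ 1 F)
    (hs : HasCompactSupport F) (v : EuclideanSpace ℝ (Fin d)) : ∫ x, fderiv ℝ F x v = 0 := by
  have h1 : Integrable F := hF.continuous.integrable_of_hasCompactSupport hs
  have h2 : Integrable fun x => fderiv ℝ F x v :=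
    ((hF.continuous_fderiv one_ne_zero).clm_apply continuous_const).integrable_of_hasCompactSupport
      ((hs.fderiv ℝ).mono fun x hx h0 => hx (by simp [h0]))
  have h3 := integral_mul_fderiv_eq_neg_fderiv_mul_of_integrable (μ := volume) (v := v)
    (f := fun _ : EuclideanSpace ℝ (Fin d) => (1 : ℂ)) (g := F) (by simp) (by simpa using h2)
    (by simpa using h1) (fun _ _ => by fun_prop)
    (fun x _ => hF.differentiable one_ne_zero x)
  simpa using h3

/-- A sequence of cutoff functions exhausting the space. -/
structure IsCutoffSeq (χ : ℕ → EuclideanSpace ℝ (Fin d) → ℝ) : Prop where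
  contDiff : ∀ N, ContDiff ℝ 1 (χ N)
  hasCompactSupport : ∀ N, HasCompactSupport (χ N)
  nonneg : ∀ N x, 0 ≤ χ N x
  le_one : ∀ N x, χ N x ≤ 1
  tendsto : ∀ x, Filter.Tendsto (fun N => χ N x) Filter.atTop (nhds 1)
  bounded : ∃ B, ∀ N x, ‖fderiv ℝ (χ N) x‖ ≤ B
  tendsto_fderiv : ∀ x, Filter.Tendsto (fun N => fderiv ℝ (χ N) x) Filter.atTop (nhds 0)

lemma exists_isCutoffSeq (d : ℕ) : ∃ χ : ℕ → EuclideanSpace ℝ (Fin d) → ℝ, IsCutoffSeq χ := by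
  let f : ContDiffBump (0 : EuclideanSpace ℝ (Fin d)) := ⟨1, 2, one_pos, one_lt_two⟩
  let s : ℕ → ℝ := fun N => 1 / ((N : ℝ) + 1)
  have hs0 : ∀ N, 0 < s N := fun N => by positivity
  have hs1 : ∀ N, s N ≤ 1 := fun N => by
    refine (div_le_one (by positivity)).2 ?_
    linarith [(Nat.cast_nonneg N : (0 : ℝ) ≤ N)]
  have hs : Filter.Tendsto s Filter.atTop (nhds 0) := tendsto_one_div_add_atTop_nhds_zero_nat
  have hf : ContDiff ℝ 1 f := f.contDiff
  have hfd : ∀ N x, fderiv ℝ (fun y => f (s N • y)) x = s N • fderiv ℝ f (s N • x) := fun N x => by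
    have h1 : HasFDerivAt (fun y => f (s N • y)) _ x :=
      ((hf.differentiable one_ne_zero) (s N • x)).hasFDerivAt.comp x
        ((hasFDerivAt_id x).const_smul (s N))
    rw [h1.fderiv]
    ext v
    simp
  obtain ⟨B, hB⟩ := (hf.continuous_fderiv one_ne_zero).bounded_above_of_compact_support
    (f.hasCompactSupport.fderiv ℝ)
  have hbd : ∀ N x, ‖fderiv ℝ (fun y => f (s N • y)) x‖ ≤ s N * B := fun N x => by
    rw [hfd, norm_smul, Real.norm_of_nonneg (hs0 N).le]
    exact mul_le_mul_of_nonneg_left (hB _) (hs0 N).le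
  have hB0 : 0 ≤ B := (norm_nonneg _).trans (hB 0)
  refine ⟨fun N x => f (s N • x), fun N => hf.comp (contDiff_const_smul (s N)), fun N => ?_,
    fun N x => f.nonneg, fun N x => f.le_one, fun x => ?_,
    ⟨B, fun N x => (hbd N x).trans (mul_le_of_le_one_left hB0 (hs1 N))⟩, fun x => ?_⟩
  · exact f.hasCompactSupport.comp_smul (hs0 N).ne'
  · have h1 : Filter.Tendsto (fun N => f (s N • x)) Filter.atTop (nhds (f ((0 : ℝ) • x))) :=
      (f.continuous.tendsto _).comp (hs.smul_const x)
    rwa [zero_smul, f.one_of_mem_closedBall (by simp [f])] at h1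
  · refine squeeze_zero_norm (hbd · x) ?_
    simpa using hs.mul_const B

lemma jetDensity_cutoff {n : ℕ} (ha : ContDiff ℝ 1 a) {χ : EuclideanSpace ℝ (Fin d) → ℝ}
    (hχ : ContDiff ℝ 1 χ) {φ : EuclideanSpace ℝ (Fin d) → Fin n → ℂ}
    (hφ : ∀ i, ContDiff ℝ 2 fun x => φ x i) {V U : EuclideanSpace ℝ (Fin d) → Matrix (Fin n) (Fin n) ℂ}
    (x : EuclideanSpace ℝ (Fin d)) (hU : χ x ≠ 0 → U x = -V x) {ξ : Fin n → ℂ}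
    (hξ : ∀ i, ∑ k, magD a k (magD a k fun y => φ y i) x + (V x *ᵥ φ x) i = -ξ i) :
    jetDensity (fun k x => a x k) U 0 x
        (jet (fun k => EuclideanSpace.single k (1 : ℝ)) (fun y => (χ y : ℂ) • φ y) x)
      = (∑ k, fderiv ℝ χ x (EuclideanSpace.single k (1 : ℝ)) ^ 2) * (star (φ x) ⬝ᵥ φ x).re
        - χ x ^ 2 * (star (φ x) ⬝ᵥ ξ).re
        + (∑ k, ∑ i, fderiv ℝ (magFlux a k χ fun y => φ y i) x (EuclideanSpace.single k (1 : ℝ))).re := by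
  have h1 : ContDiff ℝ 1 fun y => (χ y : ℂ) := Complex.ofRealCLM.contDiff.comp hχ
  have h2 : ∀ i, DifferentiableAt ℝ (fun y => (χ y : ℂ) * φ y i) x := fun i =>
    (h1.mul ((hφ i).of_le one_le_two)).differentiable one_ne_zero x
  have h3 : ∀ k, vsq (Complex.I • (jet (fun k => EuclideanSpace.single k (1 : ℝ))
      (fun y => (χ y : ℂ) • φ y) x).2 k + (a x k : ℂ) • (jet (fun k => EuclideanSpace.single k (1 : ℝ))
      (fun y => (χ y : ℂ) • φ y) x).1)
      = ∑ i, Complex.normSq (magD a k (fun y => (χ y : ℂ) * φ y i) x) := fun k => by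
    refine Finset.sum_congr rfl fun i _ => ?_
    congr 1
    have h4 : fderiv ℝ (fun y => (χ y : ℂ) • φ y) x
        = ContinuousLinearMap.pi fun i => fderiv ℝ (fun y => (χ y : ℂ) * φ y i) x :=
      (hasFDerivAt_pi.2 fun i => (h2 i).hasFDerivAt).fderiv
    simp only [jet, h4, magD]
    simp
  have h5 : qform (U x) ((χ x : ℂ) • φ x) = -(χ x ^ 2 * (star (φ x) ⬝ᵥ V x *ᵥ φ x).re) := by
    rw [qform_smul, Complex.normSq_ofReal]
    by_cases h0 : χ x = 0
    · simp [h0]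
    · rw [hU h0, qform, neg_mulVec, dotProduct_neg, Complex.neg_re]
      ring
  have h6 : (star (φ x) ⬝ᵥ ξ).re = -(∑ k, ∑ i, ((starRingEnd ℂ) (φ x i) *
      magD a k (magD a k fun y => φ y i) x).re) - (star (φ x) ⬝ᵥ V x *ᵥ φ x).re := by
    rw [Finset.sum_comm]
    simp only [dotProduct, Complex.re_sum, ← Finset.sum_neg_distrib, ← Finset.sum_sub_distrib]
    refine Finset.sum_congr rfl fun i _ => ?_
    rw [← neg_neg (ξ i), ← hξ i]
    simp only [Pi.star_apply, RCLike.star_def, mul_neg, Complex.neg_re, mul_add, Complex.add_re,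
      Finset.mul_sum, Complex.re_sum, Finset.sum_neg_distrib]
    ring
  rw [jetDensity, zero_mul, add_zero]
  simp only [h3, normSq_magD_mul ha _ hχ (hφ _), Finset.sum_add_distrib]
  rw [show (jet (fun k => EuclideanSpace.single k (1 : ℝ)) (fun y => (χ y : ℂ) • φ y) x).1
    = (χ x : ℂ) • φ x from rfl, h5, h6, ← vsq_eq_re, vsq, Finset.sum_mul]
  simp only [← Finset.mul_sum, Complex.re_sum]
  ring

lemma magD_sum {ι : Type*} [Fintype ι] (k : Fin d) (c : ι → ℂ)
    {f : ι → EuclideanSpace ℝ (Fin d) → ℂ} (hf : ∀ j, Differentiable ℝ (f j)) :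
    magD a k (fun y => ∑ j, c j * f j y) = fun y => ∑ j, c j * magD a k (f j) y := by
  funext x
  have h1 : HasFDerivAt (fun y => ∑ j, c j * f j y) (∑ j, c j • fderiv ℝ (f j) x) x :=
    HasFDerivAt.fun_sum fun j _ => ((hf j) x).hasFDerivAt.const_mul (c j)
  rw [magD, h1.fderiv]
  simp only [magD, _root_.sum_apply, _root_.smul_apply, smul_eq_mul, Finset.mul_sum,
    ← Finset.sum_add_distrib]
  exact Finset.sum_congr rfl fun j _ => by ring

lemma trPow_smul_le {n : ℕ} {p t : ℝ} (hp : 0 ≤ p) (ht : 0 ≤ t) (ht1 : t ≤ 1)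
    {A : Matrix (Fin n) (Fin n) ℂ} (hA : A.IsHermitian) : trPow p (t • A) ≤ trPow p A := by
  have hA' : IsSelfAdjoint A := hA
  rw [trPow, trFun, ← cfc_const_mul_id t A, ← cfc_comp' (fun r => max r 0 ^ p) (fun r => t * r) A
    (continuous_max_rpow hp).continuousOn]
  change trFun _ A ≤ _
  rw [trFun_eq_sum _ hA, trPow_eq_sum p hA]
  refine Finset.sum_le_sum fun i _ => Real.rpow_le_rpow (le_max_right _ _) ?_ hp
  refine max_le ?_ (le_max_right _ _)
  calc t * hA.eigenvalues i ≤ t * max (hA.eigenvalues i) 0 :=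
        mul_le_mul_of_nonneg_left (le_max_left _ _) ht
    _ ≤ max (hA.eigenvalues i) 0 := mul_le_of_le_one_left (le_max_right _ _) ht1

end Localization

section CutoffFlag

variable {d n N : ℕ} {a : EuclideanSpace ℝ (Fin d) → EuclideanSpace ℝ (Fin d)}
  {V : EuclideanSpace ℝ (Fin d) → Matrix (Fin n) (Fin n) ℂ}
  {ψ : Fin N → EuclideanSpace ℝ (Fin d) → Fin n → ℂ} {E : Fin N → ℝ}

/-- The weight with which `⟨ψ, ψ'⟩` enters the localized form at the energies `-s` and `-t`. -/
noncomputable def cutoffWeight (χ : EuclideanSpace ℝ (Fin d) → ℝ) (s t : ℝ)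
    (x : EuclideanSpace ℝ (Fin d)) : ℝ :=
  ∑ k, fderiv ℝ χ x (EuclideanSpace.single k (1 : ℝ)) ^ 2 + (s - t) * χ x ^ 2

lemma continuous_cutoffWeight {χ : EuclideanSpace ℝ (Fin d) → ℝ} (hχ : ContDiff ℝ 1 χ) (s t : ℝ) :
    Continuous (cutoffWeight χ s t) := by
  have h1 := hχ.continuous
  have h2 := hχ.continuous_fderiv one_ne_zero
  unfold cutoffWeight
  fun_prop

lemma hasCompactSupport_cutoffWeight {χ : EuclideanSpace ℝ (Fin d) → ℝ} (hχ : HasCompactSupport χ)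
    (s t : ℝ) : HasCompactSupport (cutoffWeight χ s t) := by
  refine HasCompactSupport.intro hχ.isCompact fun x hx => ?_
  rw [cutoffWeight, image_eq_zero_of_notMem_tsupport hx,
    image_eq_zero_of_notMem_tsupport fun h => hx (tsupport_fderiv_subset ℝ h)]
  simp

lemma IsCutoffSeq.tendsto_integral {χ : ℕ → EuclideanSpace ℝ (Fin d) → ℝ} (hχ : IsCutoffSeq χ)
    (s t : ℝ) {F : EuclideanSpace ℝ (Fin d) → ℂ} (hF : Integrable F) :
    Filter.Tendsto (fun R => ∫ x, (cutoffWeight (χ R) s t x : ℂ) * F x) Filter.atTop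
      (nhds ((s - t) * ∫ x, F x)) := by
  obtain ⟨B, hB⟩ := hχ.bounded
  have hB0 : 0 ≤ B := (norm_nonneg _).trans (hB 0 0)
  rw [← integral_const_mul]
  refine tendsto_integral_filter_of_dominated_convergence (fun x => (d * B ^ 2 + |s - t|) * ‖F x‖)
    (Filter.Eventually.of_forall fun R => ?_) (Filter.Eventually.of_forall fun R => ?_)
    (hF.norm.const_mul _) (Filter.Eventually.of_forall fun x => ?_)
  · exact (Complex.continuous_ofReal.comp
      (continuous_cutoffWeight (hχ.contDiff R) s t)).aestronglyMeasurable.mul hF.1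
  · refine Filter.Eventually.of_forall fun x => ?_
    rw [norm_mul, Complex.norm_real, Real.norm_eq_abs]
    refine mul_le_mul_of_nonneg_right ((abs_add_le _ _).trans (add_le_add ?_ ?_)) (norm_nonneg _)
    · rw [abs_of_nonneg (Finset.sum_nonneg fun _ _ => sq_nonneg _)]
      calc _ ≤ ∑ k : Fin d, B ^ 2 := Finset.sum_le_sum fun k _ => by
            refine sq_le_sq' ?_ ?_ <;>
            · have h1 := ((fderiv ℝ (χ R) x).le_opNorm (EuclideanSpace.single k (1 : ℝ))).trans
                (mul_le_mul_of_nonneg_right (hB R x) (norm_nonneg _))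
              rw [EuclideanSpace.norm_single, norm_one, mul_one, Real.norm_eq_abs, abs_le] at h1
              linarith [h1.1, h1.2]
        _ = d * B ^ 2 := by simp
    · rw [abs_mul, abs_of_nonneg (sq_nonneg (χ R x))]
      exact mul_le_of_le_one_right (abs_nonneg _)
        (pow_le_one₀ (hχ.nonneg R x) (hχ.le_one R x))
  · refine Filter.Tendsto.mul_const _ ?_
    have h1 : Filter.Tendsto (fun R => cutoffWeight (χ R) s t x) Filter.atTop
        (nhds (∑ k : Fin d, (0 : EuclideanSpace ℝ (Fin d) →L[ℝ] ℝ) (EuclideanSpace.single k (1 : ℝ)) ^ 2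
          + (s - t) * 1 ^ 2)) := by
      refine Filter.Tendsto.add (tendsto_finsetSum _ fun k _ => ?_) (((hχ.tendsto x).pow 2).const_mul _)
      exact (((ContinuousLinearMap.apply ℝ ℝ (EuclideanSpace.single k (1 : ℝ))).continuous.tendsto
        0).comp (hχ.tendsto_fderiv x)).pow 2
    have h2 := (Complex.continuous_ofReal.tendsto _).comp h1
    simpa [Function.comp_def] using h2

/-- The localized form evaluated on a combination of eigenfunctions. -/
lemma magForm_add_mass_cutoff (ha : ContDiff ℝ 1 a) (hψ : ∀ j i, ContDiff ℝ 2 fun x => ψ j x i)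
    (heq : ∀ j x i, (∑ k : Fin d, magD a k (magD a k fun y => ψ j y i) x) + (V x *ᵥ ψ j x) i
        = -(E j : ℂ) * ψ j x i)
    {χ : EuclideanSpace ℝ (Fin d) → ℝ} (hχ : ContDiff ℝ 1 χ) (hχs : HasCompactSupport χ)
    {U : EuclideanSpace ℝ (Fin d) → Matrix (Fin n) (Fin n) ℂ} (hUc : Continuous U)
    (hU : ∀ x, χ x ≠ 0 → U x = -V x) (s : ℝ) (c : Fin N → ℂ) :
    magForm (fun k => EuclideanSpace.single k (1 : ℝ)) (fun k x => a x k) U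
        (comb c fun j x => (χ x : ℂ) • ψ j x)
      + s * mass (comb c fun j x => (χ x : ℂ) • ψ j x)
      = (∑ j, ∑ l, (starRingEnd ℂ) (c j) * (c l *
          ∫ x, (cutoffWeight χ s (E l) x : ℂ) * (star (ψ j x) ⬝ᵥ ψ l x))).re := by
  have hχ' : ContDiff ℝ 1 fun x => (χ x : ℂ) := Complex.ofRealCLM.contDiff.comp hχ
  have hψ1 : ∀ j, ContDiff ℝ 1 (ψ j) := fun j =>
    contDiff_pi.2 fun i => (hψ j i).of_le one_le_two
  have hφ : ∀ i, ContDiff ℝ 2 fun x => comb c ψ x i := fun i => by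
    simp only [comb, Finset.sum_apply, Pi.smul_apply, smul_eq_mul]
    exact ContDiff.sum fun j _ => contDiff_const.mul (hψ j i)
  have hcomb : (comb c fun j x => (χ x : ℂ) • ψ j x) = fun x => (χ x : ℂ) • comb c ψ x := by
    funext x
    simp only [comb, Finset.smul_sum]
    exact Finset.sum_congr rfl fun j _ => smul_comm _ _ _
  have hc1 : ContDiff ℝ 1 (fun x => (χ x : ℂ) • comb c ψ x) := hχ'.smul (contDiff_comb c hψ1)
  have hcs : HasCompactSupport (fun x => (χ x : ℂ) • comb c ψ x) :=
    hχs.mono fun x hx h0 => hx (by simp [h0])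
  have hac : ∀ k, Continuous fun x => a x k := fun k =>
    (EuclideanSpace.proj (𝕜 := ℝ) k).continuous.comp ha.continuous
  have hev : ∀ x i, ∑ k, magD a k (magD a k fun y => comb c ψ y i) x + (V x *ᵥ comb c ψ x) i
      = -(∑ l, (c l * E l) • ψ l x) i := fun x i => by
    have h1 : ∀ k, magD a k (magD a k fun y => comb c ψ y i)
        = fun y => ∑ j, c j * magD a k (magD a k fun y => ψ j y i) y := fun k => by
      simp only [comb, Finset.sum_apply, Pi.smul_apply, smul_eq_mul]
      rw [magD_sum k c fun j => (hψ j i).differentiable two_ne_zero, magD_sum k c fun j =>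
        (contDiff_magD ha k (hψ j i)).differentiable one_ne_zero]
    simp only [h1]
    rw [Finset.sum_comm, comb, mulVec_sum, Finset.sum_apply, Finset.sum_apply,
      ← Finset.sum_add_distrib, ← Finset.sum_neg_distrib]
    refine Finset.sum_congr rfl fun j _ => ?_
    rw [← Finset.mul_sum, mulVec_smul, Pi.smul_apply, Pi.smul_apply, smul_eq_mul, smul_eq_mul,
      ← mul_add, heq]
    ring
  have hdens : ∀ x, jetDensity (fun k x => a x k) U s x
      (jet (fun k => EuclideanSpace.single k (1 : ℝ)) (fun y => (χ y : ℂ) • comb c ψ y) x)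
      = (∑ j, ∑ l, (starRingEnd ℂ) (c j) * (c l *
          ((cutoffWeight χ s (E l) x : ℂ) * (star (ψ j x) ⬝ᵥ ψ l x)))).re
        + (∑ k, ∑ i, fderiv ℝ (magFlux a k χ fun y => comb c ψ y i) x
            (EuclideanSpace.single k (1 : ℝ))).re := fun x => by
    have h1 := jetDensity_cutoff ha hχ hφ x (hU x) (hev x)
    have h2 : jetDensity (fun k x => a x k) U s x
        (jet (fun k => EuclideanSpace.single k (1 : ℝ)) (fun y => (χ y : ℂ) • comb c ψ y) x)
        = jetDensity (fun k x => a x k) U 0 x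
        (jet (fun k => EuclideanSpace.single k (1 : ℝ)) (fun y => (χ y : ℂ) • comb c ψ y) x)
          + s * (χ x ^ 2 * (star (comb c ψ x) ⬝ᵥ comb c ψ x).re) := by
      rw [jetDensity, jetDensity, zero_mul, add_zero, ← vsq_eq_re, jet, vsq_smul,
        Complex.normSq_ofReal]
      ring
    have h3 : ∑ j, ∑ l, (starRingEnd ℂ) (c j) * (c l *
          ((cutoffWeight χ s (E l) x : ℂ) * (star (ψ j x) ⬝ᵥ ψ l x)))
        = star (comb c ψ x) ⬝ᵥ
          (((∑ k, fderiv ℝ χ x (EuclideanSpace.single k (1 : ℝ)) ^ 2 + s * χ x ^ 2 : ℝ) : ℂ) •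
            comb c ψ x - ((χ x ^ 2 : ℝ) : ℂ) • ∑ l, (c l * E l) • ψ l x) := by
      have h4 : ((∑ k, fderiv ℝ χ x (EuclideanSpace.single k (1 : ℝ)) ^ 2 + s * χ x ^ 2 : ℝ) : ℂ) •
            comb c ψ x - ((χ x ^ 2 : ℝ) : ℂ) • ∑ l, (c l * E l) • ψ l x
          = ∑ l, (c l * (cutoffWeight χ s (E l) x : ℂ)) • ψ l x := by
        simp only [comb, Finset.smul_sum, ← Finset.sum_sub_distrib, smul_smul, ← sub_smul]
        refine Finset.sum_congr rfl fun l _ => ?_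
        congr 1
        rw [cutoffWeight]
        push_cast
        ring
      rw [h4, comb, star_sum, sum_dotProduct]
      refine Finset.sum_congr rfl fun j _ => ?_
      rw [dotProduct_sum]
      refine Finset.sum_congr rfl fun l _ => ?_
      rw [star_smul, smul_dotProduct, dotProduct_smul, smul_eq_mul, smul_eq_mul, RCLike.star_def]
      ring
    rw [h2, h1, h3, dotProduct_sub, dotProduct_smul, dotProduct_smul, smul_eq_mul, smul_eq_mul,
      Complex.sub_re, Complex.re_ofReal_mul, Complex.re_ofReal_mul]
    ring
  have hi1 : ∀ j l, Integrable fun x => (cutoffWeight χ s (E l) x : ℂ) * (star (ψ j x) ⬝ᵥ ψ l x) :=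
    fun j l => by
      have h1 := (hψ1 j).continuous
      have h2 := (hψ1 l).continuous
      have h3 := continuous_cutoffWeight hχ s (E l)
      refine Continuous.integrable_of_hasCompactSupport ?_
        ((hasCompactSupport_cutoffWeight hχs s (E l)).mono fun x hx h0 => hx (by simp [h0]))
      exact (Complex.continuous_ofReal.comp h3).mul (h1.star.dotProduct h2)
  have hF : ∀ k i, ContDiff ℝ 1 (magFlux a k χ fun y => comb c ψ y i) := fun k i =>
    contDiff_magFlux ha k hχ (hφ i)
  have hFs : ∀ k i, HasCompactSupport (magFlux a k χ fun y => comb c ψ y i) := fun k i =>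
    hχs.mono fun x hx h0 => hx (by simp [magFlux, h0])
  have hi2 : ∀ k i, Integrable fun x => fderiv ℝ (magFlux a k χ fun y => comb c ψ y i) x
      (EuclideanSpace.single k (1 : ℝ)) := fun k i =>
    (((hF k i).continuous_fderiv one_ne_zero).clm_apply
      continuous_const).integrable_of_hasCompactSupport
      (((hFs k i).fderiv ℝ).mono fun x hx h0 => hx (by simp [h0]))
  have hi3 : Integrable fun x => ∑ j, ∑ l, (starRingEnd ℂ) (c j) * (c l *
      ((cutoffWeight χ s (E l) x : ℂ) * (star (ψ j x) ⬝ᵥ ψ l x))) :=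
    integrable_finsetSum _ fun j _ => integrable_finsetSum _ fun l _ =>
      ((hi1 j l).const_mul _).const_mul _
  have hi4 : Integrable fun x => ∑ k, ∑ i, fderiv ℝ (magFlux a k χ fun y => comb c ψ y i) x
      (EuclideanSpace.single k (1 : ℝ)) :=
    integrable_finsetSum _ fun k _ => integrable_finsetSum _ fun i _ => hi2 k i
  rw [hcomb, magForm_add_mass hac hUc s hc1 hcs]
  simp only [hdens, ← Complex.add_re]
  rw [integral_complex_re (g := fun x => _ + _) (hi3.add hi4), integral_add hi3 hi4, Complex.add_re,
    integral_finsetSum _ fun k _ => integrable_finsetSum _ fun i _ => hi2 k i,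
    Finset.sum_eq_zero (s := (Finset.univ : Finset (Fin d))) fun k _ => ?_, Complex.zero_re, add_zero,
    integral_finsetSum _ fun j _ => integrable_finsetSum _ fun l _ =>
      ((hi1 j l).const_mul _).const_mul _]
  · congr 1
    refine Finset.sum_congr rfl fun j _ => ?_
    rw [integral_finsetSum _ fun l _ => ((hi1 j l).const_mul _).const_mul _]
    refine Finset.sum_congr rfl fun l _ => ?_
    rw [integral_const_mul, integral_const_mul]
  · rw [integral_finsetSum _ fun i _ => hi2 k i]
    exact Finset.sum_eq_zero fun i _ => integral_fderiv_eq_zero (hF k i) (hFs k i) _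

/-- Localized eigenfunctions form a flag at slightly lower energies. -/
lemma IsCutoffSeq.eventually_isFlag (ha : ContDiff ℝ 1 a)
    (hψ : ∀ j i, ContDiff ℝ 2 fun x => ψ j x i)
    (hψL2 : ∀ j, Integrable fun x => ∑ i, Complex.normSq (ψ j x i))
    (horth : ∀ j l, (∫ x, ∑ i, (starRingEnd ℂ) (ψ j x i) * ψ l x i) = if j = l then 1 else 0)
    (heq : ∀ j x i, (∑ k : Fin d, magD a k (magD a k fun y => ψ j y i) x) + (V x *ᵥ ψ j x) i
        = -(E j : ℂ) * ψ j x i)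
    {χ : ℕ → EuclideanSpace ℝ (Fin d) → ℝ} (hχ : IsCutoffSeq χ) {δ : ℝ} (hδ : 0 < δ) :
    ∀ᶠ R in Filter.atTop, ∀ U : EuclideanSpace ℝ (Fin d) → Matrix (Fin n) (Fin n) ℂ,
      Continuous U → (∀ x, χ R x ≠ 0 → U x = -V x) →
      IsFlag (magForm (fun k => EuclideanSpace.single k (1 : ℝ)) (fun k x => a x k) U) mass
        (fun j x => (χ R x : ℂ) • ψ j x) fun j => E j - δ := by
  have hsq : ∀ j, ψ j ∈ sqInt volume n := fun j i => by
    have hc : AEStronglyMeasurable (fun x => ψ j x i) volume :=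
      (hψ j i).continuous.aestronglyMeasurable
    rw [memLp_two_iff_integrable_sq_norm hc]
    refine (hψL2 j).mono' (hc.norm.pow 2) (Filter.Eventually.of_forall fun x => ?_)
    rw [Real.norm_of_nonneg (sq_nonneg _), ← Complex.normSq_eq_norm_sq]
    exact Finset.single_le_sum (f := fun i => Complex.normSq (ψ j x i))
      (fun _ _ => Complex.normSq_nonneg _) (Finset.mem_univ i)
  have h_int : ∀ j l, Integrable fun x => star (ψ j x) ⬝ᵥ ψ l x := fun j l =>
    integrable_pair (hsq j) (hsq l)
  have horth' : ∀ j l, ∫ x, star (ψ j x) ⬝ᵥ ψ l x = if j = l then 1 else 0 := horth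
  have hε : 0 < δ / (N + 1) := by positivity
  have hev : ∀ i j l, ∀ᶠ R in Filter.atTop,
      ‖(∫ x, (cutoffWeight (χ R) (E i - δ) (E l) x : ℂ) * (star (ψ j x) ⬝ᵥ ψ l x))
        - ((E i - δ : ℝ) - E l) * (if j = l then 1 else 0)‖ < δ / (N + 1) := fun i j l => by
    have h1 := hχ.tendsto_integral (E i - δ) (E l) (h_int j l)
    rw [horth'] at h1
    have h2 := (tendsto_iff_norm_sub_tendsto_zero.1 h1).eventually_lt_const hε
    simpa using h2
  filter_upwards [Filter.eventually_all.2 fun i => Filter.eventually_all.2 fun j =>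
    Filter.eventually_all.2 fun l => hev i j l] with R hR U hUc hU i c hc hcj
  rw [magForm_add_mass_cutoff ha hψ heq (hχ.contDiff R) (hχ.hasCompactSupport R) hUc hU]
  set D : Fin N → Fin N → ℂ := fun j l =>
    (∫ x, (cutoffWeight (χ R) (E i - δ) (E l) x : ℂ) * (star (ψ j x) ⬝ᵥ ψ l x))
        - ((E i - δ : ℝ) - E l) * (if j = l then 1 else 0) with hD
  have h1 : ∑ j, ∑ l, (starRingEnd ℂ) (c j) * (c l *
        ∫ x, (cutoffWeight (χ R) (E i - δ) (E l) x : ℂ) * (star (ψ j x) ⬝ᵥ ψ l x))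
      = ∑ j, ((E i - δ - E j) * ‖c j‖ ^ 2 : ℝ) + ∑ j, ∑ l, (starRingEnd ℂ) (c j) * (c l * D j l) := by
    push_cast
    rw [← Finset.sum_add_distrib]
    refine Finset.sum_congr rfl fun j _ => ?_
    have h2 : ((E i : ℂ) - δ - E j) * (‖c j‖ : ℂ) ^ 2 = ∑ l, (starRingEnd ℂ) (c j) * (c l *
        (((E i - δ : ℝ) - E l) * (if j = l then 1 else 0))) := by
      simp only [mul_ite, mul_one, mul_zero, Finset.sum_ite_eq, Finset.mem_univ, if_true]
      rw [← mul_assoc, ← Complex.normSq_eq_conj_mul_self, Complex.normSq_eq_norm_sq]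
      push_cast
      ring
    rw [h2, ← Finset.sum_add_distrib]
    refine Finset.sum_congr rfl fun l _ => ?_
    simp only [hD]
    ring
  have h3 : ‖∑ j, ∑ l, (starRingEnd ℂ) (c j) * (c l * D j l)‖
      ≤ (∑ j, ‖c j‖ ^ 2) * (N * (δ / (N + 1))) := by
    calc _ ≤ ∑ j, ∑ l, ‖c j‖ * ‖c l‖ * (δ / (N + 1)) := by
          refine norm_sum_le_of_le _ fun j _ => norm_sum_le_of_le _ fun l _ => ?_
          rw [norm_mul, norm_mul, RCLike.norm_conj, ← mul_assoc]
          exact mul_le_mul_of_nonneg_left (hR i j l).le (by positivity)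
      _ = (∑ j, ‖c j‖) ^ 2 * (δ / (N + 1)) := by
          simp only [sq, Finset.sum_mul_sum, ← Finset.sum_mul]
      _ ≤ (N * ∑ j, ‖c j‖ ^ 2) * (δ / (N + 1)) := by
          refine mul_le_mul_of_nonneg_right ?_ hε.le
          simpa using sq_sum_le_card_mul_sum_sq (s := Finset.univ) (f := fun j => ‖c j‖)
      _ = _ := by ring
  have h4 : ∑ j, (E i - δ - E j) * ‖c j‖ ^ 2 ≤ ∑ j, -δ * ‖c j‖ ^ 2 := by
    refine Finset.sum_le_sum fun j _ => ?_
    by_cases hj : E j < E i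
    · rw [hcj j (by linarith)]
      simp
    · exact mul_le_mul_of_nonneg_right (by linarith) (sq_nonneg _)
  have h5 : 0 < ∑ j, ‖c j‖ ^ 2 := by
    obtain ⟨j, hj⟩ := Function.ne_iff.1 hc
    exact Finset.sum_pos' (fun _ _ => sq_nonneg _)
      ⟨j, Finset.mem_univ j, pow_pos (norm_pos_iff.2 hj) 2⟩
  have h6 : (N : ℝ) * (δ / (N + 1)) < δ := by
    rw [← mul_div_assoc, div_lt_iff₀ (by positivity)]
    linarith
  have h7 := mul_lt_mul_of_pos_left h6 h5
  rw [← Finset.mul_sum] at h4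
  rw [h1, Complex.add_re, Complex.ofReal_re]
  have h8 := (Complex.re_le_norm _).trans h3
  linarith

end CutoffFlag

/-- **Lieb–Thirring bound for the magnetic Schrödinger operator `(i∇ + a)² ⊗ 1 + V`:**
for `1/2 ≤ γ < 1` and `d ≥ 2`, `∑ E_j^γ ≤ 4 L^cl_{γ,d} ∫ tr((-V)^{γ+d/2}) dx`. -/
theorem magnetic_lieb_thirring_four_times_classical (d : ℕ) (hd : 2 ≤ d)
    (n : ℕ) (hn : 1 ≤ n)
    (γ : ℝ) (hγ1 : 1 / 2 ≤ γ) (hγ2 : γ < 1)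
    (a : EuclideanSpace ℝ (Fin d) → EuclideanSpace ℝ (Fin d))
    (ha : ContDiff ℝ 1 a)
    (V : EuclideanSpace ℝ (Fin d) → Matrix (Fin n) (Fin n) ℂ)
    (hVcont : Continuous V)
    (hV : ∀ x, (-(V x)).PosSemidef)
    (hVint : Integrable fun x => traceRpow (-(V x)) (hV x).1 (γ + d / 2))
    (N : ℕ) (ψ : Fin N → EuclideanSpace ℝ (Fin d) → Fin n → ℂ) (E : Fin N → ℝ)
    (hE : ∀ j, 0 < E j)
    (hψC2 : ∀ j i, ContDiff ℝ 2 fun x => ψ j x i)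
    (hψL2 : ∀ j, Integrable fun x => ∑ i, Complex.normSq (ψ j x i))
    (horth : ∀ j l, (∫ x : EuclideanSpace ℝ (Fin d),
        ∑ i, (starRingEnd ℂ) (ψ j x i) * ψ l x i) = if j = l then 1 else 0)
    (heq : ∀ j x i,
      (∑ k : Fin d, magD a k (magD a k fun y => ψ j y i) x) + (V x *ᵥ ψ j x) i
        = -(E j : ℂ) * ψ j x i) :
    ∑ j, E j ^ γ ≤
      4 * Lcl γ d * ∫ x : EuclideanSpace ℝ (Fin d),
        traceRpow (-(V x)) (hV x).1 (γ + d / 2) := by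
  have hγ0 : 0 < γ := by linarith
  have hp : 0 < γ + (d : ℝ) / 2 := by positivity
  simp only [traceRpow_eq_trPow _ (hV _)] at hVint ⊢
  obtain ⟨χ, hχ⟩ := exists_isCutoffSeq d
  have key : ∀ δ : ℝ, 0 < δ → ∑ j, max (E j - δ) 0 ^ γ
      ≤ 4 * Lcl γ d * ∫ x, trPow (γ + d / 2) (-(V x)) := fun δ hδ => by
    obtain ⟨R, hR⟩ := (hχ.eventually_isFlag ha hψC2 hψL2 horth heq hδ).exists
    obtain ⟨η, hη1, -, hηs, hη⟩ := exists_continuous_one_zero_of_isCompact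
      (hχ.hasCompactSupport R).isCompact isClosed_empty (Set.disjoint_empty _)
    have hUc : Continuous fun x => η x • (-(V x)) := η.continuous.smul hVcont.neg
    have hUs : HasCompactSupport fun x => η x • (-(V x)) :=
      hηs.mono fun x hx h0 => hx (by simp [h0])
    have hUp : ∀ x, (η x • (-(V x))).PosSemidef := fun x => (hV x).smul (hη x).1
    have hflag := (hR _ hUc fun x hx => by
      rw [hη1 (subset_tsupport _ hx), Pi.one_apply, one_smul]).subtype 0
    have hχψ : ∀ j, ContDiff ℝ 1 fun x => (χ R x : ℂ) • ψ j x := fun j => by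
      have h1 : ContDiff ℝ 1 fun x => (χ R x : ℂ) :=
        Complex.ofRealCLM.contDiff.comp (hχ.contDiff R)
      have h2 : ContDiff ℝ 1 (ψ j) := contDiff_pi.2 fun i => (hψC2 j i).of_le one_le_two
      exact h1.smul h2
    rw [← sum_eq_sum_max_rpow hγ0]
    refine (ltBound_euclidean hd hγ1 n (fun k x => a x k) (fun x => η x • (-(V x)))
      (fun k => (EuclideanSpace.proj (𝕜 := ℝ) k).continuous.comp ha.continuous) hUc hUp hUs
      {j // 0 < E j - δ} _ _ (fun j => j.2) (fun j => hχψ j)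
      (fun j => (hχ.hasCompactSupport R).mono fun x hx h0 => hx (by simp [h0])) hflag).trans ?_
    refine mul_le_mul_of_nonneg_left ?_ (mul_nonneg (by norm_num) (Lcl_pos hγ0 d).le)
    exact integral_mono (integrable_trPow hp hUc (fun x => (hUp x).1) hUs) hVint fun x =>
      trPow_smul_le hp.le (hη x).1 (hη x).2 (hV x).1
  refine le_of_tendsto (f := fun δ : ℝ => ∑ j, max (E j - δ) 0 ^ γ) (x := nhdsWithin 0 (Set.Ioi 0))
    ?_ (Filter.eventually_of_mem self_mem_nhdsWithin key)
  have h1 : Continuous fun δ : ℝ => ∑ j, max (E j - δ) 0 ^ γ :=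
    continuous_finsetSum _ fun j _ =>
      (continuous_max_rpow hγ0.le).comp (continuous_const.sub continuous_id)
  have h2 := (h1.tendsto 0).mono_left (nhdsWithin_le_nhds (s := Set.Ioi 0))
  simpa only [sub_zero, max_eq_left (hE _).le] using h2
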